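/- Let Ω be an n-connected quadrature domain of finite area with C^∞ smooth boundary, and let S be its Szegő kernel. Then there exist points a, b ∈ Ω, Ahlfors maps f_a of Ω at a and f_b of Ω at b, and polynomials P, Q ∈ ℂ[X₁,X₂,X₃,X₄] such that the function (z,w) ↦ Q(f_a(z), f_b(z), conj(f_a(w)), conj(f_b(w))) is not identically zero on Ω × Ω and S(z,w)²·Q(f_a(z), f_b(z), conj(f_a(w)), conj(f_b(w))) = P(f_a(z), f_b(z), conj(f_a(w)), conj(f_b(w))) for all (z,w) ∈ Ω × Ω; that is, the square of the Szegő kernel is a rational combination of the two Ahlfors maps f_a and f_b. -/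

import Mathlib

open MeasureTheory Complex ComplexConjugate Metric Set

noncomputable section

/-- `f` belongs to the Bergman space `A²(Ω)`. -/
def BergmanFun (Ω : Set ℂ) (f : ℂ → ℂ) : Prop :=
  DifferentiableOn ℂ f Ω ∧ IntegrableOn (fun z => ‖f z‖ ^ 2) Ω volume

/-- `Ω` is a finitely connected domain none of whose complementary components is a point. -/
def IsFinConnDomain (Ω : Set ℂ) : Prop :=
  IsOpen Ω ∧ IsConnected Ω ∧
  {C : Set ℂ | ∃ x ∈ Ωᶜ, C = connectedComponentIn Ωᶜ x}.Finite ∧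
  ∀ x ∈ Ωᶜ, ¬ (connectedComponentIn Ωᶜ x).Subsingleton

/-- `Ω` is a quadrature domain. -/
def IsQuadratureDomain (Ω : Set ℂ) : Prop :=
  ∃ N : ℕ, 0 < N ∧ ∃ (w : Fin N → ℂ) (n : Fin N → ℕ) (c : Fin N → ℕ → ℂ),
    (∀ j, w j ∈ Ω) ∧
    ∀ f : ℂ → ℂ, BergmanFun Ω f →
      (∫ z in Ω, f z) =
        ∑ j, ∑ k ∈ Finset.range (n j + 1), c j k * iteratedDerivWithin k f Ω (w j)

/-- `fa` is an Ahlfors map of `Ω` at `a`. -/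
def IsAhlforsMap (Ω : Set ℂ) (a : ℂ) (fa : ℂ → ℂ) : Prop :=
  DifferentiableOn ℂ fa Ω ∧ (∀ z ∈ Ω, ‖fa z‖ < 1) ∧
  (deriv fa a).im = 0 ∧ 0 < (deriv fa a).re ∧
  ∀ g : ℂ → ℂ, DifferentiableOn ℂ g Ω → (∀ z ∈ Ω, ‖g z‖ < 1) →
    ‖deriv g a‖ ≤ (deriv fa a).re

/-- `Ω` is bounded with `C^∞` smooth boundary consisting of finitely many disjoint
simple closed curves. -/
def HasSmoothBoundary (Ω : Set ℂ) : Prop :=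
  Bornology.IsBounded Ω ∧
  ∃ (n : ℕ) (γ : Fin n → ℝ → ℂ),
    (∀ i, ContDiff ℝ (⊤ : ℕ∞) (γ i)) ∧
    (∀ i, Function.Periodic (γ i) (2 * Real.pi)) ∧
    (∀ i, InjOn (γ i) (Ico 0 (2 * Real.pi))) ∧
    (∀ i t, deriv (γ i) t ≠ 0) ∧
    (Pairwise fun i j => Disjoint (range (γ i)) (range (γ j))) ∧
    frontier Ω = ⋃ i, range (γ i)

/-- Partial derivative in the `x`-direction of a real-valued function on `ℂ`. -/
def pdx (u : ℂ → ℝ) (z : ℂ) : ℝ := deriv (fun t : ℝ => u (z + (t : ℂ))) 0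

/-- Partial derivative in the `y`-direction of a real-valued function on `ℂ`. -/
def pdy (u : ℂ → ℝ) (z : ℂ) : ℝ := deriv (fun t : ℝ => u (z + (t : ℂ) * Complex.I)) 0

/-- `f` is a proper holomorphic map of `Ω` onto the open unit disc. -/
def IsProperOntoDisc (Ω : Set ℂ) (f : ℂ → ℂ) : Prop :=
  DifferentiableOn ℂ f Ω ∧ f '' Ω = ball (0 : ℂ) 1 ∧
  ∀ L : Set ℂ, L ⊆ ball (0 : ℂ) 1 → IsCompact L → IsCompact (Ω ∩ f ⁻¹' L)

/-- `g` is `(m, δ)`-close to the identity on `closure Ω`. -/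
def CloseToId (Ω : Set ℂ) (m : ℕ) (δ : ℝ) (g : ℂ → ℂ) : Prop :=
  ∀ k ≤ m, ∀ z ∈ closure Ω, ‖iteratedFDeriv ℝ k (fun w => g w - w) z‖ ≤ δ

/-- `σ : [0,1] → ℂ` is a piecewise continuously differentiable curve. -/
def PiecewiseC1On01 (σ : ℝ → ℂ) : Prop :=
  ContinuousOn σ (Icc 0 1) ∧ ∃ s : Finset ℝ, ContDiffOn ℝ 1 σ (Icc (0 : ℝ) 1 \ s)

/-- `Ω` is a generalized quadrature domain. -/
def IsGenQuadratureDomain (Ω : Set ℂ) : Prop :=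
  ∃ (N M : ℕ) (w : Fin N → ℂ) (n : Fin N → ℕ) (c : Fin N → ℕ → ℂ)
    (b : Fin M → ℂ) (σ : Fin M → ℝ → ℂ),
    (∀ j, w j ∈ Ω) ∧
    (∀ m, PiecewiseC1On01 (σ m)) ∧
    (∀ m, ∀ t ∈ Icc (0 : ℝ) 1, σ m t ∈ Ω) ∧
    ∀ f : ℂ → ℂ, BergmanFun Ω f →
      (∫ z in Ω, f z) =
        (∑ j, ∑ k ∈ Finset.range (n j + 1), c j k * iteratedDerivWithin k f Ω (w j)) +
        ∑ m, b m * ∫ t in (0 : ℝ)..1, f (σ m t) * deriv (σ m) t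

open Filter Topology

/-- A smooth regular simple closed curve, parametrized with period `2π`. -/
structure SmoothLoop (γ : ℝ → ℂ) : Prop where
  smooth : ContDiff ℝ (⊤ : ℕ∞) γ
  per : Function.Periodic γ (2 * Real.pi)
  inj : InjOn γ (Ico 0 (2 * Real.pi))
  ne : ∀ t, deriv γ t ≠ 0

theorem Function.Periodic.exists_norm_le {E : Type*} [NormedAddCommGroup E] {f : ℝ → E}
    (hp : Function.Periodic f (2 * Real.pi)) (hf : Continuous f) : ∃ M > 0, ∀ t, ‖f t‖ ≤ M := by
  obtain ⟨M, hM⟩ := (isCompact_Icc (a := (0 : ℝ)) (b := 2 * Real.pi)).exists_bound_of_continuousOn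
    hf.continuousOn
  refine ⟨max M 1, by positivity, fun t => ?_⟩
  obtain ⟨y, hy, hfy⟩ := hp.exists_mem_Ico₀ Real.two_pi_pos t
  rw [hfy]
  exact (hM y ⟨hy.1, hy.2.le⟩).trans (le_max_left _ _)

theorem Function.Periodic.exists_le_norm {E : Type*} [NormedAddCommGroup E] {f : ℝ → E}
    (hp : Function.Periodic f (2 * Real.pi)) (hf : Continuous f) (h0 : ∀ t, f t ≠ 0) :
    ∃ m > 0, ∀ t, m ≤ ‖f t‖ := by
  obtain ⟨x, hx, hmin⟩ := (isCompact_Icc (a := (0 : ℝ)) (b := 2 * Real.pi)).exists_isMinOn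
    ⟨0, ⟨le_rfl, Real.two_pi_pos.le⟩⟩ hf.norm.continuousOn
  refine ⟨‖f x‖, norm_pos_iff.2 (h0 x), fun t => ?_⟩
  obtain ⟨y, hy, hfy⟩ := hp.exists_mem_Ico₀ Real.two_pi_pos t
  rw [hfy]
  exact hmin ⟨hy.1, hy.2.le⟩

namespace SmoothLoop

variable {γ : ℝ → ℂ}

theorem cont (h : SmoothLoop γ) : Continuous γ := h.smooth.continuous

theorem hasDerivAt (h : SmoothLoop γ) (t : ℝ) : HasDerivAt γ (deriv γ t) t :=
  (h.smooth.differentiable (by simp) t).hasDerivAt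

theorem smooth_deriv (h : SmoothLoop γ) : ContDiff ℝ (⊤ : ℕ∞) (deriv γ) := by
  have := h.smooth
  rw [contDiff_infty_iff_deriv] at this
  exact this.2

theorem cont_deriv (h : SmoothLoop γ) : Continuous (deriv γ) := h.smooth_deriv.continuous

theorem hasDerivAt_deriv (h : SmoothLoop γ) (t : ℝ) :
    HasDerivAt (deriv γ) (deriv (deriv γ) t) t :=
  (h.smooth_deriv.differentiable (by simp) t).hasDerivAt

theorem cont_deriv_deriv (h : SmoothLoop γ) : Continuous (deriv (deriv γ)) := by
  have := h.smooth_deriv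
  rw [contDiff_infty_iff_deriv] at this
  exact this.2.continuous

theorem _root_.Function.Periodic.deriv {f : ℝ → ℂ} {c : ℝ} (hf : Function.Periodic f c) :
    Function.Periodic (deriv f) c := by
  intro t
  have : (fun x => f (x + c)) = f := funext hf
  rw [← deriv_comp_add_const, this]

theorem per_deriv (h : SmoothLoop γ) : Function.Periodic (deriv γ) (2 * Real.pi) := h.per.deriv

theorem exists_int (h : SmoothLoop γ) {t u : ℝ} (htu : γ t = γ u) :
    ∃ k : ℤ, t = u + k * (2 * Real.pi) := by
  have hp := Real.two_pi_pos
  have e : ∀ x, γ (toIcoMod hp 0 x) = γ x := fun x => by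
    rw [toIcoMod]; exact h.per.sub_zsmul_eq _
  have hm : ∀ x, toIcoMod hp 0 x ∈ Ico 0 (2 * Real.pi) := fun x => by
    simpa using toIcoMod_mem_Ico hp 0 x
  have h1 := h.inj (hm t) (hm u) (by rw [e, e, htu])
  refine ⟨toIcoDiv hp 0 t - toIcoDiv hp 0 u, ?_⟩
  have a1 := toIcoMod_add_toIcoDiv_zsmul hp 0 t
  have a2 := toIcoMod_add_toIcoDiv_zsmul hp 0 u
  simp only [zsmul_eq_mul] at a1 a2
  push_cast
  linear_combination -a1 + a2 + h1

theorem eq_of_abs_lt (h : SmoothLoop γ) {t u : ℝ} (htu : γ t = γ u)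
    (hlt : |t - u| < 2 * Real.pi) : t = u := by
  obtain ⟨k, hk⟩ := h.exists_int htu
  have : |(k : ℝ)| < 1 := by
    have : |t - u| = |(k : ℝ)| * (2 * Real.pi) := by
      rw [hk, add_sub_cancel_left, abs_mul, abs_of_pos Real.two_pi_pos]
    rw [this] at hlt
    have := Real.two_pi_pos
    nlinarith
  have hk0 : k = 0 := by
    have : |k| < 1 := by exact_mod_cast this
    exact Int.abs_lt_one_iff.1 this
  simp [hk, hk0]

theorem bounds (h : SmoothLoop γ) : ∃ m > 0, ∃ M > 0, ∃ K > 0,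
    (∀ t, m ≤ ‖deriv γ t‖) ∧ (∀ t, ‖deriv γ t‖ ≤ M) ∧
    (∀ t u, ‖deriv γ u - deriv γ t‖ ≤ K * |u - t|) ∧
    (∀ t u, ‖γ u - γ t - (u - t) * deriv γ t‖ ≤ K * (u - t) ^ 2) := by
  obtain ⟨m, hm, hm'⟩ := h.per_deriv.exists_le_norm h.cont_deriv h.ne
  obtain ⟨M, hM, hM'⟩ := h.per_deriv.exists_norm_le h.cont_deriv
  obtain ⟨K, hK, hK'⟩ := h.per_deriv.deriv.exists_norm_le h.cont_deriv_deriv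
  have h1 : ∀ t u, ‖deriv γ u - deriv γ t‖ ≤ K * |u - t| := fun t u => by
    simpa using Convex.norm_image_sub_le_of_norm_hasDerivWithin_le (s := univ)
      (fun x _ => (h.hasDerivAt_deriv x).hasDerivWithinAt) (fun x _ => hK' x) convex_univ
      (mem_univ t) (mem_univ u)
  refine ⟨m, hm, M, hM, K, hK, hm', hM', h1, fun t u => ?_⟩
  have := Convex.norm_image_sub_le_of_norm_hasDerivWithin_le (s := uIcc t u)
      (f := fun x => γ x - (x - t) * deriv γ t) (f' := fun x => deriv γ x - deriv γ t)
      (C := K * |u - t|) (x := t) (y := u)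
      (fun x _ => by
        have h2 : HasDerivAt (fun x : ℝ => ((x : ℂ) - t) * deriv γ t) (1 * deriv γ t) x :=
          (((hasDerivAt_id x).ofReal_comp).sub_const _).mul_const _
        rw [one_mul] at h2
        exact ((h.hasDerivAt x).sub h2).hasDerivWithinAt)
      (fun x hx => (h1 t x).trans
        (mul_le_mul_of_nonneg_left (abs_sub_left_of_mem_uIcc hx) hK.le))
      (convex_uIcc t u) left_mem_uIcc right_mem_uIcc
  simp only [sub_self, zero_mul, sub_zero, Real.norm_eq_abs, mul_assoc, abs_mul_abs_self] at this
  rw [pow_two]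
  rwa [sub_right_comm]

/-- Points on the normal line stay quantitatively away from the curve. -/
theorem dom (h : SmoothLoop γ) : ∃ κ > 0, ∃ δ > 0, ∀ t u s : ℝ, |u - t| ≤ Real.pi → |s| ≤ δ →
    κ * (|u - t| + |s|) ≤ ‖γ u - (γ t + s * I * deriv γ t)‖ := by
  obtain ⟨m, hm, M, hM, K, hK, hm', hM', -, hT⟩ := h.bounds
  set τ0 := min (m / (4 * K)) 1 with hτ0
  have hτ0p : 0 < τ0 := by positivity
  have hτ1 : K * τ0 ≤ m / 4 := by
    have : τ0 ≤ m / (4 * K) := min_le_left _ _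
    calc K * τ0 ≤ K * (m / (4 * K)) := by gcongr
      _ = m / 4 := by field_simp
  have hc : IsCompact ((Icc (0 : ℝ) (2 * Real.pi)) ×ˢ
      (Icc (-Real.pi) Real.pi ∩ {x : ℝ | τ0 ≤ |x|})) :=
    isCompact_Icc.prod (isCompact_Icc.inter_right (isClosed_le continuous_const continuous_abs))
  have hcont : Continuous (fun p : ℝ × ℝ => ‖γ (p.1 + p.2) - γ p.1‖) :=
    ((h.cont.comp (continuous_fst.add continuous_snd)).sub (h.cont.comp continuous_fst)).norm
  have hne : ((Icc (0 : ℝ) (2 * Real.pi)) ×ˢ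
      (Icc (-Real.pi) Real.pi ∩ {x : ℝ | τ0 ≤ |x|})).Nonempty := by
    refine ⟨(0, 1), ⟨le_rfl, Real.two_pi_pos.le⟩, ⟨?_, ?_⟩, ?_⟩
    · linarith [Real.pi_gt_three]
    · show (1 : ℝ) ≤ _
      linarith [Real.pi_gt_three]
    · show τ0 ≤ |(1 : ℝ)|
      rw [abs_one]; exact min_le_right _ _
  obtain ⟨p, hp, hpmin⟩ := hc.exists_isMinOn hne hcont.continuousOn
  set c := ‖γ (p.1 + p.2) - γ p.1‖ with hcdef
  have hcpos : 0 < c := by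
    rw [hcdef, norm_pos_iff, sub_ne_zero]
    intro he
    have h1 := h.eq_of_abs_lt he (by
      rw [add_sub_cancel_left]
      have := abs_le.2 hp.2.1
      linarith [Real.pi_pos])
    have h2 : τ0 ≤ |p.2| := hp.2.2
    rw [add_eq_left.1 h1, abs_zero] at h2
    linarith
  have hcmin : ∀ t u : ℝ, |u - t| ≤ Real.pi → τ0 ≤ |u - t| → c ≤ ‖γ u - γ t‖ := by
    intro t u h1 h2
    have hp2 := Real.two_pi_pos
    have := hpmin (show (toIcoMod hp2 0 t, u - t) ∈ _ from
      ⟨Ico_subset_Icc_self (by simpa using toIcoMod_mem_Ico hp2 0 t), abs_le.1 h1, h2⟩)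
    have e1 : γ (toIcoMod hp2 0 t) = γ t := by rw [toIcoMod]; exact h.per.sub_zsmul_eq _
    have e2 : γ (toIcoMod hp2 0 t + (u - t)) = γ u := by
      have : toIcoMod hp2 0 t + (u - t) = u - toIcoDiv hp2 0 t • (2 * Real.pi) := by
        rw [toIcoMod]; ring
      rw [this]; exact h.per.sub_zsmul_eq _
    simp only [mem_ofPred_eq, e1, e2] at this
    exact this
  set δ := c / (2 * M) with hδ
  have hδp : 0 < δ := by positivity
  refine ⟨min (m / 4) (c / 2 / (Real.pi + δ)), by have := Real.pi_pos; positivity, δ, hδp,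
    fun t u s hut hs => ?_⟩
  rcases le_total τ0 |u - t| with hge | hle
  · have h1 := hcmin t u hut hge
    have h2 : ‖(s * I * deriv γ t : ℂ)‖ ≤ c / 2 := by
      rw [norm_mul, norm_mul, norm_I, mul_one, norm_real, Real.norm_eq_abs]
      calc |s| * ‖deriv γ t‖ ≤ δ * M := by gcongr; exact hM' t
        _ = c / 2 := by rw [hδ]; field_simp
    have h3 : ‖γ u - γ t‖ - ‖(s * I * deriv γ t : ℂ)‖ ≤ ‖γ u - (γ t + s * I * deriv γ t)‖ := by
      rw [← sub_sub]; exact norm_sub_norm_le _ _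
    have hpos : 0 < Real.pi + δ := by have := Real.pi_pos; positivity
    calc _ ≤ c / 2 / (Real.pi + δ) * (Real.pi + δ) := by
            gcongr
            exact min_le_right _ _
      _ = c / 2 := by field_simp
      _ ≤ _ := by linarith
  · have h1 := hT t u
    have h2 : ‖((u - t : ℝ) - s * I : ℂ) * deriv γ t‖ - ‖γ u - γ t - (u - t) * deriv γ t‖ ≤
        ‖γ u - (γ t + s * I * deriv γ t)‖ := by
      have := norm_sub_norm_le (((u - t : ℝ) - s * I : ℂ) * deriv γ t)
        (-(γ u - γ t - (u - t) * deriv γ t))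
      rw [norm_neg] at this
      convert this using 2
      congr 1
      push_cast; ring
    have h3 : (|u - t| + |s|) / 2 ≤ ‖((u - t : ℝ) - s * I : ℂ)‖ := by
      have a1 := abs_re_le_norm ((u - t : ℝ) - s * I : ℂ)
      have a2 := abs_im_le_norm ((u - t : ℝ) - s * I : ℂ)
      simp only [sub_re, ofReal_re, mul_re, I_re, mul_zero, ofReal_im, I_im, mul_one, sub_zero,
        sub_im, mul_im, zero_sub, abs_neg, add_zero, sub_self] at a1 a2
      linarith
    have h4 : (|u - t| + |s|) / 2 * m ≤ ‖((u - t : ℝ) - s * I : ℂ) * deriv γ t‖ := by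
      rw [norm_mul]; gcongr; exact hm' t
    have h5 : K * (u - t) ^ 2 ≤ m / 4 * |u - t| := by
      rw [← sq_abs, pow_two, ← mul_assoc]
      gcongr
      exact (mul_le_mul_of_nonneg_left hle hK.le).trans hτ1
    have h6 : min (m / 4) (c / 2 / (Real.pi + δ)) * (|u - t| + |s|) ≤ m / 4 * (|u - t| + |s|) := by
      gcongr; exact min_le_left _ _
    have : 0 ≤ m * |s| := by positivity
    linarith

end SmoothLoop

/-- The Cauchy integral `∫ ψ(t) / (γ(t) - z) dt`. -/
def CI (γ ψ : ℝ → ℂ) (z : ℂ) : ℂ := ∫ t in (0 : ℝ)..(2 * Real.pi), ψ t / (γ t - z)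

/-- The filter of one-sided approach to the boundary point with parameter `t`. -/
def sideFilter (t : ℝ) : Filter (ℝ × ℝ) := 𝓝 t ×ˢ 𝓝[>] (0 : ℝ)

instance (t : ℝ) : (sideFilter t).NeBot := by unfold sideFilter; infer_instance

instance (t : ℝ) : (sideFilter t).IsCountablyGenerated := by unfold sideFilter; infer_instance

theorem sideFilter_fst (t : ℝ) : Tendsto Prod.fst (sideFilter t) (𝓝 t) := tendsto_fst

theorem sideFilter_snd' (t : ℝ) : Tendsto Prod.snd (sideFilter t) (𝓝[>] 0) := tendsto_snd

theorem sideFilter_snd (t : ℝ) : Tendsto Prod.snd (sideFilter t) (𝓝 0) :=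
  (sideFilter_snd' t).mono_right nhdsWithin_le_nhds

theorem sideFilter_small (t : ℝ) {δ : ℝ} (hδ : 0 < δ) :
    ∀ᶠ p in sideFilter t, 0 < p.2 ∧ p.2 < δ :=
  (sideFilter_snd' t).eventually (Ioo_mem_nhdsGT hδ)

theorem intervalIntegral_eq_integral_rescale (F : ℝ → ℂ) (t : ℝ) {s : ℝ} (hs : 0 < s) :
    ∫ y in (t - Real.pi)..(t + Real.pi), F y =
      ∫ x, (Ioc (-(Real.pi / s)) (Real.pi / s)).indicator (fun x => (s : ℂ) * F (t + s * x)) x := by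
  rw [integral_indicator measurableSet_Ioc, ← intervalIntegral.integral_of_le (by
    have := Real.pi_pos; have : 0 < Real.pi / s := by positivity
    linarith)]
  have := intervalIntegral.smul_integral_comp_add_mul F s t (a := -(Real.pi / s))
    (b := Real.pi / s)
  rw [mul_neg, mul_div_cancel₀ _ hs.ne', ← sub_eq_add_neg] at this
  rw [← this, intervalIntegral.integral_const_mul, Complex.real_smul]

theorem Function.Periodic.intervalIntegral_eq_symm {F : ℝ → ℂ}
    (hF : Function.Periodic F (2 * Real.pi)) (t : ℝ) :
    ∫ y in (0 : ℝ)..(2 * Real.pi), F y = ∫ y in (t - Real.pi)..(t + Real.pi), F y := by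
  have := hF.intervalIntegral_add_eq 0 (t - Real.pi)
  rw [zero_add] at this
  rw [this]; congr 1; ring

namespace SmoothLoop

variable {γ ψ : ℝ → ℂ}

/-- Every parameter can be moved within `π` of a given one. -/
theorem _root_.exists_int_abs_le_pi (t u : ℝ) : ∃ k : ℤ, |u + k * (2 * Real.pi) - t| ≤ Real.pi := by
  have hp := Real.two_pi_pos
  refine ⟨-toIcoDiv hp (t - Real.pi) u, ?_⟩
  have h1 := toIcoMod_mem_Ico hp (t - Real.pi) u
  have h2 : toIcoMod hp (t - Real.pi) u = u + (-toIcoDiv hp (t - Real.pi) u : ℤ) * (2 * Real.pi) := by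
    rw [toIcoMod, zsmul_eq_mul]; push_cast; ring
  rw [← h2, abs_le]
  constructor <;> linarith [h1.1, h1.2]

theorem add_int (h : SmoothLoop γ) (u : ℝ) (k : ℤ) : γ (u + k * (2 * Real.pi)) = γ u := by
  simpa using h.per.int_mul k u

/-- Points close to the curve along the normal are not on the curve. -/
theorem exists_off (h : SmoothLoop γ) : ∃ δ > 0, ∀ t u s : ℝ, s ≠ 0 → |s| ≤ δ →
    γ u ≠ γ t + s * I * deriv γ t := by
  obtain ⟨κ, hκ, δ, hδ, hd⟩ := h.dom
  refine ⟨δ, hδ, fun t u s hs hsδ he => ?_⟩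
  obtain ⟨k, hk⟩ := exists_int_abs_le_pi t u
  have := hd t _ s hk hsδ
  rw [h.add_int, he, sub_self, norm_zero] at this
  have h1 : 0 < |s| := abs_pos.2 hs
  have h2 : 0 ≤ |u + k * (2 * Real.pi) - t| := abs_nonneg _
  have h3 : 0 < κ * (|u + k * (2 * Real.pi) - t| + |s|) := by positivity
  linarith

theorem tendsto_diffQuot (h : SmoothLoop γ) (t0 x : ℝ) :
    Tendsto (fun p : ℝ × ℝ => (γ (p.1 + p.2 * x) - γ p.1) / p.2) (sideFilter t0)
      (𝓝 (x * deriv γ t0)) := by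
  obtain ⟨m, hm, M, hM, K, hK, hm', hM', -, hT⟩ := h.bounds
  have h1 : Tendsto (fun p : ℝ × ℝ => (x : ℂ) * deriv γ p.1) (sideFilter t0)
      (𝓝 (x * deriv γ t0)) :=
    ((h.cont_deriv.tendsto t0).comp (sideFilter_fst t0)).const_mul _
  have h2 : Tendsto (fun p : ℝ × ℝ => (γ (p.1 + p.2 * x) - γ p.1) / p.2 - x * deriv γ p.1)
      (sideFilter t0) (𝓝 0) := by
    have h3 : Tendsto (fun p : ℝ × ℝ => K * (p.2 * x ^ 2)) (sideFilter t0) (𝓝 0) := by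
      simpa using ((sideFilter_snd t0).mul_const (x ^ 2)).const_mul K
    refine squeeze_zero_norm' ?_ h3
    filter_upwards [sideFilter_small t0 one_pos] with p hp
    have hp0 : (p.2 : ℂ) ≠ 0 := by exact_mod_cast hp.1.ne'
    have := hT p.1 (p.1 + p.2 * x)
    have e : (γ (p.1 + p.2 * x) - γ p.1) / p.2 - x * deriv γ p.1 =
      (γ (p.1 + p.2 * x) - γ p.1 - ((p.1 + p.2 * x : ℝ) - p.1) * deriv γ p.1) / p.2 := by
      field_simp; push_cast; ring
    rw [e, norm_div, norm_real, Real.norm_of_nonneg hp.1.le, div_le_iff₀ hp.1]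
    refine this.trans (le_of_eq ?_)
    ring
  simpa using h2.add h1

theorem cont_CI_integrand (h : SmoothLoop γ) (hψ : Continuous ψ) {z : ℂ} (hz : ∀ t, γ t ≠ z) :
    Continuous fun t => ψ t / (γ t - z) :=
  hψ.div (h.cont.sub continuous_const) fun t => sub_ne_zero.2 (hz t)

theorem plemelj (h : SmoothLoop γ) (hψ : Continuous ψ) (hp : Function.Periodic ψ (2 * Real.pi))
    (t0 : ℝ) :
    Tendsto (fun p : ℝ × ℝ => CI γ ψ (γ p.1 + p.2 * I * deriv γ p.1) -
      CI γ ψ (γ p.1 - p.2 * I * deriv γ p.1)) (sideFilter t0)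
      (𝓝 (2 * Real.pi * I * (ψ t0 / deriv γ t0))) := by
  obtain ⟨m, hm, M, hM, K, hK, hm', hM', -, hT⟩ := h.bounds
  obtain ⟨κ, hκ, δ, hδ, hd⟩ := h.dom
  obtain ⟨δ', hδ', hoff⟩ := h.exists_off
  obtain ⟨B, hB, hB'⟩ := hp.exists_norm_le hψ
  set G : ℝ × ℝ → ℝ → ℂ := fun p u => ψ u * (2 * p.2 * I * deriv γ p.1) /
    ((γ u - (γ p.1 + p.2 * I * deriv γ p.1)) * (γ u - (γ p.1 - p.2 * I * deriv γ p.1))) with hG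
  have hGper : ∀ p, Function.Periodic (G p) (2 * Real.pi) := fun p u => by
    simp only [hG, hp u, h.per u]
  set H : ℝ × ℝ → ℝ → ℂ := fun p => (Ioc (-(Real.pi / p.2)) (Real.pi / p.2)).indicator
    (fun x => (p.2 : ℂ) * G p (p.1 + p.2 * x)) with hH
  have hnm : ∀ p : ℝ × ℝ, γ p.1 - p.2 * I * deriv γ p.1 =
      γ p.1 + (-p.2 : ℝ) * I * deriv γ p.1 := fun p => by push_cast; ring
  have hev : ∀ᶠ p in sideFilter t0, 0 < p.2 ∧ p.2 < min δ δ' :=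
    sideFilter_small t0 (by positivity)
  have hoff2 : ∀ p : ℝ × ℝ, 0 < p.2 ∧ p.2 < min δ δ' → ∀ u,
      γ u ≠ γ p.1 + p.2 * I * deriv γ p.1 ∧ γ u ≠ γ p.1 - p.2 * I * deriv γ p.1 := by
    intro p hp u
    have h1 : |p.2| ≤ δ' := by rw [abs_of_pos hp.1]; exact (hp.2.trans_le (min_le_right _ _)).le
    refine ⟨hoff _ _ _ hp.1.ne' h1, ?_⟩
    rw [hnm p]
    exact hoff _ _ _ (neg_ne_zero.2 hp.1.ne') (by rwa [abs_neg])
  have hGcont : ∀ p : ℝ × ℝ, 0 < p.2 ∧ p.2 < min δ δ' → Continuous (G p) := by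
    intro p hp
    refine (hψ.mul continuous_const).div ((h.cont.sub continuous_const).mul
      (h.cont.sub continuous_const)) fun u => ?_
    exact mul_ne_zero (sub_ne_zero.2 (hoff2 p hp u).1) (sub_ne_zero.2 (hoff2 p hp u).2)
  have hkey : ∀ᶠ p in sideFilter t0, (∫ x, H p x) = CI γ ψ (γ p.1 + p.2 * I * deriv γ p.1) -
      CI γ ψ (γ p.1 - p.2 * I * deriv γ p.1) := by
    filter_upwards [hev] with p hp
    rw [hH, ← intervalIntegral_eq_integral_rescale _ _ hp.1,
      ← (hGper p).intervalIntegral_eq_symm, CI, CI, ← intervalIntegral.integral_sub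
      ((h.cont_CI_integrand hψ fun t => (hoff2 p hp t).1).intervalIntegrable _ _)
      ((h.cont_CI_integrand hψ fun t => (hoff2 p hp t).2).intervalIntegrable _ _)]
    congr 1
    ext u
    have h1 := sub_ne_zero.2 (hoff2 p hp u).1
    have h2 := sub_ne_zero.2 (hoff2 p hp u).2
    rw [hG, div_sub_div _ _ h1 h2]
    ring
  have hlim : ∀ x : ℝ, Tendsto (fun p => H p x) (sideFilter t0)
      (𝓝 (2 * I * (ψ t0 / deriv γ t0) * ((1 + x ^ 2 : ℝ)⁻¹ : ℝ))) := by
    intro x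
    have hd0 : deriv γ t0 ≠ 0 := h.ne t0
    have hA := h.tendsto_diffQuot t0 x
    have hγ' : Tendsto (fun p : ℝ × ℝ => deriv γ p.1) (sideFilter t0) (𝓝 (deriv γ t0)) :=
      (h.cont_deriv.tendsto t0).comp (sideFilter_fst t0)
    have hψ' : Tendsto (fun p : ℝ × ℝ => ψ (p.1 + p.2 * x)) (sideFilter t0) (𝓝 (ψ t0)) := by
      refine (hψ.tendsto t0).comp ?_
      simpa using (sideFilter_fst t0).add ((sideFilter_snd t0).mul_const x)
    have hx1 : (x : ℂ) - I ≠ 0 := fun he => by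
      have := congrArg Complex.im he; simp at this
    have hx2 : (x : ℂ) + I ≠ 0 := fun he => by
      have := congrArg Complex.im he; simp at this
    have hne : (x * deriv γ t0 - I * deriv γ t0) * (x * deriv γ t0 + I * deriv γ t0) ≠ 0 := by
      rw [← sub_mul, ← add_mul]
      exact mul_ne_zero (mul_ne_zero hx1 hd0) (mul_ne_zero hx2 hd0)
    have := (hψ'.mul (hγ'.const_mul (2 * I))).div
      ((hA.sub (hγ'.const_mul I)).mul (hA.add (hγ'.const_mul I))) hne
    have hval : ψ t0 * (2 * I * deriv γ t0) /
      ((x * deriv γ t0 - I * deriv γ t0) * (x * deriv γ t0 + I * deriv γ t0)) =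
      2 * I * (ψ t0 / deriv γ t0) * ((1 + x ^ 2 : ℝ)⁻¹ : ℝ) := by
      have e : (x * deriv γ t0 - I * deriv γ t0) * (x * deriv γ t0 + I * deriv γ t0) =
          deriv γ t0 ^ 2 * (1 + x ^ 2 : ℝ) := by
        push_cast
        linear_combination -(deriv γ t0) ^ 2 * I_sq
      have e2 : ((1 + x ^ 2 : ℝ) : ℂ) ≠ 0 := by
        rw [ofReal_ne_zero]; positivity
      rw [e, ofReal_inv]
      field_simp
    rw [hval] at this
    refine this.congr' ?_
    have hx : ∀ᶠ p in sideFilter t0, 0 < p.2 ∧ p.2 < Real.pi / (|x| + 1) :=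
      sideFilter_small t0 (by have := Real.pi_pos; positivity)
    filter_upwards [hev, hx] with p hp hpx
    have hmem : x ∈ Ioc (-(Real.pi / p.2)) (Real.pi / p.2) := by
      have h1 : |x| < Real.pi / p.2 := by
        rw [lt_div_iff₀ hp.1]
        have := (lt_div_iff₀ (by positivity)).1 hpx.2
        nlinarith [hp.1]
      rw [abs_lt] at h1
      exact ⟨h1.1, h1.2.le⟩
    have hp0 : (p.2 : ℂ) ≠ 0 := by exact_mod_cast hp.1.ne'
    simp only [hH, indicator_of_mem hmem, hG, Pi.div_apply]
    have h1 := sub_ne_zero.2 (hoff2 p hp (p.1 + p.2 * x)).1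
    have h2 := sub_ne_zero.2 (hoff2 p hp (p.1 + p.2 * x)).2
    have e1 : (γ (p.1 + p.2 * x) - γ p.1) / p.2 - I * deriv γ p.1 =
      (γ (p.1 + p.2 * x) - (γ p.1 + p.2 * I * deriv γ p.1)) / p.2 := by
      field_simp; ring
    have e2 : (γ (p.1 + p.2 * x) - γ p.1) / p.2 + I * deriv γ p.1 =
      (γ (p.1 + p.2 * x) - (γ p.1 - p.2 * I * deriv γ p.1)) / p.2 := by
      field_simp; ring
    rw [e1, e2]
    field_simp
  have hbound : ∀ᶠ p in sideFilter t0, ∀ᵐ x, ‖H p x‖ ≤ 2 * B * M / κ ^ 2 * (1 + x ^ 2)⁻¹ := by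
    filter_upwards [hev] with p hp
    refine Eventually.of_forall fun x => ?_
    simp only [hH]
    by_cases hx : x ∈ Ioc (-(Real.pi / p.2)) (Real.pi / p.2)
    · rw [indicator_of_mem hx, hG]
      have hxs : |p.1 + p.2 * x - p.1| ≤ Real.pi := by
        rw [add_sub_cancel_left, abs_mul, abs_of_pos hp.1, mul_comm, ← le_div_iff₀ hp.1, abs_le]
        exact ⟨hx.1.le, hx.2⟩
      have hsd : |p.2| ≤ δ := by
        rw [abs_of_pos hp.1]; exact (hp.2.trans_le (min_le_left _ _)).le
      have h1 := hd p.1 (p.1 + p.2 * x) p.2 hxs hsd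
      have h2 := hd p.1 (p.1 + p.2 * x) (-p.2) hxs (by rwa [abs_neg])
      rw [← hnm p] at h2
      rw [add_sub_cancel_left, abs_mul, abs_neg] at h2
      rw [add_sub_cancel_left, abs_mul] at h1
      rw [abs_of_pos hp.1] at h1 h2
      have hlow : 0 < κ * (p.2 * |x| + p.2) := by
        have := hp.1; positivity
      rw [norm_mul, norm_div, norm_mul, norm_mul, norm_mul, norm_mul, norm_mul, norm_I, norm_real,
        Real.norm_of_nonneg hp.1.le, mul_one, Complex.norm_ofNat]
      calc _ ≤ p.2 * (B * (2 * p.2 * M) / ((κ * (p.2 * |x| + p.2)) * (κ * (p.2 * |x| + p.2)))) := by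
            have := hp.1
            gcongr
            · exact hB' _
            · exact hM' _
        _ = 2 * B * M / κ ^ 2 * ((|x| + 1) ^ 2)⁻¹ := by
            have := hp.1.ne'
            have : |x| + 1 ≠ 0 := by positivity
            field_simp
        _ ≤ _ := by
            gcongr
            nlinarith [abs_nonneg x, sq_abs x]
    · rw [indicator_of_notMem hx, norm_zero]; positivity
  have hmeas : ∀ᶠ p in sideFilter t0, AEStronglyMeasurable (H p) volume := by
    filter_upwards [hev] with p hp
    refine AEStronglyMeasurable.indicator ?_ measurableSet_Ioc
    exact (continuous_const.mul ((hGcont p hp).comp (by fun_prop))).aestronglyMeasurable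
  have hfin := tendsto_integral_filter_of_dominated_convergence _ hmeas hbound
    (integrable_inv_one_add_sq.const_mul _) (Eventually.of_forall hlim)
  rw [integral_const_mul, integral_complex_ofReal, integral_univ_inv_one_add_sq] at hfin
  refine (hfin.congr' hkey).trans_eq ?_
  congr 1; ring

end SmoothLoop

theorem exists_pos_forall_fin {n : ℕ} {P : Fin n → ℝ → Prop}
    (hmono : ∀ i a b, 0 < a → a ≤ b → P i b → P i a) (h : ∀ i, ∃ δ > 0, P i δ) :
    ∃ δ > 0, ∀ i, P i δ := by
  have : ∀ᶠ δ in 𝓝[>] (0 : ℝ), ∀ i, P i δ := by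
    rw [eventually_all]
    intro i
    obtain ⟨δ, hδ, hP⟩ := h i
    filter_upwards [Ioc_mem_nhdsGT hδ] with x hx using hmono i x δ hx.1 hx.2 hP
  obtain ⟨δ, h1, h2⟩ := (this.and self_mem_nhdsWithin).exists
  exact ⟨δ, h2, h1⟩

theorem exists_forall_fin_le {n : ℕ} {P : Fin n → ℝ → Prop}
    (hmono : ∀ i a b, a ≤ b → P i a → P i b) (h : ∀ i, ∃ M, P i M) :
    ∃ M > 0, ∀ i, P i M := by
  have : ∀ᶠ M in atTop, ∀ i, P i M := by
    rw [eventually_all]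
    intro i
    obtain ⟨M, hP⟩ := h i
    filter_upwards [eventually_ge_atTop M] with x hx using hmono i M x hx hP
  obtain ⟨M, h1, h2⟩ := (this.and (eventually_gt_atTop 0)).exists
  exact ⟨M, h2, h1⟩

theorem exists_pos_le_norm_sub {γ : ℝ → ℂ} (hγ : Continuous γ)
    (hper : Function.Periodic γ (2 * Real.pi)) {z : ℂ} (hz : ∀ t, γ t ≠ z) :
    ∃ ε > 0, ∀ t, ε ≤ ‖γ t - z‖ :=
  Function.Periodic.exists_le_norm (f := fun t => γ t - z) (fun t => congrArg (· - z) (hper t))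
    (hγ.sub continuous_const) fun t => sub_ne_zero.2 (hz t)

theorem CI_hasDerivAt {γ ψ : ℝ → ℂ} (hγ : Continuous γ)
    (hper : Function.Periodic γ (2 * Real.pi)) (hψ : Continuous ψ)
    {z : ℂ} (hz : ∀ t, γ t ≠ z) :
    HasDerivAt (CI γ ψ) (∫ t in (0 : ℝ)..(2 * Real.pi), ψ t / (γ t - z) ^ 2) z := by
  obtain ⟨ε, hε, hε'⟩ := exists_pos_le_norm_sub hγ hper hz
  obtain ⟨B, hB⟩ := (isCompact_uIcc (a := (0 : ℝ)) (b := 2 * Real.pi)).exists_bound_of_continuousOn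
    hψ.continuousOn
  have hball : ∀ w ∈ ball z (ε / 2), ∀ t, ε / 2 ≤ ‖γ t - w‖ := by
    intro w hw t
    have h1 := norm_sub_norm_le (γ t - z) (w - z)
    rw [sub_sub_sub_cancel_right] at h1
    rw [mem_ball, dist_eq_norm] at hw
    linarith [hε' t]
  have hne : ∀ w ∈ ball z (ε / 2), ∀ t, γ t - w ≠ 0 := fun w hw t h0 => by
    have := hball w hw t
    rw [h0, norm_zero] at this; linarith
  have hcont : ∀ w ∈ ball z (ε / 2), Continuous fun t => ψ t / (γ t - w) := fun w hw =>
    hψ.div (hγ.sub continuous_const) (hne w hw)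
  have hzb : z ∈ ball z (ε / 2) := mem_ball_self (by positivity)
  refine (intervalIntegral.hasDerivAt_integral_of_dominated_loc_of_deriv_le
    (F := fun w t => ψ t / (γ t - w)) (F' := fun w t => ψ t / (γ t - w) ^ 2)
    (bound := fun _ => B / (ε / 2) ^ 2) (s := ball z (ε / 2)) (ball_mem_nhds z (by positivity))
    ?_ ((hcont z hzb).intervalIntegrable _ _) ?_ ?_ (by simp) ?_).2
  · filter_upwards [ball_mem_nhds z (show 0 < ε / 2 by positivity)] with w hw
    exact (hcont w hw).aestronglyMeasurable
  · exact (hψ.div ((hγ.sub continuous_const).pow 2)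
      fun t => pow_ne_zero 2 (hne z hzb t)).aestronglyMeasurable
  · refine Eventually.of_forall fun t ht w hw => ?_
    rw [norm_div, norm_pow]
    have h1 := hball w hw t
    have h2 := hB t (uIoc_subset_uIcc ht)
    gcongr
    exact (norm_nonneg _).trans h2
  · refine Eventually.of_forall fun t _ w hw => ?_
    have h2 : HasDerivAt (fun w => γ t - w) (-1) w := by
      simpa using (hasDerivAt_id w).const_sub (γ t)
    exact ((hasDerivAt_const w (ψ t)).div h2 (hne w hw t)).congr_deriv (by simp)

theorem CI_continuousAt {γ ψ : ℝ → ℂ} (hγ : Continuous γ)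
    (hper : Function.Periodic γ (2 * Real.pi)) (hψ : Continuous ψ)
    {z : ℂ} (hz : ∀ t, γ t ≠ z) : ContinuousAt (CI γ ψ) z :=
  (CI_hasDerivAt hγ hper hψ hz).continuousAt

theorem CI_deriv_hasDerivAt {γ γ' : ℝ → ℂ} (hγ : ∀ t, HasDerivAt γ (γ' t) t)
    (hper : Function.Periodic γ (2 * Real.pi)) (hγ' : Continuous γ') {z : ℂ}
    (hz : ∀ t, γ t ≠ z) : HasDerivAt (CI γ γ') 0 z := by
  have hc : Continuous γ := continuous_iff_continuousAt.2 fun t => (hγ t).continuousAt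
  have h := CI_hasDerivAt hc hper hγ' hz
  have h2 : ∫ t in (0 : ℝ)..(2 * Real.pi), γ' t / (γ t - z) ^ 2 = 0 := by
    rw [intervalIntegral.integral_eq_sub_of_hasDerivAt (f := fun t => -(γ t - z)⁻¹)]
    · have := hper 0
      rw [zero_add] at this
      rw [this, sub_self]
    · intro t _
      exact (((hγ t).sub_const z).inv (sub_ne_zero.2 (hz t))).neg.congr_deriv (by ring)
    · exact (hγ'.div ((hc.sub continuous_const).pow 2)
        fun t => pow_ne_zero 2 (sub_ne_zero.2 (hz t))).intervalIntegrable _ _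
  rwa [h2] at h

/-- A bounded domain whose boundary consists of disjoint smooth loops. -/
structure Bdry0 (Ω : Set ℂ) {n : ℕ} (γ : Fin n → ℝ → ℂ) : Prop where
  isOpen : IsOpen Ω
  conn : IsConnected Ω
  bdd : Bornology.IsBounded Ω
  loop : ∀ i, SmoothLoop (γ i)
  disj : ∀ i j t u, i ≠ j → γ i t ≠ γ j u
  frontier_eq : ∀ z, z ∈ frontier Ω ↔ ∃ i t, z = γ i t

/-- The point at signed normal offset `s` from the curve at parameter `t`. -/
def nrm (γ : ℝ → ℂ) (t s : ℝ) : ℂ := γ t + s * I * deriv γ t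

theorem nrm_neg (γ : ℝ → ℂ) (t s : ℝ) : nrm γ t (-s) = γ t - s * I * deriv γ t := by
  rw [nrm]; push_cast; ring

theorem SmoothLoop.continuous_nrm {γ : ℝ → ℂ} (h : SmoothLoop γ) :
    Continuous fun p : ℝ × ℝ => nrm γ p.1 p.2 := by
  have := h.cont
  have := h.cont_deriv
  unfold nrm
  fun_prop

namespace Bdry0

variable {Ω : Set ℂ} {n : ℕ} {γ : Fin n → ℝ → ℂ}

theorem mem_frontier (h : Bdry0 Ω γ) (i : Fin n) (t : ℝ) : γ i t ∈ frontier Ω :=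
  (h.frontier_eq _).2 ⟨i, t, rfl⟩

theorem notMem (h : Bdry0 Ω γ) (i : Fin n) (t : ℝ) : γ i t ∉ Ω := fun hm => by
  have : γ i t ∈ Ω ∩ frontier Ω := ⟨hm, h.mem_frontier i t⟩
  rwa [h.isOpen.inter_frontier_eq] at this

theorem off (h : Bdry0 Ω γ) {z : ℂ} (hz : z ∉ frontier Ω) (i : Fin n) (t : ℝ) : γ i t ≠ z :=
  fun he => hz (he ▸ h.mem_frontier i t)

theorem off_of_mem (h : Bdry0 Ω γ) {z : ℂ} (hz : z ∈ Ω) (i : Fin n) (t : ℝ) : γ i t ≠ z :=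
  fun he => h.notMem i t (he ▸ hz)

theorem frontier_subset_closure' {z : ℂ} (hz : z ∉ closure Ω) : z ∉ frontier Ω :=
  fun h => hz (frontier_subset_closure h)

theorem compact_frontier (h : Bdry0 Ω γ) : IsCompact (frontier Ω) :=
  Metric.isCompact_of_isClosed_isBounded isClosed_frontier
    (h.bdd.closure.subset frontier_subset_closure)

theorem exists_sep (h : Bdry0 Ω γ) : ∃ d > 0, ∀ i j t u, i ≠ j → d ≤ ‖γ i t - γ j u‖ := by
  refine (exists_pos_forall_fin (P := fun i d => ∀ j t u, i ≠ j → d ≤ ‖γ i t - γ j u‖)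
    (fun i a b ha hab hb j t u hij => hab.trans (hb j t u hij)) fun i => ?_).imp
      fun d hd => ⟨hd.1, fun i => hd.2 i⟩
  refine exists_pos_forall_fin (P := fun j d => ∀ t u, i ≠ j → d ≤ ‖γ i t - γ j u‖)
    (fun j a b ha hab hb t u hij => hab.trans (hb t u hij)) fun j => ?_
  by_cases hij : i = j
  · exact ⟨1, one_pos, fun _ _ h => absurd hij h⟩
  have hcpt : IsCompact (Icc (0 : ℝ) (2 * Real.pi) ×ˢ Icc (0 : ℝ) (2 * Real.pi)) :=
    isCompact_Icc.prod isCompact_Icc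
  have hcont : Continuous fun p : ℝ × ℝ => ‖γ i p.1 - γ j p.2‖ :=
    (((h.loop i).cont.comp continuous_fst).sub ((h.loop j).cont.comp continuous_snd)).norm
  obtain ⟨p, hp, hmin⟩ := hcpt.exists_isMinOn
    ⟨(0, 0), ⟨⟨le_rfl, Real.two_pi_pos.le⟩, ⟨le_rfl, Real.two_pi_pos.le⟩⟩⟩ hcont.continuousOn
  refine ⟨_, norm_pos_iff.2 (sub_ne_zero.2 (h.disj i j p.1 p.2 hij)), fun t u _ => ?_⟩
  obtain ⟨t', ht', e1⟩ := (h.loop i).per.exists_mem_Ico₀ Real.two_pi_pos t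
  obtain ⟨u', hu', e2⟩ := (h.loop j).per.exists_mem_Ico₀ Real.two_pi_pos u
  rw [e1, e2]
  exact hmin (show (t', u') ∈ _ from ⟨Ico_subset_Icc_self ht', Ico_subset_Icc_self hu'⟩)

theorem exists_dom (h : Bdry0 Ω γ) : ∃ κ > 0, ∃ δ > 0, ∀ i (t u s : ℝ), |u - t| ≤ Real.pi →
    |s| ≤ δ → κ * (|u - t| + |s|) ≤ ‖γ i u - nrm (γ i) t s‖ := by
  obtain ⟨κ, hκ, H⟩ := exists_pos_forall_fin (P := fun i κ => ∃ δ > 0, ∀ t u s : ℝ,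
    |u - t| ≤ Real.pi → |s| ≤ δ → κ * (|u - t| + |s|) ≤ ‖γ i u - nrm (γ i) t s‖)
    (fun i a b ha hab ⟨δ, hδ, hb⟩ => ⟨δ, hδ, fun t u s h1 h2 => le_trans (by gcongr) (hb t u s h1 h2)⟩)
    fun i => (h.loop i).dom
  obtain ⟨δ, hδ, H'⟩ := exists_pos_forall_fin (fun i a b ha hab hb t u s h1 h2 =>
    hb t u s h1 (h2.trans hab)) H
  exact ⟨κ, hκ, δ, hδ, H'⟩

theorem exists_bounds (h : Bdry0 Ω γ) : ∃ m > 0, ∃ M > 0, ∃ K > 0, ∀ i,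
    (∀ t, m ≤ ‖deriv (γ i) t‖) ∧ (∀ t, ‖deriv (γ i) t‖ ≤ M) ∧
    (∀ t u, ‖deriv (γ i) u - deriv (γ i) t‖ ≤ K * |u - t|) ∧
    (∀ t u, ‖γ i u - γ i t - (u - t) * deriv (γ i) t‖ ≤ K * (u - t) ^ 2) := by
  choose m hm M hM K hK hb using fun i => (h.loop i).bounds
  obtain ⟨m', hm', Hm⟩ := exists_pos_forall_fin (P := fun i x => x ≤ m i)
    (fun i a b _ h1 h2 => h1.trans h2) fun i => ⟨m i, hm i, le_rfl⟩
  obtain ⟨M', hM', HM⟩ := exists_forall_fin_le (P := fun i x => M i ≤ x)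
    (fun i a b h1 h2 => h2.trans h1) fun i => ⟨M i, le_rfl⟩
  obtain ⟨K', hK', HK⟩ := exists_forall_fin_le (P := fun i x => K i ≤ x)
    (fun i a b h1 h2 => h2.trans h1) fun i => ⟨K i, le_rfl⟩
  refine ⟨m', hm', M', hM', K', hK', fun i => ⟨fun t => (Hm i).trans ((hb i).1 t),
    fun t => ((hb i).2.1 t).trans (HM i), fun t u => ((hb i).2.2.1 t u).trans ?_,
    fun t u => ((hb i).2.2.2 t u).trans ?_⟩⟩
  · exact mul_le_mul_of_nonneg_right (HK i) (abs_nonneg _)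
  · exact mul_le_mul_of_nonneg_right (HK i) (sq_nonneg _)

/-- Small normal offsets avoid the boundary. -/
theorem exists_nrm_off (h : Bdry0 Ω γ) : ∃ δ > 0, ∀ i t s, s ≠ 0 → |s| < δ →
    nrm (γ i) t s ∉ frontier Ω := by
  obtain ⟨d, hd, hsep⟩ := h.exists_sep
  obtain ⟨m, hm, M, hM, K, hK, hb⟩ := h.exists_bounds
  obtain ⟨δ, hδ, hoff⟩ := exists_pos_forall_fin (P := fun i δ => ∀ t u s : ℝ, s ≠ 0 → |s| ≤ δ →
    γ i u ≠ γ i t + s * I * deriv (γ i) t)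
    (fun i a b ha hab hb t u s h1 h2 => hb t u s h1 (h2.trans hab)) fun i => (h.loop i).exists_off
  refine ⟨min δ (d / M), by positivity, fun i t s hs hsδ hf => ?_⟩
  obtain ⟨j, u, hju⟩ := (h.frontier_eq _).1 hf
  by_cases hij : i = j
  · subst hij
    exact hoff i t u s hs (hsδ.le.trans (min_le_left _ _)) hju.symm
  · have h1 := hsep i j t u hij
    rw [← hju, nrm, sub_add_cancel_left, norm_neg, norm_mul, norm_mul, norm_I, mul_one, norm_real,
      Real.norm_eq_abs] at h1
    have h2 : |s| < d / M := hsδ.trans_le (min_le_right _ _)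
    rw [lt_div_iff₀ hM] at h2
    have h3 : |s| * ‖deriv (γ i) t‖ ≤ |s| * M := by gcongr; exact (hb i).2.1 t
    linarith

theorem exists_nearest (h : Bdry0 Ω γ) : ∃ ε > 0, ∃ C > 0, ∀ z ∉ frontier Ω, ∀ i t0,
    ‖z - γ i t0‖ < ε → ∃ t s, |t - t0| ≤ C * ‖z - γ i t0‖ ∧ s ≠ 0 ∧ |s| ≤ C * ‖z - γ i t0‖ ∧
      z = nrm (γ i) t s := by
  obtain ⟨d, hd, hsep⟩ := h.exists_sep
  obtain ⟨m, hm, M, hM, K, hK, hb⟩ := h.exists_bounds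
  obtain ⟨κ, hκ, δ, hδ, hdom⟩ := h.exists_dom
  refine ⟨d / 2, by positivity, 2 / κ + 1 / m, by positivity, fun z hz i t0 hzt => ?_⟩
  obtain ⟨y, hy, hmin⟩ := h.compact_frontier.exists_infDist_eq_dist ⟨_, h.mem_frontier i t0⟩ z
  have hle : ∀ j u, ‖z - y‖ ≤ ‖z - γ j u‖ := fun j u => by
    rw [← dist_eq_norm, ← dist_eq_norm, ← hmin]
    exact infDist_le_dist_of_mem (h.mem_frontier j u)
  obtain ⟨j, t1, rfl⟩ := (h.frontier_eq _).1 hy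
  have hji : i = j := by
    by_contra hij
    have h1 := hsep i j t0 t1 hij
    have h2 := norm_add_le (z - γ j t1) (γ i t0 - z)
    rw [show z - γ j t1 + (γ i t0 - z) = γ i t0 - γ j t1 by ring, norm_sub_rev (γ i t0) z] at h2
    linarith [hle i t0]
  subst hji
  obtain ⟨k, hk⟩ := exists_int_abs_le_pi t0 t1
  set t := t1 + k * (2 * Real.pi) with ht
  have het : γ i t = γ i t1 := (h.loop i).add_int _ _
  rw [← het] at hle
  have hdne := (h.loop i).ne t
  have hre : ((z - γ i t) / deriv (γ i) t).re = 0 := by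
    have hloc : IsLocalMin (fun u : ℝ => (z - γ i u).re ^ 2 + (z - γ i u).im ^ 2) t := by
      refine Eventually.of_forall fun u => ?_
      have h1 := pow_le_pow_left₀ (norm_nonneg _) (hle i u) 2
      rw [Complex.sq_norm, Complex.sq_norm, normSq_apply, normSq_apply] at h1
      simp only [pow_two]; exact h1
    have hD : HasDerivAt (fun u => z - γ i u) (-deriv (γ i) t) t := ((h.loop i).hasDerivAt t).const_sub z
    have hD1 : HasDerivAt (fun u => (z - γ i u).re) (-deriv (γ i) t).re t :=
      Complex.reCLM.hasFDerivAt.comp_hasDerivAt t hD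
    have hD2 : HasDerivAt (fun u => (z - γ i u).im) (-deriv (γ i) t).im t :=
      Complex.imCLM.hasFDerivAt.comp_hasDerivAt t hD
    have h0 := hloc.hasDerivAt_eq_zero ((hD1.pow 2).add (hD2.pow 2))
    rw [div_re]
    have hns : normSq (deriv (γ i) t) ≠ 0 := by simpa using hdne
    simp only [neg_re, neg_im] at h0
    field_simp
    push_cast at h0
    linarith
  have hz0 : z ≠ γ i t := fun he => hz (he ▸ h.mem_frontier i t)
  set s := ((z - γ i t) / deriv (γ i) t).im with hs
  have hzs : z = nrm (γ i) t s := by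
    have : (z - γ i t) / deriv (γ i) t = s * I := by
      apply Complex.ext <;> simp [hre, hs]
    rw [nrm, ← this]; field_simp; ring
  refine ⟨t, s, ?_, ?_, ?_, hzs⟩
  · have h1 := hdom i t0 t 0 hk (by simpa using hδ.le)
    simp only [nrm, ofReal_zero, zero_mul, add_zero, abs_zero] at h1
    have h2 := norm_add_le (z - γ i t0) (γ i t - z)
    rw [show z - γ i t0 + (γ i t - z) = γ i t - γ i t0 by ring, norm_sub_rev (γ i t) z] at h2

    have h3 : |t - t0| ≤ 2 / κ * ‖z - γ i t0‖ := by
      rw [div_mul_eq_mul_div, le_div_iff₀ hκ]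
      linarith [hle i t0]
    have : 0 ≤ 1 / m * ‖z - γ i t0‖ := by positivity
    linarith
  · rintro h0
    apply hz0
    rw [hzs, h0, nrm]; simp
  · have h1 : |s| * m ≤ ‖z - γ i t0‖ := by
      calc |s| * m ≤ |s| * ‖deriv (γ i) t‖ := by gcongr; exact (hb i).1 t
        _ = ‖z - γ i t‖ := by
          conv_rhs => rw [hzs, nrm]
          simp
        _ ≤ _ := hle i t0
    have h3 : |s| ≤ 1 / m * ‖z - γ i t0‖ := by
      rw [div_mul_eq_mul_div, le_div_iff₀ hm]; linarith
    have : 0 ≤ 2 / κ * ‖z - γ i t0‖ := by positivity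
    linarith

end Bdry0

theorem exists_of_eventually_sideFilter {t0 : ℝ} {P : ℝ × ℝ → Prop}
    (h : ∀ᶠ p in sideFilter t0, P p) :
    ∃ η > 0, ∀ t s, |t - t0| < η → 0 < s → s < η → P (t, s) := by
  obtain ⟨pa, ha, pb, hb, hab⟩ := Filter.eventually_prod_iff.1 h
  obtain ⟨a, ha0, ha⟩ := Metric.eventually_nhds_iff.1 ha
  obtain ⟨b, hb0, hb⟩ := mem_nhdsGT_iff_exists_Ioo_subset.1 hb
  have hb0 : 0 < b := hb0
  refine ⟨min a b, by positivity, fun t s h1 h2 h3 => hab (ha ?_) (hb ⟨h2, ?_⟩)⟩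
  · rw [Real.dist_eq]; exact h1.trans_le (min_le_left _ _)
  · exact h3.trans_le (min_le_right _ _)

theorem SmoothLoop.rev {γ : ℝ → ℂ} (h : SmoothLoop γ) : SmoothLoop fun t => γ (-t) where
  smooth := h.smooth.comp contDiff_neg
  per t := by
    have := h.per.neg (-t)
    show γ (-(t + 2 * Real.pi)) = γ (-t)
    rw [← this]; congr 1; ring
  inj := by
    intro t ht u hu htu
    have := h.eq_of_abs_lt htu (by
      rw [abs_lt]; constructor <;> linarith [ht.1, ht.2, hu.1, hu.2])
    linarith
  ne t := by
    rw [deriv_comp_neg]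
    exact neg_ne_zero.2 (h.ne _)

theorem nrm_rev (γ : ℝ → ℂ) (t s : ℝ) : nrm (fun t => γ (-t)) t s = nrm γ (-t) (-s) := by
  rw [nrm, deriv_comp_neg, nrm]; push_cast; ring

theorem SmoothLoop.tendsto_nrm {γ : ℝ → ℂ} (h : SmoothLoop γ) (t0 : ℝ) :
    Tendsto (fun p : ℝ × ℝ => nrm γ p.1 p.2) (sideFilter t0) (𝓝 (γ t0)) := by
  have h1 : Tendsto (fun p : ℝ × ℝ => nrm γ p.1 p.2) (𝓝 (t0, 0)) (𝓝 (nrm γ t0 0)) :=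
    h.continuous_nrm.tendsto (t0, 0)
  rw [nhds_prod_eq] at h1
  have h2 : nrm γ t0 0 = γ t0 := by simp [nrm]
  rw [h2] at h1
  exact h1.mono_left (Filter.prod_mono le_rfl nhdsWithin_le_nhds)

theorem SmoothLoop.tendsto_nrm_neg {γ : ℝ → ℂ} (h : SmoothLoop γ) (t0 : ℝ) :
    Tendsto (fun p : ℝ × ℝ => nrm γ p.1 (-p.2)) (sideFilter t0) (𝓝 (γ t0)) := by
  have h1 : Tendsto (fun p : ℝ × ℝ => nrm γ p.1 (-p.2)) (𝓝 (t0, 0)) (𝓝 (nrm γ t0 (-0))) :=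
    (h.continuous_nrm.comp (by fun_prop : Continuous fun p : ℝ × ℝ => (p.1, -p.2))).tendsto (t0, 0)
  rw [nhds_prod_eq] at h1
  have h2 : nrm γ t0 (-0) = γ t0 := by simp [nrm]
  rw [h2] at h1
  exact h1.mono_left (Filter.prod_mono le_rfl nhdsWithin_le_nhds)

namespace Bdry0

variable {Ω : Set ℂ} {n : ℕ} {γ : Fin n → ℝ → ℂ}

theorem CI_deriv_const (h : Bdry0 Ω γ) (i : Fin n) {U : Set ℂ} (hU : IsOpen U)
    (hUc : IsPreconnected U) (hoff : ∀ z ∈ U, ∀ t, γ i t ≠ z) {z w : ℂ} (hz : z ∈ U)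
    (hw : w ∈ U) : CI (γ i) (deriv (γ i)) z = CI (γ i) (deriv (γ i)) w := by
  have hD : ∀ z ∈ U, HasDerivAt (CI (γ i) (deriv (γ i))) 0 z := fun z hz =>
    CI_deriv_hasDerivAt (h.loop i).hasDerivAt (h.loop i).per (h.loop i).cont_deriv (hoff z hz)
  exact hU.is_const_of_deriv_eq_zero hUc
    (fun z hz => (hD z hz).differentiableAt.differentiableWithinAt) (fun z hz => (hD z hz).deriv)
    hz hw

theorem mem_or_of_preconnected (h : Bdry0 Ω γ) {K : Set ℂ} (hK : IsPreconnected K)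
    (hoff : ∀ z ∈ K, z ∉ frontier Ω) : (∀ z ∈ K, z ∈ Ω) ∨ ∀ z ∈ K, z ∉ closure Ω := by
  refine isPreconnected_iff_subset_of_disjoint.1 hK Ω (closure Ω)ᶜ h.isOpen
    isClosed_closure.isOpen_compl (fun z hz => ?_) ?_
  · by_cases hc : z ∈ Ω
    · exact Or.inl hc
    · exact Or.inr fun hcl => hoff z hz ⟨hcl, fun hi => hc (interior_subset hi)⟩
  · ext z
    simp only [mem_inter_iff, mem_compl_iff, mem_empty_iff_false, iff_false, not_and, not_not]
    exact fun _ hz => subset_closure hz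

theorem exists_strips (h : Bdry0 Ω γ) : ∃ δ > 0, ∀ i,
    ((∀ t s, 0 < s → s < δ → nrm (γ i) t s ∈ Ω) ∧
      ∀ t s, 0 < s → s < δ → nrm (γ i) t (-s) ∉ closure Ω) ∨
    ((∀ t s, 0 < s → s < δ → nrm (γ i) t (-s) ∈ Ω) ∧
      ∀ t s, 0 < s → s < δ → nrm (γ i) t s ∉ closure Ω) := by
  obtain ⟨δ, hδ, hoff⟩ := h.exists_nrm_off
  refine ⟨δ, hδ, fun i => ?_⟩
  have hst : ∀ f : ℝ × ℝ → ℝ × ℝ, Continuous f →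
      (∀ t s, 0 < s → s < δ → (f (t, s)).2 ≠ 0 ∧ |(f (t, s)).2| < δ) →
      (∀ t s, 0 < s → s < δ → nrm (γ i) (f (t, s)).1 (f (t, s)).2 ∈ Ω) ∨
      ∀ t s, 0 < s → s < δ → nrm (γ i) (f (t, s)).1 (f (t, s)).2 ∉ closure Ω := by
    intro f hf hf'
    have hpre : IsPreconnected ((fun p => nrm (γ i) (f p).1 (f p).2) ''
        ((univ : Set ℝ) ×ˢ Ioo 0 δ)) :=
      (isPreconnected_univ.prod isPreconnected_Ioo).image _
        ((h.loop i).continuous_nrm.comp hf).continuousOn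
    have := h.mem_or_of_preconnected hpre (by
      rintro _ ⟨⟨t, s⟩, ⟨-, hs⟩, rfl⟩
      exact hoff i _ _ (hf' t s hs.1 hs.2).1 (hf' t s hs.1 hs.2).2)
    refine this.imp (fun H t s h1 h2 => ?_) fun H t s h1 h2 => ?_
    · exact H _ ⟨(t, s), ⟨mem_univ _, h1, h2⟩, rfl⟩
    · exact H _ ⟨(t, s), ⟨mem_univ _, h1, h2⟩, rfl⟩
  have hp := hst id continuous_id fun t s h1 h2 => ⟨h1.ne', by simpa [abs_of_pos h1] using h2⟩
  have hm := hst (fun p => (p.1, -p.2)) (by fun_prop) fun t s h1 h2 =>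
    ⟨neg_ne_zero.2 h1.ne', by simpa [abs_of_pos h1] using h2⟩
  simp only [id] at hp hm
  rcases hp with hp | hp <;> rcases hm with hm | hm
  · exfalso
    have hlim := (h.loop i).plemelj (h.loop i).cont_deriv (h.loop i).per_deriv 0
    have hev : ∀ᶠ p in sideFilter 0, CI (γ i) (deriv (γ i)) (γ i p.1 + p.2 * I * deriv (γ i) p.1) -
      CI (γ i) (deriv (γ i)) (γ i p.1 - p.2 * I * deriv (γ i) p.1) = 0 := by
      filter_upwards [sideFilter_small 0 hδ] with p hps
      rw [sub_eq_zero]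
      refine h.CI_deriv_const i h.isOpen h.conn.isPreconnected
        (fun z hz t => h.off_of_mem hz i t) (hp p.1 p.2 hps.1 hps.2) ?_
      have := hm p.1 p.2 hps.1 hps.2
      rwa [nrm_neg] at this
    have h0 := tendsto_nhds_unique (hlim.congr' hev) tendsto_const_nhds
    rw [div_self ((h.loop i).ne 0)] at h0
    simp [Real.pi_ne_zero] at h0
  · exact Or.inl ⟨hp, hm⟩
  · exact Or.inr ⟨hm, hp⟩
  · exfalso
    obtain ⟨ε, hε, C, hC, hnear⟩ := h.exists_nearest
    have hcl : γ i 0 ∈ closure Ω := frontier_subset_closure (h.mem_frontier i 0)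
    obtain ⟨z, hz, hzd⟩ := Metric.mem_closure_iff.1 hcl (min ε (δ / C)) (by positivity)
    rw [dist_comm, dist_eq_norm] at hzd
    obtain ⟨t, s, h1, h2, h3, rfl⟩ := hnear z (fun hf => by
      obtain ⟨j, u, hju⟩ := (h.frontier_eq _).1 hf
      exact h.off_of_mem hz j u hju.symm) i 0 (hzd.trans_le (min_le_left _ _))
    have hsδ : |s| < δ := by
      have := hzd.trans_le (min_le_right _ _)
      rw [lt_div_iff₀ hC] at this
      linarith
    rcases lt_or_gt_of_ne h2 with hs | hs
    · rw [abs_of_neg hs] at hsδ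
      have := hm t (-s) (by linarith) hsδ
      rw [neg_neg] at this
      exact this (subset_closure hz)
    · rw [abs_of_pos hs] at hsδ
      exact hp t s hs hsδ (subset_closure hz)

end Bdry0

/-- Boundary data with all curves positively oriented. -/
structure Bdry (Ω : Set ℂ) {n : ℕ} (γ : Fin n → ℝ → ℂ) : Prop extends Bdry0 Ω γ where
  side : ∃ δ > 0, ∀ i t s, 0 < s → s < δ → nrm (γ i) t s ∈ Ω ∧ nrm (γ i) t (-s) ∉ closure Ω

theorem Bdry0.exists_bdry {Ω : Set ℂ} {n : ℕ} {γ : Fin n → ℝ → ℂ} (h : Bdry0 Ω γ) :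
    ∃ γ' : Fin n → ℝ → ℂ, Bdry Ω γ' := by
  obtain ⟨δ, hδ, hs⟩ := h.exists_strips
  have : ∀ i, ∃ g : ℝ → ℂ, SmoothLoop g ∧ (range g = range (γ i)) ∧
      ∀ t s, 0 < s → s < δ → nrm g t s ∈ Ω ∧ nrm g t (-s) ∉ closure Ω := by
    intro i
    rcases hs i with ⟨h1, h2⟩ | ⟨h1, h2⟩
    · exact ⟨γ i, h.loop i, rfl, fun t s a b => ⟨h1 t s a b, h2 t s a b⟩⟩
    · refine ⟨fun t => γ i (-t), (h.loop i).rev, ?_, fun t s a b => ⟨?_, ?_⟩⟩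
      · exact (Equiv.neg ℝ).surjective.range_comp (γ i)
      · rw [nrm_rev]; exact h1 _ s a b
      · rw [nrm_rev, neg_neg]; exact h2 _ s a b
  choose g hg hr hgs using this
  have hmem : ∀ i t, ∃ u, γ i u = g i t := fun i t => by
    have : g i t ∈ range (γ i) := hr i ▸ mem_range_self t
    exact this
  refine ⟨g, ⟨h.isOpen, h.conn, h.bdd, hg, fun i j t u hij he => ?_, fun z => ?_⟩,
    δ, hδ, fun i t s a b => hgs i t s a b⟩
  · obtain ⟨t', ht'⟩ := hmem i t
    obtain ⟨u', hu'⟩ := hmem j u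
    exact h.disj i j t' u' hij (by rw [ht', hu', he])
  · rw [h.frontier_eq]
    refine exists_congr fun i => ?_
    have : z ∈ range (γ i) ↔ z ∈ range (g i) := by rw [hr i]
    simpa only [mem_range, eq_comm] using this

namespace Bdry

variable {Ω : Set ℂ} {n : ℕ} {γ : Fin n → ℝ → ℂ}

theorem eventually_side (h : Bdry Ω γ) (i : Fin n) (t0 : ℝ) :
    ∀ᶠ p in sideFilter t0, nrm (γ i) p.1 p.2 ∈ Ω ∧ nrm (γ i) p.1 (-p.2) ∉ closure Ω := by
  obtain ⟨δ, hδ, hs⟩ := h.side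
  filter_upwards [sideFilter_small t0 hδ] with p hp using hs i p.1 p.2 hp.1 hp.2

theorem tendsto_in (h : Bdry Ω γ) (i : Fin n) (t0 : ℝ) :
    Tendsto (fun p : ℝ × ℝ => nrm (γ i) p.1 p.2) (sideFilter t0) (𝓝[Ω] (γ i t0)) :=
  tendsto_nhdsWithin_iff.2 ⟨(h.loop i).tendsto_nrm t0, (h.eventually_side i t0).mono fun _ h => h.1⟩

theorem tendsto_out (h : Bdry Ω γ) (i : Fin n) (t0 : ℝ) :
    Tendsto (fun p : ℝ × ℝ => nrm (γ i) p.1 (-p.2)) (sideFilter t0) (𝓝[(closure Ω)ᶜ] (γ i t0)) :=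
  tendsto_nhdsWithin_iff.2
    ⟨(h.loop i).tendsto_nrm_neg t0, (h.eventually_side i t0).mono fun _ h => h.2⟩

theorem nhds_aux (h : Bdry Ω γ) (i : Fin n) (t0 : ℝ) : ∃ C > 0, ∃ ε > 0, ∀ z ∉ frontier Ω,
    ‖z - γ i t0‖ < ε → ∃ t s, |t - t0| ≤ C * ‖z - γ i t0‖ ∧ 0 < s ∧ s ≤ C * ‖z - γ i t0‖ ∧
      ((z ∈ Ω → z = nrm (γ i) t s) ∧ (z ∉ closure Ω → z = nrm (γ i) t (-s))) := by
  obtain ⟨δ, hδ, hs⟩ := h.side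
  obtain ⟨ε, hε, C, hC, hn⟩ := h.exists_nearest
  refine ⟨C, hC, min ε (δ / C), by positivity, fun z hz hzd => ?_⟩
  obtain ⟨t, s, h1, h2, h3, h4⟩ := hn z hz i t0 (hzd.trans_le (min_le_left _ _))
  have hsδ : |s| < δ := by
    have := hzd.trans_le (min_le_right _ _)
    rw [lt_div_iff₀ hC] at this
    linarith
  rcases lt_or_gt_of_ne h2 with h0 | h0
  · rw [abs_of_neg h0] at hsδ h3
    refine ⟨t, -s, h1, by linarith, h3, fun hm => ?_, fun _ => by rw [neg_neg]; exact h4⟩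
    have := (hs i t (-s) (by linarith) hsδ).2
    rw [neg_neg, ← h4] at this
    exact absurd (subset_closure hm) this
  · rw [abs_of_pos h0] at hsδ h3
    refine ⟨t, s, h1, h0, h3, fun _ => h4, fun hm => ?_⟩
    exact absurd (subset_closure (h4 ▸ (hs i t s h0 hsδ).1)) hm

theorem nhds_in (h : Bdry Ω γ) (i : Fin n) (t0 : ℝ) {P : ℂ → Prop}
    (hP : ∀ᶠ p in sideFilter t0, P (nrm (γ i) p.1 p.2)) : ∀ᶠ z in 𝓝[Ω] (γ i t0), P z := by
  obtain ⟨C, hC, ε, hε, H⟩ := h.nhds_aux i t0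
  obtain ⟨η, hη, hη'⟩ := exists_of_eventually_sideFilter hP
  have hb : ball (γ i t0) (min ε (η / C)) ∈ 𝓝 (γ i t0) := ball_mem_nhds _ (by positivity)
  filter_upwards [mem_nhdsWithin_of_mem_nhds hb, self_mem_nhdsWithin] with z hz hzΩ
  rw [mem_ball, dist_eq_norm] at hz
  have h2 := hz.trans_le (min_le_right _ _)
  rw [lt_div_iff₀ hC] at h2
  obtain ⟨t, s, a1, a2, a3, a4, -⟩ := H z (fun hf => by
      obtain ⟨j, u, hju⟩ := (h.frontier_eq _).1 hf
      exact h.off_of_mem hzΩ j u hju.symm) (hz.trans_le (min_le_left _ _))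
  rw [a4 hzΩ]
  exact hη' t s (by linarith) a2 (by linarith)

theorem nhds_out (h : Bdry Ω γ) (i : Fin n) (t0 : ℝ) {P : ℂ → Prop}
    (hP : ∀ᶠ p in sideFilter t0, P (nrm (γ i) p.1 (-p.2))) :
    ∀ᶠ z in 𝓝[(closure Ω)ᶜ] (γ i t0), P z := by
  obtain ⟨C, hC, ε, hε, H⟩ := h.nhds_aux i t0
  obtain ⟨η, hη, hη'⟩ := exists_of_eventually_sideFilter hP
  have hb : ball (γ i t0) (min ε (η / C)) ∈ 𝓝 (γ i t0) := ball_mem_nhds _ (by positivity)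
  filter_upwards [mem_nhdsWithin_of_mem_nhds hb, self_mem_nhdsWithin] with z hz hzΩ
  rw [mem_ball, dist_eq_norm] at hz
  have h2 := hz.trans_le (min_le_right _ _)
  rw [lt_div_iff₀ hC] at h2
  obtain ⟨t, s, a1, a2, a3, -, a4⟩ := H z (fun hf => hzΩ (frontier_subset_closure hf))
    (hz.trans_le (min_le_left _ _))
  rw [a4 hzΩ]
  exact hη' t s (by linarith) a2 (by linarith)

theorem tendsto_nhds_in (h : Bdry Ω γ) (i : Fin n) (t0 : ℝ) {α : Type*} {l : Filter α}
    {f : ℂ → α} (hf : Tendsto (fun p : ℝ × ℝ => f (nrm (γ i) p.1 p.2)) (sideFilter t0) l) :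
    Tendsto f (𝓝[Ω] (γ i t0)) l := fun _ hs => h.nhds_in i t0 (hf hs)

theorem tendsto_nhds_out (h : Bdry Ω γ) (i : Fin n) (t0 : ℝ) {α : Type*} {l : Filter α}
    {f : ℂ → α} (hf : Tendsto (fun p : ℝ × ℝ => f (nrm (γ i) p.1 (-p.2))) (sideFilter t0) l) :
    Tendsto f (𝓝[(closure Ω)ᶜ] (γ i t0)) l := fun _ hs => h.nhds_out i t0 (hf hs)

end Bdry

theorem exists_bdry {Ω : Set ℂ} (hΩ : IsFinConnDomain Ω) (hsm : HasSmoothBoundary Ω) :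
    ∃ (n : ℕ) (γ : Fin n → ℝ → ℂ), Bdry Ω γ := by
  obtain ⟨hb, n, γ, h1, h2, h3, h4, h5, h6⟩ := hsm
  have : Bdry0 Ω γ := ⟨hΩ.1, hΩ.2.1, hb, fun i => ⟨h1 i, h2 i, h3 i, h4 i⟩, fun i j t u hij he =>
    (Set.disjoint_left.1 (h5 hij)) (mem_range_self t) (he ▸ mem_range_self u), fun z => by
      rw [h6]; simp [eq_comm]⟩
  exact ⟨n, this.exists_bdry⟩

theorem hausdorff_image_bounds {γ : ℝ → ℂ} {E : Set ℝ} {c η : ℝ} (hη : 0 ≤ η) (hc : η < c)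
    (hE : ∀ t ∈ E, ∀ u ∈ E, |‖γ u - γ t‖ - c * (|u - t|)| ≤ η * |u - t|) :
    μH[1] (γ '' E) ≤ ENNReal.ofReal (c + η) * volume E ∧
      ENNReal.ofReal (c - η) * volume E ≤ μH[1] (γ '' E) := by
  rw [← hausdorffMeasure_real]
  constructor
  · have hL : LipschitzOnWith (c + η).toNNReal γ E := by
      refine LipschitzOnWith.of_dist_le_mul fun x hx y hy => ?_
      have := abs_le.1 (hE y hy x hx)
      rw [dist_eq_norm, Real.dist_eq, Real.coe_toNNReal _ (by linarith)]
      linarith [this.2]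
    simpa [ENNReal.ofReal] using hL.hausdorffMeasure_image_le (d := 1) zero_le_one
  · have hinj : InjOn γ E := fun x hx y hy hxy => by
      have := abs_le.1 (hE y hy x hx)
      rw [hxy, sub_self, norm_zero] at this
      by_contra hne
      have : 0 < |x - y| := abs_pos.2 (sub_ne_zero.2 hne)
      nlinarith
    have hL : LipschitzOnWith (c - η).toNNReal⁻¹ (Function.invFunOn γ E) (γ '' E) := by
      refine LipschitzOnWith.of_dist_le_mul ?_
      rintro _ ⟨x, hx, rfl⟩ _ ⟨y, hy, rfl⟩
      have hx' : Function.invFunOn γ E (γ x) = x := hinj.leftInvOn_invFunOn hx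
      have hy' : Function.invFunOn γ E (γ y) = y := hinj.leftInvOn_invFunOn hy
      rw [hx', hy']
      have := abs_le.1 (hE y hy x hx)
      rw [dist_eq_norm, dist_eq_norm, Real.norm_eq_abs, NNReal.coe_inv, Real.coe_toNNReal _ (by linarith),
        inv_mul_eq_div, le_div_iff₀ (by linarith)]
      linarith [this.1]
    have h1 := hL.hausdorffMeasure_image_le (d := 1) zero_le_one
    have h2 : Function.invFunOn γ E '' (γ '' E) = E := hinj.leftInvOn_invFunOn.image_image
    rw [h2] at h1
    have hpos : (c - η).toNNReal ≠ 0 := by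
      rw [Ne, Real.toNNReal_eq_zero]; linarith
    calc ENNReal.ofReal (c - η) * μH[1] E
        ≤ ENNReal.ofReal (c - η) * (((c - η).toNNReal⁻¹ : NNReal) ^ (1 : ℝ) * μH[1] (γ '' E)) := by
          gcongr
      _ = μH[1] (γ '' E) := by
          rw [ENNReal.rpow_one, ENNReal.coe_inv hpos, ENNReal.ofReal, ← mul_assoc,
            ENNReal.mul_inv_cancel (by simpa using hpos) ENNReal.coe_ne_top, one_mul]

namespace SmoothLoop

variable {γ : ℝ → ℂ}

theorem hausdorff_small (h : SmoothLoop γ) : ∃ K > 0, ∃ r0 > 0, ∀ r, 0 < r → r ≤ r0 → ∀ a,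
    ∀ E ⊆ Ico a (a + r), MeasurableSet E →
      μH[1] (γ '' E) ≤ (∫⁻ t in E, ENNReal.ofReal ‖deriv γ t‖) + ENNReal.ofReal (K * r) * volume E ∧
      (∫⁻ t in E, ENNReal.ofReal ‖deriv γ t‖) ≤ μH[1] (γ '' E) + ENNReal.ofReal (K * r) * volume E := by
  obtain ⟨m, hm, M, hM, K, hK, hb1, hb2, hb3, hb4⟩ := h.bounds
  refine ⟨3 * K, by positivity, m / (4 * K), by positivity, fun r hr hr0 a E hE hEm => ?_⟩
  have hKr : K * r ≤ m / 4 := by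
    calc K * r ≤ K * (m / (4 * K)) := by gcongr
      _ = m / 4 := by field_simp
  have hKr0 : 0 < K * r := by positivity
  set c := ‖deriv γ a‖ with hc
  have hcm : m ≤ c := hb1 a
  have hd : ∀ t ∈ E, |‖deriv γ t‖ - c| ≤ K * r := fun t ht => by
    refine (abs_norm_sub_norm_le _ _).trans ((hb3 a t).trans ?_)
    gcongr
    rw [abs_of_nonneg (by linarith [(hE ht).1])]
    linarith [(hE ht).2]
  have key := hausdorff_image_bounds (γ := γ) (E := E) (c := c) (η := 2 * (K * r)) (by positivity)
    (by linarith) (fun t ht u hu => by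
      have h1 := (abs_norm_sub_norm_le (γ u - γ t) ((u - t) * deriv γ t)).trans (hb4 t u)
      have hnorm : ‖((u : ℂ) - t) * deriv γ t‖ = |u - t| * ‖deriv γ t‖ := by
        rw [norm_mul, ← ofReal_sub, norm_real, Real.norm_eq_abs]
      rw [hnorm] at h1
      have hut : |u - t| ≤ r := by
        rw [abs_le]
        constructor <;> linarith [(hE ht).1, (hE ht).2, (hE hu).1, (hE hu).2]
      have h2 : K * (u - t) ^ 2 ≤ K * r * |u - t| := by
        rw [← sq_abs, pow_two, ← mul_assoc]
        gcongr
      have h3 : |(|u - t| * ‖deriv γ t‖ - c * |u - t|)| ≤ K * r * |u - t| := by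
        rw [mul_comm c, ← mul_sub, abs_mul, abs_abs, mul_comm]
        gcongr
        exact hd t ht
      calc |‖γ u - γ t‖ - c * (|u - t|)|
          ≤ |‖γ u - γ t‖ - |u - t| * ‖deriv γ t‖| + |(|u - t| * ‖deriv γ t‖ - c * |u - t|)| :=
            abs_sub_le _ _ _
        _ ≤ 2 * (K * r) * |u - t| := by linarith)
  have hup : ∫⁻ t in E, ENNReal.ofReal ‖deriv γ t‖ ≤ ENNReal.ofReal (c + K * r) * volume E := by
    rw [← setLIntegral_const]
    exact setLIntegral_mono' hEm fun t ht =>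
      ENNReal.ofReal_le_ofReal (by linarith [(abs_le.1 (hd t ht)).2])
  have hlo : ENNReal.ofReal (c - K * r) * volume E ≤ ∫⁻ t in E, ENNReal.ofReal ‖deriv γ t‖ := by
    rw [← setLIntegral_const]
    exact setLIntegral_mono' hEm fun t ht =>
      ENNReal.ofReal_le_ofReal (by linarith [(abs_le.1 (hd t ht)).1])
  constructor
  · refine key.1.trans (le_trans (le_of_eq ?_) (add_le_add_left hlo _))
    rw [← add_mul, ← ENNReal.ofReal_add (by linarith) (by positivity)]
    congr 2; ring
  · refine hup.trans (le_trans (le_of_eq ?_) (add_le_add_left key.2 _))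
    rw [← add_mul, ← ENNReal.ofReal_add (by linarith) (by positivity)]
    congr 2; ring

theorem hausdorff_image (h : SmoothLoop γ) {E : Set ℝ} (hE : E ⊆ Ico 0 (2 * Real.pi))
    (hEm : MeasurableSet E) : μH[1] (γ '' E) = ∫⁻ t in E, ENNReal.ofReal ‖deriv γ t‖ := by
  obtain ⟨K, hK, r0, hr0, hs⟩ := h.hausdorff_small
  have hdec : ∀ r, 0 < r → r ≤ r0 →
      μH[1] (γ '' E) ≤ (∫⁻ t in E, ENNReal.ofReal ‖deriv γ t‖) + ENNReal.ofReal (K * r) * volume E ∧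
      (∫⁻ t in E, ENNReal.ofReal ‖deriv γ t‖) ≤ μH[1] (γ '' E) + ENNReal.ofReal (K * r) * volume E := by
    intro r hr hr'
    set F : ℤ → Set ℝ := fun k => E ∩ Ico (k • r) ((k + 1) • r) with hF
    have hFm : ∀ k, MeasurableSet (F k) := fun k => hEm.inter measurableSet_Ico
    have hFd : Pairwise (Function.onFun Disjoint F) := fun i j hij =>
      (pairwise_disjoint_Ico_zsmul r hij).mono inter_subset_right inter_subset_right
    have hFE : E = ⋃ k, F k := by
      rw [hF, ← inter_iUnion, iUnion_Ico_zsmul hr, inter_univ]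
    have hFi : ∀ k, F k ⊆ Ico (k • r) (k • r + r) := fun k => by
      refine inter_subset_right.trans (le_of_eq ?_)
      rw [add_smul, one_smul]
    have e1 : μH[1] (γ '' E) = ∑' k, μH[1] (γ '' F k) := by
      conv_lhs => rw [hFE, image_iUnion]
      refine measure_iUnion (fun i j hij => ?_) fun k =>
        (hFm k).image_of_continuousOn_injOn h.cont.continuousOn
          (h.inj.mono (inter_subset_left.trans hE))
      refine Set.disjoint_left.2 ?_
      rintro _ ⟨x, hx, rfl⟩ ⟨y, hy, hxy⟩
      have hyx : y = x := h.inj (hE hy.1) (hE hx.1) hxy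
      exact Set.disjoint_left.1 (hFd hij) hx (hyx ▸ hy)
    have e2 : ∫⁻ t in E, ENNReal.ofReal ‖deriv γ t‖ = ∑' k, ∫⁻ t in F k, ENNReal.ofReal ‖deriv γ t‖ := by
      conv_lhs => rw [hFE]
      exact lintegral_iUnion hFm hFd _
    have e3 : volume E = ∑' k, volume (F k) := by
      conv_lhs => rw [hFE]
      exact measure_iUnion hFd hFm
    rw [e1, e2, e3, ← ENNReal.tsum_mul_left, ← ENNReal.tsum_add, ← ENNReal.tsum_add]
    exact ⟨ENNReal.tsum_le_tsum fun k => (hs r hr hr' _ _ (hFi k) (hFm k)).1,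
      ENNReal.tsum_le_tsum fun k => (hs r hr hr' _ _ (hFi k) (hFm k)).2⟩
  have hvol : volume E ≠ ⊤ := ne_top_of_le_ne_top measure_Ico_lt_top.ne (measure_mono hE)
  have hlim : ∀ x : ENNReal, Tendsto (fun r : ℝ => x + ENNReal.ofReal (K * r) * volume E) (𝓝[>] 0)
      (𝓝 x) := by
    intro x
    have h1 : Tendsto (fun r : ℝ => ENNReal.ofReal (K * r)) (𝓝[>] 0) (𝓝 0) := by
      have : Tendsto (fun r : ℝ => ENNReal.ofReal (K * r)) (𝓝 0) (𝓝 (ENNReal.ofReal (K * 0))) :=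
        (ENNReal.continuous_ofReal.comp (continuous_const.mul continuous_id)).tendsto 0
      rw [mul_zero, ENNReal.ofReal_zero] at this
      exact this.mono_left nhdsWithin_le_nhds
    have h2 := ENNReal.Tendsto.mul_const (b := volume E) h1 (Or.inr hvol)
    simpa using h2.const_add x
  have hev : ∀ᶠ r in 𝓝[>] (0 : ℝ), 0 < r ∧ r ≤ r0 := Ioc_mem_nhdsGT hr0
  exact le_antisymm (ge_of_tendsto (hlim _) (hev.mono fun r hr => (hdec r hr.1 hr.2).1))
    (ge_of_tendsto (hlim _) (hev.mono fun r hr => (hdec r hr.1 hr.2).2))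

theorem range_eq (h : SmoothLoop γ) : range γ = γ '' Ico 0 (2 * Real.pi) := by
  refine Subset.antisymm ?_ (image_subset_range _ _)
  rintro _ ⟨t, rfl⟩
  obtain ⟨y, hy, hty⟩ := h.per.exists_mem_Ico₀ Real.two_pi_pos t
  exact ⟨y, hy, hty.symm⟩

theorem isCompact_range (h : SmoothLoop γ) : IsCompact (range γ) := by
  have := h.per.image_Icc Real.two_pi_pos 0
  rw [← this]
  exact isCompact_Icc.image h.cont

theorem hausdorff_restrict (h : SmoothLoop γ) : (μH[1] : Measure ℂ).restrict (range γ) =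
    Measure.map γ ((volume.restrict (Ico 0 (2 * Real.pi))).withDensity
      fun t => ENNReal.ofReal ‖deriv γ t‖) := by
  ext A hA
  have hpm : MeasurableSet (γ ⁻¹' A) := h.cont.measurable hA
  rw [Measure.restrict_apply hA, Measure.map_apply h.cont.measurable hA,
    withDensity_apply _ hpm, Measure.restrict_restrict hpm, ← h.hausdorff_image inter_subset_right
      (hpm.inter measurableSet_Ico), h.range_eq, image_preimage_inter]

theorem hausdorff_range_ne_top (h : SmoothLoop γ) : (μH[1] : Measure ℂ) (range γ) ≠ ⊤ := by
  rw [h.range_eq, h.hausdorff_image subset_rfl measurableSet_Ico]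
  obtain ⟨M, hM, hM'⟩ := h.per_deriv.exists_norm_le h.cont_deriv
  have : ∫⁻ t in Ico 0 (2 * Real.pi), ENNReal.ofReal ‖deriv γ t‖ ≤
      ∫⁻ _ in Ico 0 (2 * Real.pi), ENNReal.ofReal M :=
    lintegral_mono fun t => ENNReal.ofReal_le_ofReal (hM' t)
  refine ne_top_of_le_ne_top ?_ this
  rw [setLIntegral_const]
  exact ENNReal.mul_ne_top ENNReal.ofReal_ne_top measure_Ico_lt_top.ne

theorem integrableOn_range (h : SmoothLoop γ) {f : ℂ → ℂ} (hf : ContinuousOn f (range γ)) :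
    IntegrableOn f (range γ) μH[1] := by
  obtain ⟨B, hB⟩ := h.isCompact_range.exists_bound_of_continuousOn hf
  have hm : MeasurableSet (range γ) := h.isCompact_range.isClosed.measurableSet
  refine ⟨hf.aestronglyMeasurable hm, HasFiniteIntegral.restrict_of_bounded B
    h.hausdorff_range_ne_top.lt_top ?_⟩
  exact (ae_restrict_iff' hm).2 (Eventually.of_forall hB)

theorem integral_range (h : SmoothLoop γ) {f : ℂ → ℂ} (hf : ContinuousOn f (range γ)) :
    ∫ z in range γ, f z ∂μH[1] = ∫ t in (0 : ℝ)..(2 * Real.pi), f (γ t) * ‖deriv γ t‖ := by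
  have hm : MeasurableSet (range γ) := h.isCompact_range.isClosed.measurableSet
  have hf' := hf.aestronglyMeasurable (μ := μH[1]) hm
  rw [h.hausdorff_restrict] at hf' ⊢
  rw [integral_map h.cont.measurable.aemeasurable hf']
  have hmeas : Measurable fun t => ENNReal.ofReal ‖deriv γ t‖ :=
    h.cont_deriv.norm.measurable.ennreal_ofReal
  rw [integral_withDensity_eq_integral_toReal_smul hmeas (by simp),
    intervalIntegral.integral_of_le Real.two_pi_pos.le, integral_Ico_eq_integral_Ioc]
  congr 1
  ext t
  rw [ENNReal.toReal_ofReal (norm_nonneg _), Complex.real_smul, mul_comm]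

end SmoothLoop

theorem Bdry0.integral_frontier {Ω : Set ℂ} {n : ℕ} {γ : Fin n → ℝ → ℂ} (h : Bdry0 Ω γ)
    {f : ℂ → ℂ} (hf : ContinuousOn f (frontier Ω)) :
    ∫ z in frontier Ω, f z ∂μH[1] =
      ∑ i, ∫ t in (0 : ℝ)..(2 * Real.pi), f (γ i t) * ‖deriv (γ i) t‖ := by
  have hfr : frontier Ω = ⋃ i, range (γ i) := by
    ext z; rw [h.frontier_eq]; simp [eq_comm]
  have hsub : ∀ i, range (γ i) ⊆ frontier Ω := fun i => by
    rintro _ ⟨t, rfl⟩; exact h.mem_frontier i t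
  rw [hfr, integral_iUnion_fintype]
  · exact Finset.sum_congr rfl fun i _ => (h.loop i).integral_range (hf.mono (hsub i))
  · exact fun i => (h.loop i).isCompact_range.isClosed.measurableSet
  · intro i j hij
    refine Set.disjoint_left.2 ?_
    rintro _ ⟨t, rfl⟩ ⟨u, hu⟩
    exact h.disj i j t u hij hu.symm
  · exact fun i => (h.loop i).integrableOn_range (hf.mono (hsub i))

theorem tendsto_CI_cocompact {γ ψ : ℝ → ℂ} (hγ : Continuous γ)
    (hper : Function.Periodic γ (2 * Real.pi)) (hψ : Continuous ψ) :
    Tendsto (CI γ ψ) (cocompact ℂ) (𝓝 0) := by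
  obtain ⟨M, hM, hM'⟩ := hper.exists_norm_le hγ
  obtain ⟨B, hB⟩ := (isCompact_uIcc (a := (0 : ℝ)) (b := 2 * Real.pi)).exists_bound_of_continuousOn
    hψ.continuousOn
  have hlim : Tendsto (fun z : ℂ => B * (‖z‖ - M)⁻¹ * (2 * Real.pi)) (cocompact ℂ) (𝓝 0) := by
    have h1 : Tendsto (fun z : ℂ => ‖z‖ - M) (cocompact ℂ) atTop :=
      tendsto_atTop_add_const_right _ _ tendsto_norm_cocompact_atTop
    simpa using (h1.inv_tendsto_atTop.const_mul B).mul_const (2 * Real.pi)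
  refine squeeze_zero_norm' ?_ hlim
  filter_upwards [(tendsto_norm_cocompact_atTop (E := ℂ)).eventually (eventually_gt_atTop M)] with z hz
  refine (intervalIntegral.norm_integral_le_of_norm_le_const (C := B * (‖z‖ - M)⁻¹)
    fun t ht => ?_).trans (le_of_eq ?_)
  · have h1 : ‖z‖ - M ≤ ‖γ t - z‖ := by
      have := norm_sub_norm_le z (γ t)
      rw [norm_sub_rev (γ t) z]
      linarith [hM' t]
    rw [norm_div, div_eq_mul_inv]
    have h2 : 0 < ‖z‖ - M := by linarith
    have h3 := hB t (uIoc_subset_uIcc ht)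
    gcongr
    exact (norm_nonneg _).trans h3
  · rw [sub_zero, abs_of_pos Real.two_pi_pos]

namespace Bdry

variable {Ω : Set ℂ} {n : ℕ} {γ : Fin n → ℝ → ℂ}

theorem eq_of_frontier {z : ℂ} (h : Bdry Ω γ) (hz : z ∈ frontier Ω) : ∃ i t, z = γ i t :=
  (h.frontier_eq z).1 hz

theorem _root_.mem_frontier_of_closure {Ω : Set ℂ} {z : ℂ} (hz : z ∈ closure Ω) (hz' : z ∉ Ω) :
    z ∈ frontier Ω := ⟨hz, fun hi => hz' (interior_subset hi)⟩

theorem sum_plemelj (h : Bdry Ω γ) {ψ : Fin n → ℝ → ℂ} (hψ : ∀ i, Continuous (ψ i))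
    (hp : ∀ i, Function.Periodic (ψ i) (2 * Real.pi)) (i : Fin n) (t0 : ℝ) :
    Tendsto (fun p : ℝ × ℝ => ∑ j, CI (γ j) (ψ j) (nrm (γ i) p.1 p.2) -
      ∑ j, CI (γ j) (ψ j) (nrm (γ i) p.1 (-p.2))) (sideFilter t0)
      (𝓝 (2 * Real.pi * I * (ψ i t0 / deriv (γ i) t0))) := by
  have h1 : ∀ j, Tendsto (fun p : ℝ × ℝ => CI (γ j) (ψ j) (nrm (γ i) p.1 p.2) -
      CI (γ j) (ψ j) (nrm (γ i) p.1 (-p.2))) (sideFilter t0)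
      (𝓝 (if j = i then 2 * Real.pi * I * (ψ i t0 / deriv (γ i) t0) else 0)) := by
    intro j
    split_ifs with hij
    · subst hij
      simp only [nrm_neg]
      exact (h.loop j).plemelj (hψ j) (hp j) t0
    · have hc : ContinuousAt (CI (γ j) (ψ j)) (γ i t0) :=
        CI_continuousAt (h.loop j).cont (h.loop j).per (hψ j) fun t => h.disj j i t t0 hij
      simpa using (hc.tendsto.comp ((h.loop i).tendsto_nrm t0)).sub
        (hc.tendsto.comp ((h.loop i).tendsto_nrm_neg t0))
  have h2 := tendsto_finsetSum Finset.univ fun j _ => h1 j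
  simpa [Finset.sum_sub_distrib] using h2

theorem winding (h : Bdry Ω γ) :
    (∀ z ∉ closure Ω, ∑ i, CI (γ i) (deriv (γ i)) z = 0) ∧
      ∀ z ∈ Ω, ∑ i, CI (γ i) (deriv (γ i)) z = 2 * Real.pi * I := by
  set W : ℂ → ℂ := fun z => ∑ i, CI (γ i) (deriv (γ i)) z with hW
  have hconst : ∀ U : Set ℂ, IsOpen U → IsPreconnected U → (∀ z ∈ U, z ∉ frontier Ω) →
      ∀ z ∈ U, ∀ w ∈ U, W z = W w := fun U hU hUc hoff z hz w hw =>
    Finset.sum_congr rfl fun i _ => h.CI_deriv_const i hU hUc (fun x hx t => h.off (hoff x hx) i t) hz hw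
  have hne : Ω.Nonempty := h.conn.nonempty
  obtain ⟨b, hb⟩ := hne
  have hin : ∀ z ∈ Ω, W z = W b := fun z hz => hconst Ω h.isOpen h.conn.isPreconnected
    (fun x hx hf => by
      obtain ⟨i, t, rfl⟩ := h.eq_of_frontier hf
      exact h.notMem i t hx) z hz b hb
  have hjump : ∀ i t0, Tendsto W (𝓝[(closure Ω)ᶜ] (γ i t0)) (𝓝 (W b - 2 * Real.pi * I)) := by
    intro i t0
    refine h.tendsto_nhds_out i t0 ?_
    have h1 := h.sum_plemelj (fun j => (h.loop j).cont_deriv) (fun j => (h.loop j).per_deriv) i t0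
    rw [div_self ((h.loop i).ne t0), mul_one] at h1
    have h2 := (tendsto_const_nhds (x := W b)).sub h1
    refine h2.congr' ?_
    filter_upwards [h.eventually_side i t0] with p hp
    have := hin _ hp.1
    simp only [hW] at this ⊢
    rw [this]; ring
  have hcpt : IsCompact (closure Ω) := Metric.isCompact_of_isClosed_isBounded isClosed_closure h.bdd.closure
  obtain ⟨p, hp, hmax⟩ := hcpt.exists_isMaxOn ⟨b, subset_closure hb⟩ continuous_norm.continuousOn
  have hmax' : ∀ z ∈ closure Ω, ‖z‖ ≤ ‖p‖ := fun z hz => hmax hz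
  obtain ⟨r, hr, hball⟩ := Metric.isOpen_iff.1 h.isOpen b hb
  have hp0 : 0 < ‖p‖ := by
    by_contra hc
    have hz : ∀ z ∈ closure Ω, z = 0 := fun z hz => by
      have := hmax' z hz
      exact norm_le_zero_iff.1 (by linarith)
    have h1 := hz b (subset_closure hb)
    have h2 := hz (b + (r / 2 : ℝ)) (subset_closure (hball (by
      rw [mem_ball, dist_eq_norm, add_sub_cancel_left, norm_real, Real.norm_eq_abs, abs_of_pos (by positivity)]
      linarith)))
    rw [h1, zero_add, ofReal_eq_zero] at h2
    linarith
  have hray : ∀ x : ℝ, 1 < x → (x : ℂ) * p ∉ closure Ω := fun x hx hm => by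
    have := hmax' _ hm
    rw [norm_mul, norm_real, Real.norm_eq_abs, abs_of_pos (by linarith)] at this
    nlinarith
  have hpf : p ∈ frontier Ω := by
    refine mem_frontier_of_closure hp fun hpΩ => ?_
    have hc : Tendsto (fun x : ℝ => (x : ℂ) * p) (𝓝[>] 1) (𝓝 p) := by
      have : Tendsto (fun x : ℝ => (x : ℂ) * p) (𝓝 1) (𝓝 (((1 : ℝ) : ℂ) * p)) :=
        (continuous_ofReal.mul continuous_const).tendsto 1
      rw [ofReal_one, one_mul] at this
      exact this.mono_left nhdsWithin_le_nhds
    obtain ⟨x, hx1, hx2⟩ := ((hc.eventually (h.isOpen.mem_nhds hpΩ)).and self_mem_nhdsWithin).exists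
    exact hray x hx2 (subset_closure hx1)
  set H : Set ℂ := {z | ‖p‖ ^ 2 < (z * conj p).re} with hH
  have hHext : ∀ z ∈ H, z ∉ closure Ω := fun z hz hzc => by
    have h1 := hmax' z hzc
    have h2 : (z * conj p).re ≤ ‖z‖ * ‖p‖ := by
      refine (re_le_norm _).trans ?_
      rw [norm_mul, norm_conj]
    have h3 : ‖p‖ ^ 2 < (z * conj p).re := hz
    nlinarith
  have hHo : IsOpen H := isOpen_lt continuous_const (by fun_prop)
  have hHc : IsPreconnected H := by
    have : Convex ℝ H := by
      have := convex_halfSpace_gt (𝕜 := ℝ) (f := fun z : ℂ => (z * conj p).re)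
        ⟨fun x y => by rw [add_mul, add_re], fun c x => by
          rw [Complex.real_smul, mul_assoc, re_ofReal_mul, smul_eq_mul]⟩ (‖p‖ ^ 2)
      exact this
    exact this.isPreconnected
  have hrayH : ∀ x : ℝ, 1 < x → (x : ℂ) * p ∈ H := fun x hx => by
    show ‖p‖ ^ 2 < ((x : ℂ) * p * conj p).re
    rw [mul_assoc, mul_conj, re_ofReal_mul, ofReal_re, normSq_eq_norm_sq]
    nlinarith [pow_pos hp0 2]
  have hcoc : Tendsto W (cocompact ℂ) (𝓝 0) := by
    have := tendsto_finsetSum Finset.univ fun j _ =>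
      tendsto_CI_cocompact (h.loop j).cont (h.loop j).per (h.loop j).cont_deriv
    simpa using this
  have hH0 : ∀ z ∈ H, W z = 0 := by
    intro z hz
    have h1 : Tendsto (fun x : ℝ => (x : ℂ) * p) atTop (cocompact ℂ) := by
      rw [← Metric.cobounded_eq_cocompact, ← tendsto_norm_atTop_iff_cobounded]
      simp only [norm_mul, norm_real, Real.norm_eq_abs]
      exact tendsto_abs_atTop_atTop.atTop_mul_const hp0
    have h2 : Tendsto (fun x : ℝ => W (x * p)) atTop (𝓝 (W z)) := by
      refine tendsto_const_nhds.congr' ?_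
      filter_upwards [eventually_gt_atTop 1] with x hx
      exact hconst H hHo hHc (fun w hw => Bdry0.frontier_subset_closure' (hHext w hw)) _ hz _ (hrayH x hx)
    exact tendsto_nhds_unique h2 (hcoc.comp h1)
  obtain ⟨i, t, hpt⟩ := h.eq_of_frontier hpf
  have hb2 : W b - 2 * Real.pi * I = 0 := by
    have h1 : Tendsto (fun x : ℝ => (x : ℂ) * p) (𝓝[>] 1) (𝓝[(closure Ω)ᶜ] (γ i t)) := by
      refine tendsto_nhdsWithin_iff.2 ⟨?_, ?_⟩
      · have : Tendsto (fun x : ℝ => (x : ℂ) * p) (𝓝 1) (𝓝 (((1 : ℝ) : ℂ) * p)) :=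
          (continuous_ofReal.mul continuous_const).tendsto 1
        rw [ofReal_one, one_mul, hpt] at this
        rw [hpt]
        exact this.mono_left nhdsWithin_le_nhds
      · filter_upwards [self_mem_nhdsWithin] with x hx using hray x hx
    have h2 : Tendsto (fun x : ℝ => W (x * p)) (𝓝[>] 1) (𝓝 0) := by
      refine tendsto_const_nhds.congr' ?_
      filter_upwards [self_mem_nhdsWithin] with x hx
      exact (hH0 _ (hrayH x hx)).symm
    exact tendsto_nhds_unique ((hjump i t).comp h1) h2
  refine ⟨fun z hz => ?_, fun z hz => (hin z hz).trans (sub_eq_zero.1 hb2)⟩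
  obtain ⟨q, hq, hqd⟩ := hcpt.exists_infDist_eq_dist ⟨b, subset_closure hb⟩ z
  have hballext : ∀ w ∈ ball z (dist z q), w ∉ closure Ω := fun w hw hwc => by
    have := infDist_le_dist_of_mem (x := z) hwc
    rw [hqd] at this
    rw [mem_ball, dist_comm] at hw
    linarith
  have hzq : 0 < dist z q := dist_pos.2 fun he => hz (he ▸ hq)
  have hqcl : q ∈ closure (ball z (dist z q)) := by
    rw [closure_ball _ hzq.ne', mem_closedBall, dist_comm]
  have hqf : q ∈ frontier Ω := by
    refine mem_frontier_of_closure hq fun hqΩ => ?_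
    obtain ⟨w, hw1, hw2⟩ := mem_closure_iff.1 hqcl Ω h.isOpen hqΩ
    exact hballext w hw2 (subset_closure hw1)
  obtain ⟨j, u, rfl⟩ := h.eq_of_frontier hqf
  have hnb : (𝓝[ball z (dist z (γ j u))] (γ j u)).NeBot := mem_closure_iff_nhdsWithin_neBot.1 hqcl
  have h1 := (hjump j u).mono_left (nhdsWithin_mono (γ j u)
    (show ball z (dist z (γ j u)) ⊆ (closure Ω)ᶜ from hballext))
  rw [hb2] at h1
  have h2 : Tendsto W (𝓝[ball z (dist z (γ j u))] (γ j u)) (𝓝 (W z)) := by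
    refine tendsto_const_nhds.congr' ?_
    filter_upwards [self_mem_nhdsWithin] with w hw
    exact hconst _ isOpen_ball (convex_ball _ _).isPreconnected
      (fun x hx => Bdry0.frontier_subset_closure' (hballext x hx)) z (mem_ball_self hzq) w hw
  exact tendsto_nhds_unique h2 h1

end Bdry

/-- The derivative of `nrm` along the curve. -/
def nrm' (γ : ℝ → ℂ) (t s : ℝ) : ℂ := deriv γ t + s * I * deriv (deriv γ) t

/-- The contour integral of `f` along the curve with offset `s`. -/
def cint {n : ℕ} (γ : Fin n → ℝ → ℂ) (f : ℂ → ℂ) (s : ℝ) : ℂ :=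
  ∑ i, ∫ t in (0 : ℝ)..(2 * Real.pi), f (nrm (γ i) t s) * nrm' (γ i) t s

theorem nrm_zero (γ : ℝ → ℂ) (t : ℝ) : nrm γ t 0 = γ t := by simp [nrm]

theorem nrm'_zero (γ : ℝ → ℂ) (t : ℝ) : nrm' γ t 0 = deriv γ t := by simp [nrm']

namespace SmoothLoop

variable {γ : ℝ → ℂ}

theorem hasDerivAt_nrm_fst (h : SmoothLoop γ) (t s : ℝ) :
    HasDerivAt (fun t => nrm γ t s) (nrm' γ t s) t :=
  (h.hasDerivAt t).add ((h.hasDerivAt_deriv t).const_mul _)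

theorem hasDerivAt_nrm_snd (γ : ℝ → ℂ) (t s : ℝ) :
    HasDerivAt (fun s => nrm γ t s) (I * deriv γ t) s := by
  have := (((hasDerivAt_id s).ofReal_comp.mul_const I).mul_const (deriv γ t)).const_add (γ t)
  simpa [nrm] using this

theorem hasDerivAt_nrm'_snd (γ : ℝ → ℂ) (t s : ℝ) :
    HasDerivAt (fun s => nrm' γ t s) (I * deriv (deriv γ) t) s := by
  have := (((hasDerivAt_id s).ofReal_comp.mul_const I).mul_const (deriv (deriv γ) t)).const_add
    (deriv γ t)
  simpa [nrm'] using this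

theorem continuous_nrm' (h : SmoothLoop γ) : Continuous fun p : ℝ × ℝ => nrm' γ p.1 p.2 := by
  have := h.cont_deriv
  have := h.cont_deriv_deriv
  unfold nrm'
  fun_prop

theorem per_nrm (h : SmoothLoop γ) (s : ℝ) : Function.Periodic (fun t => nrm γ t s) (2 * Real.pi) := by
  intro t; simp only [nrm]; rw [h.per, h.per_deriv]

theorem continuous_nrm_fst (h : SmoothLoop γ) (s : ℝ) : Continuous fun t => nrm γ t s :=
  h.continuous_nrm.comp (by fun_prop : Continuous fun t : ℝ => (t, s))

theorem continuous_nrm'_fst (h : SmoothLoop γ) (s : ℝ) : Continuous fun t => nrm' γ t s :=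
  h.continuous_nrm'.comp (by fun_prop : Continuous fun t : ℝ => (t, s))

theorem integral_nrm_const (h : SmoothLoop γ) {V : Set ℂ} (hV : IsOpen V) {g : ℂ → ℂ}
    (hg : DifferentiableOn ℂ g V) {δ : ℝ} (hin : ∀ t s, 0 < s → s < δ → nrm γ t s ∈ V) {s₁ s₂ : ℝ}
    (h1 : s₁ ∈ Ioo 0 δ) (h2 : s₂ ∈ Ioo 0 δ) :
    ∫ t in (0 : ℝ)..(2 * Real.pi), g (nrm γ t s₁) * nrm' γ t s₁ =
      ∫ t in (0 : ℝ)..(2 * Real.pi), g (nrm γ t s₂) * nrm' γ t s₂ := by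
  have hg' : DifferentiableOn ℂ (deriv g) V := hg.deriv hV
  have hmaps : MapsTo (fun p : ℝ × ℝ => nrm γ p.1 p.2) (univ ×ˢ Ioo 0 δ) V :=
    fun p hp => hin _ _ hp.2.1 hp.2.2
  have c1 : ContinuousOn (fun p : ℝ × ℝ => g (nrm γ p.1 p.2)) (univ ×ˢ Ioo 0 δ) :=
    hg.continuousOn.comp h.continuous_nrm.continuousOn hmaps
  have c2 : ContinuousOn (fun p : ℝ × ℝ => deriv g (nrm γ p.1 p.2)) (univ ×ˢ Ioo 0 δ) :=
    hg'.continuousOn.comp h.continuous_nrm.continuousOn hmaps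
  have hcd : Continuous fun p : ℝ × ℝ => I * deriv γ p.1 :=
    continuous_const.mul (h.cont_deriv.comp continuous_fst)
  have hcdd : Continuous fun p : ℝ × ℝ => I * deriv (deriv γ) p.1 :=
    continuous_const.mul (h.cont_deriv_deriv.comp continuous_fst)
  have hF'c : ContinuousOn (fun p : ℝ × ℝ => deriv g (nrm γ p.1 p.2) * (I * deriv γ p.1) *
      nrm' γ p.1 p.2 + g (nrm γ p.1 p.2) * (I * deriv (deriv γ) p.1)) (univ ×ˢ Ioo 0 δ) :=
    ((c2.mul hcd.continuousOn).mul h.continuous_nrm'.continuousOn).add (c1.mul hcdd.continuousOn)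
  have slice : ∀ {f : ℝ × ℝ → ℂ}, ContinuousOn f (univ ×ˢ Ioo 0 δ) → ∀ s ∈ Ioo 0 δ,
      Continuous fun t => f (t, s) := fun hf s hs =>
    continuousOn_univ.1 (hf.comp (by fun_prop : Continuous fun t : ℝ => (t, s)).continuousOn
      fun t _ => ⟨trivial, hs⟩)
  have hD : ∀ s ∈ Ioo 0 δ, HasDerivAt (fun s => ∫ t in (0 : ℝ)..(2 * Real.pi),
      g (nrm γ t s) * nrm' γ t s) 0 s := by
    intro s hs
    have hcpt : IsCompact (Icc 0 (2 * Real.pi) ×ˢ Icc (s / 2) ((s + δ) / 2)) :=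
      isCompact_Icc.prod isCompact_Icc
    have hsub : Icc (s / 2) ((s + δ) / 2) ⊆ Ioo 0 δ := fun x hx =>
      ⟨by linarith [hs.1, hx.1], by linarith [hs.2, hx.2]⟩
    obtain ⟨B, hB⟩ := hcpt.exists_bound_of_continuousOn
      (hF'c.mono (prod_mono (subset_univ _) hsub))
    have key := intervalIntegral.hasDerivAt_integral_of_dominated_loc_of_deriv_le (μ := volume)
      (a := 0) (b := 2 * Real.pi) (x₀ := s) (s := Ioo (s / 2) ((s + δ) / 2)) (bound := fun _ => B)
      (F := fun s t => g (nrm γ t s) * nrm' γ t s)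
      (F' := fun s t => deriv g (nrm γ t s) * (I * deriv γ t) * nrm' γ t s +
        g (nrm γ t s) * (I * deriv (deriv γ) t))
      (Ioo_mem_nhds (by linarith [hs.1]) (by linarith [hs.2]))
      (by
        filter_upwards [Ioo_mem_nhds hs.1 hs.2] with x hx
        exact (slice (c1.mul h.continuous_nrm'.continuousOn) x hx).aestronglyMeasurable)
      ((slice (c1.mul h.continuous_nrm'.continuousOn) s hs).intervalIntegrable _ _)
      (slice hF'c s hs).aestronglyMeasurable
      (by
        refine Eventually.of_forall fun t ht x hx => hB (t, x) ⟨?_, Ioo_subset_Icc_self hx⟩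
        rw [uIoc_of_le Real.two_pi_pos.le] at ht
        exact Ioc_subset_Icc_self ht)
      intervalIntegrable_const
      (by
        refine Eventually.of_forall fun t _ x hx => ?_
        have hx' := hsub (Ioo_subset_Icc_self hx)
        have hgd : HasDerivAt g (deriv g (nrm γ t x)) (nrm γ t x) :=
          (hg.differentiableAt (hV.mem_nhds (hin t x hx'.1 hx'.2))).hasDerivAt
        exact (hgd.comp_of_eq x (hasDerivAt_nrm_snd γ t x) rfl).mul (hasDerivAt_nrm'_snd γ t x))
    have h0 : ∫ t in (0 : ℝ)..(2 * Real.pi), (deriv g (nrm γ t s) * (I * deriv γ t) * nrm' γ t s +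
        g (nrm γ t s) * (I * deriv (deriv γ) t)) = 0 := by
      rw [intervalIntegral.integral_eq_sub_of_hasDerivAt
        (f := fun t => g (nrm γ t s) * (I * deriv γ t))]
      · have e1 := h.per_nrm s 0
        have e2 := h.per_deriv 0
        simp only [zero_add] at e1 e2
        rw [e1, e2, sub_self]
      · intro t _
        have hgd : HasDerivAt g (deriv g (nrm γ t s)) (nrm γ t s) :=
          (hg.differentiableAt (hV.mem_nhds (hin t s hs.1 hs.2))).hasDerivAt
        refine ((hgd.comp_of_eq t (h.hasDerivAt_nrm_fst t s) rfl).mul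
          ((h.hasDerivAt_deriv t).const_mul I)).congr_deriv ?_
        simp only [Function.comp]
        ring
      · exact (slice hF'c s hs).intervalIntegrable _ _
    rw [h0] at key
    exact key.2
  exact isOpen_Ioo.is_const_of_deriv_eq_zero isPreconnected_Ioo
    (fun s hs => (hD s hs).differentiableAt.differentiableWithinAt) (fun s hs => (hD s hs).deriv) h1 h2

theorem tendsto_integral_nrm (h : SmoothLoop γ) {V : Set ℂ} {g : ℂ → ℂ}
    (hg : ContinuousOn g V) {δ : ℝ} (hδ : 0 < δ) (hin : ∀ t s, 0 ≤ s → s < δ → nrm γ t s ∈ V)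
    {k : ℝ × ℝ → ℂ} (hk : Continuous k) :
    Tendsto (fun s => ∫ t in (0 : ℝ)..(2 * Real.pi), g (nrm γ t s) * k (t, s)) (𝓝[>] 0)
      (𝓝 (∫ t in (0 : ℝ)..(2 * Real.pi), g (γ t) * k (t, 0))) := by
  have hmaps : MapsTo (fun p : ℝ × ℝ => nrm γ p.1 p.2) (univ ×ˢ Ico 0 δ) V :=
    fun p hp => hin _ _ hp.2.1 hp.2.2
  have c1 : ContinuousOn (fun p : ℝ × ℝ => g (nrm γ p.1 p.2) * k p) (univ ×ˢ Ico 0 δ) :=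
    (hg.comp h.continuous_nrm.continuousOn hmaps).mul hk.continuousOn
  have slice : ∀ s ∈ Ico 0 δ, Continuous fun t => g (nrm γ t s) * k (t, s) := fun s hs =>
    continuousOn_univ.1 (c1.comp (by fun_prop : Continuous fun t : ℝ => (t, s)).continuousOn
      fun t _ => ⟨trivial, hs⟩)
  have hcpt : IsCompact (Icc 0 (2 * Real.pi) ×ˢ Icc 0 (δ / 2)) := isCompact_Icc.prod isCompact_Icc
  have hsub : Icc 0 (δ / 2) ⊆ Ico 0 δ := fun x hx => ⟨hx.1, by linarith [hx.2]⟩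
  obtain ⟨B, hB⟩ := hcpt.exists_bound_of_continuousOn (c1.mono (prod_mono (subset_univ _) hsub))
  have hev : ∀ᶠ s in 𝓝[>] (0 : ℝ), s ∈ Icc 0 (δ / 2) :=
    mem_of_superset (Ioc_mem_nhdsGT (by positivity : (0 : ℝ) < δ / 2)) Ioc_subset_Icc_self
  refine intervalIntegral.tendsto_integral_filter_of_dominated_convergence (fun _ => B)
    (hev.mono fun s hs => (slice s (hsub hs)).aestronglyMeasurable) ?_ intervalIntegrable_const ?_
  · refine hev.mono fun s hs => Eventually.of_forall fun t ht => hB (t, s) ⟨?_, hs⟩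
    rw [uIoc_of_le Real.two_pi_pos.le] at ht
    exact Ioc_subset_Icc_self ht
  · refine Eventually.of_forall fun t _ => ?_
    have h1 : ContinuousOn (fun s => g (nrm γ t s) * k (t, s)) (Ico 0 δ) :=
      c1.comp (by fun_prop : Continuous fun s : ℝ => (t, s)).continuousOn fun s hs => ⟨trivial, hs⟩
    have h2 := (h1 0 ⟨le_rfl, hδ⟩).tendsto
    simp only [nrm_zero] at h2
    refine h2.mono_left (nhdsWithin_le_iff.2 ?_)
    exact mem_of_superset (Ioo_mem_nhdsGT hδ) fun s hs => ⟨hs.1.le, hs.2⟩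

end SmoothLoop

namespace Bdry

variable {Ω : Set ℂ} {n : ℕ} {γ : Fin n → ℝ → ℂ}

theorem cint_const (h : Bdry Ω γ) {V : Set ℂ} (hV : IsOpen V) {g : ℂ → ℂ}
    (hg : DifferentiableOn ℂ g V) {δ : ℝ} (hin : ∀ i t s, 0 < s → s < δ → nrm (γ i) t s ∈ V)
    {s₁ s₂ : ℝ} (h1 : s₁ ∈ Ioo 0 δ) (h2 : s₂ ∈ Ioo 0 δ) : cint γ g s₁ = cint γ g s₂ :=
  Finset.sum_congr rfl fun i _ => (h.loop i).integral_nrm_const hV hg (hin i) h1 h2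

theorem tendsto_cint (h : Bdry Ω γ) {V : Set ℂ} {g : ℂ → ℂ}
    (hg : ContinuousOn g V) {δ : ℝ} (hδ : 0 < δ)
    (hin : ∀ i t s, 0 ≤ s → s < δ → nrm (γ i) t s ∈ V) :
    Tendsto (cint γ g) (𝓝[>] 0) (𝓝 (cint γ g 0)) := by
  refine tendsto_finsetSum _ fun i _ => ?_
  simp only [nrm_zero]
  exact (h.loop i).tendsto_integral_nrm hg hδ (hin i) (k := fun p => nrm' (γ i) p.1 p.2)
    (h.loop i).continuous_nrm'

theorem cint_eq_of_Ico (h : Bdry Ω γ) {V : Set ℂ} (hV : IsOpen V) {g : ℂ → ℂ}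
    (hg : DifferentiableOn ℂ g V) {δ : ℝ} (hin : ∀ i t s, 0 ≤ s → s < δ → nrm (γ i) t s ∈ V)
    {s : ℝ} (hs : s ∈ Ioo 0 δ) : cint γ g s = cint γ g 0 := by
  refine tendsto_nhds_unique (tendsto_const_nhds.congr' ?_)
    (h.tendsto_cint hg.continuousOn (hs.1.trans hs.2) hin)
  filter_upwards [Ioo_mem_nhdsGT (hs.1.trans hs.2)] with x hx
  exact h.cint_const hV hg (fun i t s h1 h2 => hin i t s h1.le h2) hs hx

theorem notMem_frontier (h : Bdry Ω γ) {b : ℂ} (hb : b ∈ Ω) : b ∉ frontier Ω := fun hf => by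
  obtain ⟨i, t, rfl⟩ := h.eq_of_frontier hf
  exact h.notMem i t hb

theorem exists_far (h : Bdry Ω γ) {b : ℂ} (hb : b ∉ frontier Ω) :
    ∃ r > 0, ∃ δ > 0, ∀ i t s, |s| < δ → r ≤ ‖nrm (γ i) t s - b‖ := by
  obtain ⟨m, hm, M, hM, K, hK, hbd⟩ := h.exists_bounds
  obtain ⟨d, hd, hdb⟩ := exists_pos_forall_fin (P := fun i d => ∀ t, d ≤ ‖γ i t - b‖)
    (fun i x y _ hxy hy t => hxy.trans (hy t)) fun i =>
      exists_pos_le_norm_sub (h.loop i).cont (h.loop i).per (h.off hb i)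
  refine ⟨d / 2, by positivity, d / (2 * M), by positivity, fun i t s hs => ?_⟩
  have h1 : ‖(s : ℂ) * I * deriv (γ i) t‖ ≤ d / 2 := by
    rw [norm_mul, norm_mul, norm_I, mul_one, norm_real, Real.norm_eq_abs]
    calc |s| * ‖deriv (γ i) t‖ ≤ d / (2 * M) * M := by
          gcongr
          exact (hbd i).2.1 t
      _ = d / 2 := by field_simp
  have h2 : γ i t - b = nrm (γ i) t s - b - s * I * deriv (γ i) t := by rw [nrm]; ring
  have h3 := hdb i t
  rw [h2] at h3
  linarith [norm_sub_le (nrm (γ i) t s - b) (s * I * deriv (γ i) t)]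

theorem _root_.cint_eq_CI (γ : Fin n → ℝ → ℂ) (g : ℂ → ℂ) (s : ℝ) (w : ℂ) :
    cint γ (fun ζ => g ζ / (ζ - w)) s =
      ∑ i, CI (fun t => nrm (γ i) t s) (fun t => g (nrm (γ i) t s) * nrm' (γ i) t s) w := by
  simp only [cint, CI, div_mul_eq_mul_div]

theorem _root_.winding_eq_CI (γ : Fin n → ℝ → ℂ) (s : ℝ) (w : ℂ) :
    cint γ (fun ζ => (ζ - w)⁻¹) s =
      ∑ i, CI (fun t => nrm (γ i) t s) (fun t => nrm' (γ i) t s) w := by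
  simp only [cint, CI, div_eq_inv_mul]

theorem winding_const (h : Bdry Ω γ) {s : ℝ} {U : Set ℂ} (hU : IsOpen U) (hUc : IsPreconnected U)
    (hoff : ∀ z ∈ U, ∀ i t, nrm (γ i) t s ≠ z) {z w : ℂ} (hz : z ∈ U) (hw : w ∈ U) :
    cint γ (fun ζ => (ζ - z)⁻¹) s = cint γ (fun ζ => (ζ - w)⁻¹) s := by
  rw [winding_eq_CI, winding_eq_CI]
  refine Finset.sum_congr rfl fun i _ => ?_
  have hD : ∀ z ∈ U, HasDerivAt (CI (fun t => nrm (γ i) t s) fun t => nrm' (γ i) t s) 0 z :=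
    fun z hz => CI_deriv_hasDerivAt (fun t => (h.loop i).hasDerivAt_nrm_fst t s)
      ((h.loop i).per_nrm s) ((h.loop i).continuous_nrm'_fst s) fun t => hoff z hz i t
  exact hU.is_const_of_deriv_eq_zero hUc
    (fun z hz => (hD z hz).differentiableAt.differentiableWithinAt) (fun z hz => (hD z hz).deriv)
    hz hw

theorem _root_.winding_zero (γ : Fin n → ℝ → ℂ) (w : ℂ) :
    cint γ (fun ζ => (ζ - w)⁻¹) 0 = ∑ i, CI (γ i) (deriv (γ i)) w := by
  simp only [cint, CI, nrm_zero, nrm'_zero, div_eq_inv_mul]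

theorem _root_.differentiableOn_inv_sub (w : ℂ) : DifferentiableOn ℂ (fun ζ : ℂ => (ζ - w)⁻¹) {w}ᶜ :=
  fun _ hζ => ((differentiableAt_id.sub_const w).inv (sub_ne_zero.2 hζ)).differentiableWithinAt

theorem winding_in (h : Bdry Ω γ) {b : ℂ} (hb : b ∈ Ω) :
    ∃ δ > 0, ∀ s ∈ Ioo 0 δ, cint γ (fun ζ => (ζ - b)⁻¹) s = 2 * Real.pi * I := by
  obtain ⟨r, hr, δ, hδ, hfar⟩ := h.exists_far (b := b) (h.notMem_frontier hb)
  refine ⟨δ, hδ, fun s hs => ?_⟩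
  rw [h.cint_eq_of_Ico isOpen_compl_singleton (differentiableOn_inv_sub b) (fun i t s h1 h2 he => ?_) hs,
    winding_zero, h.winding.2 b hb]
  have := hfar i t s (by rwa [abs_of_nonneg h1])
  rw [he, sub_self, norm_zero] at this
  linarith

theorem exists_ball_off (h : Bdry Ω γ) {s : ℝ} {w : ℂ} (hw : ∀ i t, nrm (γ i) t s ≠ w) :
    ∃ r > 0, ∀ z ∈ ball w r, ∀ i t, nrm (γ i) t s ≠ z := by
  obtain ⟨d, hd, hdb⟩ := exists_pos_forall_fin (P := fun i d => ∀ t, d ≤ ‖nrm (γ i) t s - w‖)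
    (fun i x y _ hxy hy t => hxy.trans (hy t)) fun i =>
      exists_pos_le_norm_sub ((h.loop i).continuous_nrm_fst s) ((h.loop i).per_nrm s) (hw i)
  refine ⟨d, hd, fun z hz i t he => ?_⟩
  rw [mem_ball, dist_eq_norm] at hz
  have := hdb i t
  rw [he] at this
  linarith

theorem winding_out (h : Bdry Ω γ) {δ : ℝ}
    (hside : ∀ i t s, 0 < s → s < δ → nrm (γ i) t s ∈ Ω ∧ nrm (γ i) t (-s) ∉ closure Ω)
    {w : ℂ} (hw : w ∉ Ω) {s : ℝ} (hs : s ∈ Ioo 0 δ) : cint γ (fun ζ => (ζ - w)⁻¹) s = 0 := by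
  have hext : ∀ w ∉ closure Ω, cint γ (fun ζ => (ζ - w)⁻¹) s = 0 := fun w hw => by
    rw [h.cint_eq_of_Ico isOpen_compl_singleton (differentiableOn_inv_sub w) (fun i t s h1 h2 he => ?_) hs,
      winding_zero, h.winding.1 w hw]
    rcases h1.eq_or_lt with rfl | h1
    · rw [nrm_zero] at he
      exact hw (he ▸ frontier_subset_closure (h.mem_frontier i t))
    · exact hw (he ▸ subset_closure (hside i t s h1 h2).1)
  by_cases hcl : w ∈ closure Ω
  · obtain ⟨r, hr, hball⟩ := h.exists_ball_off (s := s) (w := w)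
      fun i t he => hw (he ▸ (hside i t s hs.1 hs.2).1)
    obtain ⟨i, t, rfl⟩ := h.eq_of_frontier (mem_frontier_of_closure hcl hw)
    obtain ⟨p, hp⟩ := ((h.tendsto_out i t).eventually
      (Filter.Eventually.and (mem_nhdsWithin_of_mem_nhds (ball_mem_nhds _ hr))
        self_mem_nhdsWithin)).exists
    rw [h.winding_const isOpen_ball (convex_ball _ _).isPreconnected hball (mem_ball_self hr) hp.1]
    exact hext _ hp.2
  · exact hext w hcl

theorem cauchy_aux (h : Bdry Ω γ) {g : ℂ → ℂ} (hg : DifferentiableOn ℂ g Ω) {δ : ℝ} (hδ : 0 < δ)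
    (hside : ∀ i t s, 0 < s → s < δ → nrm (γ i) t s ∈ Ω ∧ nrm (γ i) t (-s) ∉ closure Ω)
    {w : ℂ} (hw : w ∈ Ω) {s : ℝ} (hs : s ∈ Ioo 0 δ) : cint γ (dslope g w) s = 0 := by
  classical
  set E : ℝ → ℂ → ℂ := fun s w => cint γ (fun ζ => g ζ / (ζ - w)) s with hE
  set H : ℂ → ℂ := fun w => if w ∈ Ω then cint γ (dslope g w) s else E s w with hH
  have hgc : ∀ i, ∀ s ∈ Ioo 0 δ, Continuous fun t => g (nrm (γ i) t s) := fun i s hs =>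
    hg.continuousOn.comp_continuous ((h.loop i).continuous_nrm_fst s)
      fun t => (hside i t s hs.1 hs.2).1
  have hEd : ∀ s ∈ Ioo 0 δ, ∀ w, (∀ i t, nrm (γ i) t s ≠ w) → DifferentiableAt ℂ (E s) w := by
    intro s hs w hw
    have : E s = fun w => ∑ i, CI (fun t => nrm (γ i) t s)
        (fun t => g (nrm (γ i) t s) * nrm' (γ i) t s) w := funext fun w => cint_eq_CI γ g s w
    rw [this]
    exact DifferentiableAt.fun_sum fun i _ => (CI_hasDerivAt ((h.loop i).continuous_nrm_fst s)
      ((h.loop i).per_nrm s) ((hgc i s hs).mul ((h.loop i).continuous_nrm'_fst s)) (hw i)).differentiableAt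
  have hds : ∀ w ∈ Ω, ∀ s ∈ Ioo 0 δ, (∀ i t, nrm (γ i) t s ≠ w) →
      cint γ (dslope g w) s = E s w - g w * cint γ (fun ζ => (ζ - w)⁻¹) s := by
    intro w hw s hs hoff
    simp only [hE]
    rw [cint_eq_CI, winding_eq_CI, Finset.mul_sum, ← Finset.sum_sub_distrib, cint]
    refine Finset.sum_congr rfl fun i _ => ?_
    have hne : ∀ t, nrm (γ i) t s - w ≠ 0 := fun t => sub_ne_zero.2 (hoff i t)
    rw [CI, CI, ← intervalIntegral.integral_const_mul, ← intervalIntegral.integral_sub]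
    · refine intervalIntegral.integral_congr fun t _ => ?_
      rw [dslope_of_ne _ (hoff i t), slope_def_field]
      field_simp [hne t]
    · exact (((hgc i s hs).mul ((h.loop i).continuous_nrm'_fst s)).div
        (((h.loop i).continuous_nrm_fst s).sub continuous_const) hne).intervalIntegrable _ _
    · exact (continuous_const.mul (((h.loop i).continuous_nrm'_fst s).div
        (((h.loop i).continuous_nrm_fst s).sub continuous_const) hne)).intervalIntegrable _ _
  have hdiff : Differentiable ℂ H := by
    intro w0
    by_cases hw0 : w0 ∈ Ω
    · obtain ⟨r, hr, δ', hδ', hfar⟩ := h.exists_far (b := w0) (h.notMem_frontier hw0)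
      set s' := min δ δ' / 2 with hs'
      have hs'0 : 0 < s' := by positivity
      have hs'1 : s' ∈ Ioo 0 δ := ⟨hs'0, by linarith [min_le_left δ δ']⟩
      have hoff : ∀ z ∈ ball w0 r, ∀ i t, nrm (γ i) t s' ≠ z := fun z hz i t he => by
        have := hfar i t s' (by rw [abs_of_pos hs'0]; linarith [min_le_right δ δ'])
        rw [he] at this
        rw [mem_ball, dist_eq_norm] at hz
        linarith
      have hd : DifferentiableAt ℂ (fun z => E s' z - g z * cint γ (fun ζ => (ζ - w0)⁻¹) s') w0 :=
        (hEd s' hs'1 w0 (hoff w0 (mem_ball_self hr))).sub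
          ((hg.differentiableAt (h.isOpen.mem_nhds hw0)).mul_const _)
      refine hd.congr_of_eventuallyEq ?_
      filter_upwards [h.isOpen.mem_nhds hw0, ball_mem_nhds w0 hr] with z hz hzb
      simp only [hH]
      rw [if_pos hz, h.cint_const h.isOpen
        ((differentiableOn_dslope (h.isOpen.mem_nhds hz)).2 hg)
        (fun i t s h1 h2 => (hside i t s h1 h2).1) hs hs'1, hds z hz s' hs'1 (hoff z hzb),
        h.winding_const isOpen_ball (convex_ball _ _).isPreconnected hoff hzb (mem_ball_self hr)]
    · have hne : ∀ i t, nrm (γ i) t s ≠ w0 := fun i t he => hw0 (he ▸ (hside i t s hs.1 hs.2).1)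
      obtain ⟨r, hr, hoff⟩ := h.exists_ball_off hne
      refine (hEd s hs w0 hne).congr_of_eventuallyEq ?_
      filter_upwards [ball_mem_nhds w0 hr] with z hzb
      simp only [hH]
      split_ifs with hz
      · rw [hds z hz s hs (hoff z hzb), h.winding_const isOpen_ball (convex_ball _ _).isPreconnected
          hoff hzb (mem_ball_self hr), h.winding_out hside hw0 hs, mul_zero, sub_zero]
      · rfl
  have hlim : Tendsto H (cocompact ℂ) (𝓝 0) := by
    have h1 : Tendsto (E s) (cocompact ℂ) (𝓝 0) := by
      have := tendsto_finsetSum Finset.univ fun i _ => tendsto_CI_cocompact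
        ((h.loop i).continuous_nrm_fst s) ((h.loop i).per_nrm s)
        ((hgc i s hs).mul ((h.loop i).continuous_nrm'_fst s))
      rw [Finset.sum_const_zero] at this
      exact this.congr fun w => (cint_eq_CI γ g s w).symm
    refine h1.congr' ?_
    have hc : (closure Ω)ᶜ ∈ cocompact ℂ := by
      exact (Metric.isCompact_of_isClosed_isBounded isClosed_closure h.bdd.closure).compl_mem_cocompact
    filter_upwards [hc] with z hz
    simp only [hH]
    rw [if_neg fun hzΩ => hz (subset_closure hzΩ)]
  have := hdiff.apply_eq_of_tendsto_cocompact w hlim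
  simpa [hH, hw] using this

/-- Cauchy's theorem. -/
theorem cauchy (h : Bdry Ω γ) {g : ℂ → ℂ} (hg : DifferentiableOn ℂ g Ω) {δ : ℝ} (hδ : 0 < δ)
    (hside : ∀ i t s, 0 < s → s < δ → nrm (γ i) t s ∈ Ω ∧ nrm (γ i) t (-s) ∉ closure Ω)
    {s : ℝ} (hs : s ∈ Ioo 0 δ) : cint γ g s = 0 := by
  obtain ⟨b, hb⟩ := h.conn.nonempty
  obtain ⟨r, hr, δ', hδ', hfar⟩ := h.exists_far (b := b) (h.notMem_frontier hb)
  set s' := min δ δ' / 2 with hs'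
  have hs'0 : 0 < s' := by positivity
  have hs'1 : s' ∈ Ioo 0 δ := ⟨hs'0, by linarith [min_le_left δ δ']⟩
  have hG : DifferentiableOn ℂ (fun z => (z - b) * g z) Ω :=
    (differentiableOn_id.sub_const b).mul hg
  have h1 := h.cauchy_aux hG hδ hside hb hs'1
  rw [h.cint_const h.isOpen hg (fun i t s h1 h2 => (hside i t s h1 h2).1) hs hs'1, ← h1]
  refine Finset.sum_congr rfl fun i _ => intervalIntegral.integral_congr fun t _ => ?_
  have hne : nrm (γ i) t s' ≠ b := fun he => by
    have := hfar i t s' (by rw [abs_of_pos hs'0]; linarith [min_le_right δ δ'])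
    rw [he, sub_self, norm_zero] at this
    linarith
  have hne' := sub_ne_zero.2 hne
  rw [dslope_of_ne _ hne, slope_def_field, sub_self, zero_mul, sub_zero, mul_div_cancel_left₀ _ hne']

theorem cauchy_boundary (h : Bdry Ω γ) {g : ℂ → ℂ} (hg : DifferentiableOn ℂ g Ω)
    (hgc : ContinuousOn g (closure Ω)) :
    ∑ i, ∫ t in (0 : ℝ)..(2 * Real.pi), g (γ i t) * deriv (γ i) t = 0 := by
  obtain ⟨δ, hδ, hside⟩ := h.side
  have h1 := h.tendsto_cint hgc hδ fun i t s h1 h2 => by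
    rcases h1.eq_or_lt with rfl | h1
    · rw [nrm_zero]; exact frontier_subset_closure (h.mem_frontier i t)
    · exact subset_closure (hside i t s h1 h2).1
  have h2 : Tendsto (cint γ g) (𝓝[>] 0) (𝓝 0) := by
    refine tendsto_const_nhds.congr' ?_
    filter_upwards [Ioo_mem_nhdsGT hδ] with s hs using (h.cauchy hg hδ hside hs).symm
  have := tendsto_nhds_unique h1 h2
  simpa only [cint, nrm_zero, nrm'_zero] using this

theorem continuous_cint_integrand (h : Bdry Ω γ) {V : Set ℂ} {g : ℂ → ℂ} (hg : ContinuousOn g V)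
    {s : ℝ} (hin : ∀ i t, nrm (γ i) t s ∈ V) (i : Fin n) :
    Continuous fun t => g (nrm (γ i) t s) * nrm' (γ i) t s :=
  (hg.comp_continuous ((h.loop i).continuous_nrm_fst s) (hin i)).mul
    ((h.loop i).continuous_nrm'_fst s)

theorem cint_add (h : Bdry Ω γ) {V : Set ℂ} {f g : ℂ → ℂ} (hf : ContinuousOn f V)
    (hg : ContinuousOn g V) {s : ℝ} (hin : ∀ i t, nrm (γ i) t s ∈ V) :
    cint γ (fun z => f z + g z) s = cint γ f s + cint γ g s := by
  simp only [cint, add_mul]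
  rw [← Finset.sum_add_distrib]
  exact Finset.sum_congr rfl fun i _ => intervalIntegral.integral_add
    ((h.continuous_cint_integrand hf hin i).intervalIntegrable _ _)
    ((h.continuous_cint_integrand hg hin i).intervalIntegrable _ _)

theorem _root_.cint_const_mul (γ : Fin n → ℝ → ℂ) (c : ℂ) (f : ℂ → ℂ) (s : ℝ) :
    cint γ (fun z => c * f z) s = c * cint γ f s := by
  simp only [cint, mul_assoc, intervalIntegral.integral_const_mul, Finset.mul_sum]

theorem _root_.cint_congr {γ : Fin n → ℝ → ℂ} {f g : ℂ → ℂ} {s : ℝ}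
    (hfg : ∀ i t, f (nrm (γ i) t s) = g (nrm (γ i) t s)) : cint γ f s = cint γ g s :=
  Finset.sum_congr rfl fun i _ => intervalIntegral.integral_congr fun t _ => by
    simp only [hfg]

theorem cint_inv_sq (h : Bdry Ω γ) {b : ℂ} {s : ℝ} (hb : ∀ i t, nrm (γ i) t s ≠ b) :
    cint γ (fun ζ => ((ζ - b) ^ 2)⁻¹) s = 0 := by
  refine Finset.sum_eq_zero fun i _ => ?_
  have h1 := CI_hasDerivAt ((h.loop i).continuous_nrm_fst s) ((h.loop i).per_nrm s)
    ((h.loop i).continuous_nrm'_fst s) (hb i)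
  have h2 := CI_deriv_hasDerivAt (fun t => (h.loop i).hasDerivAt_nrm_fst t s)
    ((h.loop i).per_nrm s) ((h.loop i).continuous_nrm'_fst s) (hb i)
  rw [← h1.unique h2]
  simp only [div_eq_inv_mul]

/-- Cauchy's formula for the derivative. -/
theorem cauchy_deriv (h : Bdry Ω γ) {g : ℂ → ℂ} (hg : DifferentiableOn ℂ g Ω) {b : ℂ} (hb : b ∈ Ω) :
    ∃ δ > 0, ∀ s ∈ Ioo 0 δ, cint γ (fun ζ => g ζ / (ζ - b) ^ 2) s = 2 * Real.pi * I * deriv g b := by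
  obtain ⟨δ, hδ, hside⟩ := h.side
  obtain ⟨r, hr, δ', hδ', hfar⟩ := h.exists_far (h.notMem_frontier hb)
  obtain ⟨δ'', hδ'', hw⟩ := h.winding_in hb
  refine ⟨min δ (min δ' δ''), by positivity, fun s hs => ?_⟩
  have hs1 : s ∈ Ioo 0 δ := ⟨hs.1, hs.2.trans_le (min_le_left _ _)⟩
  have hs2 : s < δ' := hs.2.trans_le ((min_le_right _ _).trans (min_le_left _ _))
  have hs3 : s < δ'' := hs.2.trans_le ((min_le_right _ _).trans (min_le_right _ _))
  have hne : ∀ i t, nrm (γ i) t s ≠ b := fun i t he => by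
    have := hfar i t s (by rwa [abs_of_pos hs.1])
    rw [he, sub_self, norm_zero] at this
    linarith
  have hk := (differentiableOn_dslope (h.isOpen.mem_nhds hb)).2 hg
  have hk2 := (differentiableOn_dslope (h.isOpen.mem_nhds hb)).2 hk
  have hin : ∀ i t, nrm (γ i) t s ∈ Ω \ {b} := fun i t => ⟨(hside i t s hs.1 hs1.2).1, hne i t⟩
  have c0 : ∀ x ∈ Ω \ {b}, x - b ≠ 0 := fun x hx => sub_ne_zero.2 hx.2
  have c1 : ContinuousOn (fun ζ => g b * ((ζ - b) ^ 2)⁻¹) (Ω \ {b}) :=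
    continuousOn_const.mul (ContinuousOn.inv₀ (by fun_prop) fun x hx => pow_ne_zero 2 (c0 x hx))
  have c2 : ContinuousOn (fun ζ => dslope g b b * (ζ - b)⁻¹) (Ω \ {b}) :=
    continuousOn_const.mul (ContinuousOn.inv₀ (by fun_prop) c0)
  have c3 : ContinuousOn (dslope (dslope g b) b) (Ω \ {b}) := hk2.continuousOn.mono sdiff_subset
  have e : cint γ (fun ζ => g ζ / (ζ - b) ^ 2) s = cint γ (fun ζ => (g b * ((ζ - b) ^ 2)⁻¹ +
      dslope g b b * (ζ - b)⁻¹) + dslope (dslope g b) b ζ) s := by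
    refine cint_congr fun i t => ?_
    have h0 := sub_ne_zero.2 (hne i t)
    rw [dslope_of_ne (dslope g b) (hne i t), slope_def_field, dslope_of_ne g (hne i t), slope_def_field]
    field_simp
    ring
  have c12 : ContinuousOn (fun ζ => g b * ((ζ - b) ^ 2)⁻¹ + dslope g b b * (ζ - b)⁻¹) (Ω \ {b}) :=
    c1.add c2
  rw [e, h.cint_add c12 c3 hin, h.cint_add c1 c2 hin, cint_const_mul, cint_const_mul,
    h.cint_inv_sq hne, hw s ⟨hs.1, hs3⟩, h.cauchy hk2 hδ hside hs1, dslope_same]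
  ring

end Bdry

theorem integrableOn_inv_ball (R : ℝ) : IntegrableOn (fun u : ℂ => u⁻¹) (ball 0 R) := by
  have h : IntegrableOn (fun u : ℂ => (fun x : ℝ => x⁻¹) ‖u‖) (ball 0 R) := by
    rw [integrableOn_fun_norm_addHaar]
    refine (integrableOn_const (C := (1 : ℝ)) (by simp) (by simp)).congr_fun (fun y hy => ?_)
      measurableSet_Ioo
    have := hy.1.ne'
    simp [Complex.finrank_real_complex, this]
  refine Integrable.mono' h (by fun_prop) (Eventually.of_forall fun u => ?_)
  simp

theorem integrableOn_inv_sub {Ω : Set ℂ} (hb : Bornology.IsBounded Ω) (ζ : ℂ) :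
    IntegrableOn (fun z : ℂ => (ζ - z)⁻¹) Ω := by
  obtain ⟨R, hR⟩ := hb.subset_ball ζ
  refine IntegrableOn.mono_set ?_ hR
  have h := (integrableOn_inv_ball R)
  rw [← integrable_indicator_iff measurableSet_ball] at h ⊢
  refine (h.comp_sub_left ζ).congr (Eventually.of_forall fun z => ?_)
  simp [indicator, dist_eq_norm, norm_sub_rev ζ z]

theorem circle_inv {w : ℂ} {ρ : ℝ} (hρ : 0 < ρ) (h : ρ ≠ ‖w‖) :
    ∫ θ in Ioo (-Real.pi) Real.pi, (w - ρ * (Real.cos θ + Real.sin θ * I))⁻¹ =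
      if ρ < ‖w‖ then 2 * Real.pi / w else 0 := by
  have key : Real.circleAverage (fun u => (w - ρ * u)⁻¹) 0 1 = if ρ < ‖w‖ then w⁻¹ else 0 := by
    split_ifs with hlt
    · have hd : DiffContOnCl ℂ (fun u => (w - ρ * u)⁻¹) (ball 0 |1|) := by
        refine DifferentiableOn.diffContOnCl ?_
        intro u hu
        have hu' : ‖u‖ ≤ 1 := by
          have := closure_ball_subset_closedBall hu
          simpa using this
        have hne : w - ρ * u ≠ 0 := fun h0 => by
          have e : w = ρ * u := sub_eq_zero.1 h0
          have : ‖w‖ ≤ ρ := by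
            rw [e, norm_mul, Complex.norm_real, Real.norm_of_nonneg hρ.le]
            nlinarith
          linarith
        have : DifferentiableAt ℂ (fun u => w - ρ * u) u := by fun_prop
        exact (this.inv hne).differentiableWithinAt
      simpa using hd.circleAverage
    · have hlt' : ‖w‖ < ρ := lt_of_le_of_ne (not_lt.1 hlt) h.symm
      rw [← Real.circleAverage_zero_one_congr_inv]
      have hc : Real.circleAverage (fun u => (w - ρ * u⁻¹)⁻¹) 0 1 =
          Real.circleAverage (fun u => u * (w * u - ρ)⁻¹) 0 1 := by
        refine Real.circleAverage_congr_sphere fun u hu => ?_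
        have hu0 : u ≠ 0 := fun h0 => by simp [h0] at hu
        have : w - ρ * u⁻¹ = (w * u - ρ) * u⁻¹ := by field_simp
        simp only [this, mul_inv, inv_inv, mul_comm]
      rw [hc]
      have hd : DiffContOnCl ℂ (fun u => u * (w * u - ρ)⁻¹) (ball 0 |1|) := by
        refine DifferentiableOn.diffContOnCl ?_
        intro u hu
        have hu' : ‖u‖ ≤ 1 := by
          have := closure_ball_subset_closedBall hu
          simpa using this
        have hne : w * u - ρ ≠ 0 := fun h0 => by
          have e : (ρ : ℂ) = w * u := (sub_eq_zero.1 h0).symm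
          have e2 := congrArg norm e
          rw [norm_mul, Complex.norm_real, Real.norm_of_nonneg hρ.le] at e2
          nlinarith [norm_nonneg w]
        have : DifferentiableAt ℂ (fun u => w * u - ρ) u := by fun_prop
        exact (differentiableAt_id.mul (this.inv hne)).differentiableWithinAt
      simpa using hd.circleAverage
  rw [Real.circleAverage_eq_integral_add (-Real.pi)] at key
  have hsub := intervalIntegral.integral_comp_add_right (a := 0) (b := 2 * Real.pi)
    (fun θ => (w - ρ * circleMap 0 1 θ)⁻¹) (-Real.pi)
  rw [hsub, zero_add, show 2 * Real.pi + -Real.pi = Real.pi by ring] at key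
  have e : ∫ θ in Ioo (-Real.pi) Real.pi, (w - ρ * (Real.cos θ + Real.sin θ * I))⁻¹ =
      ∫ θ in (-Real.pi)..Real.pi, (w - ρ * circleMap 0 1 θ)⁻¹ := by
    rw [intervalIntegral.integral_of_le (by linarith [Real.pi_pos]), integral_Ioc_eq_integral_Ioo]
    refine setIntegral_congr_fun measurableSet_Ioo fun θ _ => ?_
    simp [circleMap, Complex.exp_mul_I]
  rw [e]
  have hpi : (2 * Real.pi) ≠ 0 := by positivity
  rw [inv_smul_eq_iff₀ hpi] at key
  rw [key]
  split_ifs <;> simp [div_eq_mul_inv]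

theorem integral_ball_inv {r : ℝ} {w : ℂ} (hw : ‖w‖ < r) :
    ∫ u in ball (0 : ℂ) r, (w - u)⁻¹ = Real.pi * conj w := by
  have hr : 0 < r := (norm_nonneg w).trans_lt hw
  set f : ℂ → ℂ := (ball (0 : ℂ) r).indicator fun u => (w - u)⁻¹ with hf
  have hfi : Integrable f := (integrable_indicator_iff measurableSet_ball).2
    (integrableOn_inv_sub isBounded_ball w)
  have hfm : Measurable f := by
    refine Measurable.indicator ?_ measurableSet_ball
    fun_prop
  rw [← integral_indicator measurableSet_ball, ← Complex.integral_comp_polarCoord_symm]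
  have hsymm : Measurable fun p : ℝ × ℝ => Complex.polarCoord.symm p := by
    simp only [Complex.polarCoord_symm_apply]
    fun_prop
  have hI : IntegrableOn (fun p : ℝ × ℝ => p.1 • f (Complex.polarCoord.symm p)) polarCoord.target := by
    refine ⟨(measurable_fst.smul (hfm.comp hsymm)).aestronglyMeasurable, ?_⟩
    have h2 := hfi.2
    rw [HasFiniteIntegral, ← Complex.lintegral_comp_polarCoord_symm] at h2
    refine lt_of_le_of_lt (le_of_eq ?_) h2
    refine setLIntegral_congr_fun polarCoord.open_target.measurableSet fun p hp => ?_
    have hp1 : 0 < p.1 := hp.1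
    simp only [smul_eq_mul]
    rw [enorm_smul, Real.enorm_eq_ofReal hp1.le]
  have htar : polarCoord.target = Ioi (0 : ℝ) ×ˢ Ioo (-Real.pi) Real.pi := rfl
  rw [htar] at hI ⊢
  rw [Measure.volume_eq_prod] at hI ⊢
  rw [setIntegral_prod _ hI]
  have hin : ∀ ρ ∈ Ioi (0 : ℝ), ρ ≠ ‖w‖ → (∫ θ in Ioo (-Real.pi) Real.pi,
      ((ρ, θ) : ℝ × ℝ).1 • f (Complex.polarCoord.symm (ρ, θ))) =
      (Ioo 0 ‖w‖).indicator (fun ρ : ℝ => (ρ : ℂ) * (2 * Real.pi / w)) ρ := by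
    intro ρ hρ hne
    have hρ0 : 0 < ρ := hρ
    rw [integral_smul]
    by_cases hρr : ρ < r
    · have : ∀ θ, f (Complex.polarCoord.symm (ρ, θ)) =
          (w - ρ * (Real.cos θ + Real.sin θ * I))⁻¹ := fun θ => by
        have hm : Complex.polarCoord.symm (ρ, θ) ∈ ball (0 : ℂ) r := by
          rw [mem_ball_zero_iff, Complex.norm_polarCoord_symm, abs_of_pos hρ]
          exact hρr
        rw [hf, indicator_of_mem hm, Complex.polarCoord_symm_apply]
      simp only [this]
      rw [circle_inv hρ hne]
      simp only [indicator, mem_Ioo, hρ0, true_and]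
      split_ifs <;> simp
    · have : ∀ θ, f (Complex.polarCoord.symm (ρ, θ)) = 0 := fun θ => by
        have hm : Complex.polarCoord.symm (ρ, θ) ∉ ball (0 : ℂ) r := by
          rw [mem_ball_zero_iff, Complex.norm_polarCoord_symm, abs_of_pos hρ]
          exact hρr
        rw [hf, indicator_of_notMem hm]
      simp only [this]
      rw [indicator_of_notMem (fun h => by linarith [h.2])]
      simp
  have hcongr : (∫ ρ in Ioi (0 : ℝ), ∫ θ in Ioo (-Real.pi) Real.pi,
      ((ρ, θ) : ℝ × ℝ).1 • f (Complex.polarCoord.symm (ρ, θ))) =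
      ∫ ρ in Ioi (0 : ℝ), (Ioo 0 ‖w‖).indicator (fun ρ : ℝ => (ρ : ℂ) * (2 * Real.pi / w)) ρ := by
    refine setIntegral_congr_ae measurableSet_Ioi ?_
    have : ∀ᵐ ρ : ℝ, ρ ≠ ‖w‖ := by simp [ae_iff]
    filter_upwards [this] with ρ h1 h2 using hin ρ h2 h1
  rw [hcongr, setIntegral_indicator measurableSet_Ioo,
    inter_eq_self_of_subset_right (fun x hx => hx.1), integral_mul_const,
    ← integral_Ioc_eq_integral_Ioo, ← intervalIntegral.integral_of_le (norm_nonneg w),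
    intervalIntegral.integral_ofReal, integral_id]
  by_cases hw0 : w = 0
  · simp [hw0]
  · have : (‖w‖ : ℂ) ^ 2 = w * conj w := by
      rw [Complex.mul_conj, Complex.normSq_eq_norm_sq]
      push_cast
      ring
    push_cast
    rw [zero_pow two_ne_zero, sub_zero, this]
    field_simp

/-- The Cauchy transform of area measure on `Ω`. -/
def areaCauchy (Ω : Set ℂ) (ζ : ℂ) : ℂ := ∫ z in Ω, (ζ - z)⁻¹

theorem tendsto_integral_inv_ball :
    Tendsto (fun n : ℕ => ∫ u in ball (0 : ℂ) (1 / ((n : ℝ) + 1)), ‖u⁻¹‖) atTop (𝓝 0) := by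
  have h := tendsto_setIntegral_of_antitone (μ := volume) (f := fun u : ℂ => ‖u⁻¹‖)
    (s := fun n : ℕ => ball (0 : ℂ) (1 / ((n : ℝ) + 1))) (fun n => measurableSet_ball)
    (fun m n hmn => ball_subset_ball (by
      have : (m : ℝ) ≤ n := by exact_mod_cast hmn
      gcongr))
    ⟨0, (integrableOn_inv_ball _).norm⟩
  have hz : (⋂ n : ℕ, ball (0 : ℂ) (1 / ((n : ℝ) + 1))) ⊆ {0} := by
    intro x hx
    by_contra hne
    have hp : 0 < ‖x‖ := norm_pos_iff.2 hne
    obtain ⟨n, hn⟩ := exists_nat_one_div_lt hp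
    have := mem_iInter.1 hx n
    rw [mem_ball_zero_iff] at this
    linarith
  have h0 : ∫ u in (⋂ n : ℕ, ball (0 : ℂ) (1 / ((n : ℝ) + 1))), ‖u⁻¹‖ = 0 :=
    setIntegral_measure_zero _ (measure_mono_null hz (by simp))
  rwa [h0] at h

theorem continuous_areaCauchy {Ω : Set ℂ} (hb : Bornology.IsBounded Ω) :
    Continuous (areaCauchy Ω) := by
  have hfin : volume Ω < ⊤ := hb.measure_lt_top
  have : IsFiniteMeasure (volume.restrict Ω) := ⟨by simpa using hfin⟩
  set k : ℕ → ℂ → ℂ := fun n u => conj u / ((max ‖u‖ (1 / ((n : ℝ) + 1)) ^ 2 : ℝ) : ℂ) with hk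
  have hpos : ∀ n : ℕ, (0 : ℝ) < 1 / ((n : ℝ) + 1) := fun n => by positivity
  have hmax : ∀ (n : ℕ) (u : ℂ), 0 < max ‖u‖ (1 / ((n : ℝ) + 1)) := fun n u =>
    lt_max_of_lt_right (hpos n)
  have hkc : ∀ n, Continuous (k n) := fun n => by
    refine Continuous.div continuous_conj (by fun_prop) fun u => ?_
    exact_mod_cast (pow_pos (hmax n u) 2).ne'
  have hknorm : ∀ n u, ‖k n u‖ = ‖u‖ / max ‖u‖ (1 / ((n : ℝ) + 1)) ^ 2 := fun n u => by
    rw [hk]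
    simp only [norm_div, RCLike.norm_conj, Complex.norm_real]
    rw [Real.norm_of_nonneg (by positivity)]
  have hkb : ∀ n u, ‖k n u‖ ≤ n + 1 := fun n u => by
    rw [hknorm, div_le_iff₀ (pow_pos (hmax n u) 2)]
    have h1 := le_max_left ‖u‖ (1 / ((n : ℝ) + 1))
    have h2 := le_max_right ‖u‖ (1 / ((n : ℝ) + 1))
    have h3 : 1 ≤ ((n : ℝ) + 1) * max ‖u‖ (1 / ((n : ℝ) + 1)) := by
      rw [div_le_iff₀ (by positivity)] at h2
      linarith
    nlinarith [hmax n u]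
  have hdiff : ∀ n u, ‖k n u - u⁻¹‖ ≤ (ball (0 : ℂ) (1 / ((n : ℝ) + 1))).indicator
      (fun u => ‖u⁻¹‖) u := fun n u => by
    by_cases hu : ‖u‖ < 1 / ((n : ℝ) + 1)
    · rw [indicator_of_mem (by simpa using hu)]
      by_cases hu0 : u = 0
      · simp [hk, hu0]
      have e : u⁻¹ = conj u / ((‖u‖ ^ 2 : ℝ) : ℂ) := by
        rw [Complex.inv_def, Complex.normSq_eq_norm_sq]
        push_cast
        rw [div_eq_mul_inv]
      have hn : 0 < ‖u‖ := norm_pos_iff.2 hu0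
      have e2 : k n u - u⁻¹ = conj u * (((max ‖u‖ (1 / ((n : ℝ) + 1)) ^ 2)⁻¹ - (‖u‖ ^ 2)⁻¹ : ℝ) : ℂ) := by
        rw [e, hk]
        push_cast
        rw [div_eq_mul_inv, div_eq_mul_inv]
        ring
      rw [e2, norm_mul, RCLike.norm_conj, Complex.norm_real, Real.norm_eq_abs, norm_inv]
      have h1 : (max ‖u‖ (1 / ((n : ℝ) + 1)) ^ 2)⁻¹ ≤ (‖u‖ ^ 2)⁻¹ := by
        gcongr
        exact le_max_left _ _
      have h2 : 0 < (max ‖u‖ (1 / ((n : ℝ) + 1)) ^ 2)⁻¹ := inv_pos.2 (pow_pos (hmax n u) 2)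
      rw [abs_of_nonpos (by linarith)]
      calc ‖u‖ * -((max ‖u‖ (1 / ((n : ℝ) + 1)) ^ 2)⁻¹ - (‖u‖ ^ 2)⁻¹) ≤ ‖u‖ * (‖u‖ ^ 2)⁻¹ := by
            gcongr
            linarith
        _ = ‖u‖⁻¹ := by field_simp
    · rw [indicator_of_notMem (by simpa using hu)]
      have hm : max ‖u‖ (1 / ((n : ℝ) + 1)) = ‖u‖ := max_eq_left (not_lt.1 hu)
      have e : u⁻¹ = conj u / ((‖u‖ ^ 2 : ℝ) : ℂ) := by
        rw [Complex.inv_def, Complex.normSq_eq_norm_sq]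
        push_cast
        rw [div_eq_mul_inv]
      simp only [hk]
      rw [hm, ← e, sub_self, norm_zero]
  have hcont : ∀ n, Continuous fun ζ => ∫ z in Ω, k n (ζ - z) := fun n => by
    refine continuous_of_dominated (F := fun ζ z => k n (ζ - z)) (bound := fun _ => (n : ℝ) + 1)
      (fun ζ => ((hkc n).comp (by fun_prop)).aestronglyMeasurable)
      (fun ζ => Eventually.of_forall fun z => hkb n _) (integrable_const _)
      (Eventually.of_forall fun z => (hkc n).comp (by fun_prop))
  have hunif : TendstoUniformly (fun n ζ => ∫ z in Ω, k n (ζ - z)) (areaCauchy Ω) atTop := by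
    rw [Metric.tendstoUniformly_iff]
    intro ε hε
    filter_upwards [tendsto_integral_inv_ball.eventually_lt_const hε] with n hn ζ
    rw [dist_eq_norm, norm_sub_rev, areaCauchy]
    have hi1 : Integrable (fun z => k n (ζ - z)) (volume.restrict Ω) :=
      Integrable.mono' (integrable_const ((n : ℝ) + 1))
        ((hkc n).comp (by fun_prop)).aestronglyMeasurable (Eventually.of_forall fun z => hkb n _)
    have hi2 := integrableOn_inv_sub hb ζ
    have hi3 : Integrable ((ball (0 : ℂ) (1 / ((n : ℝ) + 1))).indicator (fun u => ‖u⁻¹‖)) :=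
      (integrable_indicator_iff measurableSet_ball).2 (integrableOn_inv_ball _).norm
    rw [← integral_sub hi1 hi2]
    refine lt_of_le_of_lt (norm_integral_le_integral_norm _) (lt_of_le_of_lt ?_ hn)
    calc ∫ z in Ω, ‖k n (ζ - z) - (ζ - z)⁻¹‖
        ≤ ∫ z in Ω, (ball (0 : ℂ) (1 / ((n : ℝ) + 1))).indicator (fun u => ‖u⁻¹‖) (ζ - z) :=
          integral_mono (hi1.sub hi2).norm (hi3.comp_sub_left ζ).integrableOn fun z => hdiff n _
      _ ≤ ∫ z, (ball (0 : ℂ) (1 / ((n : ℝ) + 1))).indicator (fun u => ‖u⁻¹‖) (ζ - z) :=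
          setIntegral_le_integral (hi3.comp_sub_left ζ)
            (Eventually.of_forall fun z => indicator_nonneg (fun _ _ => norm_nonneg _) _)
      _ = ∫ u in ball (0 : ℂ) (1 / ((n : ℝ) + 1)), ‖u⁻¹‖ := by
          rw [integral_sub_left_eq_self (fun u => (ball (0 : ℂ) (1 / ((n : ℝ) + 1))).indicator
            (fun u => ‖u⁻¹‖) u) volume ζ, integral_indicator measurableSet_ball]
  exact hunif.continuous (Frequently.of_forall hcont)

theorem differentiableOn_areaCauchy_sub {Ω : Set ℂ} (hb : Bornology.IsBounded Ω) (hO : IsOpen Ω) :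
    DifferentiableOn ℂ (fun ζ => conj ζ - areaCauchy Ω ζ / Real.pi) Ω := by
  intro c hc
  obtain ⟨r, hr, hrΩ⟩ := Metric.isOpen_iff.1 hO c hc
  have hloc : ∀ ζ ∈ ball c r, conj ζ - areaCauchy Ω ζ / Real.pi =
      conj c - (∫ z in Ω \ ball c r, (ζ - z)⁻¹) / Real.pi := by
    intro ζ hζ
    have h1 := eq_sub_iff_add_eq.1
      (setIntegral_sdiff (μ := volume) measurableSet_ball (integrableOn_inv_sub hb ζ) hrΩ)
    have h2 : ∫ z in ball c r, (ζ - z)⁻¹ = Real.pi * conj (ζ - c) := by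
      rw [← integral_ball_inv (r := r) (w := ζ - c) (by simpa [dist_eq_norm] using hζ),
        ← integral_indicator measurableSet_ball, ← integral_indicator measurableSet_ball,
        ← integral_add_right_eq_self _ c]
      congr 1
      ext z
      simp only [indicator, mem_ball, dist_eq_norm, add_sub_cancel_right, sub_zero]
      rw [show ζ - (z + c) = ζ - c - z by ring]
    rw [areaCauchy, ← h1, h2, add_div, mul_div_cancel_left₀ _ (by exact_mod_cast Real.pi_ne_zero), map_sub]
    ring
  have hfin : volume Ω < ⊤ := hb.measure_lt_top
  have hfin' : IsFiniteMeasure (volume.restrict (Ω \ ball c r)) :=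
    ⟨by simpa using lt_of_le_of_lt (measure_mono sdiff_subset) hfin⟩
  have hmeas : MeasurableSet (Ω \ ball c r) := hO.measurableSet.diff measurableSet_ball
  have hfar : ∀ z ∈ Ω \ ball c r, ∀ x ∈ ball c (r / 2), r / 2 ≤ ‖x - z‖ := fun z hz x hx => by
    have h1 : r ≤ dist z c := not_lt.1 hz.2
    have h2 : dist x c < r / 2 := hx
    have := dist_triangle z x c
    rw [dist_comm z x, dist_eq_norm x z] at this
    linarith
  have hder := hasDerivAt_integral_of_dominated_loc_of_deriv_le (μ := volume.restrict (Ω \ ball c r))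
    (F := fun ζ z => (ζ - z)⁻¹) (F' := fun ζ z => -1 / (ζ - z) ^ 2) (x₀ := c)
    (bound := fun _ => ((r / 2) ^ 2)⁻¹)
    (ball_mem_nhds c (half_pos hr))
    (Eventually.of_forall fun ζ => (by fun_prop : Measurable fun z : ℂ => (ζ - z)⁻¹).aestronglyMeasurable)
    ((integrableOn_inv_sub hb c).mono_set sdiff_subset)
    ((by fun_prop : Measurable fun z : ℂ => -1 / (c - z) ^ 2).aestronglyMeasurable)
    (by
      refine (ae_restrict_iff' hmeas).2 (Eventually.of_forall fun z hz x hx => ?_)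
      have := hfar z hz x hx
      rw [norm_div, norm_neg, norm_one, norm_pow, one_div]
      gcongr)
    (integrable_const _)
    (by
      refine (ae_restrict_iff' hmeas).2 (Eventually.of_forall fun z hz x hx => ?_)
      have := hfar z hz x hx
      exact ((hasDerivAt_id x).sub_const z).inv (norm_pos_iff.1 (by simpa using lt_of_lt_of_le (half_pos hr) this)))
  have hd : DifferentiableAt ℂ (fun ζ => conj c - (∫ z in Ω \ ball c r, (ζ - z)⁻¹) / Real.pi) c :=
    ((hder.2.differentiableAt).div_const _).const_sub _
  refine (hd.congr_of_eventuallyEq ?_).differentiableWithinAt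
  filter_upwards [ball_mem_nhds c hr] with ζ hζ using hloc ζ hζ

theorem iteratedDeriv_inv_sub (k : ℕ) (ζ w : ℂ) :
    iteratedDeriv k (fun z => (ζ - z)⁻¹) w = k.factorial / (ζ - w) ^ (k + 1) := by
  have h := congrFun (iter_deriv_inv_linear k (-1 : ℂ) ζ) w
  have e : (fun z : ℂ => (ζ - z)⁻¹) = fun x => (-1 * x + ζ)⁻¹ := by
    ext z
    ring_nf
  rw [iteratedDeriv_eq_iterate, e, h, show (-1 : ℂ) * w + ζ = ζ - w by ring,
    show (-1 - k : ℤ) = -((k + 1 : ℕ) : ℤ) by push_cast; ring, zpow_neg, zpow_natCast, div_eq_mul_inv]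
  congr 1
  rw [mul_right_comm, ← mul_pow]
  simp

/-- `f` agrees on `U` with a rational function without poles outside `Ω`. -/
def RatOn (Ω U : Set ℂ) (f : ℂ → ℂ) : Prop :=
  ∃ D N : Polynomial ℂ, D ≠ 0 ∧ (∀ z, D.eval z = 0 → z ∈ Ω) ∧ ∀ ζ ∈ U, f ζ * D.eval ζ = N.eval ζ

theorem RatOn.sum {Ω U : Set ℂ} {ι : Type*} (s : Finset ι) {f : ι → ℂ → ℂ}
    (hf : ∀ i ∈ s, RatOn Ω U (f i)) : RatOn Ω U (fun ζ => ∑ i ∈ s, f i ζ) := by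
  classical
  induction s using Finset.induction_on with
  | empty => exact ⟨1, 0, one_ne_zero, by simp, by simp⟩
  | insert i s his ih =>
    obtain ⟨D, N, h1, h2, h3⟩ := hf i (Finset.mem_insert_self i s)
    obtain ⟨D', N', h1', h2', h3'⟩ := ih fun j hj => hf j (Finset.mem_insert_of_mem hj)
    refine ⟨D * D', N * D' + N' * D, mul_ne_zero h1 h1', fun z hz => ?_, fun ζ hζ => ?_⟩
    · rw [Polynomial.eval_mul, mul_eq_zero] at hz
      exact hz.elim (h2 z) (h2' z)
    · simp only [Finset.sum_insert his, Polynomial.eval_mul, Polynomial.eval_add]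
      rw [← h3 ζ hζ, ← h3' ζ hζ]
      ring

theorem exists_schwarz {Ω : Set ℂ} {n : ℕ} {γ : Fin n → ℝ → ℂ} (h : Bdry Ω γ)
    (hq : IsQuadratureDomain Ω) :
    ∃ (D : Polynomial ℂ) (σ : ℂ → ℂ), D ≠ 0 ∧ (∀ z, D.eval z = 0 → z ∈ Ω) ∧
      DifferentiableOn ℂ σ Ω ∧ Continuous σ ∧ ∀ z ∈ frontier Ω, σ z = conj z * D.eval z := by
  obtain ⟨N, -, w, m, c, hw, hq⟩ := hq
  have hfin : volume Ω < ⊤ := h.bdd.measure_lt_top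
  have hrat : RatOn Ω (closure Ω)ᶜ (areaCauchy Ω) := by
    have h1 : RatOn Ω (closure Ω)ᶜ fun ζ => ∑ j, ∑ k ∈ Finset.range (m j + 1),
        c j k * (k.factorial / (ζ - w j) ^ (k + 1)) := by
      refine RatOn.sum _ fun j _ => RatOn.sum _ fun k _ => ?_
      refine ⟨(Polynomial.X - Polynomial.C (w j)) ^ (k + 1), Polynomial.C (c j k * k.factorial),
        pow_ne_zero _ (Polynomial.X_sub_C_ne_zero _), fun z hz => ?_, fun ζ hζ => ?_⟩
      · have : z - w j = 0 := by simpa using hz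
        rw [sub_eq_zero.1 this]
        exact hw j
      · have : ζ - w j ≠ 0 := fun h0 => hζ (subset_closure (by rw [sub_eq_zero.1 h0]; exact hw j))
        simp only [Polynomial.eval_pow, Polynomial.eval_sub, Polynomial.eval_X, Polynomial.eval_C]
        field_simp
    obtain ⟨D, M, h2, h3, h4⟩ := h1
    refine ⟨D, M, h2, h3, fun ζ hζ => ?_⟩
    rw [← h4 ζ hζ]
    congr 1
    obtain ⟨ε, hε, hεb⟩ := Metric.isOpen_iff.1 isClosed_closure.isOpen_compl ζ hζ
    have hfar : ∀ z ∈ Ω, ε ≤ ‖ζ - z‖ := fun z hz => by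
      by_contra hlt
      exact hεb (mem_ball'.2 (by simpa [dist_eq_norm] using not_le.1 hlt)) (subset_closure hz)
    have hne : ∀ z ∈ Ω, ζ - z ≠ 0 := fun z hz => norm_pos_iff.1 (hε.trans_le (hfar z hz))
    have hB : BergmanFun Ω fun z => (ζ - z)⁻¹ := by
      refine ⟨DifferentiableOn.inv (by fun_prop) hne, ?_⟩
      have : IsFiniteMeasure (volume.restrict Ω) := ⟨by simpa using hfin⟩
      refine Integrable.mono' (integrable_const ((ε⁻¹) ^ 2))
        (by fun_prop : Measurable fun z : ℂ => ‖(ζ - z)⁻¹‖ ^ 2).aestronglyMeasurable ?_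
      refine (ae_restrict_iff' h.isOpen.measurableSet).2 (Eventually.of_forall fun z hz => ?_)
      rw [Real.norm_of_nonneg (by positivity), norm_inv]
      have := hfar z hz
      gcongr
    rw [areaCauchy, hq _ hB]
    refine Finset.sum_congr rfl fun j _ => Finset.sum_congr rfl fun k _ => ?_
    rw [iteratedDerivWithin_of_isOpen h.isOpen (hw j), iteratedDeriv_inv_sub]
  obtain ⟨D, M, hD, hDr, hDM⟩ := hrat
  have hC := continuous_areaCauchy h.bdd
  refine ⟨D, fun ζ => D.eval ζ * (conj ζ - areaCauchy Ω ζ / Real.pi) + M.eval ζ / Real.pi, hD, hDr,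
    ?_, ?_, fun z hz => ?_⟩
  · exact (D.differentiable.differentiableOn.mul (differentiableOn_areaCauchy_sub h.bdd h.isOpen)).add
      (M.differentiable.differentiableOn.div_const _)
  · exact (D.continuous.mul (continuous_conj.sub (hC.div_const _))).add (M.continuous.div_const _)
  · beta_reduce
    have hz' : areaCauchy Ω z * D.eval z = M.eval z := by
      obtain ⟨i, t, rfl⟩ := h.eq_of_frontier hz
      have hcl : closure (closure Ω)ᶜ ⊆ {z | areaCauchy Ω z * D.eval z = M.eval z} :=
        closure_minimal hDM (isClosed_eq (hC.mul D.continuous) M.continuous)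
      refine hcl (mem_closure_iff_nhdsWithin_neBot.2 ?_)
      exact (h.tendsto_out i t).neBot
    rw [← hz']
    have : (Real.pi : ℂ) ≠ 0 := by exact_mod_cast Real.pi_ne_zero
    field_simp
    ring

/-- Integral over all boundary parameters. -/
def bint {n : ℕ} (F : Fin n → ℝ → ℂ) : ℂ := ∑ i, ∫ t in (0 : ℝ)..(2 * Real.pi), F i t

section bint

variable {n : ℕ} {F G : Fin n → ℝ → ℂ}

theorem bint_add (hF : ∀ i, Continuous (F i)) (hG : ∀ i, Continuous (G i)) :
    bint (fun i t => F i t + G i t) = bint F + bint G := by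
  simp only [bint]
  rw [← Finset.sum_add_distrib]
  exact Finset.sum_congr rfl fun i _ => intervalIntegral.integral_add
    ((hF i).intervalIntegrable _ _) ((hG i).intervalIntegrable _ _)

theorem bint_sub (hF : ∀ i, Continuous (F i)) (hG : ∀ i, Continuous (G i)) :
    bint (fun i t => F i t - G i t) = bint F - bint G := by
  simp only [bint]
  rw [← Finset.sum_sub_distrib]
  exact Finset.sum_congr rfl fun i _ => intervalIntegral.integral_sub
    ((hF i).intervalIntegrable _ _) ((hG i).intervalIntegrable _ _)

theorem bint_const_mul (c : ℂ) (F : Fin n → ℝ → ℂ) :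
    bint (fun i t => c * F i t) = c * bint F := by
  simp only [bint, intervalIntegral.integral_const_mul, Finset.mul_sum]

theorem bint_congr (h : ∀ i t, F i t = G i t) : bint F = bint G := by
  congr 1
  ext i t
  exact h i t

theorem conj_bint (F : Fin n → ℝ → ℂ) : conj (bint F) = bint fun i t => conj (F i t) := by
  simp only [bint, map_sum]
  exact Finset.sum_congr rfl fun i _ => intervalIntegral.intervalIntegral_conj.symm

theorem bint_ofReal (F : Fin n → ℝ → ℝ) : bint (fun i t => (F i t : ℂ)) =
    ((∑ i, ∫ t in (0 : ℝ)..(2 * Real.pi), F i t : ℝ) : ℂ) := by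
  simp only [bint, intervalIntegral.integral_ofReal, ofReal_sum]

end bint

/-- `f` is holomorphic on `Ω` and continuous up to the boundary. -/
def AO (Ω : Set ℂ) (f : ℂ → ℂ) : Prop := DifferentiableOn ℂ f Ω ∧ ContinuousOn f (closure Ω)

namespace AO

variable {Ω : Set ℂ} {f g : ℂ → ℂ}

theorem mul (hf : AO Ω f) (hg : AO Ω g) : AO Ω fun z => f z * g z :=
  ⟨hf.1.mul hg.1, hf.2.mul hg.2⟩

theorem add (hf : AO Ω f) (hg : AO Ω g) : AO Ω fun z => f z + g z :=
  ⟨hf.1.add hg.1, hf.2.add hg.2⟩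

theorem sub (hf : AO Ω f) (hg : AO Ω g) : AO Ω fun z => f z - g z :=
  ⟨hf.1.sub hg.1, hf.2.sub hg.2⟩

theorem const (Ω : Set ℂ) (c : ℂ) : AO Ω fun _ => c :=
  ⟨differentiableOn_const _, continuousOn_const⟩

theorem of_differentiable (hf : Differentiable ℂ f) : AO Ω f :=
  ⟨hf.differentiableOn, hf.continuous.continuousOn⟩

theorem inv_sub {z : ℂ} (hz : z ∉ closure Ω) : AO Ω fun ζ => (ζ - z)⁻¹ :=
  ⟨(differentiableOn_inv_sub z).mono fun ζ hζ h0 => hz (subset_closure (by rw [← h0]; exact hζ)),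
    (differentiableOn_inv_sub z).continuousOn.mono fun ζ hζ h0 => hz (by rw [← h0]; exact hζ)⟩

theorem dslope (hf : AO Ω f) (hO : IsOpen Ω) {w : ℂ} (hw : w ∈ Ω) : AO Ω (dslope f w) :=
  ⟨(differentiableOn_dslope (hO.mem_nhds hw)).2 hf.1,
    (continuousOn_dslope (mem_of_superset (hO.mem_nhds hw) subset_closure)).2
      ⟨hf.2, hf.1.differentiableAt (hO.mem_nhds hw)⟩⟩

end AO

namespace Bdry

variable {Ω : Set ℂ} {n : ℕ} {γ : Fin n → ℝ → ℂ}

theorem mem_closure (h : Bdry Ω γ) (i : Fin n) (t : ℝ) : γ i t ∈ closure Ω :=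
  frontier_subset_closure (h.mem_frontier i t)

theorem cont_comp (h : Bdry Ω γ) {f : ℂ → ℂ} (hf : ContinuousOn f (closure Ω)) (i : Fin n) :
    Continuous fun t => f (γ i t) :=
  hf.comp_continuous (h.loop i).cont fun t => h.mem_closure i t

theorem sub_ne (h : Bdry Ω γ) {w : ℂ} (hw : w ∈ Ω) (i : Fin n) (t : ℝ) : γ i t - w ≠ 0 :=
  sub_ne_zero.2 (h.off_of_mem hw i t)

theorem cont_inv (h : Bdry Ω γ) {w : ℂ} (hw : w ∈ Ω) (i : Fin n) :
    Continuous fun t => (γ i t - w)⁻¹ :=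
  ((h.loop i).cont.sub continuous_const).inv₀ (h.sub_ne hw i)

theorem bint_cauchy (h : Bdry Ω γ) {f : ℂ → ℂ} (hf : AO Ω f) :
    bint (fun i t => f (γ i t) * deriv (γ i) t) = 0 := h.cauchy_boundary hf.1 hf.2

theorem bint_cauchy_formula (h : Bdry Ω γ) {f : ℂ → ℂ} (hf : AO Ω f) {w : ℂ} (hw : w ∈ Ω) :
    bint (fun i t => f (γ i t) * (γ i t - w)⁻¹ * deriv (γ i) t) = 2 * Real.pi * I * f w := by
  have h1 := h.bint_cauchy (hf.dslope h.isOpen hw)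
  have h2 : bint (fun i t => (γ i t - w)⁻¹ * deriv (γ i) t) = 2 * Real.pi * I := by
    rw [← h.winding.2 w hw]
    refine Finset.sum_congr rfl fun i _ => ?_
    rw [CI]
    congr 1
    ext t
    rw [div_eq_mul_inv, mul_comm]
  have e : bint (fun i t => f (γ i t) * (γ i t - w)⁻¹ * deriv (γ i) t) =
      bint (fun i t => _root_.dslope f w (γ i t) * deriv (γ i) t +
        f w * ((γ i t - w)⁻¹ * deriv (γ i) t)) := by
    refine bint_congr fun i t => ?_
    have hne := h.sub_ne hw i t
    rw [dslope_of_ne _ (sub_ne_zero.1 hne), slope_def_field]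
    field_simp
    ring
  rw [e, bint_add, bint_const_mul, h1, h2]
  · ring
  · exact fun i => (h.cont_comp (hf.dslope h.isOpen hw).2 i).mul (h.loop i).cont_deriv
  · exact fun i => continuous_const.mul ((h.cont_inv hw i).mul (h.loop i).cont_deriv)

/-- Extension of a holomorphic function by its boundary values. -/
theorem extend (h : Bdry Ω γ) {f : ℂ → ℂ} (hf : DifferentiableOn ℂ f Ω) {v : Fin n → ℝ → ℂ}
    (hv : ∀ i t, Tendsto f (𝓝[Ω] (γ i t)) (𝓝 (v i t))) :
    AO Ω (extendFrom Ω f) ∧ (∀ z ∈ Ω, extendFrom Ω f z = f z) ∧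
      ∀ i t, extendFrom Ω f (γ i t) = v i t := by
  have h1 : ∀ z ∈ Ω, extendFrom Ω f z = f z := extendFrom_extends hf.continuousOn
  refine ⟨⟨hf.congr h1, continuousOn_extendFrom subset_rfl fun x hx => ?_⟩, h1, fun i t =>
    extendFrom_eq (h.mem_closure i t) (hv i t)⟩
  by_cases hxΩ : x ∈ Ω
  · exact ⟨f x, hf.continuousOn x hxΩ⟩
  · obtain ⟨i, t, rfl⟩ := h.eq_of_frontier (mem_frontier_of_closure hx hxΩ)
    exact ⟨v i t, hv i t⟩

end Bdry

/-- A smoothly bounded domain with its Szegő kernel. -/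
structure Szego (Ω : Set ℂ) {n : ℕ} (γ : Fin n → ℝ → ℂ) (S : ℂ → ℂ → ℂ) : Prop
    extends Bdry Ω γ where
  ao : ∀ w ∈ Ω, AO Ω fun z => S z w
  repr : ∀ f, AO Ω f → ∀ w ∈ Ω,
    f w = bint fun i t => f (γ i t) * conj (S (γ i t) w) * ‖deriv (γ i) t‖

/-- Cauchy transform of the conjugate Szegő kernel. -/
def szC {n : ℕ} (γ : Fin n → ℝ → ℂ) (S : ℂ → ℂ → ℂ) (w z : ℂ) : ℂ :=
  ∑ i, CI (γ i) (fun t => conj (S (γ i t) w) * ‖deriv (γ i) t‖) z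

/-- Regular part of the Garabedian kernel. -/
def garK (Ω : Set ℂ) {n : ℕ} (γ : Fin n → ℝ → ℂ) (S : ℂ → ℂ → ℂ) (w : ℂ) : ℂ → ℂ :=
  extendFrom Ω (szC γ S w)

/-- The Garabedian kernel. -/
def gar (Ω : Set ℂ) {n : ℕ} (γ : Fin n → ℝ → ℂ) (S : ℂ → ℂ → ℂ) (w z : ℂ) : ℂ :=
  garK Ω γ S w z + (z - w)⁻¹

theorem norm_sq_eq (z : ℂ) : (‖z‖ : ℂ) ^ 2 = z * conj z := by
  rw [Complex.mul_conj, Complex.normSq_eq_norm_sq]; push_cast; rfl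

namespace Szego

variable {Ω : Set ℂ} {n : ℕ} {γ : Fin n → ℝ → ℂ} {S : ℂ → ℂ → ℂ}

theorem contS (h : Szego Ω γ S) {w : ℂ} (hw : w ∈ Ω) (i : Fin n) :
    Continuous fun t => S (γ i t) w := h.cont_comp (h.ao w hw).2 i

theorem cont_norm (h : Szego Ω γ S) (i : Fin n) : Continuous fun t => (‖deriv (γ i) t‖ : ℂ) :=
  continuous_ofReal.comp (h.loop i).cont_deriv.norm

theorem cont_weight (h : Szego Ω γ S) {w : ℂ} (hw : w ∈ Ω) (i : Fin n) :
    Continuous fun t => conj (S (γ i t) w) * (‖deriv (γ i) t‖ : ℂ) :=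
  (continuous_conj.comp (h.contS hw i)).mul (h.cont_norm i)

theorem herm (h : Szego Ω γ S) {z w : ℂ} (hz : z ∈ Ω) (hw : w ∈ Ω) : S z w = conj (S w z) := by
  rw [h.repr _ (h.ao w hw) z hz, h.repr _ (h.ao z hz) w hw, conj_bint]
  refine bint_congr fun i t => ?_
  simp only [map_mul, conj_conj, conj_ofReal]
  ring

theorem diag_eq (h : Szego Ω γ S) {b : ℂ} (hb : b ∈ Ω) :
    S b b = ((∑ i, ∫ t in (0 : ℝ)..(2 * Real.pi), ‖S (γ i t) b‖ ^ 2 * ‖deriv (γ i) t‖ : ℝ) : ℂ) := by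
  rw [← bint_ofReal, h.repr _ (h.ao b hb) b hb]
  refine bint_congr fun i t => ?_
  push_cast
  rw [norm_sq_eq]

theorem diag_pos (h : Szego Ω γ S) {b : ℂ} (hb : b ∈ Ω) :
    0 < ∑ i, ∫ t in (0 : ℝ)..(2 * Real.pi), ‖S (γ i t) b‖ ^ 2 * ‖deriv (γ i) t‖ := by
  set σ := ∑ i, ∫ t in (0 : ℝ)..(2 * Real.pi), ‖S (γ i t) b‖ ^ 2 * ‖deriv (γ i) t‖ with hσ
  set ℓ := ∑ i, ∫ t in (0 : ℝ)..(2 * Real.pi), ‖deriv (γ i) t‖ with hℓ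
  have h1 := h.repr _ (AO.const Ω 1) b hb
  have h2 : ∀ c : ℝ, 0 ≤ σ - 2 * c + c ^ 2 * ℓ := by
    intro c
    have e : ((∑ i, ∫ t in (0 : ℝ)..(2 * Real.pi), ‖S (γ i t) b - c‖ ^ 2 * ‖deriv (γ i) t‖ : ℝ) : ℂ) =
        ((σ - 2 * c + c ^ 2 * ℓ : ℝ) : ℂ) := by
      have e1 : bint (fun i t => S (γ i t) b * (‖deriv (γ i) t‖ : ℂ)) = 1 := by
        have := congrArg conj h1
        rw [map_one, conj_bint] at this
        rw [this]
        refine bint_congr fun i t => ?_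
        simp
      have e2 : bint (fun i t => conj (S (γ i t) b) * (‖deriv (γ i) t‖ : ℂ)) = 1 := by
        conv_rhs => rw [h1]
        refine bint_congr fun i t => ?_
        simp
      have e3 : ((∑ i, ∫ t in (0 : ℝ)..(2 * Real.pi), ‖S (γ i t) b - c‖ ^ 2 * ‖deriv (γ i) t‖ : ℝ) : ℂ)
          = bint fun i t => S (γ i t) b * (conj (S (γ i t) b) * (‖deriv (γ i) t‖ : ℂ)) +
            ((-c) * (S (γ i t) b * (‖deriv (γ i) t‖ : ℂ)) +
            ((-c) * (conj (S (γ i t) b) * (‖deriv (γ i) t‖ : ℂ)) + c ^ 2 * (‖deriv (γ i) t‖ : ℂ))) := by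
        rw [← bint_ofReal]
        refine bint_congr fun i t => ?_
        push_cast
        rw [norm_sq_eq, map_sub, conj_ofReal]
        ring
      have cw := h.cont_weight hb
      have cS := h.contS hb
      have cn := h.cont_norm
      have e4 : bint (fun i t => S (γ i t) b * (conj (S (γ i t) b) * (‖deriv (γ i) t‖ : ℂ))) = σ := by
        rw [← h.diag_eq hb, h.repr _ (h.ao b hb) b hb]
        exact bint_congr fun i t => by ring
      have e5 : bint (fun i t => (‖deriv (γ i) t‖ : ℂ)) = ℓ := bint_ofReal _
      have q1 := fun i => (continuous_const (y := -(c : ℂ))).mul ((cS i).mul (cn i))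
      have q2 := fun i => (continuous_const (y := -(c : ℂ))).mul (cw i)
      have q3 := fun i => (continuous_const (y := (c : ℂ) ^ 2)).mul (cn i)
      rw [e3, bint_add, bint_add, bint_add, bint_const_mul, bint_const_mul,
        bint_const_mul, e1, e2, e4, e5]
      · push_cast
        ring
      exacts [q2, q3, q1, fun i => (q2 i).add (q3 i), fun i => (cS i).mul (cw i),
        fun i => (q1 i).add ((q2 i).add (q3 i))]
    rw [← Complex.ofReal_inj.1 e]
    refine Finset.sum_nonneg fun i _ => intervalIntegral.integral_nonneg Real.two_pi_pos.le
      fun t _ => by positivity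
  have hℓ0 : 0 ≤ ℓ := Finset.sum_nonneg fun i _ => intervalIntegral.integral_nonneg
    Real.two_pi_pos.le fun t _ => norm_nonneg _
  have h3 := h2 (1 / (ℓ + 1))
  have h4 : (0 : ℝ) < 1 / (ℓ + 1) := by positivity
  have h5 : (1 / (ℓ + 1)) ^ 2 * ℓ ≤ 1 / (ℓ + 1) := by
    rw [div_pow, one_pow, div_mul_eq_mul_div, one_mul, div_le_div_iff₀ (by positivity) (by positivity)]
    nlinarith
  linarith

theorem szC_out (h : Szego Ω γ S) {w : ℂ} (hw : w ∈ Ω) {z : ℂ} (hz : z ∉ closure Ω) :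
    szC γ S w z = (w - z)⁻¹ := by
  rw [h.repr _ (AO.inv_sub hz) w hw]
  refine Finset.sum_congr rfl fun i _ => ?_
  rw [CI]
  congr 1
  ext t
  rw [div_eq_mul_inv]
  ring

theorem per_weight (h : Szego Ω γ S) (w : ℂ) (i : Fin n) :
    Function.Periodic (fun t => conj (S (γ i t) w) * (‖deriv (γ i) t‖ : ℂ)) (2 * Real.pi) := by
  intro t
  simp only
  rw [(h.loop i).per, (h.loop i).per_deriv]

theorem differentiableOn_szC (h : Szego Ω γ S) {w : ℂ} (hw : w ∈ Ω) :
    DifferentiableOn ℂ (szC γ S w) Ω := fun _ hz =>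
  (DifferentiableAt.fun_sum fun i _ => (CI_hasDerivAt (h.loop i).cont (h.loop i).per
    (h.cont_weight hw i) (h.off_of_mem hz i)).differentiableAt).differentiableWithinAt

theorem tendsto_szC (h : Szego Ω γ S) {w : ℂ} (hw : w ∈ Ω) (i : Fin n) (t : ℝ) :
    Tendsto (szC γ S w) (𝓝[Ω] (γ i t)) (𝓝 ((w - γ i t)⁻¹ +
      2 * Real.pi * I * (conj (S (γ i t) w) * ‖deriv (γ i) t‖ / deriv (γ i) t))) := by
  refine h.tendsto_nhds_in i t ?_
  have h1 := h.sum_plemelj (h.cont_weight hw) (h.per_weight w) i t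
  have h2 : Tendsto (fun p : ℝ × ℝ => (w - nrm (γ i) p.1 (-p.2))⁻¹) (sideFilter t)
      (𝓝 (w - γ i t)⁻¹) :=
    (tendsto_const_nhds.sub ((h.loop i).tendsto_nrm_neg t)).inv₀
      (sub_ne_zero.2 (h.off_of_mem hw i t).symm)
  refine (h2.add h1).congr' ?_
  filter_upwards [h.eventually_side i t] with p hp
  rw [← h.szC_out hw hp.2]
  simp only [szC]
  ring

theorem garK_spec (h : Szego Ω γ S) {w : ℂ} (hw : w ∈ Ω) :
    AO Ω (garK Ω γ S w) ∧ (∀ z ∈ Ω, garK Ω γ S w z = szC γ S w z) ∧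
      ∀ i t, garK Ω γ S w (γ i t) = (w - γ i t)⁻¹ +
        2 * Real.pi * I * (conj (S (γ i t) w) * ‖deriv (γ i) t‖ / deriv (γ i) t) :=
  h.extend (h.differentiableOn_szC hw) (h.tendsto_szC hw)

/-- Boundary values of the Garabedian kernel. -/
theorem gar_bdry (h : Szego Ω γ S) {w : ℂ} (hw : w ∈ Ω) (i : Fin n) (t : ℝ) :
    gar Ω γ S w (γ i t) * deriv (γ i) t =
      2 * Real.pi * I * (conj (S (γ i t) w) * ‖deriv (γ i) t‖) := by
  have h1 := (h.loop i).ne t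
  have h2 := h.sub_ne hw i t
  have h3 : w - γ i t ≠ 0 := by rw [← neg_sub]; exact neg_ne_zero.2 h2
  rw [gar, (h.garK_spec hw).2.2, ← neg_sub (γ i t) w, inv_neg]
  field_simp
  ring

theorem cont_gar (h : Szego Ω γ S) {w : ℂ} (hw : w ∈ Ω) (i : Fin n) :
    Continuous fun t => gar Ω γ S w (γ i t) :=
  (h.cont_comp (h.garK_spec hw).1.2 i).add (h.cont_inv hw i)

theorem res_one (h : Szego Ω γ S) {f : ℂ → ℂ} (hf : AO Ω f) {w : ℂ} (hw : w ∈ Ω) :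
    bint (fun i t => f (γ i t) * gar Ω γ S w (γ i t) * deriv (γ i) t) = 2 * Real.pi * I * f w := by
  rw [h.repr f hf w hw, ← bint_const_mul]
  refine bint_congr fun i t => ?_
  rw [mul_assoc, h.gar_bdry hw]
  ring

theorem res_two (h : Szego Ω γ S) {f : ℂ → ℂ} (hf : AO Ω f) {w z : ℂ} (hw : w ∈ Ω) (hz : z ∈ Ω)
    (hwz : w ≠ z) :
    bint (fun i t => f (γ i t) * gar Ω γ S w (γ i t) * gar Ω γ S z (γ i t) * deriv (γ i) t) =
      2 * Real.pi * I * (f z * gar Ω γ S w z + f w * gar Ω γ S z w) := by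
  have hKw := (h.garK_spec hw).1
  have hKz := (h.garK_spec hz).1
  have h1 := h.res_one (hf.mul hKw) hz
  have h2 := h.bint_cauchy_formula (hf.mul hKz) hw
  have h3 := h.bint_cauchy_formula hf hw
  have h4 := h.bint_cauchy_formula hf hz
  have hwz' : w - z ≠ 0 := sub_ne_zero.2 hwz
  have e : bint (fun i t => f (γ i t) * gar Ω γ S w (γ i t) * gar Ω γ S z (γ i t) * deriv (γ i) t) =
      bint (fun i t => f (γ i t) * garK Ω γ S w (γ i t) * gar Ω γ S z (γ i t) * deriv (γ i) t +
        (f (γ i t) * garK Ω γ S z (γ i t) * (γ i t - w)⁻¹ * deriv (γ i) t +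
        (w - z)⁻¹ * (f (γ i t) * (γ i t - w)⁻¹ * deriv (γ i) t -
          f (γ i t) * (γ i t - z)⁻¹ * deriv (γ i) t))) := by
    refine bint_congr fun i t => ?_
    have e1 := h.sub_ne hw i t
    have e2 := h.sub_ne hz i t
    simp only [gar]
    field_simp
    ring
  have c1 := fun i => h.cont_comp hf.2 i
  have c2 := fun i => h.cont_comp hKw.2 i
  have c3 := fun i => h.cont_comp hKz.2 i
  have c4 := h.cont_inv hw
  have c5 := h.cont_inv hz
  have c6 := fun i => (h.loop i).cont_deriv
  have c7 := h.cont_gar hz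
  have q1 := fun i => (((c1 i).mul (c2 i)).mul (c7 i)).mul (c6 i)
  have q2 := fun i => (((c1 i).mul (c3 i)).mul (c4 i)).mul (c6 i)
  have q3 := fun i => ((c1 i).mul (c4 i)).mul (c6 i)
  have q4 := fun i => ((c1 i).mul (c5 i)).mul (c6 i)
  have q5 := fun i => (continuous_const (y := (w - z)⁻¹)).mul ((q3 i).sub (q4 i))
  rw [e, bint_add, bint_add, bint_const_mul, bint_sub, h1, h2, h3, h4]
  · simp only [gar]
    have hwz2 : z - w ≠ 0 := sub_ne_zero.2 hwz.symm
    rw [← neg_sub w z, inv_neg]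
    ring
  exacts [q3, q4, q2, q5, q1, fun i => (q2 i).add (q5 i)]

theorem antisymm (h : Szego Ω γ S) {w z : ℂ} (hw : w ∈ Ω) (hz : z ∈ Ω) (hwz : w ≠ z) :
    gar Ω γ S z w = -gar Ω γ S w z := by
  have h1 := h.res_two (AO.const Ω 1) hw hz hwz
  have h2 := h.bint_cauchy ((h.ao w hw).mul (h.ao z hz))
  have h3 := congrArg conj h2
  rw [conj_bint, map_zero] at h3
  have e : bint (fun i t => (1 : ℂ) * gar Ω γ S w (γ i t) * gar Ω γ S z (γ i t) * deriv (γ i) t) =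
      (2 * Real.pi * I) ^ 2 * bint (fun i t => conj (S (γ i t) w * S (γ i t) z * deriv (γ i) t)) := by
    rw [← bint_const_mul]
    refine bint_congr fun i t => ?_
    refine mul_right_cancel₀ ((h.loop i).ne t) ?_
    have : (1 : ℂ) * gar Ω γ S w (γ i t) * gar Ω γ S z (γ i t) * deriv (γ i) t * deriv (γ i) t =
      (gar Ω γ S w (γ i t) * deriv (γ i) t) * (gar Ω γ S z (γ i t) * deriv (γ i) t) := by ring
    rw [this, h.gar_bdry hw, h.gar_bdry hz, map_mul, map_mul]
    have := norm_sq_eq (deriv (γ i) t)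
    linear_combination (2 * Real.pi * I) ^ 2 * (conj (S (γ i t) w) * conj (S (γ i t) z)) * this
  rw [e, h3, mul_zero] at h1
  have h4 := (mul_eq_zero.1 h1.symm).resolve_left (by
    simp [Real.pi_ne_zero])
  linear_combination h4

end Szego

theorem exists_szego {Ω : Set ℂ} {n : ℕ} {γ : Fin n → ℝ → ℂ} (h : Bdry Ω γ) {S : ℂ → ℂ → ℂ}
    (hS1 : ∀ w ∈ Ω, DifferentiableOn ℂ (fun z => S z w) Ω ∧
      ContinuousOn (fun z => S z w) (closure Ω))
    (hS2 : ∀ f : ℂ → ℂ, DifferentiableOn ℂ f Ω → ContinuousOn f (closure Ω) →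
      ∀ w ∈ Ω, f w = ∫ z in frontier Ω, f z * conj (S z w) ∂(μH[1])) : Szego Ω γ S where
  toBdry := h
  ao := hS1
  repr f hf w hw := by
    rw [hS2 f hf.1 hf.2 w hw, h.integral_frontier]
    · rfl
    · exact (hf.2.mul (continuous_conj.comp_continuousOn (hS1 w hw).2)).mono frontier_subset_closure

theorem exists_continuous_sqrt {q : ℝ × ℝ → ℂ} (hq : Continuous q) (h0 : ∀ p, q p ≠ 0) :
    ∃ v : ℝ × ℝ → ℂ, Continuous v ∧ ∀ p, v p ^ 2 = q p := by
  obtain ⟨F, ⟨-, hF⟩, -⟩ := Complex.isCoveringMap_exp.existsUnique_continuousMap_lifts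
    (⟨fun p => ⟨q p, h0 p⟩, hq.subtype_mk h0⟩ : C(ℝ × ℝ, {z : ℂ // z ≠ 0})) (0, 0)
    (Complex.log (q (0, 0))) (by
      ext
      simp [Complex.exp_log (h0 _)])
  refine ⟨fun p => Complex.exp (F p / 2), by fun_prop, fun p => ?_⟩
  have h1 := congrArg Subtype.val (congrFun hF p)
  simp only [Function.comp, ContinuousMap.coe_mk] at h1
  rw [← h1, sq, ← Complex.exp_add, add_halves]

namespace SmoothLoop

variable {γ : ℝ → ℂ}

/-- Mean of the derivative over a parameter interval. -/
def meanDeriv (γ : ℝ → ℂ) (p : ℝ × ℝ) : ℂ := ∫ θ in (0 : ℝ)..1, deriv γ (p.1 + θ * p.2)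

theorem continuous_meanDeriv (h : SmoothLoop γ) : Continuous (meanDeriv γ) := by
  refine intervalIntegral.continuous_parametric_intervalIntegral_of_continuous' ?_ 0 1
  have := h.cont_deriv
  simp only [Function.uncurry_def]
  fun_prop

theorem mul_meanDeriv (h : SmoothLoop γ) (x k : ℝ) : k * meanDeriv γ (x, k) = γ (x + k) - γ x := by
  have h1 : ∀ θ ∈ uIcc (0 : ℝ) 1,
      HasDerivAt (fun θ : ℝ => γ (x + θ * k)) (k * deriv γ (x + θ * k)) θ := by
    intro θ _
    have h2 : HasDerivAt (fun θ : ℝ => x + θ * k) k θ := by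
      simpa using ((hasDerivAt_id θ).mul_const k).const_add x
    exact ((h.hasDerivAt (x + θ * k)).scomp θ h2).congr_deriv (by simp)
  have h3 := intervalIntegral.integral_eq_sub_of_hasDerivAt h1
    (Continuous.intervalIntegrable (by have := h.cont_deriv; fun_prop) _ _)
  rw [intervalIntegral.integral_const_mul] at h3
  simpa [meanDeriv] using h3

theorem meanDeriv_rev (γ : ℝ → ℂ) (x k : ℝ) : meanDeriv γ (x + k, -k) = meanDeriv γ (x, k) := by
  have := intervalIntegral.integral_comp_sub_left (a := 0) (b := 1)
    (fun θ : ℝ => deriv γ (x + θ * k)) 1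
  simp only [sub_self, sub_zero] at this
  rw [meanDeriv, meanDeriv, ← this]
  congr 1
  ext θ
  congr 1
  ring

/-- The tangent of a smooth loop has no continuous periodic square root. -/
theorem not_sq_deriv (h : SmoothLoop γ) {w : ℝ → ℂ} (hw : Continuous w)
    (hper : w (2 * Real.pi) = w 0) : ¬ ∀ t, w t ^ 2 = deriv γ t := by
  intro hsq
  set L := 2 * Real.pi with hL
  have hL0 : 0 < L := Real.two_pi_pos
  set q : ℝ × ℝ → ℂ := fun p => meanDeriv γ p - meanDeriv γ (p.1, p.2 - L) with hq
  have hqc : Continuous q := by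
    have := h.continuous_meanDeriv
    exact this.sub (this.comp (by fun_prop))
  have hq0 : ∀ x, q (x, 0) = deriv γ x := by
    intro x
    have h1 : meanDeriv γ (x, 0) = deriv γ x := by simp [meanDeriv]
    have h2 := h.mul_meanDeriv x (-L)
    have h3 : γ (x + -L) = γ x := by
      have := h.per (x + -L)
      rw [← this]; congr 1; ring
    rw [h3, sub_self, mul_eq_zero] at h2
    have h4 := h2.resolve_left (by exact_mod_cast (neg_ne_zero.2 hL0.ne'))
    simp only [hq]
    rw [zero_sub, h4, h1, sub_zero]
  have hsymm : ∀ x k, q (x + k, L - k) = -q (x, k) := by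
    intro x k
    have e1 : meanDeriv γ (x + k, L - k - L) = meanDeriv γ (x, k) := by
      rw [← meanDeriv_rev γ x k]; congr 2; ring
    have e2 : meanDeriv γ (x + k, L - k) = meanDeriv γ (x, k - L) := by
      rw [← meanDeriv_rev γ (x + k) (L - k)]
      simp only [meanDeriv]
      congr 1
      ext θ
      rw [← (Function.Periodic.deriv h.per) (x + θ * (k - L))]
      congr 1
      rw [hL]; ring
    simp only [hq]
    rw [e1, e2]; ring
  have hqne : ∀ x, ∀ k ∈ Icc 0 L, q (x, k) ≠ 0 := by
    intro x k hk h0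
    rcases eq_or_lt_of_le hk.1 with rfl | hk0
    · exact h.ne x (by rw [← hq0, h0])
    rcases eq_or_lt_of_le hk.2 with hkL | hk1
    · have := hsymm x L
      rw [sub_self, hq0, ← hkL, h0, neg_zero] at this
      exact h.ne _ this
    have h1 := h.mul_meanDeriv x k
    have h2 := h.mul_meanDeriv x (k - L)
    have h3 : γ (x + (k - L)) = γ (x + k) := by
      rw [← h.per (x + (k - L))]; congr 1; rw [hL]; ring
    have h4 : meanDeriv γ (x, k) = meanDeriv γ (x, k - L) := sub_eq_zero.1 h0
    rw [h3, ← h1, ← h4] at h2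
    push_cast at h2
    have h5 : (L : ℂ) * meanDeriv γ (x, k) = 0 := by linear_combination -h2
    have h6 := (mul_eq_zero.1 h5).resolve_left (by exact_mod_cast hL0.ne')
    rw [h6, mul_zero] at h1
    obtain ⟨m, hm⟩ := h.exists_int (sub_eq_zero.1 h1.symm)
    have h7 : k = m * L := by rw [hL]; linarith
    have h8 : (0 : ℝ) < m := by by_contra hc; nlinarith
    have h9 : (m : ℝ) < 1 := by by_contra hc; nlinarith
    have h10 : 0 < m := by exact_mod_cast h8
    have h11 : m < 1 := by exact_mod_cast h9
    omega
  set c : ℝ → ℝ := fun k => max 0 (min k L) with hc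
  have hcm : ∀ k, c k ∈ Icc 0 L := fun k => ⟨le_max_left _ _, max_le hL0.le (min_le_right _ _)⟩
  have hcc : ∀ k ∈ Icc 0 L, c k = k := fun k hk => by
    simp only [hc]; rw [min_eq_left hk.2, max_eq_right hk.1]
  obtain ⟨v, hv, hv2⟩ := exists_continuous_sqrt (q := fun p => q (p.1, c p.2))
    (hqc.comp (by simp only [hc]; fun_prop)) (fun p => hqne _ _ (hcm _))
  have hv2' : ∀ x, ∀ k ∈ Icc 0 L, v (x, k) ^ 2 = q (x, k) := fun x k hk => by
    rw [hv2]; simp only; rw [hcc k hk]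
  have hvne : ∀ p, v p ≠ 0 := fun p h0 => by
    have := hv2 p
    rw [h0] at this
    exact hqne _ _ (hcm _) (this.symm.trans (by simp))
  have hpre : IsPreconnected ((univ : Set ℝ) ×ˢ Icc 0 L) :=
    isPreconnected_univ.prod isPreconnected_Icc
  have hreflect : ∀ k ∈ Icc 0 L, L - k ∈ Icc 0 L := fun k hk => ⟨by linarith [hk.2], by linarith [hk.1]⟩
  have hk : ∃ κ : ℂ, κ ^ 2 = -1 ∧ ∀ x, ∀ k ∈ Icc 0 L, v (x + k, L - k) = κ * v (x, k) := by
    have := hpre.eq_or_eq_neg_of_sq_eq (f := fun p : ℝ × ℝ => v (p.1 + p.2, L - p.2))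
      (g := fun p => I * v p) (hv.comp (by fun_prop)).continuousOn (continuous_const.mul hv).continuousOn
      (fun p hp => by
        simp only [Pi.pow_apply]
        rw [mul_pow, I_sq, hv2' _ _ (hreflect _ hp.2), hv2' p.1 p.2 hp.2, hsymm]
        ring) (fun {p} _ => mul_ne_zero I_ne_zero (hvne p))
    rcases this with h1 | h1
    · exact ⟨I, I_sq, fun x k hk => h1 (show (x, k) ∈ _ from ⟨mem_univ _, hk⟩)⟩
    · refine ⟨-I, by simp, fun x k hk => ?_⟩
      have := h1 (show (x, k) ∈ _ from ⟨mem_univ _, hk⟩)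
      simpa using this
  obtain ⟨κ, hκ, hκv⟩ := hk
  have h0 : (0 : ℝ) ∈ Icc 0 L := ⟨le_rfl, hL0.le⟩
  have h1 : v (L, 0) = -v (0, 0) := by
    have e1 := hκv 0 0 h0
    have e2 := hκv (0 + 0) (L - 0) (hreflect 0 h0)
    rw [e1, ← mul_assoc, ← sq, hκ] at e2
    simpa using e2
  have h2 := (isPreconnected_univ (α := ℝ)).eq_or_eq_neg_of_sq_eq (f := fun x => v (x, 0)) (g := w)
    (hv.comp (by fun_prop)).continuousOn hw.continuousOn
    (fun x _ => by simp only [Pi.pow_apply]; rw [hv2' _ _ h0, hq0, hsq])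
    (fun {x} _ h3 => h.ne x (by rw [← hsq, h3]; simp))
  have h3 : v (L, 0) = v (0, 0) := by
    rcases h2 with h2 | h2
    · have e1 := h2 (mem_univ L)
      have e2 := h2 (mem_univ 0)
      simp only at e1 e2
      rw [e1, e2, hper]
    · have e1 := h2 (mem_univ L)
      have e2 := h2 (mem_univ 0)
      simp only [Pi.neg_apply] at e1 e2
      rw [e1, e2, hper]
  rw [h3] at h1
  exact hvne _ (self_eq_neg.1 h1)

/-- A continuous periodic function `g` with `κ g² γ'` nonnegative must vanish somewhere. -/
theorem exists_zero_of_nonneg (h : SmoothLoop γ) {g : ℝ → ℂ} (hg : Continuous g)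
    (hper : g (2 * Real.pi) = g 0) {κ : ℂ} (hκ : κ ≠ 0)
    (hr : ∀ t, ∃ r : ℝ, 0 ≤ r ∧ κ * deriv γ t * g t ^ 2 = r) : ∃ t, g t = 0 := by
  by_contra! hne
  choose r hr0 hr using hr
  obtain ⟨c, hc⟩ := IsAlgClosed.exists_pow_nat_eq κ⁻¹ (n := 2) two_pos
  have hreq : r = fun t => ‖κ * deriv γ t * g t ^ 2‖ := by
    ext t
    rw [hr, norm_real, Real.norm_of_nonneg (hr0 t)]
  have hrc : Continuous r := by
    rw [hreq]
    have := h.cont_deriv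
    fun_prop
  have hd : r (2 * Real.pi) = r 0 := by
    rw [hreq]
    have : deriv γ (2 * Real.pi) = deriv γ 0 := by simpa using (Function.Periodic.deriv h.per) 0
    simp only [hper, this]
  refine h.not_sq_deriv (w := fun t => (Real.sqrt (r t) : ℂ) * c / g t) ?_ ?_ fun t => ?_
  · exact ((continuous_ofReal.comp hrc.sqrt).mul continuous_const).div hg hne
  · simp only [hd, hper]
  · have h1 : ((Real.sqrt (r t) : ℂ)) ^ 2 = r t := by
      rw [← ofReal_pow, Real.sq_sqrt (hr0 t)]
    rw [div_pow, mul_pow, h1, hc, ← hr]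
    have := hne t
    field_simp

end SmoothLoop

theorem ratio_mem_slitPlane {ζ c z : ℂ} (h : ‖z - c‖ < ‖ζ - c‖) : (ζ - z) / (ζ - c) ∈ slitPlane := by
  have h0 : 0 < ‖ζ - c‖ := (norm_nonneg _).trans_lt h
  refine ball_one_subset_slitPlane ?_
  rw [mem_ball, dist_eq_norm, div_sub_one (norm_pos_iff.1 h0), sub_sub_sub_cancel_left, norm_div,
    div_lt_one h0, norm_sub_rev c z]
  exact h

/-- A holomorphic potential on a disc disjoint from the loop. -/
def logInt (γ : ℝ → ℂ) (ψ : ℝ → ℂ) (c z : ℂ) : ℂ :=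
  ∫ t in (0 : ℝ)..(2 * Real.pi), ψ t * Complex.log ((γ t - z) / (γ t - c))

theorem continuous_logInt_integrand {γ ψ : ℝ → ℂ} (hγ : Continuous γ) (hψ : Continuous ψ) {c z : ℂ}
    (hz : ∀ t, ‖z - c‖ < ‖γ t - c‖) :
    Continuous fun t => ψ t * Complex.log ((γ t - z) / (γ t - c)) :=
  hψ.mul (Continuous.clog ((hγ.sub continuous_const).div (hγ.sub continuous_const) fun t =>
    norm_pos_iff.1 ((norm_nonneg _).trans_lt (hz t))) fun t => ratio_mem_slitPlane (hz t))

theorem logInt_hasDerivAt {γ ψ : ℝ → ℂ} (hγ : Continuous γ)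
    (hper : Function.Periodic γ (2 * Real.pi)) (hψ : Continuous ψ) {c : ℂ} {r : ℝ}
    (hr : ∀ t, r ≤ ‖γ t - c‖) {z : ℂ} (hz : z ∈ ball c r) :
    HasDerivAt (logInt γ ψ c) (-CI γ ψ z) z := by
  have hlt : ∀ w ∈ ball c r, ∀ t, ‖w - c‖ < ‖γ t - c‖ := fun w hw t => by
    rw [mem_ball, dist_eq_norm] at hw
    exact hw.trans_le (hr t)
  have hoff : ∀ w ∈ ball c r, ∀ t, γ t ≠ w := fun w hw t h0 => by
    have := hlt w hw t
    rw [h0] at this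
    exact this.false
  obtain ⟨ε, hε, hε'⟩ := exists_pos_le_norm_sub hγ hper (hoff z hz)
  obtain ⟨B, hB⟩ := (isCompact_uIcc (a := (0 : ℝ)) (b := 2 * Real.pi)).exists_bound_of_continuousOn
    hψ.continuousOn
  have hs : ball z (ε / 2) ∩ ball c r ∈ 𝓝 z :=
    inter_mem (ball_mem_nhds z (by positivity)) (isOpen_ball.mem_nhds hz)
  have hball : ∀ w ∈ ball z (ε / 2) ∩ ball c r, ∀ t, ε / 2 ≤ ‖γ t - w‖ := by
    intro w hw t
    have h1 := norm_sub_norm_le (γ t - z) (w - z)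
    rw [sub_sub_sub_cancel_right] at h1
    have := hw.1
    rw [mem_ball, dist_eq_norm] at this
    linarith [hε' t]
  have hd := (intervalIntegral.hasDerivAt_integral_of_dominated_loc_of_deriv_le
    (F := fun w t => ψ t * Complex.log ((γ t - w) / (γ t - c)))
    (F' := fun w t => -(ψ t / (γ t - w))) (μ := volume) (a := 0) (b := 2 * Real.pi)
    (bound := fun _ => B / (ε / 2)) (s := ball z (ε / 2) ∩ ball c r) hs
    (by
      filter_upwards [hs] with w hw
      exact (continuous_logInt_integrand hγ hψ (hlt w hw.2)).aestronglyMeasurable)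
    ((continuous_logInt_integrand hγ hψ (hlt z hz)).intervalIntegrable _ _)
    ((hψ.div (hγ.sub continuous_const) fun t =>
      sub_ne_zero.2 (hoff z hz t)).neg.aestronglyMeasurable)
    (Eventually.of_forall fun t ht w hw => by
      rw [norm_neg, norm_div]
      exact div_le_div₀ ((norm_nonneg _).trans (hB t (uIoc_subset_uIcc ht)))
        (hB t (uIoc_subset_uIcc ht)) (by positivity) (hball w hw t))
    (by simp)
    (Eventually.of_forall fun t ht w hw => by
      have h1 := hoff w hw.2 t
      have h2 : γ t - c ≠ 0 := norm_pos_iff.1 ((norm_nonneg _).trans_lt (hlt w hw.2 t))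
      have h3 : HasDerivAt (fun w => (γ t - w) / (γ t - c)) (-1 / (γ t - c)) w :=
        ((hasDerivAt_id w).const_sub (γ t)).div_const _
      refine ((h3.clog (ratio_mem_slitPlane (hlt w hw.2 t))).const_mul (ψ t)).congr_deriv ?_
      have h4 := sub_ne_zero.2 h1
      field_simp)).2
  refine hd.congr_deriv ?_
  rw [intervalIntegral.integral_neg, CI]

/-- Logarithmic potential of a density on the boundary. -/
def logPot {n : ℕ} (γ : Fin n → ℝ → ℂ) (ψ : Fin n → ℝ → ℝ) (z : ℂ) : ℝ :=
  ∑ i, ∫ t in (0 : ℝ)..(2 * Real.pi), ψ i t * Real.log ‖γ i t - z‖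

theorem continuous_logPot_integrand {γ : ℝ → ℂ} {ψ : ℝ → ℝ} (hγ : Continuous γ) (hψ : Continuous ψ)
    {z : ℂ} (hz : ∀ t, γ t ≠ z) : Continuous fun t => ψ t * Real.log ‖γ t - z‖ :=
  hψ.mul ((hγ.sub continuous_const).norm.log fun t => norm_ne_zero_iff.2 (sub_ne_zero.2 (hz t)))

theorem re_logInt {γ : ℝ → ℂ} {ψ : ℝ → ℝ} (hγ : Continuous γ) (hψ : Continuous ψ) {c z : ℂ}
    (hz : ∀ t, ‖z - c‖ < ‖γ t - c‖) : (logInt γ (fun t => (ψ t : ℂ)) c z).re =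
      (∫ t in (0 : ℝ)..(2 * Real.pi), ψ t * Real.log ‖γ t - z‖) -
        ∫ t in (0 : ℝ)..(2 * Real.pi), ψ t * Real.log ‖γ t - c‖ := by
  have h1 : ∀ t, γ t ≠ z := fun t h0 => by have := hz t; rw [h0] at this; exact this.false
  have h2 : ∀ t, γ t ≠ c := fun t h0 => by
    have := (norm_nonneg _).trans_lt (hz t); rw [h0, sub_self, norm_zero] at this; exact this.false
  have hc := (continuous_logInt_integrand hγ (continuous_ofReal.comp hψ) hz)
  rw [← intervalIntegral.integral_sub ((continuous_logPot_integrand hγ hψ h1).intervalIntegrable _ _)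
    ((continuous_logPot_integrand hγ hψ h2).intervalIntegrable _ _)]
  have := reCLM.intervalIntegral_comp_comm (hc.intervalIntegrable 0 (2 * Real.pi)) (μ := volume)
  simp only [reCLM_apply, Function.comp] at this
  rw [logInt, ← this]
  congr 1
  ext t
  rw [re_ofReal_mul, log_re, norm_div, Real.log_div (norm_ne_zero_iff.2 (sub_ne_zero.2 (h1 t)))
    (norm_ne_zero_iff.2 (sub_ne_zero.2 (h2 t)))]
  ring

namespace Bdry

variable {Ω : Set ℂ} {n : ℕ} {γ : Fin n → ℝ → ℂ} {ψ : Fin n → ℝ → ℝ}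

/-- Locally the logarithmic potential is the real part of a holomorphic function. -/
theorem exists_potential (h : Bdry Ω γ) (hψ : ∀ i, Continuous (ψ i)) {c : ℂ} {r : ℝ}
    (hr : ∀ i t, r ≤ ‖γ i t - c‖) : ∃ V : ℂ → ℂ, ∀ z ∈ ball c r,
      HasDerivAt V (-∑ i, CI (γ i) (fun t => (ψ i t : ℂ)) z) z ∧ (V z).re = logPot γ ψ z := by
  refine ⟨fun z => ∑ i, logInt (γ i) (fun t => (ψ i t : ℂ)) c z + logPot γ ψ c, fun z hz => ⟨?_, ?_⟩⟩
  · rw [← Finset.sum_neg_distrib]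
    exact (HasDerivAt.fun_sum fun i _ => logInt_hasDerivAt (h.loop i).cont (h.loop i).per
      (continuous_ofReal.comp (hψ i)) (hr i) hz).add_const _
  · have hlt : ∀ i t, ‖z - c‖ < ‖γ i t - c‖ := fun i t => by
      rw [mem_ball, dist_eq_norm] at hz
      exact hz.trans_le (hr i t)
    rw [add_re, re_sum, ofReal_re]
    simp only [fun i => re_logInt (h.loop i).cont (hψ i) (hlt i), logPot, Finset.sum_sub_distrib]
    ring

theorem exists_radius (h : Bdry Ω γ) {c : ℂ} (hc : c ∉ frontier Ω) :
    ∃ r > 0, ∀ i t, r ≤ ‖γ i t - c‖ := by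
  obtain ⟨r, hr, δ, hδ, H⟩ := h.exists_far hc
  exact ⟨r, hr, fun i t => by simpa [nrm_zero] using H i t 0 (by simpa using hδ)⟩

theorem exists_dom_all (h : Bdry Ω γ) : ∃ κ > 0, ∃ δ > 0, ∀ i j (t u s : ℝ), |s| ≤ δ →
    κ * |s| ≤ ‖γ j u - nrm (γ i) t s‖ := by
  obtain ⟨κ, hκ, δ, hδ, H⟩ := h.exists_dom
  obtain ⟨d, hd, Hd⟩ := h.exists_sep
  obtain ⟨m, hm, M, hM, K, hK, Hb⟩ := h.exists_bounds
  refine ⟨min κ M, by positivity, min δ (d / (2 * M)), by positivity, fun i j t u s hs => ?_⟩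
  have hs1 := hs.trans (min_le_left _ _)
  have hs2 := hs.trans (min_le_right _ _)
  by_cases hij : i = j
  · subst hij
    obtain ⟨k, hk⟩ := exists_int_abs_le_pi t u
    have h1 := H i t _ s hk hs1
    rw [(h.loop i).add_int] at h1
    refine le_trans ?_ h1
    exact mul_le_mul (min_le_left _ _) (le_add_of_nonneg_left (abs_nonneg _)) (abs_nonneg _) hκ.le
  · have h1 := Hd i j t u hij
    have h2 : ‖nrm (γ i) t s - γ i t‖ ≤ |s| * M := by
      rw [nrm, add_sub_cancel_left, norm_mul, norm_mul, norm_I, mul_one, norm_real, Real.norm_eq_abs]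
      exact mul_le_mul_of_nonneg_left ((Hb i).2.1 t) (abs_nonneg _)
    have h3 : |s| * (2 * M) ≤ d := by rwa [le_div_iff₀ (by positivity)] at hs2
    have h4 := norm_sub_norm_le (γ i t - γ j u) (γ i t - nrm (γ i) t s)
    rw [sub_sub_sub_cancel_left, norm_sub_rev (γ i t) (nrm (γ i) t s),
      norm_sub_rev (nrm (γ i) t s) (γ j u)] at h4
    have h5 : min κ M * |s| ≤ M * |s| := mul_le_mul_of_nonneg_right (min_le_right _ _) (abs_nonneg _)
    linarith

/-- The logarithmic potential does not jump across the boundary. -/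
theorem tendsto_logPot_sub (h : Bdry Ω γ) (hψ : ∀ i, Continuous (ψ i)) (i : Fin n) (t0 : ℝ) :
    Tendsto (fun p : ℝ × ℝ => logPot γ ψ (nrm (γ i) p.1 p.2) - logPot γ ψ (nrm (γ i) p.1 (-p.2)))
      (sideFilter t0) (𝓝 0) := by
  obtain ⟨κ, hκ, δ, hδ, H⟩ := h.exists_dom_all
  obtain ⟨m, hm, M, hM, K, hK, Hb⟩ := h.exists_bounds
  set A := 1 + 2 * M / κ with hA
  have hA1 : 1 ≤ A := by rw [hA]; linarith [show 0 < 2 * M / κ by positivity]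
  have hle : ∀ (a b : ℂ) (s : ℝ), ‖a - b‖ ≤ 2 * M * s → κ * s ≤ ‖b‖ → ‖a‖ ≤ A * ‖b‖ := by
    intro a b s h1 h2
    have h3 := norm_sub_norm_le a b
    have h4 : 2 * M * s ≤ 2 * M / κ * ‖b‖ := by
      rw [div_mul_eq_mul_div, le_div_iff₀ hκ]; nlinarith
    rw [hA]; linarith
  have hlog : ∀ (j : Fin n) (t u s : ℝ), 0 < s → s < δ →
      |Real.log ‖γ j u - nrm (γ i) t s‖ - Real.log ‖γ j u - nrm (γ i) t (-s)‖| ≤ Real.log A := by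
    intro j t u s hs hsδ
    have a1 := H i j t u s (by rw [abs_of_pos hs]; exact hsδ.le)
    have a2 := H i j t u (-s) (by rw [abs_neg, abs_of_pos hs]; exact hsδ.le)
    rw [abs_neg, abs_of_pos hs] at a2
    rw [abs_of_pos hs] at a1
    have a3 : ‖(γ j u - nrm (γ i) t s) - (γ j u - nrm (γ i) t (-s))‖ ≤ 2 * M * s := by
      have : (γ j u - nrm (γ i) t s) - (γ j u - nrm (γ i) t (-s)) =
          -((2 * s : ℝ) * I * deriv (γ i) t) := by
        simp only [nrm]; push_cast; ring
      rw [this, norm_neg, norm_mul, norm_mul, norm_I, mul_one, norm_real, Real.norm_of_nonneg (by positivity)]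
      nlinarith [(Hb i).2.1 t]
    have b1 := hle _ _ s a3 a2
    have b2 := hle _ _ s (by rw [norm_sub_rev]; exact a3) a1
    have p1 : 0 < ‖γ j u - nrm (γ i) t s‖ := lt_of_lt_of_le (by positivity) a1
    have p2 : 0 < ‖γ j u - nrm (γ i) t (-s)‖ := lt_of_lt_of_le (by positivity) a2
    have c1 := Real.log_le_log p1 b1
    have c2 := Real.log_le_log p2 b2
    rw [Real.log_mul (by positivity) p2.ne'] at c1
    rw [Real.log_mul (by positivity) p1.ne'] at c2
    rw [abs_le]; constructor <;> linarith
  have hoff : ∀ (j : Fin n) (t u s : ℝ), s ≠ 0 → |s| < δ → γ j u ≠ nrm (γ i) t s := by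
    intro j t u s hs hsδ h0
    have := H i j t u s hsδ.le
    rw [h0, sub_self, norm_zero] at this
    have : 0 < κ * |s| := by positivity
    linarith
  have hsmall := sideFilter_small t0 hδ
  have heq : ∀ᶠ p in sideFilter t0, ∑ j, ∫ u in (0 : ℝ)..(2 * Real.pi),
      ψ j u * (Real.log ‖γ j u - nrm (γ i) p.1 p.2‖ - Real.log ‖γ j u - nrm (γ i) p.1 (-p.2)‖) =
      logPot γ ψ (nrm (γ i) p.1 p.2) - logPot γ ψ (nrm (γ i) p.1 (-p.2)) := by
    filter_upwards [hsmall] with p hp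
    rw [logPot, logPot, ← Finset.sum_sub_distrib]
    refine Finset.sum_congr rfl fun j _ => ?_
    rw [← intervalIntegral.integral_sub]
    · congr 1; ext u; ring
    · exact (continuous_logPot_integrand (h.loop j).cont (hψ j) fun u =>
        hoff j _ u _ hp.1.ne' (by rw [abs_of_pos hp.1]; exact hp.2)).intervalIntegrable _ _
    · exact (continuous_logPot_integrand (h.loop j).cont (hψ j) fun u =>
        hoff j _ u _ (neg_ne_zero.2 hp.1.ne')
          (by rw [abs_neg, abs_of_pos hp.1]; exact hp.2)).intervalIntegrable _ _
  refine Tendsto.congr' heq ?_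
  rw [← Finset.sum_const_zero (s := Finset.univ (α := Fin n))]
  refine tendsto_finsetSum _ fun j _ => ?_
  suffices hs : Tendsto (fun p : ℝ × ℝ => ∫ u in (0 : ℝ)..(2 * Real.pi), ψ j u *
      (Real.log ‖γ j u - nrm (γ i) p.1 p.2‖ - Real.log ‖γ j u - nrm (γ i) p.1 (-p.2)‖))
      (sideFilter t0) (𝓝 (∫ u in (0 : ℝ)..(2 * Real.pi), (0 : ℝ))) by simpa using hs
  refine intervalIntegral.tendsto_integral_filter_of_dominated_convergence
    (fun u => |ψ j u| * Real.log A) ?_ ?_ ?_ ?_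
  · filter_upwards [hsmall] with p hp
    refine Continuous.aestronglyMeasurable ?_
    have q1 := continuous_logPot_integrand (h.loop j).cont (hψ j) fun u =>
      hoff j p.1 u p.2 hp.1.ne' (by rw [abs_of_pos hp.1]; exact hp.2)
    have q2 := continuous_logPot_integrand (h.loop j).cont (hψ j) fun u =>
      hoff j p.1 u (-p.2) (neg_ne_zero.2 hp.1.ne') (by rw [abs_neg, abs_of_pos hp.1]; exact hp.2)
    refine (q1.sub q2).congr fun u => ?_
    simp only [Pi.sub_apply]
    ring
  · filter_upwards [hsmall] with p hp
    refine Eventually.of_forall fun u _ => ?_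
    rw [Real.norm_eq_abs, abs_mul]
    exact mul_le_mul_of_nonneg_left (hlog j p.1 u p.2 hp.1 hp.2) (abs_nonneg _)
  · exact ((hψ j).abs.mul continuous_const).intervalIntegrable _ _
  · have hfin : {u : ℝ | γ j u = γ i t0}.Countable := by
      by_cases hij : i = j
      · subst hij
        refine (countable_range fun k : ℤ => t0 + k * (2 * Real.pi)).mono ?_
        intro u hu
        obtain ⟨k, hk⟩ := (h.loop i).exists_int (show γ i u = γ i t0 from hu)
        exact ⟨k, by simp only; linarith⟩
      · refine (countable_empty).mono fun u hu => ?_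
        obtain ⟨d, hd, Hd⟩ := h.exists_sep
        have := Hd i j t0 u hij
        rw [show γ j u = γ i t0 from hu, sub_self, norm_zero] at this
        linarith
    have hae := (hfin.ae_notMem volume)
    filter_upwards [hae] with u hu _
    have hne : ‖γ j u - γ i t0‖ ≠ 0 := norm_ne_zero_iff.2 (sub_ne_zero.2 hu)
    have l1 := ((tendsto_const_nhds (x := γ j u)).sub ((h.loop i).tendsto_nrm t0)).norm.log hne
    have l2 := ((tendsto_const_nhds (x := γ j u)).sub ((h.loop i).tendsto_nrm_neg t0)).norm.log hne
    simpa using (l1.sub l2).const_mul (ψ j u)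

end Bdry

/-- Harnack's lower bound for holomorphic functions with positive real part. -/
theorem harnack_le {W : ℂ → ℂ} {c : ℂ} {r : ℝ} (hd : DifferentiableOn ℂ W (ball c r))
    (hpos : ∀ z ∈ ball c r, 0 < (W z).re) {z : ℂ} (hz : z ∈ ball c r) :
    (W c).re * (r - dist z c) ≤ (W z).re * (r + dist z c) := by
  have hr : 0 < r := pos_of_mem_ball hz
  have hc := mem_ball_self (x := c) hr
  have hne : ∀ w ∈ ball c r, W w + conj (W c) ≠ 0 := fun w hw h0 => by
    have := congrArg re h0
    simp only [add_re, conj_re, zero_re] at this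
    linarith [hpos w hw, hpos c hc]
  have hsq : ∀ w, ‖W w - W c‖ ^ 2 = ((W w).re - (W c).re) ^ 2 + ((W w).im - (W c).im) ^ 2 ∧
      ‖W w + conj (W c)‖ ^ 2 = ((W w).re + (W c).re) ^ 2 + ((W w).im - (W c).im) ^ 2 := by
    intro w
    rw [← normSq_eq_norm_sq, ← normSq_eq_norm_sq, normSq_apply, normSq_apply]
    simp only [sub_re, sub_im, add_re, add_im, conj_re, conj_im]
    constructor <;> ring
  set f : ℂ → ℂ := fun w => (W w - W c) / (W w + conj (W c)) with hf
  have hfc : f c = 0 := by simp [hf]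
  have h1 := dist_le_div_mul_dist_of_mapsTo_ball (f := f) (c := c) (z := z) (R₁ := r) (R₂ := 1)
    (((hd.sub_const _).div (hd.add_const _) hne)) (fun w hw => by
      rw [hfc, mem_closedBall, dist_zero_right, hf]
      simp only
      rw [norm_div]
      refine div_le_one_of_le₀ ?_ (norm_nonneg _)
      refine le_of_sq_le_sq ?_ (norm_nonneg _)
      rw [(hsq w).1, (hsq w).2]
      nlinarith [mul_pos (hpos w hw) (hpos c hc)]) hz
  rw [hfc, dist_zero_right, hf] at h1
  simp only at h1
  rw [norm_div, div_le_iff₀ (norm_pos_iff.2 (hne z hz))] at h1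
  set ρ := 1 / r * dist z c with hρ
  have hρ0 : 0 ≤ ρ := by positivity
  have hρ1 : ρ < 1 := by
    rw [hρ, one_div, inv_mul_lt_iff₀ hr, mul_one]; exact hz
  have h2 := pow_le_pow_left₀ (norm_nonneg _) h1 2
  rw [mul_pow, (hsq z).1, (hsq z).2] at h2
  have h3 : ((W z).re - (W c).re) ^ 2 ≤ (ρ * ((W z).re + (W c).re)) ^ 2 := by
    have hρ2 : ρ ^ 2 ≤ 1 := pow_le_one₀ hρ0 hρ1.le
    have := mul_nonneg (sub_nonneg.2 hρ2) (sq_nonneg ((W z).im - (W c).im))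
    rw [mul_pow]
    linarith
  have hs := hpos z hz
  have hs' := hpos c hc
  have h4 := abs_le_of_sq_le_sq h3 (by positivity)
  have h5 := (abs_le.1 h4).1
  have hdist : dist z c = ρ * r := by rw [hρ]; field_simp
  rw [hdist]
  nlinarith

/-- A quantitative form of the fact that a small circle tangent to a curve does not cross it. -/
theorem le_norm_sub_of_taylor {a b v : ℂ} {x R K η : ℝ} (hR : 0 < R) (hx : |x| < η)
    (hRη : R ≤ η / 2) (hη : 4 * K * η = ‖v‖) (hK : 0 < K)
    (h1 : ‖a - b - x * v‖ ≤ K * x ^ 2) : R * ‖v‖ ≤ ‖a - (b + R * I * v)‖ := by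
  have h2 : ‖(x - R * I : ℂ) * v‖ = Real.sqrt (x ^ 2 + R ^ 2) * ‖v‖ := by
    rw [norm_mul, Complex.norm_def, normSq_apply]
    congr 2
    simp
    ring
  have h3 := norm_sub_norm_le ((x - R * I : ℂ) * v) (-(a - b - x * v))
  rw [sub_neg_eq_add, norm_neg, h2] at h3
  have h4 : (x - R * I : ℂ) * v + (a - b - x * v) = a - (b + R * I * v) := by ring
  rw [h4] at h3
  have h5 : Real.sqrt (x ^ 2 + R ^ 2) ≤ |x| + R := by
    rw [Real.sqrt_le_left (by positivity)]
    nlinarith [sq_abs x, mul_nonneg (abs_nonneg x) hR.le]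
  have h6 : R ≤ Real.sqrt (x ^ 2 + R ^ 2) := Real.le_sqrt_of_sq_le (by nlinarith [sq_nonneg x])
  have h7 : Real.sqrt (x ^ 2 + R ^ 2) ^ 2 = x ^ 2 + R ^ 2 := Real.sq_sqrt (by positivity)
  generalize Real.sqrt (x ^ 2 + R ^ 2) = q at *
  have h9 : K * x ^ 2 ≤ (q - R) * ‖v‖ := by
    have e1 : x ^ 2 = (q - R) * (q + R) := by linarith
    have e2 : K * (q + R) ≤ ‖v‖ := by
      rw [← hη]
      have : K * (q + R) ≤ K * (4 * η) := mul_le_mul_of_nonneg_left (by linarith) hK.le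
      linarith
    rw [e1]
    have := mul_le_mul_of_nonneg_left e2 (sub_nonneg.2 h6)
    linarith
  linarith

namespace Bdry

variable {Ω : Set ℂ} {n : ℕ} {γ : Fin n → ℝ → ℂ} {ψ : Fin n → ℝ → ℝ}

/-- Interior tangent disc condition. -/
theorem exists_tangent_ball (h : Bdry Ω γ) (i : Fin n) (t0 : ℝ) : ∃ R > 0,
    nrm (γ i) t0 R ∈ Ω ∧ ∀ j u, R * ‖deriv (γ i) t0‖ ≤ ‖γ j u - nrm (γ i) t0 R‖ := by
  obtain ⟨δ, hδ, hside⟩ := h.side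
  obtain ⟨κ, hκ, δ', hδ', H⟩ := h.exists_dom
  obtain ⟨d, hd, Hd⟩ := h.exists_sep
  obtain ⟨m, hm, M, hM, K, hK, Hb⟩ := h.exists_bounds
  obtain ⟨b1, b2, b3, b4⟩ := Hb i
  set τ := ‖deriv (γ i) t0‖ with hτ
  have hτ0 : 0 < τ := hm.trans_le (b1 t0)
  set η := τ / (4 * K) with hη
  have hη0 : 0 < η := by positivity
  set e := min d (κ * η) with he
  have he0 : 0 < e := by positivity
  have hpos : 0 < min (min (δ / 2) δ') (min (e / (2 * τ)) (η / 2)) := by positivity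
  set R := min (min (δ / 2) δ') (min (e / (2 * τ)) (η / 2)) with hR
  have r1 : R ≤ δ / 2 := (min_le_left _ _).trans (min_le_left _ _)
  have r3 : R ≤ e / (2 * τ) := (min_le_right _ _).trans (min_le_left _ _)
  have r4 : R ≤ η / 2 := (min_le_right _ _).trans (min_le_right _ _)
  rw [le_div_iff₀ (by positivity)] at r3
  refine ⟨R, hpos, (hside i t0 R hpos (by linarith)).1, fun j u => ?_⟩
  have hnrm : ‖nrm (γ i) t0 R - γ i t0‖ = R * τ := by
    rw [nrm, add_sub_cancel_left, norm_mul, norm_mul, norm_I, mul_one, norm_real,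
      Real.norm_of_nonneg hpos.le]
  have hfar : e ≤ ‖γ j u - γ i t0‖ → R * τ ≤ ‖γ j u - nrm (γ i) t0 R‖ := by
    intro h1
    have h4 := norm_sub_norm_le (γ j u - γ i t0) (nrm (γ i) t0 R - γ i t0)
    rw [sub_sub_sub_cancel_right, hnrm] at h4
    linarith
  by_cases hij : i = j
  swap
  · refine hfar ((min_le_left _ _).trans ?_)
    rw [norm_sub_rev]
    exact Hd i j t0 u hij
  subst hij
  obtain ⟨k, hk⟩ := exists_int_abs_le_pi t0 u
  set u' := u + k * (2 * Real.pi) with hu'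
  have hγu : γ i u' = γ i u := (h.loop i).add_int u k
  rw [← hγu] at hfar ⊢
  by_cases hx : η ≤ |u' - t0|
  · refine hfar ((min_le_right _ _).trans ?_)
    have := H i t0 u' 0 hk (by rw [abs_zero]; exact hδ'.le)
    rw [nrm_zero, abs_zero, add_zero] at this
    exact (mul_le_mul_of_nonneg_left hx hκ.le).trans this
  push Not at hx
  refine le_norm_sub_of_taylor hpos hx r4 ?_ hK ?_
  · rw [hη, ← hτ]; field_simp
  · have := b4 t0 u'
    rwa [← ofReal_sub] at this

theorem eq_zero_of_CI_eq_zero (h : Bdry Ω γ) (hψ : ∀ i, Continuous (ψ i))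
    (hp : ∀ i, Function.Periodic (ψ i) (2 * Real.pi))
    (hout : ∀ z ∉ closure Ω, ∑ i, CI (γ i) (fun t => (ψ i t : ℂ)) z = 0)
    (hin : ∀ z ∈ Ω, ∑ i, CI (γ i) (fun t => (ψ i t : ℂ)) z = 0) (i : Fin n) (t : ℝ) : ψ i t = 0 := by
  have h1 := h.sum_plemelj (fun i => continuous_ofReal.comp (hψ i))
    (fun i x => by simp only [Function.comp]; rw [hp i x]) i t
  have h2 := tendsto_nhds_unique (h1.congr' (f₂ := fun _ => (0 : ℂ)) (by
    filter_upwards [h.eventually_side i t] with p hp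
    have a1 := hin _ hp.1
    have a2 := hout _ hp.2
    simp only [Function.comp_def]
    rw [a1, a2, sub_zero])) tendsto_const_nhds
  have h3 := (h.loop i).ne t
  have h4 : (ψ i t : ℂ) = 0 := by
    simpa [Real.pi_ne_zero, h3] using h2
  exact_mod_cast h4

/-- A real density annihilating `A(Ω)` and having a zero on every boundary curve vanishes. -/
theorem eq_zero_of_annihilates (h : Bdry Ω γ) (hψ : ∀ i, Continuous (ψ i))
    (hp : ∀ i, Function.Periodic (ψ i) (2 * Real.pi))
    (hout : ∀ z ∉ closure Ω, ∑ i, CI (γ i) (fun t => (ψ i t : ℂ)) z = 0)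
    (hzero : ∀ i, ∃ t, ψ i t = 0) (i : Fin n) (t : ℝ) : ψ i t = 0 := by
  set C : ℂ → ℂ := fun z => ∑ i, CI (γ i) (fun t => (ψ i t : ℂ)) z with hC
  set U := logPot γ ψ with hU
  have hψc : ∀ i, Continuous fun t => (ψ i t : ℂ) := fun i => continuous_ofReal.comp (hψ i)
  have hCd : DifferentiableOn ℂ C Ω := fun z hz =>
    (DifferentiableAt.fun_sum fun i _ => (CI_hasDerivAt (h.loop i).cont (h.loop i).per
      (hψc i) (h.off_of_mem hz i)).differentiableAt).differentiableWithinAt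
  by_contra hne
  -- no local maxima inside
  have hmax : ∀ z0 ∈ Ω, ¬ ∀ z ∈ Ω, U z ≤ U z0 := by
    intro z0 hz0 hle
    obtain ⟨r, hr, Hr⟩ := h.exists_radius (h.notMem_frontier hz0)
    obtain ⟨V, hV⟩ := h.exists_potential hψ Hr
    obtain ⟨ε, hε, hball⟩ := Metric.isOpen_iff.1 h.isOpen z0 hz0
    set ρ := min r ε
    have hρ : 0 < ρ := lt_min hr hε
    have hb1 : ball z0 ρ ⊆ ball z0 r := ball_subset_ball (min_le_left _ _)
    have hb2 : ball z0 ρ ⊆ Ω := (ball_subset_ball (min_le_right _ _)).trans hball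
    have hm0 := mem_ball_self (x := z0) hρ
    have hconst := Complex.eqOn_of_isPreconnected_of_isMaxOn_norm (f := fun z => Complex.exp (V z))
      (U := ball z0 ρ) (c := z0) (convex_ball z0 ρ).isPreconnected isOpen_ball
      (fun z hz => (hV z (hb1 hz)).1.cexp.differentiableAt.differentiableWithinAt) hm0
      (fun z hz => by
        simp only [mem_ofPred_eq, Function.comp, norm_exp]
        rw [(hV z (hb1 hz)).2, (hV z0 (hb1 hm0)).2]
        exact Real.exp_le_exp.2 (hle z (hb2 hz)))
    have hC0 : ∀ z ∈ ball z0 ρ, C z = 0 := by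
      intro z hz
      have e1 := (hV z (hb1 hz)).1.cexp
      have e2 : HasDerivAt (fun z => Complex.exp (V z)) 0 z :=
        (hasDerivAt_const z (Complex.exp (V z0))).congr_of_eventuallyEq
          (hconst.eventuallyEq_of_mem (isOpen_ball.mem_nhds hz))
      have e3 := e1.unique e2
      exact neg_eq_zero.1 ((mul_eq_zero.1 e3).resolve_left (Complex.exp_ne_zero _))
    have hCΩ : EqOn C 0 Ω := (hCd.analyticOnNhd h.isOpen).eqOn_zero_of_preconnected_of_eventuallyEq_zero
      h.conn.isPreconnected hz0 (by
        filter_upwards [isOpen_ball.mem_nhds hm0] with z hz using hC0 z hz)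
    exact hne (h.eq_zero_of_CI_eq_zero hψ hp hout hCΩ i t)
  -- constancy outside
  obtain ⟨δ, hδ, hside⟩ := h.side
  have hout_const : ∀ i, ∃ c : ℝ, ∀ t s, 0 < s → s < δ → U (nrm (γ i) t (-s)) = c := by
    intro i
    have hloc : IsLocallyConstant fun p : ℝ × Ioo (0 : ℝ) δ => U (nrm (γ i) p.1 (-p.2)) := by
      rw [IsLocallyConstant.iff_eventually_eq]
      intro p
      have hz0 : nrm (γ i) p.1 (-p.2) ∉ closure Ω := (hside i p.1 p.2 p.2.2.1 p.2.2.2).2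
      obtain ⟨r, hr, Hr⟩ := h.exists_radius (fun h' => hz0 (frontier_subset_closure h'))
      obtain ⟨V, hV⟩ := h.exists_potential hψ Hr
      have hm0 := mem_ball_self (x := nrm (γ i) p.1 (-p.2)) hr
      have hb : ∀ z ∈ ball (nrm (γ i) p.1 (-p.2)) r, z ∉ closure Ω := by
        refine (h.mem_or_of_preconnected (convex_ball _ r).isPreconnected ?_).resolve_left ?_
        · intro z hz hf
          obtain ⟨j, u, rfl⟩ := h.eq_of_frontier hf
          rw [mem_ball, dist_eq_norm] at hz
          linarith [Hr j u]
        · exact fun h' => hz0 (subset_closure (h' _ hm0))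
      have hVc : ∀ z ∈ ball (nrm (γ i) p.1 (-p.2)) r, V z = V (nrm (γ i) p.1 (-p.2)) := by
        intro z hz
        refine isOpen_ball.is_const_of_deriv_eq_zero (convex_ball _ r).isPreconnected
          (fun z hz => (hV z hz).1.differentiableAt.differentiableWithinAt) (fun z hz => ?_) hz hm0
        rw [(hV z hz).1.deriv, hout z (hb z hz)]
        simp
      have hcont : Continuous fun p : ℝ × Ioo (0 : ℝ) δ => nrm (γ i) p.1 (-p.2) := by
        have := (h.loop i).cont
        have := (h.loop i).cont_deriv
        simp only [nrm]
        fun_prop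
      filter_upwards [hcont.continuousAt.preimage_mem_nhds (isOpen_ball.mem_nhds hm0)] with y hy
      have hy' : nrm (γ i) y.1 (-y.2) ∈ ball (nrm (γ i) p.1 (-p.2)) r := hy
      change logPot γ ψ (nrm (γ i) y.1 (-y.2)) = logPot γ ψ (nrm (γ i) p.1 (-p.2))
      rw [← (hV _ hy').2, ← (hV _ hm0).2, hVc _ hy']
    have : PreconnectedSpace (Ioo (0 : ℝ) δ) := Subtype.preconnectedSpace isPreconnected_Ioo
    refine ⟨U (nrm (γ i) 0 (-(δ / 2))), fun t s hs hsδ => ?_⟩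
    exact hloc.apply_eq_of_preconnectedSpace (t, ⟨s, hs, hsδ⟩) (0, ⟨δ / 2, by positivity, by linarith⟩)
  choose c hc using hout_const
  have hlim : ∀ i t, Tendsto U (𝓝[Ω] (γ i t)) (𝓝 (c i)) := by
    intro i t
    refine h.tendsto_nhds_in i t ?_
    have := (h.tendsto_logPot_sub hψ i t).add_const (c i)
    rw [zero_add] at this
    refine this.congr' ?_
    filter_upwards [sideFilter_small t hδ] with p hp
    rw [← hU, hc i p.1 p.2 hp.1 hp.2, sub_add_cancel]
  have hUc : ContinuousOn U Ω := by
    intro z hz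
    obtain ⟨r, hr, Hr⟩ := h.exists_radius (h.notMem_frontier hz)
    obtain ⟨V, hV⟩ := h.exists_potential hψ Hr
    have hm := mem_ball_self (x := z) hr
    refine ContinuousAt.continuousWithinAt ?_
    refine (Complex.continuous_re.continuousAt.comp (hV z hm).1.continuousAt).congr ?_
    filter_upwards [isOpen_ball.mem_nhds hm] with y hy using (hV y hy).2
  have : Nonempty (Fin n) := ⟨i⟩
  obtain ⟨i0, hi0⟩ := Finite.exists_max c
  have hlt : ∀ z ∈ Ω, U z < c i0 := by
    by_contra! hcon
    obtain ⟨z0, hz0, hz0'⟩ := hcon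
    have hcl : IsCompact (closure Ω) := h.bdd.isCompact_closure
    have hE : ContinuousOn (extendFrom Ω U) (closure Ω) := by
      refine continuousOn_extendFrom subset_rfl fun x hx => ?_
      by_cases hxΩ : x ∈ Ω
      · exact ⟨U x, hUc x hxΩ⟩
      · obtain ⟨i, t, rfl⟩ := h.eq_of_frontier (mem_frontier_of_closure hx hxΩ)
        exact ⟨c i, hlim i t⟩
    have hEU : ∀ z ∈ Ω, extendFrom Ω U z = U z := extendFrom_extends hUc
    obtain ⟨z1, hz1, hz1max⟩ := hcl.exists_isMaxOn ⟨z0, subset_closure hz0⟩ hE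
    by_cases hz1Ω : z1 ∈ Ω
    · refine hmax z1 hz1Ω fun z hz => ?_
      have := hz1max (subset_closure hz)
      simp only [mem_ofPred_eq] at this
      rwa [hEU z hz, hEU z1 hz1Ω] at this
    · obtain ⟨j, u, rfl⟩ := h.eq_of_frontier (mem_frontier_of_closure hz1 hz1Ω)
      refine hmax z0 hz0 fun z hz => ?_
      have := hz1max (subset_closure hz)
      simp only [mem_ofPred_eq] at this
      rw [hEU z hz, extendFrom_eq (h.mem_closure j u) (hlim j u)] at this
      linarith [hi0 j]
  obtain ⟨t0, ht0⟩ := hzero i0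
  obtain ⟨R, hR, hRΩ, hRdist⟩ := h.exists_tangent_ball i0 t0
  set τ := ‖deriv (γ i0) t0‖ with hτ
  have hτ0 : 0 < τ := norm_pos_iff.2 ((h.loop i0).ne t0)
  obtain ⟨V, hV⟩ := h.exists_potential hψ hRdist
  have hballΩ : ∀ z ∈ ball (nrm (γ i0) t0 R) (R * τ), z ∈ Ω := by
    refine (h.mem_or_of_preconnected (convex_ball _ _).isPreconnected ?_).resolve_right ?_
    · intro z hz hf
      obtain ⟨j, u, rfl⟩ := h.eq_of_frontier hf
      rw [mem_ball, dist_eq_norm] at hz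
      linarith [hRdist j u]
    · exact fun h' => h' _ (mem_ball_self (by positivity)) (subset_closure hRΩ)
  have hmem : ∀ s, 0 < s → s ≤ R → dist (nrm (γ i0) t0 s) (nrm (γ i0) t0 R) = (R - s) * τ := by
    intro s hs hsR
    rw [dist_eq_norm, nrm, nrm, add_sub_add_left_eq_sub, ← sub_mul, ← sub_mul, norm_mul, norm_mul,
      norm_I, mul_one, ← ofReal_sub, norm_real, norm_sub_rev s R, Real.norm_of_nonneg (by linarith)]
  have hmem' : ∀ s, 0 < s → s ≤ R → nrm (γ i0) t0 s ∈ ball (nrm (γ i0) t0 R) (R * τ) := by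
    intro s hs hsR
    rw [mem_ball, hmem s hs hsR]
    nlinarith
  set g : ℝ → ℝ := fun s => c i0 - U (nrm (γ i0) t0 s) with hg
  have hgR : 0 < g R := sub_pos.2 (hlt _ hRΩ)
  have hlow : ∀ s, 0 < s → s ≤ R → g R * s ≤ g s * (2 * R) := by
    intro s hs hsR
    have e1 := harnack_le (W := fun z => c i0 - V z) (c := nrm (γ i0) t0 R) (r := R * τ)
      (fun z hz => ((hV z hz).1.differentiableAt.const_sub _).differentiableWithinAt)
      (fun z hz => by
        rw [sub_re, ofReal_re, (hV z hz).2]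
        exact sub_pos.2 (hlt z (hballΩ z hz))) (hmem' s hs hsR)
    rw [hmem s hs hsR, sub_re, sub_re, ofReal_re, (hV _ (hmem' s hs hsR)).2,
      (hV _ (hmem' R hR le_rfl)).2] at e1
    have e2 : g R * (s * τ) ≤ g s * ((2 * R - s) * τ) := by
      convert e1 using 2 <;> ring
    have e3 : 0 < g s := sub_pos.2 (hlt _ (hballΩ _ (hmem' s hs hsR)))
    have e4 : g R * s ≤ g s * (2 * R - s) := by
      by_contra! hcon
      nlinarith
    nlinarith
  have hder : ∀ s, 0 < s → s ≤ R →
      HasDerivAt g (C (nrm (γ i0) t0 s) * (I * deriv (γ i0) t0)).re s := by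
    intro s hs hsR
    have e1 : HasDerivAt (fun s : ℝ => nrm (γ i0) t0 s) (I * deriv (γ i0) t0) s :=
      SmoothLoop.hasDerivAt_nrm_snd _ t0 s
    have e2 := (hV _ (hmem' s hs hsR)).1.comp_of_eq s e1 rfl
    have e3 := (reCLM.hasFDerivAt.comp_hasDerivAt s e2).const_sub (c i0)
    refine (e3.congr_of_eventuallyEq ?_).congr_deriv ?_
    · have : ∀ᶠ s' in 𝓝 s, nrm (γ i0) t0 s' ∈ ball (nrm (γ i0) t0 R) (R * τ) :=
        e1.continuousAt.preimage_mem_nhds (isOpen_ball.mem_nhds (hmem' s hs hsR))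
      filter_upwards [this] with s' hs'
      simp only [hg, Function.comp, reCLM_apply]
      rw [(hV _ hs').2]
    · simp [hC]
      ring
  have htend : Tendsto (fun s : ℝ => (t0, s)) (𝓝[>] 0) (sideFilter t0) :=
    tendsto_const_nhds.prodMk tendsto_id
  have hC0 : Tendsto (fun s : ℝ => C (nrm (γ i0) t0 s)) (𝓝[>] 0) (𝓝 0) := by
    have e1 := (h.sum_plemelj hψc (fun i x => by rw [hp i x]) i0 t0).comp htend
    rw [ht0, ofReal_zero, zero_div, mul_zero] at e1
    refine e1.congr' ?_
    filter_upwards [htend.eventually (h.eventually_side i0 t0)] with s hs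
    simp only [Function.comp, hC]
    rw [hout _ hs.2, sub_zero]
  have hg0 : Tendsto g (𝓝[>] 0) (𝓝 0) := by
    have e1 := ((hlim i0 t0).comp ((h.tendsto_in i0 t0).comp htend)).const_sub (c i0)
    rw [sub_self] at e1
    exact e1
  set ε := g R / (4 * R) with hε
  have hε0 : 0 < ε := by positivity
  have hC1 : Tendsto (fun s : ℝ => (C (nrm (γ i0) t0 s) * (I * deriv (γ i0) t0)).re) (𝓝[>] 0) (𝓝 0) := by
    have := (continuous_re.tendsto _).comp (hC0.mul_const (I * deriv (γ i0) t0))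
    rw [zero_mul, zero_re] at this
    exact this
  obtain ⟨η, hη, hηs⟩ := mem_nhdsGT_iff_exists_Ioo_subset.1
    (hC1.eventually (Metric.closedBall_mem_nhds 0 hε0))
  set s1 := min R η / 2 with hs1
  have hη' : (0 : ℝ) < η := hη
  have hs1pos : 0 < s1 := by positivity
  have hs1R : s1 < R := by
    have := min_le_left R η; linarith
  have hs1η : s1 < η := by
    have := min_le_right R η; linarith
  have hup : ∀ᶠ s in 𝓝[>] (0 : ℝ), g s1 - g s ≤ ε * s1 := by
    filter_upwards [Ioo_mem_nhdsGT hs1pos] with s hs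
    have := (convex_Icc s s1).norm_image_sub_le_of_norm_hasDerivWithin_le (f := g)
      (f' := fun s => (C (nrm (γ i0) t0 s) * (I * deriv (γ i0) t0)).re) (C := ε)
      (fun y hy => (hder y (hs.1.trans_le hy.1) (hy.2.trans hs1R.le)).hasDerivWithinAt)
      (fun y hy => by
        have := hηs ⟨hs.1.trans_le hy.1, hy.2.trans_lt hs1η⟩
        simpa using this) (left_mem_Icc.2 hs.2.le) (right_mem_Icc.2 hs.2.le)
    rw [Real.norm_eq_abs, Real.norm_eq_abs, abs_of_nonneg (sub_nonneg.2 hs.2.le)] at this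
    have h2 := (le_abs_self _).trans this
    nlinarith [hs.1]
  have hfin : g s1 - 0 ≤ ε * s1 :=
    le_of_tendsto (tendsto_const_nhds.sub hg0) hup
  have h1 := hlow s1 hs1pos hs1R.le
  have h2 : g s1 * (2 * R) ≤ g R * s1 / 2 := by
    have : ε * s1 * (2 * R) = g R * s1 / 2 := by rw [hε]; field_simp; ring
    rw [← this, ← sub_zero (g s1)]
    exact mul_le_mul_of_nonneg_right hfin (by positivity)
  nlinarith [mul_pos hgR hs1pos]

end Bdry

/-- The Garabedian kernel multiplied by `z - w`. -/
def garL (Ω : Set ℂ) {n : ℕ} (γ : Fin n → ℝ → ℂ) (S : ℂ → ℂ → ℂ) (w z : ℂ) : ℂ :=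
  1 + (z - w) * garK Ω γ S w z

theorem garL_eq {Ω : Set ℂ} {n : ℕ} {γ : Fin n → ℝ → ℂ} {S : ℂ → ℂ → ℂ} {w z : ℂ} (hzw : z ≠ w) :
    garL Ω γ S w z = (z - w) * gar Ω γ S w z := by
  rw [garL, gar, mul_add, mul_inv_cancel₀ (sub_ne_zero.2 hzw), add_comm]

theorem garL_self {Ω : Set ℂ} {n : ℕ} {γ : Fin n → ℝ → ℂ} {S : ℂ → ℂ → ℂ} {w : ℂ} :
    garL Ω γ S w w = 1 := by
  rw [garL, sub_self, zero_mul, add_zero]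

theorem exists_rotation (l : ℂ) : ∃ c : ℂ, c ≠ 0 ∧ c * l + conj c * conj l = 0 := by
  by_cases hl : l = 0
  · exact ⟨1, one_ne_zero, by simp [hl]⟩
  · refine ⟨I * conj l, mul_ne_zero I_ne_zero ((map_ne_zero _).2 hl), ?_⟩
    simp only [map_mul, conj_I, conj_conj]
    ring

theorem AO.sub_const (Ω : Set ℂ) (w : ℂ) : AO Ω fun z => z - w :=
  AO.of_differentiable (differentiable_id.sub_const w)

namespace Bdry

variable {Ω : Set ℂ} {n : ℕ} {γ : Fin n → ℝ → ℂ}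

theorem eq_zero_of_boundary (h : Bdry Ω γ) {f : ℂ → ℂ} (hf : AO Ω f)
    (h0 : ∀ i t, f (γ i t) = 0) {w : ℂ} (hw : w ∈ Ω) : f w = 0 := by
  have h1 := h.bint_cauchy_formula hf hw
  have h2 : bint (fun i t => f (γ i t) * (γ i t - w)⁻¹ * deriv (γ i) t) = 0 := by
    simp [bint, h0]
  rw [h2] at h1
  exact (mul_eq_zero.1 h1.symm).resolve_left (by simp [Real.pi_ne_zero])

end Bdry

namespace Szego

variable {Ω : Set ℂ} {n : ℕ} {γ : Fin n → ℝ → ℂ} {S : ℂ → ℂ → ℂ}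

theorem ao_garL (h : Szego Ω γ S) {w : ℂ} (hw : w ∈ Ω) : AO Ω (garL Ω γ S w) :=
  (AO.const Ω 1).add ((AO.sub_const Ω w).mul (h.garK_spec hw).1)

/-- Boundary conjugation symmetry of combinations of the Szegő and Garabedian kernels. -/
theorem conj_comb (h : Szego Ω γ S) {w : ℂ} (hw : w ∈ Ω) (α β : ℂ) (i : Fin n) (t : ℝ) :
    conj (α * (2 * Real.pi * S (γ i t) w) + β * gar Ω γ S w (γ i t)) * ‖deriv (γ i) t‖ =
      -I * deriv (γ i) t * (conj α * gar Ω γ S w (γ i t) +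
        conj β * (2 * Real.pi * S (γ i t) w)) := by
  have h0 : (‖deriv (γ i) t‖ : ℂ) ≠ 0 := by
    rw [ofReal_ne_zero, norm_ne_zero_iff]; exact (h.loop i).ne t
  have h1 := h.gar_bdry hw i t
  have h2 := congrArg conj h1
  simp only [map_mul, conj_conj, conj_ofReal, conj_I, map_ofNat] at h2
  have h3 := norm_sq_eq (deriv (γ i) t)
  have h4 : conj (gar Ω γ S w (γ i t)) * ‖deriv (γ i) t‖ =
      -I * deriv (γ i) t * (2 * Real.pi * S (γ i t) w) := by
    apply mul_right_cancel₀ h0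
    linear_combination (conj (gar Ω γ S w (γ i t))) * h3 + deriv (γ i) t * h2
  simp only [map_add, map_mul, conj_ofReal, map_ofNat]
  linear_combination conj β * h4 + I * conj α * h1 + (2 * Real.pi * conj α *
    conj (S (γ i t) w) * ‖deriv (γ i) t‖) * I_sq

theorem res_comb (h : Szego Ω γ S) {f : ℂ → ℂ} (hf : AO Ω f) {b z : ℂ} (hb : b ∈ Ω) (hz : z ∈ Ω)
    (hbz : b ≠ z) (p q r s : ℂ) :
    bint (fun i t => f (γ i t) * ((p * S (γ i t) b + q * gar Ω γ S b (γ i t)) *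
      (r * S (γ i t) z + s * gar Ω γ S z (γ i t))) * deriv (γ i) t) =
    2 * Real.pi * I * (p * s * (f z * S z b) + q * r * (f b * S b z) +
      q * s * (f z * gar Ω γ S b z + f b * gar Ω γ S z b)) := by
  have h1 := h.res_one (hf.mul (h.ao b hb)) hz
  have h2 := h.res_one (hf.mul (h.ao z hz)) hb
  have h3 := h.res_two hf hb hz hbz
  have h4 := h.bint_cauchy ((hf.mul (h.ao b hb)).mul (h.ao z hz))
  have c1 := fun i => (h.loop i).cont_deriv
  have c2 := fun i => h.contS hb i
  have c3 := fun i => h.contS hz i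
  have c4 := fun i => h.cont_gar hb i
  have c5 := fun i => h.cont_gar hz i
  have c6 := fun i => h.cont_comp hf.2 i
  have t1 := fun i => ((((c6 i).mul (c2 i)).mul (c5 i)).mul (c1 i)).const_mul (p * s)
  have t2 := fun i => ((((c6 i).mul (c3 i)).mul (c4 i)).mul (c1 i)).const_mul (q * r)
  have t3 := fun i => ((((c6 i).mul (c4 i)).mul (c5 i)).mul (c1 i)).const_mul (q * s)
  have t4 := fun i => ((((c6 i).mul (c2 i)).mul (c3 i)).mul (c1 i)).const_mul (p * r)
  have e : bint (fun i t => f (γ i t) * ((p * S (γ i t) b + q * gar Ω γ S b (γ i t)) *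
      (r * S (γ i t) z + s * gar Ω γ S z (γ i t))) * deriv (γ i) t) =
      bint (fun i t => ((p * s) * (f (γ i t) * S (γ i t) b * gar Ω γ S z (γ i t) * deriv (γ i) t) +
        (q * r) * (f (γ i t) * S (γ i t) z * gar Ω γ S b (γ i t) * deriv (γ i) t)) +
        ((q * s) * (f (γ i t) * gar Ω γ S b (γ i t) * gar Ω γ S z (γ i t) * deriv (γ i) t) +
        (p * r) * (f (γ i t) * S (γ i t) b * S (γ i t) z * deriv (γ i) t))) :=
    bint_congr fun i t => by ring
  rw [e, bint_add, bint_add, bint_add, bint_const_mul, bint_const_mul, bint_const_mul,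
    bint_const_mul, h1, h2, h3, h4]
  · ring
  exacts [t3, t4, t1, t2, fun i => (t1 i).add (t2 i), fun i => (t3 i).add (t4 i)]

theorem comb_ne_zero (h : Szego Ω γ S) {b z : ℂ} (hb : b ∈ Ω) (hz : z ∈ Ω) (hbz : b ≠ z) {l : ℂ}
    (hl : l * conj l = 1) : 2 * Real.pi * S z b - l * gar Ω γ S b z ≠ 0 := by
  intro h0
  obtain ⟨c, hc, hcl⟩ := exists_rotation (gar Ω γ S b z)
  set G : ℂ → ℂ := fun ζ => (2 * Real.pi) * S ζ b + (-l) * gar Ω γ S b ζ with hG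
  set G1 : ℂ → ℂ := fun ζ => (-l * conj c * (2 * Real.pi)) * S ζ z + c * gar Ω γ S z ζ with hG1
  have hl0 : conj l ≠ 0 := right_ne_zero_of_mul_eq_one hl
  have hGb : ∀ i t, conj (G (γ i t)) * ‖deriv (γ i) t‖ =
      (I * conj l) * deriv (γ i) t * G (γ i t) := fun i t => by
    have := h.conj_comb hb 1 (-l) i t
    rw [one_mul] at this
    rw [hG, this]
    simp only [map_one, map_neg]
    linear_combination (I * deriv (γ i) t * gar Ω γ S b (γ i t)) * hl
  have hG1b : ∀ i t, conj (G1 (γ i t)) * ‖deriv (γ i) t‖ =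
      (I * conj l) * deriv (γ i) t * G1 (γ i t) := fun i t => by
    have := h.conj_comb hz (-l * conj c) c i t
    rw [← mul_assoc] at this
    rw [hG1, this]
    simp only [map_neg, map_mul, conj_conj]
    linear_combination (2 * I * deriv (γ i) t * Real.pi * conj c * S (γ i t) z) * hl
  have hGc : ∀ i, Continuous fun t => G (γ i t) := fun i =>
    ((h.contS hb i).const_mul _).add ((h.cont_gar hb i).const_mul _)
  have hG1c : ∀ i, Continuous fun t => G1 (γ i t) := fun i =>
    ((h.contS hz i).const_mul _).add ((h.cont_gar hz i).const_mul _)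
  set Ψ : Fin n → ℝ → ℂ := fun i t => (I * conj l) * deriv (γ i) t * (G (γ i t) * G1 (γ i t)) with hΨ
  have hreal : ∀ i t, ((Ψ i t).re : ℂ) = Ψ i t := by
    intro i t
    rw [← conj_eq_iff_re]
    have h0 : (‖deriv (γ i) t‖ : ℂ) ≠ 0 := by
      rw [ofReal_ne_zero, norm_ne_zero_iff]; exact (h.loop i).ne t
    have e1 : Ψ i t = conj (G (γ i t)) * ‖deriv (γ i) t‖ * G1 (γ i t) := by
      rw [hGb]; simp only [hΨ]; ring
    rw [e1]
    simp only [map_mul, conj_conj, conj_ofReal]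
    linear_combination G (γ i t) * hG1b i t - G1 (γ i t) * hGb i t
  have hψ0 : ∀ i t, (Ψ i t).re = 0 := by
    refine h.eq_zero_of_annihilates (ψ := fun i t => (Ψ i t).re) (fun i => ?_) (fun i t => ?_) ?_ ?_
    · exact continuous_re.comp ((continuous_const.mul (h.loop i).cont_deriv).mul
        ((hGc i).mul (hG1c i)))
    · simp only [hΨ]
      rw [(h.loop i).per, (h.loop i).per_deriv]
    · intro w hw
      have e1 := h.res_comb (AO.inv_sub hw) hb hz hbz (2 * Real.pi) (-l)
        (-l * conj c * (2 * Real.pi)) c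
      have e2 : ∑ i, CI (γ i) (fun t => ((Ψ i t).re : ℂ)) w = (I * conj l) *
          bint (fun i t => (γ i t - w)⁻¹ * (G (γ i t) * G1 (γ i t)) * deriv (γ i) t) := by
        rw [← bint_const_mul]
        refine Finset.sum_congr rfl fun i _ => ?_
        rw [CI]
        congr 1
        ext t
        rw [hreal]
        simp only [hΨ]
        ring
      rw [e2, e1, h.antisymm hb hz hbz]
      have e3 := congrArg conj h0
      simp only [map_sub, map_mul, conj_ofReal, map_ofNat, map_zero] at e3
      rw [← h.herm hb hz] at e3
      have e4 : (2 * Real.pi * S z b) = l * gar Ω γ S b z := sub_eq_zero.1 h0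
      have e5 : 2 * Real.pi * S b z = conj l * conj (gar Ω γ S b z) := sub_eq_zero.1 e3
      refine mul_eq_zero_of_right _ (mul_eq_zero_of_right _ ?_)
      linear_combination (c * (z - w)⁻¹) * e4 + (l ^ 2 * conj c * (b - w)⁻¹) * e5 +
        (l * (b - w)⁻¹) * hcl + (l * conj c * (b - w)⁻¹ * conj (gar Ω γ S b z)) * hl
    · intro i
      obtain ⟨t, ht⟩ := (h.loop i).exists_zero_of_nonneg (hGc i)
        (by have := (h.loop i).per 0; rw [zero_add] at this; rw [this])
        (mul_ne_zero I_ne_zero hl0) (fun t => ⟨‖G (γ i t)‖ ^ 2 * ‖deriv (γ i) t‖, by positivity, by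
          push_cast
          rw [norm_sq_eq]
          linear_combination -G (γ i t) * hGb i t⟩)
      refine ⟨t, ?_⟩
      simp only [hΨ]
      rw [ht]
      simp
  have hGG : ∀ i t, G (γ i t) * G1 (γ i t) = 0 := by
    intro i t
    have := hreal i t
    rw [hψ0, ofReal_zero] at this
    exact (mul_eq_zero.1 this.symm).resolve_left
      (mul_ne_zero (mul_ne_zero I_ne_zero hl0) ((h.loop i).ne t))
  set g : ℂ → ℂ := fun ζ => (ζ - b) * ((2 * Real.pi) * S ζ b) + (-l) * garL Ω γ S b ζ with hg
  set g1 : ℂ → ℂ := fun ζ => (ζ - z) * ((-l * conj c * (2 * Real.pi)) * S ζ z) +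
    c * garL Ω γ S z ζ with hg1
  have hgA : AO Ω g := ((AO.sub_const Ω b).mul ((AO.const Ω _).mul (h.ao b hb))).add
    ((AO.const Ω _).mul (h.ao_garL hb))
  have hg1A : AO Ω g1 := ((AO.sub_const Ω z).mul ((AO.const Ω _).mul (h.ao z hz))).add
    ((AO.const Ω _).mul (h.ao_garL hz))
  have hprod : ∀ ζ ∈ Ω, g ζ * g1 ζ = 0 := fun ζ hζ =>
    h.eq_zero_of_boundary (hgA.mul hg1A) (fun i t => by
      have e1 : g (γ i t) = (γ i t - b) * G (γ i t) := by
        simp only [hg, hG]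
        rw [garL_eq (h.off_of_mem hb i t)]; ring
      have e2 : g1 (γ i t) = (γ i t - z) * G1 (γ i t) := by
        simp only [hg1, hG1]
        rw [garL_eq (h.off_of_mem hz i t)]; ring
      rw [e1, e2, mul_mul_mul_comm, hGG, mul_zero]) hζ
  rcases (hgA.1.analyticOnNhd h.isOpen).eq_zero_or_eq_zero_of_mul_eq_zero
    (hg1A.1.analyticOnNhd h.isOpen) hprod h.conn.isPreconnected with h1 | h1
  · have := h1 b hb
    simp only [hg, garL_self, sub_self, zero_mul, zero_add, mul_one, neg_eq_zero] at this
    rw [this, zero_mul] at hl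
    exact zero_ne_one hl
  · have := h1 z hz
    simp only [hg1, garL_self, sub_self, zero_mul, zero_add, mul_one] at this
    exact hc this

theorem norm_lt_garL (h : Szego Ω γ S) {b : ℂ} (hb : b ∈ Ω) {z : ℂ} (hz : z ∈ Ω) :
    ‖2 * Real.pi * S z b * (z - b)‖ < ‖garL Ω γ S b z‖ := by
  by_contra! hle
  have hcont : ContinuousOn (fun z => ‖garL Ω γ S b z‖ - ‖2 * Real.pi * S z b * (z - b)‖) Ω :=
    (h.ao_garL hb).1.continuousOn.norm.sub
      (((continuousOn_const.mul (h.ao b hb).1.continuousOn).mul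
        (continuousOn_id.sub continuousOn_const)).norm)
  have := h.conn.isPreconnected.image _ hcont
  obtain ⟨w, hw, hw0⟩ := this.Icc_subset ⟨z, hz, rfl⟩ ⟨b, hb, rfl⟩
    (show (0 : ℝ) ∈ _ from ⟨sub_nonpos.2 hle, by beta_reduce; rw [garL_self]; simp⟩)
  have hwb : b ≠ w := by
    rintro rfl
    beta_reduce at hw0
    rw [garL_self] at hw0
    simp at hw0
  have hsub : w - b ≠ 0 := sub_ne_zero.2 hwb.symm
  have hn : ‖gar Ω γ S b w‖ = ‖2 * Real.pi * S w b‖ := by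
    have := sub_eq_zero.1 hw0
    rw [garL_eq hwb.symm, norm_mul, norm_mul _ (w - b), mul_comm] at this
    exact mul_right_cancel₀ (norm_ne_zero_iff.2 hsub) this
  by_cases hg0 : gar Ω γ S b w = 0
  · rw [hg0, norm_zero] at hn
    refine h.comb_ne_zero hb hw hwb (l := 1) (by simp) ?_
    rw [norm_eq_zero.1 hn.symm, hg0]
    simp
  · refine h.comb_ne_zero hb hw hwb (l := 2 * Real.pi * S w b / gar Ω γ S b w) ?_ ?_
    · rw [Complex.mul_conj, normSq_eq_norm_sq, norm_div, hn, div_self (by rw [← hn]; exact norm_ne_zero_iff.2 hg0)]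
      simp
    · rw [div_mul_cancel₀ _ hg0, sub_self]

theorem garL_ne_zero (h : Szego Ω γ S) {b : ℂ} (hb : b ∈ Ω) {z : ℂ} (hz : z ∈ Ω) :
    garL Ω γ S b z ≠ 0 :=
  norm_pos_iff.1 ((norm_nonneg _).trans_lt (h.norm_lt_garL hb hz))

end Szego

/-- The quotient of the Szegő and Garabedian kernels. -/
def ahl (Ω : Set ℂ) {n : ℕ} (γ : Fin n → ℝ → ℂ) (S : ℂ → ℂ → ℂ) (b z : ℂ) : ℂ :=
  2 * Real.pi * S z b * (z - b) / garL Ω γ S b z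

namespace Szego

variable {Ω : Set ℂ} {n : ℕ} {γ : Fin n → ℝ → ℂ} {S : ℂ → ℂ → ℂ}

theorem ahl_differentiableOn (h : Szego Ω γ S) {b : ℂ} (hb : b ∈ Ω) :
    DifferentiableOn ℂ (ahl Ω γ S b) Ω :=
  (((h.ao b hb).1.const_mul _).mul (differentiableOn_id.sub_const b)).div (h.ao_garL hb).1
    fun _ hz => h.garL_ne_zero hb hz

theorem norm_ahl_lt (h : Szego Ω γ S) {b : ℂ} (hb : b ∈ Ω) {z : ℂ} (hz : z ∈ Ω) :
    ‖ahl Ω γ S b z‖ < 1 := by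
  rw [ahl, norm_div, div_lt_one (norm_pos_iff.2 (h.garL_ne_zero hb hz))]
  exact h.norm_lt_garL hb hz

theorem ahl_deriv (h : Szego Ω γ S) {b : ℂ} (hb : b ∈ Ω) :
    deriv (ahl Ω γ S b) b = 2 * Real.pi * S b b := by
  have hn := h.isOpen.mem_nhds hb
  have h1 := ((h.ao b hb).1.differentiableAt hn).hasDerivAt
  have h2 := ((h.ao_garL hb).1.differentiableAt hn).hasDerivAt
  have h3 := ((h1.const_mul (2 * Real.pi : ℂ)).mul ((hasDerivAt_id b).sub_const b)).div h2
    (h.garL_ne_zero hb hb)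
  have := h3.deriv
  simp only [id, Pi.mul_apply, sub_self, mul_zero, zero_add, mul_one, garL_self, zero_mul, sub_zero,
    one_pow, div_one] at this
  exact this

end Szego

namespace Szego

variable {Ω : Set ℂ} {n : ℕ} {γ : Fin n → ℝ → ℂ} {S : ℂ → ℂ → ℂ}

theorem garK_self (h : Szego Ω γ S) {b : ℂ} (hb : b ∈ Ω) : garK Ω γ S b b = 0 := by
  have hK := (h.garK_spec hb).1
  have h1 := h.bint_cauchy_formula hK hb
  have h2 := h.bint_cauchy (hK.mul hK)
  have h3 := h.bint_cauchy ((h.ao b hb).mul (h.ao b hb))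
  have h4 := congrArg conj h3
  rw [conj_bint, map_zero] at h4
  have h5 : bint (fun i t => ((γ i t - b) ^ 2)⁻¹ * deriv (γ i) t) = 0 := by
    rw [← h.cint_inv_sq (s := 0) (b := b) (fun i t => by rw [nrm_zero]; exact h.off_of_mem hb i t)]
    simp only [bint, cint, nrm_zero, nrm'_zero]
  have e1 : bint (fun i t => gar Ω γ S b (γ i t) ^ 2 * deriv (γ i) t) =
      (2 * Real.pi * I) ^ 2 * bint (fun i t => conj (S (γ i t) b * S (γ i t) b * deriv (γ i) t)) := by
    rw [← bint_const_mul]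
    refine bint_congr fun i t => ?_
    refine mul_right_cancel₀ ((h.loop i).ne t) ?_
    have : gar Ω γ S b (γ i t) ^ 2 * deriv (γ i) t * deriv (γ i) t =
      (gar Ω γ S b (γ i t) * deriv (γ i) t) ^ 2 := by ring
    rw [this, h.gar_bdry hb, map_mul, map_mul]
    have := norm_sq_eq (deriv (γ i) t)
    linear_combination (2 * Real.pi * I) ^ 2 * (conj (S (γ i t) b) * conj (S (γ i t) b)) * this
  have c0 := fun i => (h.loop i).cont_deriv
  have c1 := fun i => h.cont_inv hb i
  have c2 := fun i => h.cont_comp hK.2 i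
  have c3 : ∀ i, Continuous fun t => ((γ i t - b) ^ 2)⁻¹ * deriv (γ i) t := fun i => by
    refine (((c1 i).pow 2).mul (c0 i)).congr fun t => ?_
    simp only [Pi.mul_apply, Pi.pow_apply, inv_pow]
  have c4 := fun i => (((c2 i).mul (c1 i)).mul (c0 i)).const_mul 2
  have c5 := fun i => ((c2 i).mul (c2 i)).mul (c0 i)
  have e2 : bint (fun i t => gar Ω γ S b (γ i t) ^ 2 * deriv (γ i) t) =
      bint (fun i t => ((γ i t - b) ^ 2)⁻¹ * deriv (γ i) t +
        (2 * (garK Ω γ S b (γ i t) * (γ i t - b)⁻¹ * deriv (γ i) t) +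
        garK Ω γ S b (γ i t) * garK Ω γ S b (γ i t) * deriv (γ i) t)) :=
    bint_congr fun i t => by
      rw [gar, ← inv_pow]; ring
  rw [e1, h4, bint_add, bint_add, bint_const_mul, h1, h2, h5] at e2
  · have := e2.symm
    simpa [Real.pi_ne_zero] using this
  exacts [c4, c5, c3, fun i => (c4 i).add (c5 i)]

theorem deriv_mul_garL_sq (h : Szego Ω γ S) {b : ℂ} (hb : b ∈ Ω) {f : ℂ → ℂ}
    (hf : DifferentiableOn ℂ f Ω) :
    deriv (fun z => f z * garL Ω γ S b z ^ 2) b = deriv f b := by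
  have hn := h.isOpen.mem_nhds hb
  have h1 := (hf.differentiableAt hn).hasDerivAt
  have h2 := ((h.garK_spec hb).1.1.differentiableAt hn).hasDerivAt
  have h3 : HasDerivAt (garL Ω γ S b) (1 * garK Ω γ S b b + (b - b) * _) b :=
    (((hasDerivAt_id b).sub_const b).mul h2).const_add 1
  rw [h.garK_self hb, sub_self, zero_mul, mul_zero, add_zero] at h3
  have h4 := (h1.mul (h3.pow 2)).deriv
  simp only [garL_self, mul_zero, add_zero, one_pow, mul_one, Pi.pow_apply] at h4
  exact h4

theorem norm_deriv_le (h : Szego Ω γ S) {b : ℂ} (hb : b ∈ Ω) {f : ℂ → ℂ}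
    (hf : DifferentiableOn ℂ f Ω) (hf1 : ∀ z ∈ Ω, ‖f z‖ < 1) :
    ‖deriv f b‖ ≤ (2 * Real.pi * S b b).re := by
  obtain ⟨δ1, hδ1, H1⟩ := h.cauchy_deriv (hf.mul ((h.ao_garL hb).1.pow 2)) hb
  obtain ⟨δ2, hδ2, H2⟩ := h.side
  obtain ⟨r, hr, δ3, hδ3, H3⟩ := h.exists_far (h.notMem_frontier hb)
  have hδ : 0 < min δ1 (min δ2 δ3) := by positivity
  set δ := min δ1 (min δ2 δ3) with hδdef
  have l1 : δ ≤ δ1 := min_le_left _ _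
  have l2 : δ ≤ δ2 := (min_le_right _ _).trans (min_le_left _ _)
  have l3 : δ ≤ δ3 := (min_le_right _ _).trans (min_le_right _ _)
  set g : ℂ → ℂ := fun z => ((‖garL Ω γ S b z ^ 2 / (z - b) ^ 2‖ : ℝ) : ℂ) with hg
  set V := closure Ω \ {b} with hV
  have hgV : ContinuousOn g V := by
    refine continuous_ofReal.comp_continuousOn (ContinuousOn.norm (ContinuousOn.div ?_ ?_ ?_))
    · exact ((h.ao_garL hb).2.mono sdiff_subset).pow 2
    · exact (continuousOn_id.sub continuousOn_const).pow 2
    · exact fun z hz => pow_ne_zero 2 (sub_ne_zero.2 hz.2)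
  have hin : ∀ i t s, 0 ≤ s → s < δ → nrm (γ i) t s ∈ V := by
    intro i t s hs hsδ
    refine ⟨?_, fun h0 => ?_⟩
    · rcases hs.eq_or_lt with rfl | hs
      · rw [nrm_zero]; exact h.mem_closure i t
      · exact subset_closure (H2 i t s hs (hsδ.trans_le l2)).1
    · have := H3 i t s (by rw [abs_of_nonneg hs]; exact hsδ.trans_le l3)
      rw [h0, sub_self, norm_zero] at this
      linarith
  have hk : ∀ i, Continuous fun p : ℝ × ℝ => ((‖nrm' (γ i) p.1 p.2‖ : ℝ) : ℂ) := fun i =>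
    continuous_ofReal.comp (h.loop i).continuous_nrm'.norm
  have htend : Tendsto (fun s => ∑ i, ∫ t in (0 : ℝ)..(2 * Real.pi),
      g (nrm (γ i) t s) * ((‖nrm' (γ i) t s‖ : ℝ) : ℂ)) (𝓝[>] 0)
      (𝓝 (∑ i, ∫ t in (0 : ℝ)..(2 * Real.pi), g (γ i t) * ((‖nrm' (γ i) t 0‖ : ℝ) : ℂ))) :=
    tendsto_finsetSum _ fun i _ => (h.loop i).tendsto_integral_nrm hgV hδ (hin i) (hk i)
  have hlim : (∑ i, ∫ t in (0 : ℝ)..(2 * Real.pi), g (γ i t) * ((‖nrm' (γ i) t 0‖ : ℝ) : ℂ)) =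
      4 * Real.pi ^ 2 * S b b := by
    rw [h.diag_eq hb, ← bint_ofReal, ← bint_const_mul]
    refine Finset.sum_congr rfl fun i _ => ?_
    congr 1
    ext t
    have hb' := h.off_of_mem hb i t
    have e1 := congrArg norm (h.gar_bdry hb i t)
    have h0 : (‖deriv (γ i) t‖ : ℝ) ≠ 0 := norm_ne_zero_iff.2 ((h.loop i).ne t)
    simp only [norm_mul, norm_I, mul_one, RCLike.norm_conj, norm_real, norm_norm, norm_ofNat,
      Real.norm_of_nonneg Real.pi_pos.le, ← mul_assoc] at e1
    have e2 := mul_right_cancel₀ h0 e1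
    simp only [hg]
    rw [nrm'_zero, garL_eq hb', ← div_pow, mul_div_cancel_left₀ _ (sub_ne_zero.2 hb'), norm_pow, e2]
    push_cast
    ring
  rw [hlim] at htend
  have hle : ∀ s ∈ Ioo 0 δ, 2 * Real.pi * ‖deriv f b‖ ≤ (∑ i, ∫ t in (0 : ℝ)..(2 * Real.pi),
      g (nrm (γ i) t s) * ((‖nrm' (γ i) t s‖ : ℝ) : ℂ)).re := by
    intro s hs
    have e1 := H1 s ⟨hs.1, hs.2.trans_le l1⟩
    have e0 := h.deriv_mul_garL_sq hb hf
    have e1' := e1.trans (congrArg (2 * Real.pi * I * ·) e0)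
    have e2 := congrArg norm e1'
    simp only [norm_mul, norm_I, mul_one, norm_real, norm_ofNat,
      Real.norm_of_nonneg Real.pi_pos.le] at e2
    rw [← e2, cint, re_sum]
    refine (norm_sum_le _ _).trans (Finset.sum_le_sum fun i _ => ?_)
    have hc1 : Continuous fun t => g (nrm (γ i) t s) * ((‖nrm' (γ i) t s‖ : ℝ) : ℂ) :=
      (hgV.comp_continuous ((h.loop i).continuous_nrm_fst s)
        fun t => hin i t s hs.1.le hs.2).mul (continuous_ofReal.comp
          ((h.loop i).continuous_nrm'_fst s).norm)
    have e3 : (∫ t in (0 : ℝ)..(2 * Real.pi), g (nrm (γ i) t s) * ((‖nrm' (γ i) t s‖ : ℝ) : ℂ)) =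
        ((∫ t in (0 : ℝ)..(2 * Real.pi), ‖garL Ω γ S b (nrm (γ i) t s) ^ 2 /
          (nrm (γ i) t s - b) ^ 2‖ * ‖nrm' (γ i) t s‖ : ℝ) : ℂ) := by
      rw [← intervalIntegral.integral_ofReal]
      congr 1
      ext t
      simp only [hg]
      push_cast
      ring
    rw [e3, ofReal_re]
    refine intervalIntegral.norm_integral_le_of_norm_le (by positivity) ?_ ?_
    · refine Eventually.of_forall fun t _ => ?_
      rw [norm_mul]
      refine mul_le_mul_of_nonneg_right ?_ (norm_nonneg _)
      have hmem := (H2 i t s hs.1 (hs.2.trans_le l2)).1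
      have := (hf1 _ hmem).le
      simp only [Pi.mul_apply, Pi.pow_apply]
      rw [mul_div_assoc, norm_mul]
      exact mul_le_of_le_one_left (norm_nonneg _) this
    · have := continuous_re.comp hc1
      refine Continuous.intervalIntegrable ?_ _ _
      refine this.congr fun t => ?_
      simp only [Function.comp, hg]
      rw [← ofReal_mul, ofReal_re]
  have hfin := ge_of_tendsto ((continuous_re.tendsto _).comp htend)
    (by filter_upwards [Ioo_mem_nhdsGT hδ] with s hs using hle s hs)
  have e4 : (4 * Real.pi ^ 2 * S b b : ℂ).re = 2 * Real.pi * (2 * Real.pi * S b b : ℂ).re := by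
    have : (4 * Real.pi ^ 2 * S b b : ℂ) = ((2 * Real.pi : ℝ) : ℂ) * (2 * Real.pi * S b b) := by
      push_cast; ring
    rw [this, re_ofReal_mul]
  rw [e4] at hfin
  exact le_of_mul_le_mul_left hfin (by positivity)

theorem isAhlforsMap (h : Szego Ω γ S) {b : ℂ} (hb : b ∈ Ω) : IsAhlforsMap Ω b (ahl Ω γ S b) := by
  have hd : 2 * Real.pi * S b b = ((2 * Real.pi *
      ∑ i, ∫ t in (0 : ℝ)..(2 * Real.pi), ‖S (γ i t) b‖ ^ 2 * ‖deriv (γ i) t‖ : ℝ) : ℂ) := by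
    rw [h.diag_eq hb]; push_cast; rfl
  refine ⟨h.ahl_differentiableOn hb, fun z hz => h.norm_ahl_lt hb hz, ?_, ?_, fun g hg hg1 => ?_⟩
  · rw [h.ahl_deriv hb, hd, ofReal_im]
  · rw [h.ahl_deriv hb, hd, ofReal_re]
    exact mul_pos (by positivity) (h.diag_pos hb)
  · rw [h.ahl_deriv hb]
    exact h.norm_deriv_le hb hg hg1

end Szego

/-- A bounded domain such that each boundary point is the endpoint of a segment outside it. -/
structure SegDom (Ω : Set ℂ) : Prop where
  isOpen : IsOpen Ω
  conn : IsConnected Ω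
  bdd : Bornology.IsBounded Ω
  seg : ∀ p ∈ frontier Ω, ∃ q, q ≠ p ∧ ∀ x ∈ segment ℝ p q, x ∉ Ω

theorem Bdry.segDom {Ω : Set ℂ} {n : ℕ} {γ : Fin n → ℝ → ℂ} (h : Bdry Ω γ) : SegDom Ω where
  isOpen := h.isOpen
  conn := h.conn
  bdd := h.bdd
  seg p hp := by
    obtain ⟨i, t, rfl⟩ := h.eq_of_frontier hp
    obtain ⟨δ, hδ, hside⟩ := h.side
    have hI : I * deriv (γ i) t ≠ 0 := mul_ne_zero I_ne_zero ((h.loop i).ne t)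
    refine ⟨nrm (γ i) t (-(δ / 2)), fun h0 => ?_, fun x hx => ?_⟩
    · have := (hside i t (δ / 2) (by positivity) (by linarith)).2
      rw [h0] at this
      exact this (h.mem_closure i t)
    · rw [segment_eq_image'] at hx
      obtain ⟨θ, hθ, rfl⟩ := hx
      have e : γ i t + θ • (nrm (γ i) t (-(δ / 2)) - γ i t) = nrm (γ i) t (-(θ * (δ / 2))) := by
        simp only [nrm, real_smul]; push_cast; ring
      beta_reduce
      rw [e]
      rcases hθ.1.eq_or_lt with h0 | h0
      · rw [← h0, zero_mul, neg_zero, nrm_zero]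
        exact h.notMem i t
      · refine fun h' => (hside i t (θ * (δ / 2)) (by positivity) ?_).2 (subset_closure h')
        nlinarith [hθ.2]

namespace SegDom

variable {Ω : Set ℂ}

theorem notMem (h : SegDom Ω) {p : ℂ} (hp : p ∈ frontier Ω) : p ∉ Ω := by
  rw [h.isOpen.frontier_eq] at hp; exact hp.2

theorem exists_frontier (h : SegDom Ω) : ∃ p, p ∈ frontier Ω := by
  rw [← Set.Nonempty, nonempty_frontier_iff]
  refine ⟨h.conn.nonempty, fun h0 => ?_⟩
  have := h.bdd
  rw [h0] at this
  exact NormedSpace.unbounded_univ ℂ ℂ this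

/-- The maximum principle with boundary control in the `limsup` sense. -/
theorem norm_le_of_frontier (h : SegDom Ω) {V : ℂ → ℂ} (hV : DifferentiableOn ℂ V Ω) {M : ℝ}
    (hb : ∀ p ∈ frontier Ω, ∀ M' > M, ∀ᶠ z in 𝓝[Ω] p, ‖V z‖ ≤ M') {z : ℂ} (hz : z ∈ Ω) :
    ‖V z‖ ≤ M := by
  by_contra! hlt
  obtain ⟨M', hM', hM'z⟩ := exists_between hlt
  set K := {x ∈ Ω | ‖V z‖ ≤ ‖V x‖} with hK
  have hKc : IsClosed K := by
    rw [← closure_subset_iff_isClosed]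
    intro x hx
    have hfreq : ∃ᶠ y in 𝓝[Ω] x, ‖V z‖ ≤ ‖V y‖ := by
      have := mem_closure_iff_frequently.1 hx
      rw [frequently_nhdsWithin_iff]
      exact this.mono fun y hy => ⟨hy.2, hy.1⟩
    by_cases hxΩ : x ∈ Ω
    · refine ⟨hxΩ, ?_⟩
      have := (hV.continuousOn x hxΩ).norm
      by_contra! hlt'
      exact hfreq ((this.eventually (gt_mem_nhds hlt')).mono fun y hy => not_le.2 hy)
    · have hxf : x ∈ frontier Ω :=
        mem_frontier_of_closure (closure_mono (sep_subset _ _) hx) hxΩ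
      exact absurd ((hb x hxf M' hM').mono fun y hy => not_le.2 (hy.trans_lt hM'z)) hfreq
  have hKcomp : IsCompact K :=
    Metric.isCompact_of_isClosed_isBounded hKc (h.bdd.subset (sep_subset _ _))
  obtain ⟨z1, hz1, hmax⟩ := hKcomp.exists_isMaxOn ⟨z, hz, le_rfl⟩
    ((hV.continuousOn.mono (sep_subset _ _)).norm)
  have hmax' : IsMaxOn (norm ∘ V) Ω z1 := by
    intro x hx
    by_cases hxK : ‖V z‖ ≤ ‖V x‖
    · exact hmax ⟨hx, hxK⟩
    · exact (not_le.1 hxK).le.trans hz1.2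
  have hconst := Complex.norm_eqOn_of_isPreconnected_of_isMaxOn h.conn.isPreconnected h.isOpen hV
    hz1.1 hmax'
  obtain ⟨p, hp⟩ := h.exists_frontier
  have : (𝓝[Ω] p).NeBot := mem_closure_iff_nhdsWithin_neBot.1 (frontier_subset_closure hp)
  obtain ⟨y, hy, hyΩ⟩ := ((hb p hp M' hM').and self_mem_nhdsWithin).exists
  have := hconst hyΩ
  simp only [Function.comp, Function.const] at this
  linarith [hz1.2]

/-- A function that is locally bounded near each boundary point is bounded. -/
theorem exists_bound (h : SegDom Ω) {f : ℂ → ℂ} (hf : ContinuousOn f Ω)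
    (hb : ∀ p ∈ frontier Ω, ∃ C, ∀ᶠ z in 𝓝[Ω] p, ‖f z‖ ≤ C) : ∃ C, ∀ z ∈ Ω, ‖f z‖ ≤ C := by
  have hc : IsCompact (closure Ω) := h.bdd.isCompact_closure
  have := hc.induction_on (p := fun s => ∃ C, ∀ z ∈ s, z ∈ Ω → ‖f z‖ ≤ C) ⟨0, by simp⟩
    (fun s t hst ⟨C, hC⟩ => ⟨C, fun z hz => hC z (hst hz)⟩)
    (fun s t ⟨C, hC⟩ ⟨C', hC'⟩ => ⟨max C C', fun z hz hzΩ => hz.elim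
      (fun hs => (hC z hs hzΩ).trans (le_max_left _ _))
      (fun ht => (hC' z ht hzΩ).trans (le_max_right _ _))⟩)
    (fun x hx => ?_)
  · obtain ⟨C, hC⟩ := this
    exact ⟨C, fun z hz => hC z (subset_closure hz) hz⟩
  · have : ∃ C, ∀ᶠ z in 𝓝[Ω] x, ‖f z‖ ≤ C := by
      by_cases hxΩ : x ∈ Ω
      · exact ⟨‖f x‖ + 1, (hf x hxΩ).norm.eventually (ge_mem_nhds (lt_add_one _))⟩
      · exact hb x (mem_frontier_of_closure hx hxΩ)
    obtain ⟨C, hC⟩ := this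
    rw [eventually_nhdsWithin_iff] at hC
    exact ⟨{z | z ∈ Ω → ‖f z‖ ≤ C}, mem_nhdsWithin_of_mem_nhds hC, C, fun z hz => hz⟩

end SegDom

/-- The Möbius coordinate sending a segment to the negative half-axis. -/
theorem div_mem_slitPlane {p q z : ℂ} (hz : z ∉ segment ℝ p q) : (z - p) / (z - q) ∈ slitPlane := by
  have hzq : z - q ≠ 0 := fun h0 => hz (by rw [sub_eq_zero.1 h0]; exact right_mem_segment ℝ p q)
  rw [mem_slitPlane_iff_not_le_zero]
  intro hle
  obtain ⟨r, hr⟩ : ∃ r : ℝ, (z - p) / (z - q) = -r := by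
    refine ⟨-((z - p) / (z - q)).re, ?_⟩
    apply Complex.ext
    · simp
    · have := (Complex.le_def.1 hle).2
      simpa using this
  have hr0 : 0 ≤ r := by
    rw [hr] at hle
    have := (Complex.le_def.1 hle).1
    simpa using this
  rw [div_eq_iff hzq] at hr
  apply hz
  rw [segment_eq_image']
  refine ⟨r / (1 + r), ⟨by positivity, (div_le_one (by positivity)).2 (by linarith)⟩, ?_⟩
  have h1 : (1 + r : ℂ) ≠ 0 := by
    have : (1 + r : ℝ) ≠ 0 := by positivity
    exact_mod_cast this
  simp only [real_smul]
  push_cast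
  field_simp
  linear_combination -hr

theorem re_exp_neg_log_ge {w : ℂ} :
    Real.cos (Real.pi / 4) * Real.exp (-(Real.log ‖w‖ / 4)) ≤ (cexp (-(log w / 4))).re := by
  rw [exp_re]
  have e1 : (-(log w / 4)).re = -(Real.log ‖w‖ / 4) := by
    have : log w / 4 = log w / (4 : ℝ) := by push_cast; rfl
    rw [neg_re, this, div_ofReal_re, log_re]
  have e2 : (-(log w / 4)).im = -(w.arg / 4) := by
    have : log w / 4 = log w / (4 : ℝ) := by push_cast; rfl
    rw [neg_im, this, div_ofReal_im, log_im]
  rw [e1, e2, Real.cos_neg, mul_comm]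
  refine mul_le_mul_of_nonneg_left ?_ (Real.exp_pos _).le
  rw [← Real.cos_abs (w.arg / 4)]
  refine Real.cos_le_cos_of_nonneg_of_le_pi (abs_nonneg _) (by linarith [Real.pi_pos]) ?_
  rw [abs_div, abs_of_pos (show (0:ℝ) < 4 by norm_num)]
  linarith [abs_arg_le_pi w]

namespace SegDom

variable {Ω : Set ℂ}

/-- A Phragmén–Lindelöf principle with finitely many exceptional boundary points. -/
theorem norm_le_of_frontier_off (h : SegDom Ω) {V : ℂ → ℂ} (hV : DifferentiableOn ℂ V Ω)
    {c : Polynomial ℂ} (hc : c ≠ 0) {C : ℝ} (hgrow : ∀ z ∈ Ω, ‖V z‖ * ‖c.eval z‖ ≤ C)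
    {M : ℝ} (hM : 0 ≤ M)
    (hb : ∀ p ∈ frontier Ω, c.eval p ≠ 0 → ∀ M' > M, ∀ᶠ z in 𝓝[Ω] p, ‖V z‖ ≤ M')
    {z : ℂ} (hz : z ∈ Ω) : ‖V z‖ ≤ M := by
  classical
  choose! q hq hseg using h.seg
  set T := c.roots.toFinset.filter (· ∈ frontier Ω) with hT
  have hTf : ∀ p ∈ T, p ∈ frontier Ω := fun p hp => (Finset.mem_filter.1 hp).2
  set w : ℂ → ℂ → ℂ := fun p z => (z - p) / (z - q p) with hw
  set U : ℂ → ℂ := fun z => ∑ p ∈ T, cexp (-(log (w p z) / 4)) with hU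
  have hslit : ∀ p ∈ T, ∀ z ∈ Ω, w p z ∈ slitPlane := fun p hp z hz =>
    div_mem_slitPlane fun h' => hseg p (hTf p hp) z h' hz
  have hzq : ∀ p ∈ T, ∀ z ∈ Ω, z - q p ≠ 0 := fun p hp z hz h0 =>
    hseg p (hTf p hp) _ (right_mem_segment ℝ p (q p)) (by rw [← sub_eq_zero.1 h0]; exact hz)
  have hUd : DifferentiableOn ℂ U Ω := by
    refine DifferentiableOn.fun_sum fun p hp => ?_
    refine ((DifferentiableOn.clog ?_ (hslit p hp)).div_const 4).neg.cexp
    exact (differentiableOn_id.sub_const p).div (differentiableOn_id.sub_const _) (hzq p hp)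
  have hcos : 0 < Real.cos (Real.pi / 4) := by rw [Real.cos_pi_div_four]; positivity
  have hre : ∀ p z, 0 < (cexp (-(log (w p z) / 4))).re := fun p z =>
    (mul_pos hcos (Real.exp_pos _)).trans_le re_exp_neg_log_ge
  have hUre : ∀ p ∈ T, ∀ z, Real.cos (Real.pi / 4) * Real.exp (-(Real.log ‖w p z‖ / 4)) ≤
      (U z).re := by
    intro p hp z
    simp only [hU, re_sum]
    exact re_exp_neg_log_ge.trans
      (Finset.single_le_sum (f := fun p => (cexp (-(log (w p z) / 4))).re)
        (fun p _ => (hre p z).le) hp)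
  have hUre0 : ∀ z, 0 ≤ (U z).re := fun z => by
    simp only [hU, re_sum]
    exact Finset.sum_nonneg fun p _ => (hre p z).le
  have key : ∀ ε > 0, ‖V z‖ * Real.exp (-(ε * (U z).re)) ≤ M := by
    intro ε hε
    have hnorm : ∀ z, ‖V z * cexp (-(ε * U z))‖ = ‖V z‖ * Real.exp (-(ε * (U z).re)) := by
      intro z
      rw [norm_mul, norm_exp, neg_re, re_ofReal_mul]
    rw [← hnorm]
    refine h.norm_le_of_frontier (V := fun z => V z * cexp (-(ε * U z)))
      (hV.mul (hUd.const_mul _).neg.cexp) (fun p hp M' hM' => ?_) hz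
    by_cases hcp : c.eval p = 0
    swap
    · filter_upwards [hb p hp hcp M' hM'] with x hx
      rw [hnorm]
      refine (mul_le_of_le_one_right (norm_nonneg _) ?_).trans hx
      rw [Real.exp_le_one_iff]
      have := mul_nonneg hε.le (hUre0 x)
      linarith
    · have hpT : p ∈ T := Finset.mem_filter.2
        ⟨by rw [Multiset.mem_toFinset, Polynomial.mem_roots hc]; exact hcp, hp⟩
      obtain ⟨g, hg, hgp⟩ := Polynomial.exists_eq_pow_rootMultiplicity_mul_and_not_dvd c hc p
      set m := Polynomial.rootMultiplicity p c
      have hgp0 : g.eval p ≠ 0 := fun h0 => hgp (Polynomial.dvd_iff_isRoot.2 h0)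
      have hpq : p - q p ≠ 0 := sub_ne_zero.2 (hq p hp).symm
      set x : ℂ → ℝ := fun z => Real.exp (-(Real.log ‖w p z‖ / 4)) with hx
      have hwt : Tendsto (fun z => ‖w p z‖) (𝓝[Ω] p) (𝓝[>] 0) := by
        refine tendsto_nhdsWithin_of_tendsto_nhds_of_eventually_within _ ?_ ?_
        · have : ContinuousAt (fun z => ‖w p z‖) p :=
            ((continuousAt_id.sub continuousAt_const).div
              (continuousAt_id.sub continuousAt_const) hpq).norm
          have h2 := this.tendsto
          simp only [hw, sub_self, zero_div, norm_zero] at h2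
          exact h2.mono_left nhdsWithin_le_nhds
        · filter_upwards [self_mem_nhdsWithin] with z hz
          exact norm_pos_iff.2 (slitPlane_ne_zero (hslit p hpT z hz))
      have hxt : Tendsto x (𝓝[Ω] p) atTop := by
        refine Real.tendsto_exp_atTop.comp ?_
        refine tendsto_neg_atBot_atTop.comp ?_
        exact (Real.tendsto_log_nhdsGT_zero.comp hwt).atBot_div_const (by norm_num)
      have ha : 0 < ε * Real.cos (Real.pi / 4) := mul_pos hε hcos
      have hlim1 : Tendsto (fun y : ℝ => y ^ (4 * m) * Real.exp (-(ε * Real.cos (Real.pi / 4)) * y))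
          atTop (𝓝 0) := by
        have := (Real.tendsto_pow_mul_exp_neg_atTop_nhds_zero (4 * m)).comp
          (tendsto_id.const_mul_atTop ha)
        have h2 := this.const_mul (((ε * Real.cos (Real.pi / 4)) ^ (4 * m))⁻¹)
        rw [mul_zero] at h2
        refine h2.congr fun y => ?_
        simp only [Function.comp, id, mul_pow]
        have : ((ε * Real.cos (Real.pi / 4)) ^ (4 * m)) ≠ 0 := (pow_pos ha _).ne'
        rw [← mul_pow ε]
        field_simp
      have hlim2 : Tendsto (fun z => C / (‖z - q p‖ ^ m * ‖g.eval z‖) *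
          (x z ^ (4 * m) * Real.exp (-(ε * Real.cos (Real.pi / 4)) * x z))) (𝓝[Ω] p) (𝓝 0) := by
        have e1 : ContinuousAt (fun z => C / (‖z - q p‖ ^ m * ‖g.eval z‖)) p := by
          refine continuousAt_const.div ?_ ?_
          · exact (((continuousAt_id.sub continuousAt_const).norm).pow m).mul
              g.continuous.continuousAt.norm
          · exact mul_ne_zero (pow_ne_zero _ (norm_ne_zero_iff.2 hpq)) (norm_ne_zero_iff.2 hgp0)
        have := (e1.tendsto.mono_left (nhdsWithin_le_nhds (s := Ω))).mul (hlim1.comp hxt)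
        rw [mul_zero] at this
        exact this
      have hgne : ∀ᶠ z in 𝓝[Ω] p, g.eval z ≠ 0 :=
        mem_nhdsWithin_of_mem_nhds (g.continuous.continuousAt.eventually_ne hgp0)
      filter_upwards [hlim2.eventually (ge_mem_nhds (hM.trans_lt hM')), self_mem_nhdsWithin, hgne]
        with z hz1 hzΩ hgz
      rw [hnorm]
      refine le_trans ?_ hz1
      have hw0 : 0 < ‖w p z‖ := norm_pos_iff.2 (slitPlane_ne_zero (hslit p hpT z hzΩ))
      have hx4 : x z ^ (4 * m) = (‖w p z‖ ^ m)⁻¹ := by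
        rw [pow_mul, ← inv_pow]
        congr 1
        rw [hx]
        beta_reduce
        rw [← Real.exp_nat_mul, ← Real.exp_log hw0, ← Real.exp_neg, Real.log_exp]
        congr 1
        push_cast
        ring
      have hzq0 := norm_pos_iff.2 (hzq p hpT z hzΩ)
      have hzp : ‖z - p‖ = ‖w p z‖ * ‖z - q p‖ := by
        rw [← norm_mul, hw]
        beta_reduce
        rw [div_mul_cancel₀ _ (hzq p hpT z hzΩ)]
      have hgz0 := norm_pos_iff.2 hgz
      have hVz : ‖V z‖ ≤ C / (‖z - q p‖ ^ m * ‖g.eval z‖) * x z ^ (4 * m) := by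
        rw [hx4, ← div_eq_mul_inv, div_div, le_div_iff₀ (by positivity)]
        have := hgrow z hzΩ
        rw [hg, Polynomial.eval_mul, Polynomial.eval_pow, Polynomial.eval_sub, Polynomial.eval_X,
          Polynomial.eval_C, norm_mul, norm_pow, hzp, mul_pow] at this
        refine le_trans (le_of_eq ?_) this
        ring
      rw [← mul_assoc]
      refine mul_le_mul hVz ?_ (Real.exp_pos _).le ((norm_nonneg _).trans hVz)
      refine Real.exp_le_exp.2 ?_
      have := mul_le_mul_of_nonneg_left (hUre p hpT z) hε.le
      rw [hx]
      beta_reduce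
      linarith
  have hlim : Tendsto (fun ε : ℝ => ‖V z‖ * Real.exp (-(ε * (U z).re))) (𝓝[>] 0) (𝓝 ‖V z‖) := by
    have : ContinuousAt (fun ε : ℝ => ‖V z‖ * Real.exp (-(ε * (U z).re))) 0 := by fun_prop
    have h2 := this.tendsto
    simp only [zero_mul, neg_zero, Real.exp_zero, mul_one] at h2
    exact h2.mono_left nhdsWithin_le_nhds
  exact le_of_tendsto hlim (by filter_upwards [self_mem_nhdsWithin] with ε hε using key ε hε)

end SegDom

/-- Bounded holomorphic functions. -/
structure BH (Ω : Set ℂ) (f : ℂ → ℂ) : Prop where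
  diff : DifferentiableOn ℂ f Ω
  bdd : ∃ C, ∀ z ∈ Ω, ‖f z‖ ≤ C

namespace BH

variable {Ω : Set ℂ} {f g : ℂ → ℂ}

theorem const (c : ℂ) : BH Ω fun _ => c :=
  ⟨differentiableOn_const c, ‖c‖, fun _ _ => le_rfl⟩

theorem add (hf : BH Ω f) (hg : BH Ω g) : BH Ω fun z => f z + g z := by
  obtain ⟨C, hC⟩ := hf.bdd
  obtain ⟨C', hC'⟩ := hg.bdd
  exact ⟨hf.diff.add hg.diff, C + C', fun z hz => (norm_add_le _ _).trans
    (add_le_add (hC z hz) (hC' z hz))⟩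

theorem mul (hf : BH Ω f) (hg : BH Ω g) : BH Ω fun z => f z * g z := by
  obtain ⟨C, hC⟩ := hf.bdd
  obtain ⟨C', hC'⟩ := hg.bdd
  refine ⟨hf.diff.mul hg.diff, C * C', fun z hz => ?_⟩
  rw [norm_mul]
  exact mul_le_mul (hC z hz) (hC' z hz) (norm_nonneg _) ((norm_nonneg _).trans (hC z hz))

theorem const_mul (c : ℂ) (hf : BH Ω f) : BH Ω fun z => c * f z := (const c).mul hf

theorem sub (hf : BH Ω f) (hg : BH Ω g) : BH Ω fun z => f z - g z := by
  simpa only [neg_one_mul, ← sub_eq_add_neg] using hf.add (hg.const_mul (-1))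

theorem pow (hf : BH Ω f) (n : ℕ) : BH Ω fun z => f z ^ n := by
  induction n with
  | zero => simpa using const (Ω := Ω) 1
  | succ n ih => simpa only [pow_succ] using ih.mul hf

theorem sum {ι : Type*} (s : Finset ι) {F : ι → ℂ → ℂ} (h : ∀ i ∈ s, BH Ω (F i)) :
    BH Ω fun z => ∑ i ∈ s, F i z := by
  classical
  induction s using Finset.induction_on with
  | empty => simpa using const (Ω := Ω) 0
  | insert a s ha ih =>
    simp only [Finset.sum_insert ha]
    exact (h a (Finset.mem_insert_self _ _)).add
      (ih fun i hi => h i (Finset.mem_insert_of_mem hi))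

end BH

theorem BH.of_ao {Ω : Set ℂ} {f : ℂ → ℂ} (hb : Bornology.IsBounded Ω) (hf : AO Ω f) : BH Ω f := by
  obtain ⟨C, hC⟩ := hb.isCompact_closure.exists_bound_of_continuousOn hf.2
  exact ⟨hf.1, C, fun z hz => hC z (subset_closure hz)⟩

namespace SegDom

variable {Ω : Set ℂ}

theorem bh_poly (h : SegDom Ω) (p : Polynomial ℂ) : BH Ω fun z => p.eval z :=
  .of_ao h.bdd (AO.of_differentiable p.differentiable)

theorem frontier_neBot {p : ℂ} (hp : p ∈ frontier Ω) : (𝓝[Ω] p).NeBot :=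
  mem_closure_iff_nhdsWithin_neBot.1 (frontier_subset_closure hp)

/-- The identity theorem on a domain: the product of two holomorphic functions vanishes only if
one of them does. -/
theorem eq_zero_or (h : SegDom Ω) {f g : ℂ → ℂ} (hf : DifferentiableOn ℂ f Ω)
    (hg : DifferentiableOn ℂ g Ω) (hfg : ∀ z ∈ Ω, f z * g z = 0) :
    (∀ z ∈ Ω, f z = 0) ∨ ∀ z ∈ Ω, g z = 0 := by
  by_contra! hcon
  obtain ⟨⟨a, ha, hfa⟩, b, hb, hgb⟩ := hcon
  have hfn : AnalyticOnNhd ℂ f Ω := hf.analyticOnNhd h.isOpen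
  have hgn : AnalyticOnNhd ℂ g Ω := hg.analyticOnNhd h.isOpen
  have : ∀ᶠ z in 𝓝 a, g z = 0 := by
    filter_upwards [(hf.continuousOn.continuousAt (h.isOpen.mem_nhds ha)).eventually_ne hfa,
      h.isOpen.mem_nhds ha] with z hz hzΩ
    exact (mul_eq_zero.1 (hfg z hzΩ)).resolve_left hz
  exact hgb (hgn.eqOn_zero_of_preconnected_of_eventuallyEq_zero h.conn.isPreconnected ha this hb)

theorem const_of_norm_exp (h : SegDom Ω) {f : ℂ → ℂ} (hf : DifferentiableOn ℂ f Ω)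
    (hr : ∀ z ∈ Ω, (f z).re = 0) : ∃ k, ∀ z ∈ Ω, f z = k := by
  obtain ⟨a, ha⟩ := h.conn.nonempty
  have hE : DifferentiableOn ℂ (fun z => cexp (f z)) Ω := hf.cexp
  have hmax : IsMaxOn (norm ∘ fun z => cexp (f z)) Ω a := by
    intro x hx
    simp only [Function.comp, norm_exp, hr x hx, hr a ha, mem_ofPred_eq, le_refl]
  have hc := Complex.eqOn_of_isPreconnected_of_isMaxOn_norm h.conn.isPreconnected h.isOpen hE ha
    hmax
  refine ⟨f a, fun z hz => h.isOpen.is_const_of_deriv_eq_zero h.conn.isPreconnected hf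
    (fun y hy => ?_) hz ha⟩
  have h1 : HasDerivAt (fun z => cexp (f z)) (cexp (f y) * deriv f y) y :=
    ((hf y hy).differentiableAt (h.isOpen.mem_nhds hy)).hasDerivAt.cexp
  have h2 : HasDerivAt (fun z => cexp (f z)) 0 y :=
    (hasDerivAt_const y (cexp (f a))).congr_of_eventuallyEq
      (mem_of_superset (h.isOpen.mem_nhds hy) fun x hx => hc hx)
  have := h1.unique h2
  simpa using this

theorem const_of_re (h : SegDom Ω) {f : ℂ → ℂ} (hf : BH Ω f) {c : Polynomial ℂ} (hc : c ≠ 0)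
    (hb : ∀ p ∈ frontier Ω, c.eval p ≠ 0 → Tendsto (fun z => (f z).re) (𝓝[Ω] p) (𝓝 0)) :
    ∃ k, ∀ z ∈ Ω, f z = k := by
  have key : ∀ g : ℂ → ℂ, BH Ω g → (∀ p ∈ frontier Ω, c.eval p ≠ 0 →
      Tendsto (fun z => (g z).re) (𝓝[Ω] p) (𝓝 0)) → ∀ z ∈ Ω, (g z).re ≤ 0 := by
    intro g hg hgb z hz
    obtain ⟨C, hC⟩ := hg.bdd
    obtain ⟨C', hC'⟩ := (h.bh_poly c).bdd
    have := h.norm_le_of_frontier_off (V := fun z => cexp (g z)) hg.diff.cexp (M := 1)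
      (C := Real.exp C * C') hc (fun z hz => ?_) zero_le_one (fun p hp hcp M' hM' => ?_) hz
    · rw [norm_exp] at this
      simpa using this
    · rw [norm_exp]
      exact mul_le_mul (Real.exp_le_exp.2 ((re_le_norm _).trans (hC z hz))) (hC' z hz)
        (norm_nonneg _) (Real.exp_pos _).le
    · have ht := (Real.continuous_exp.tendsto 0).comp (hgb p hp hcp)
      rw [Real.exp_zero] at ht
      filter_upwards [ht.eventually (ge_mem_nhds hM')] with x hx
      rw [norm_exp]; exact hx
  refine h.const_of_norm_exp hf.diff fun z hz => le_antisymm (key f hf hb z hz) ?_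
  have := key (fun z => -1 * f z) (hf.const_mul _) (fun p hp hcp => ?_) z hz
  · simp at this; exact this
  · simpa using (hb p hp hcp).neg

/-- Bounded holomorphic functions that are conjugate to each other at the boundary are
constant. -/
theorem const_of_conj (h : SegDom Ω) {u v : ℂ → ℂ} (hu : BH Ω u) (hv : BH Ω v)
    {c : Polynomial ℂ} (hc : c ≠ 0)
    (hb : ∀ p ∈ frontier Ω, c.eval p ≠ 0 →
      Tendsto (fun z => conj (u z) - v z) (𝓝[Ω] p) (𝓝 0)) :
    ∃ k, ∀ z ∈ Ω, u z = k := by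
  obtain ⟨k1, h1⟩ := h.const_of_re (f := fun z => u z - v z) (hu.sub hv) hc fun p hp hcp => by
    have := (continuous_re.tendsto 0).comp (hb p hp hcp)
    simpa [Function.comp_def] using this
  obtain ⟨k2, h2⟩ := h.const_of_re (f := fun z => I * (u z + v z)) ((hu.add hv).const_mul I) hc
    fun p hp hcp => by
      have := (continuous_im.tendsto 0).comp (hb p hp hcp)
      simp only [Function.comp_def, sub_im, conj_im, zero_im] at this
      simpa [neg_add, sub_eq_add_neg, add_comm] using this
  refine ⟨(k1 + k2 / I) / 2, fun z hz => ?_⟩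
  rw [← h1 z hz, ← h2 z hz]
  field_simp
  ring

end SegDom

/-- Holomorphic functions as a submodule. -/
def holSub (Ω : Set ℂ) : Submodule ℂ (ℂ → ℂ) where
  carrier := {f | DifferentiableOn ℂ f Ω}
  add_mem' hf hg := DifferentiableOn.add hf hg
  zero_mem' := differentiableOn_const 0
  smul_mem' c _ hf := DifferentiableOn.const_smul hf c

/-- Division by `z - w`, as a linear map on holomorphic functions. -/
def divLin {Ω : Set ℂ} (hΩ : IsOpen Ω) {w : ℂ} (hw : w ∈ Ω) : holSub Ω →ₗ[ℂ] holSub Ω where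
  toFun f := ⟨dslope f.1 w,
    (Complex.differentiableOn_dslope (hΩ.mem_nhds hw)).2 f.2⟩
  map_add' f g := by
    have hd : ∀ f : holSub Ω, DifferentiableAt ℂ f.1 w :=
      fun f => DifferentiableOn.differentiableAt f.2 (hΩ.mem_nhds hw)
    ext z
    rcases eq_or_ne z w with rfl | hz
    · simp [dslope_same, deriv_add (hd f) (hd g)]
    · simp [dslope_of_ne _ hz, slope_def_field]; ring
  map_smul' c f := by
    have hd : ∀ f : holSub Ω, DifferentiableAt ℂ f.1 w :=
      fun f => DifferentiableOn.differentiableAt f.2 (hΩ.mem_nhds hw)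
    ext z
    rcases eq_or_ne z w with rfl | hz
    · simp [dslope_same, deriv_const_smul c (hd f)]
    · simp [dslope_of_ne _ hz, slope_def_field]; ring

/-- Divisibility by a polynomial with roots in `Ω` amounts to `natDegree` linear conditions. -/
theorem exists_jet {Ω : Set ℂ} (hΩ : IsOpen Ω) (d : ℕ) : ∀ (E : Polynomial ℂ), E.natDegree = d →
    E ≠ 0 → (∀ z, E.eval z = 0 → z ∈ Ω) → ∃ J : holSub Ω →ₗ[ℂ] (Fin d → ℂ),
      ∀ f, J f = 0 → ∃ g, DifferentiableOn ℂ g Ω ∧ ∀ z, f.1 z = E.eval z * g z := by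
  induction d with
  | zero =>
    intro E hE h0 _
    obtain ⟨c, rfl⟩ := Polynomial.natDegree_eq_zero.1 hE
    have hc : c ≠ 0 := fun h => h0 (by rw [h, map_zero])
    exact ⟨0, fun f _ => ⟨fun z => c⁻¹ * f.1 z, DifferentiableOn.const_mul f.2 _, fun z => by
      rw [Polynomial.eval_C, mul_inv_cancel_left₀ hc]⟩⟩
  | succ d ih =>
    intro E hE h0 hroot
    have hdeg : E.degree ≠ 0 := by
      rw [Polynomial.degree_eq_natDegree h0, hE]
      exact_mod_cast (Nat.succ_ne_zero d)
    obtain ⟨w, hw⟩ := IsAlgClosed.exists_root E hdeg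
    obtain ⟨E1, rfl⟩ := Polynomial.dvd_iff_isRoot.2 hw
    have h1 : E1 ≠ 0 := right_ne_zero_of_mul h0
    have hwΩ := hroot w hw
    obtain ⟨J1, hJ1⟩ := ih E1 (by
      rw [Polynomial.natDegree_mul (Polynomial.X_sub_C_ne_zero w) h1,
        Polynomial.natDegree_X_sub_C] at hE
      omega) h1 (fun z hz => hroot z (by rw [Polynomial.eval_mul, hz, mul_zero]))
    refine ⟨LinearMap.pi (Fin.cases ((LinearMap.proj w).comp (holSub Ω).subtype)
      fun j => (LinearMap.proj j).comp (J1.comp (divLin hΩ hwΩ))), fun f hf => ?_⟩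
    have hfw : f.1 w = 0 := congrFun hf 0
    have hf1 : J1 (divLin hΩ hwΩ f) = 0 := funext fun j => congrFun hf j.succ
    obtain ⟨g, hg, hfg⟩ := hJ1 _ hf1
    refine ⟨g, hg, fun z => ?_⟩
    have h2 := hfg z
    have h3 : (z - w) * dslope f.1 w z = f.1 z := by
      have := sub_smul_dslope f.1 w z
      rw [hfw, sub_zero] at this
      exact this
    rw [Polynomial.eval_mul, mul_assoc, ← h2, ← h3]
    simp [divLin]

theorem SegDom.bh_of_mul {Ω : Set ℂ} (h : SegDom Ω) {E : Polynomial ℂ}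
    (hE : ∀ z, E.eval z = 0 → z ∈ Ω) {f g : ℂ → ℂ} (hf : BH Ω f) (hg : DifferentiableOn ℂ g Ω)
    (hfg : ∀ z ∈ Ω, f z = E.eval z * g z) : BH Ω g := by
  refine ⟨hg, h.exists_bound hg.continuousOn fun p hp => ?_⟩
  have hEp : E.eval p ≠ 0 := fun h0 => h.notMem hp (hE p h0)
  obtain ⟨C, hC⟩ := hf.bdd
  have hpos : 0 < ‖E.eval p‖ := norm_pos_iff.2 hEp
  refine ⟨C / (‖E.eval p‖ / 2), ?_⟩
  have : ∀ᶠ z in 𝓝 p, ‖E.eval p‖ / 2 < ‖E.eval z‖ :=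
    E.continuous.norm.continuousAt.eventually (lt_mem_nhds (by linarith))
  filter_upwards [nhdsWithin_le_nhds this, self_mem_nhdsWithin] with z hz hzΩ
  rw [le_div_iff₀ (by positivity)]
  have h1 := hC z hzΩ
  rw [hfg z hzΩ, norm_mul] at h1
  nlinarith [norm_nonneg (g z)]

/-- `h / E` and `H / E'` are complex conjugate at the boundary, off the roots of `c`. -/
structure Pair (Ω : Set ℂ) (c E E' : Polynomial ℂ) (h H : ℂ → ℂ) : Prop where
  fst : BH Ω h
  snd : BH Ω H
  bdry : ∀ p ∈ frontier Ω, c.eval p ≠ 0 →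
    Tendsto (fun z => conj (h z) * E'.eval z - H z * conj (E.eval z)) (𝓝[Ω] p) (𝓝 0)

theorem tendsto_bdd_mul {Ω : Set ℂ} {p : ℂ} {f g : ℂ → ℂ} (hf : ∃ C, ∀ z ∈ Ω, ‖f z‖ ≤ C)
    (hg : Tendsto g (𝓝[Ω] p) (𝓝 0)) : Tendsto (fun z => f z * g z) (𝓝[Ω] p) (𝓝 0) := by
  obtain ⟨C, hC⟩ := hf
  refine squeeze_zero_norm' (a := fun z => C * ‖g z‖) ?_ (by simpa using hg.norm.const_mul C)
  filter_upwards [self_mem_nhdsWithin] with z hz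
  rw [norm_mul]
  exact mul_le_mul_of_nonneg_right (hC z hz) (norm_nonneg _)

namespace Pair

variable {Ω : Set ℂ} {c E E' F F' : Polynomial ℂ} {h H k K : ℂ → ℂ}

theorem mul (hΩ : SegDom Ω) (h1 : Pair Ω c E E' h H) (h2 : Pair Ω c F F' k K) :
    Pair Ω c (E * F) (E' * F') (fun z => h z * k z) fun z => H z * K z where
  fst := h1.fst.mul h2.fst
  snd := h1.snd.mul h2.snd
  bdry p hp hcp := by
    obtain ⟨C, hC⟩ := (h1.fst.mul (hΩ.bh_poly E')).bdd
    obtain ⟨C', hC'⟩ := (h2.snd.mul (hΩ.bh_poly F)).bdd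
    have a1 := tendsto_bdd_mul (f := fun z => conj (h z) * E'.eval z) ⟨C, fun z hz => by
      simpa using hC z hz⟩ (h2.bdry p hp hcp)
    have a2 := tendsto_bdd_mul (f := fun z => K z * conj (F.eval z)) ⟨C', fun z hz => by
      simpa using hC' z hz⟩ (h1.bdry p hp hcp)
    have := a1.add a2
    rw [add_zero] at this
    refine this.congr fun z => ?_
    simp only [map_mul, Polynomial.eval_mul]
    ring

theorem add (h1 : Pair Ω c E E' h H) (h2 : Pair Ω c E E' k K) :
    Pair Ω c E E' (fun z => h z + k z) fun z => H z + K z where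
  fst := h1.fst.add h2.fst
  snd := h1.snd.add h2.snd
  bdry p hp hcp := by
    have := (h1.bdry p hp hcp).add (h2.bdry p hp hcp)
    rw [add_zero] at this
    refine this.congr fun z => ?_
    simp only [map_add]
    ring

theorem const (b : ℂ) : Pair Ω c 1 1 (fun _ => b) fun _ => conj b where
  fst := .const b
  snd := .const _
  bdry p _ _ := by simp [tendsto_const_nhds]

theorem const_mul (b : ℂ) (h1 : Pair Ω c E E' h H) :
    Pair Ω c E E' (fun z => b * h z) fun z => conj b * H z where
  fst := h1.fst.const_mul b
  snd := h1.snd.const_mul _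
  bdry p hp hcp := by
    have := (h1.bdry p hp hcp).const_mul (conj b)
    rw [mul_zero] at this
    refine this.congr fun z => ?_
    simp only [map_mul]
    ring

/-- Denominators can be enlarged. -/
theorem scale (hΩ : SegDom Ω) (F F' : Polynomial ℂ) (h1 : Pair Ω c E E' h H) :
    Pair Ω c (E * F) (E' * F') (fun z => h z * F.eval z) fun z => H z * F'.eval z := by
  refine h1.mul hΩ ⟨hΩ.bh_poly F, hΩ.bh_poly F', fun p _ _ => ?_⟩
  refine tendsto_const_nhds.congr fun z => ?_
  ring

theorem pow (hΩ : SegDom Ω) (h1 : Pair Ω c E E' h H) (n : ℕ) :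
    Pair Ω c (E ^ n) (E' ^ n) (fun z => h z ^ n) fun z => H z ^ n := by
  induction n with
  | zero => simpa using const (Ω := Ω) (c := c) 1
  | succ n ih => simpa only [pow_succ] using ih.mul hΩ h1

theorem of_dvd {c' : Polynomial ℂ} (hcc : c ∣ c') (h1 : Pair Ω c E E' h H) :
    Pair Ω c' E E' h H where
  fst := h1.fst
  snd := h1.snd
  bdry p hp hcp := h1.bdry p hp fun h0 => hcp (Polynomial.eval_eq_zero_of_dvd_of_eval_eq_zero hcc h0)

theorem sum {ι : Type*} (s : Finset ι) {u v : ι → ℂ → ℂ} (hp : ∀ i ∈ s, Pair Ω c E E' (u i) (v i)) :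
    Pair Ω c E E' (fun z => ∑ i ∈ s, u i z) fun z => ∑ i ∈ s, v i z := by
  classical
  induction s using Finset.induction_on with
  | empty => exact ⟨by simpa using BH.const 0, by simpa using BH.const 0, fun p _ _ => by simp [tendsto_const_nhds]⟩
  | insert a s ha ih =>
    simp only [Finset.sum_insert ha]
    exact (hp a (Finset.mem_insert_self _ _)).add
      (ih fun i hi => hp i (Finset.mem_insert_of_mem hi))

theorem symm (h1 : Pair Ω c E E' h H) : Pair Ω c E' E H h where
  fst := h1.snd
  snd := h1.fst
  bdry p hp hcp := by
    have := ((continuous_conj.tendsto 0).comp (h1.bdry p hp hcp)).neg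
    simpa [Function.comp_def, mul_comm] using this

/-- If the numerators are divisible by the denominators, the quotient is constant. -/
theorem const_of_dvd (hΩ : SegDom Ω) (hc : c ≠ 0)
    (hE : ∀ z, E.eval z = 0 → z ∈ Ω) (hE' : ∀ z, E'.eval z = 0 → z ∈ Ω)
    (h1 : Pair Ω c E E' h H) (hk : DifferentiableOn ℂ k Ω) (hK : DifferentiableOn ℂ K Ω)
    (hhk : ∀ z ∈ Ω, h z = E.eval z * k z) (hHK : ∀ z ∈ Ω, H z = E'.eval z * K z) :
    ∃ b, ∀ z ∈ Ω, k z = b := by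
  refine hΩ.const_of_conj (hΩ.bh_of_mul hE h1.fst hk hhk) (hΩ.bh_of_mul hE' h1.snd hK hHK)
    hc fun p hp hcp => ?_
  have hEp : E.eval p ≠ 0 := fun h0 => hΩ.notMem hp (hE p h0)
  have hEp' : E'.eval p ≠ 0 := fun h0 => hΩ.notMem hp (hE' p h0)
  have hcont : Tendsto (fun z => (conj (E.eval z) * E'.eval z)⁻¹) (𝓝[Ω] p)
      (𝓝 (conj (E.eval p) * E'.eval p)⁻¹) := by
    refine Tendsto.inv₀ (((continuous_conj.comp E.continuous).mul E'.continuous).continuousAt.mono_left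
      nhdsWithin_le_nhds) (mul_ne_zero ((map_ne_zero _).2 hEp) hEp')
  have := hcont.mul (h1.bdry p hp hcp)
  rw [mul_zero] at this
  refine this.congr' ?_
  filter_upwards [self_mem_nhdsWithin,
    nhdsWithin_le_nhds (E.continuous.continuousAt.eventually_ne hEp),
    nhdsWithin_le_nhds (E'.continuous.continuousAt.eventually_ne hEp')] with z hz hz1 hz2
  have : conj (E.eval z) ≠ 0 := (map_ne_zero _).2 hz1
  rw [hhk z hz, hHK z hz, map_mul]
  field_simp

/-- Sufficiently many pairs with common denominators are linearly dependent. -/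
theorem exists_linear_relation (hΩ : SegDom Ω) (hc : c ≠ 0) (hE0 : E ≠ 0) (hE0' : E' ≠ 0)
    (hE : ∀ z, E.eval z = 0 → z ∈ Ω) (hE' : ∀ z, E'.eval z = 0 → z ∈ Ω)
    {ι : Type*} [Fintype ι] {u v : ι → ℂ → ℂ} (hp : ∀ i, Pair Ω c E E' (u i) (v i))
    (hcard : E.natDegree + E'.natDegree + 2 ≤ Fintype.card ι) :
    ∃ b : ι → ℂ, b ≠ 0 ∧ ∀ z ∈ Ω, ∑ i, b i * u i z = 0 := by
  obtain ⟨J, hJ⟩ := exists_jet hΩ.isOpen _ E rfl hE0 hE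
  obtain ⟨J', hJ'⟩ := exists_jet hΩ.isOpen _ E' rfl hE0' hE'
  obtain ⟨zs, hzs, hEzs⟩ : ∃ z ∈ Ω, E.eval z ≠ 0 := by
    by_contra! hcon
    obtain ⟨a, ha⟩ := hΩ.conn.nonempty
    refine hE0 (Polynomial.eq_zero_of_infinite_isRoot E ?_)
    exact (infinite_of_mem_nhds a (hΩ.isOpen.mem_nhds ha)).mono hcon
  let U : (ι → ℂ) →ₗ[ℂ] holSub Ω :=
    { toFun := fun b => ⟨fun z => ∑ i, b i * u i z,
        (BH.sum _ fun i _ => (hp i).fst.const_mul (b i)).diff⟩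
      map_add' := fun b b' => by
        ext z; simp [add_mul, Finset.sum_add_distrib]
      map_smul' := fun r b => by
        ext z; simp [Finset.mul_sum, mul_assoc] }
  let V : (ι → ℂ) →ₗ[ℝ] holSub Ω :=
    { toFun := fun b => ⟨fun z => ∑ i, conj (b i) * v i z,
        (BH.sum _ fun i _ => (hp i).snd.const_mul (conj (b i))).diff⟩
      map_add' := fun b b' => by
        ext z; simp [add_mul, Finset.sum_add_distrib]
      map_smul' := fun r b => by
        ext z; simp [Finset.mul_sum, mul_assoc] }
  let T : (ι → ℂ) →ₗ[ℝ] ((Fin E.natDegree → ℂ) × (Fin E'.natDegree → ℂ) × ℂ) :=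
    ((J.comp U).restrictScalars ℝ).prod (((J'.restrictScalars ℝ).comp V).prod
      (((LinearMap.proj zs).comp ((holSub Ω).subtype.comp U)).restrictScalars ℝ))
  have hfin : Module.finrank ℝ ((Fin E.natDegree → ℂ) × (Fin E'.natDegree → ℂ) × ℂ) <
      Module.finrank ℝ (ι → ℂ) := by
    rw [Module.finrank_prod, Module.finrank_prod, Module.finrank_pi_fintype,
      Module.finrank_pi_fintype, Module.finrank_pi_fintype]
    simp only [Complex.finrank_real_complex, Finset.sum_const, Finset.card_univ, Fintype.card_fin,
      smul_eq_mul]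
    omega
  obtain ⟨b, hb, hb0⟩ := Submodule.exists_mem_ne_zero_of_ne_bot
    (LinearMap.ker_ne_bot_of_finrank_lt (f := T) hfin)
  have hT : T b = 0 := hb
  have hT1 : J (U b) = 0 := congrArg Prod.fst hT
  have hT2 : J' (V b) = 0 := congrArg (fun x => x.2.1) hT
  have hT3 : ∑ i, b i * u i zs = 0 := congrArg (fun x => x.2.2) hT
  obtain ⟨g, hg, hug⟩ := hJ _ hT1
  obtain ⟨k, hk, hvk⟩ := hJ' _ hT2
  obtain ⟨r, hr⟩ := const_of_dvd hΩ hc hE hE'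
    (Pair.sum Finset.univ fun i _ => (hp i).const_mul (b i)) hg hk (fun z _ => hug z)
    fun z _ => hvk z
  have hr0 : r = 0 := by
    have := hug zs
    rw [hr zs hzs] at this
    exact (mul_eq_zero.1 (this.symm.trans hT3)).resolve_left hEzs
  refine ⟨b, hb0, fun z hz => ?_⟩
  have := hug z
  rw [hr z hz, hr0, mul_zero] at this
  exact this

end Pair

/-- A nonzero polynomial with all its roots in `Ω`. -/
structure InRoots (Ω : Set ℂ) (E : Polynomial ℂ) : Prop where
  ne : E ≠ 0
  mem : ∀ z, E.eval z = 0 → z ∈ Ω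

namespace InRoots

variable {Ω : Set ℂ} {E F : Polynomial ℂ}

theorem one : InRoots Ω 1 := ⟨one_ne_zero, fun z hz => by simp at hz⟩

theorem mul (hE : InRoots Ω E) (hF : InRoots Ω F) : InRoots Ω (E * F) :=
  ⟨mul_ne_zero hE.ne hF.ne, fun z hz => by
    rw [Polynomial.eval_mul] at hz
    exact (mul_eq_zero.1 hz).elim (hE.mem z) (hF.mem z)⟩

theorem pow (hE : InRoots Ω E) (n : ℕ) : InRoots Ω (E ^ n) :=
  ⟨pow_ne_zero n hE.ne, fun z hz => by
    rw [Polynomial.eval_pow] at hz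
    exact hE.mem z (eq_zero_of_pow_eq_zero hz)⟩

end InRoots

theorem SegDom.exists_eval_ne {Ω : Set ℂ} (h : SegDom Ω) {E : Polynomial ℂ} (hE : E ≠ 0) :
    ∃ z ∈ Ω, E.eval z ≠ 0 := by
  by_contra! hcon
  obtain ⟨a, ha⟩ := h.conn.nonempty
  refine hE (Polynomial.eq_zero_of_infinite_isRoot E ?_)
  exact (infinite_of_mem_nhds a (h.isOpen.mem_nhds ha)).mono hcon

/-- Two holomorphic functions that agree off the roots of a polynomial agree. -/
theorem SegDom.eq_zero_of_off {Ω : Set ℂ} (h : SegDom Ω) {E : Polynomial ℂ} (hE : E ≠ 0)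
    {f : ℂ → ℂ} (hf : DifferentiableOn ℂ f Ω) (h0 : ∀ z ∈ Ω, E.eval z ≠ 0 → f z = 0) :
    ∀ z ∈ Ω, f z = 0 := by
  rcases h.eq_zero_or E.differentiable.differentiableOn hf fun z hz => by
    by_cases h1 : E.eval z = 0
    · rw [h1, zero_mul]
    · rw [h0 z hz h1, mul_zero] with h1 | h1
  · obtain ⟨z, hz, hz'⟩ := h.exists_eval_ne hE
    exact absurd (h1 z hz) hz'
  · exact h1

theorem bipoly_induction {motive : Polynomial (Polynomial ℂ) → Prop}
    (hc : ∀ a, motive (Polynomial.C (Polynomial.C a)))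
    (hx : motive (Polynomial.C Polynomial.X)) (hy : motive Polynomial.X)
    (hadd : ∀ P Q, motive P → motive Q → motive (P + Q))
    (hmul : ∀ P Q, motive P → motive Q → motive (P * Q)) (P : Polynomial (Polynomial ℂ)) :
    motive P := by
  have h1 : ∀ p : Polynomial ℂ, motive (Polynomial.C p) := fun p => by
    induction p using Polynomial.induction_on with
    | C a => exact hc a
    | add p q hp hq => rw [map_add]; exact hadd _ _ hp hq
    | monomial n a ih =>
      rw [pow_succ, ← mul_assoc, map_mul]
      exact hmul _ _ ih hx
  induction P using Polynomial.induction_on with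
  | C a => exact h1 a
  | add p q hp hq => exact hadd _ _ hp hq
  | monomial n a ih =>
    rw [pow_succ, ← mul_assoc]
    exact hmul _ _ ih hy

theorem exists_hasDerivAt_evalEval (P : Polynomial (Polynomial ℂ)) :
    ∃ A : Polynomial (Polynomial ℂ), ∀ (x y : ℝ → ℂ) (x' y' : ℂ) (t : ℝ), HasDerivAt x x' t →
      HasDerivAt y y' t → HasDerivAt (fun t => P.evalEval (x t) (y t))
        (A.evalEval (x t) (y t) * x' + P.derivative.evalEval (x t) (y t) * y') t := by
  induction P using bipoly_induction with
  | hc a => exact ⟨0, fun x y x' y' t _ _ => by simpa using hasDerivAt_const t a⟩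
  | hx => exact ⟨1, fun x y x' y' t hx _ => by
    simpa [Polynomial.evalEval_C] using hx⟩
  | hy => exact ⟨0, fun x y x' y' t _ hy => by simpa using hy⟩
  | hadd P Q hP hQ =>
    obtain ⟨A, hA⟩ := hP
    obtain ⟨B, hB⟩ := hQ
    refine ⟨A + B, fun x y x' y' t hx hy => ?_⟩
    simp only [Polynomial.evalEval_add, Polynomial.derivative_add]
    exact ((hA x y x' y' t hx hy).add (hB x y x' y' t hx hy)).congr_deriv (by ring)
  | hmul P Q hP hQ =>
    obtain ⟨A, hA⟩ := hP
    obtain ⟨B, hB⟩ := hQ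
    refine ⟨A * Q + P * B, fun x y x' y' t hx hy => ?_⟩
    simp only [Polynomial.evalEval_add, Polynomial.derivative_mul, Polynomial.evalEval_mul]
    exact ((hA x y x' y' t hx hy).mul (hB x y x' y' t hx hy)).congr_deriv (by ring)

/-- Clearing denominators in a polynomial expression of two quotients, inside an algebra `M` of
functions. -/
theorem exists_numerator {M : (ℂ → ℂ) → Prop} (hc : ∀ a, M fun _ => a)
    (hadd : ∀ f g, M f → M g → M fun z => f z + g z)
    (hmul : ∀ f g, M f → M g → M fun z => f z * g z) {x y D : ℂ → ℂ} (hD : M D) (hx : M x)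
    (hy : M y) (P : Polynomial (Polynomial ℂ)) :
    ∃ N : ℕ, ∀ n ≥ N, ∃ h, M h ∧ ∀ z, D z ≠ 0 →
      h z = D z ^ n * P.evalEval (x z / D z) (y z / D z) := by
  have hD : ∀ n : ℕ, M fun z => D z ^ n := fun n => by
    induction n with
    | zero => simpa using hc 1
    | succ n ih => simpa only [pow_succ] using hmul _ _ ih hD
  induction P using bipoly_induction with
  | hc a => exact ⟨0, fun n _ => ⟨_, hmul _ _ (hD n) (hc a), fun z _ => by simp⟩⟩
  | hx =>
    refine ⟨1, fun n hn => ⟨_, hmul _ _ (hD (n - 1)) hx, fun z hz => ?_⟩⟩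
    obtain ⟨m, rfl⟩ := Nat.exists_eq_add_of_le' hn
    simp [pow_succ, Polynomial.evalEval_C]; field_simp
  | hy =>
    refine ⟨1, fun n hn => ⟨_, hmul _ _ (hD (n - 1)) hy, fun z hz => ?_⟩⟩
    obtain ⟨m, rfl⟩ := Nat.exists_eq_add_of_le' hn
    simp [pow_succ]; field_simp
  | hadd P Q hP hQ =>
    obtain ⟨N, hN⟩ := hP
    obtain ⟨M, hM⟩ := hQ
    refine ⟨max N M, fun n hn => ?_⟩
    obtain ⟨f, hf, hf'⟩ := hN n (le_of_max_le_left hn)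
    obtain ⟨g, hg, hg'⟩ := hM n (le_of_max_le_right hn)
    refine ⟨_, hadd _ _ hf hg, fun z hz => ?_⟩
    rw [hf' z hz, hg' z hz, Polynomial.evalEval_add, mul_add]
  | hmul P Q hP hQ =>
    obtain ⟨N, hN⟩ := hP
    obtain ⟨M, hM⟩ := hQ
    refine ⟨N + M, fun n hn => ?_⟩
    obtain ⟨f, hf, hf'⟩ := hN N le_rfl
    obtain ⟨g, hg, hg'⟩ := hM (n - N) (by omega)
    refine ⟨_, hmul _ _ hf hg, fun z hz => ?_⟩
    rw [hf' z hz, hg' z hz, Polynomial.evalEval_mul,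
      show D z ^ n = D z ^ N * D z ^ (n - N) by rw [← pow_add]; congr 1; omega]
    ring

theorem exists_ao_evalEval {Ω : Set ℂ} {x y : ℂ → ℂ} (D : Polynomial ℂ) (hx : AO Ω x)
    (hy : AO Ω y) (P : Polynomial (Polynomial ℂ)) :
    ∃ N : ℕ, ∀ n ≥ N, ∃ h, AO Ω h ∧ ∀ z, D.eval z ≠ 0 →
      h z = D.eval z ^ n * P.evalEval (x z / D.eval z) (y z / D.eval z) :=
  exists_numerator (M := AO Ω) (AO.const Ω) (fun _ _ h h' => h.add h') (fun _ _ h h' => h.mul h')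
    (AO.of_differentiable D.differentiable) hx hy P

theorem exists_bh_evalEval {Ω : Set ℂ} (hΩ : SegDom Ω) {x y : ℂ → ℂ} (D : Polynomial ℂ)
    (hx : BH Ω x) (hy : BH Ω y) (P : Polynomial (Polynomial ℂ)) :
    ∃ N : ℕ, ∀ n ≥ N, ∃ h, BH Ω h ∧ ∀ z, D.eval z ≠ 0 →
      h z = D.eval z ^ n * P.evalEval (x z / D.eval z) (y z / D.eval z) :=
  exists_numerator (M := BH Ω) BH.const (fun _ _ h h' => h.add h') (fun _ _ h h' => h.mul h')
    (hΩ.bh_poly D) hx hy P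

/-- The bivariate polynomial with prescribed coefficients. -/
def bipoly {m : ℕ} (b : Fin m × Fin m → ℂ) : Polynomial (Polynomial ℂ) :=
  ∑ i, Polynomial.monomial (i.2 : ℕ) (Polynomial.monomial (i.1 : ℕ) (b i))

theorem evalEval_bipoly {m : ℕ} (b : Fin m × Fin m → ℂ) (x y : ℂ) :
    (bipoly b).evalEval x y = ∑ i, b i * (x ^ (i.1 : ℕ) * y ^ (i.2 : ℕ)) := by
  rw [bipoly, Polynomial.evalEval_finsetSum]
  refine Finset.sum_congr rfl fun i _ => ?_
  simp only [Polynomial.evalEval, Polynomial.eval_monomial, Polynomial.eval_mul,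
    Polynomial.eval_pow, Polynomial.eval_C]
  ring

theorem bipoly_ne_zero {m : ℕ} {b : Fin m × Fin m → ℂ} (hb : b ≠ 0) : bipoly b ≠ 0 := by
  intro h0
  refine hb (funext fun i => ?_)
  have : ((bipoly b).coeff i.2).coeff i.1 = b i := by
    simp only [bipoly, Polynomial.finsetSum_coeff, Polynomial.coeff_monomial]
    rw [Finset.sum_eq_single i]
    · simp
    · rintro j - hj
      by_cases h2 : (j.2 : ℕ) = i.2
      · have h1 : (j.1 : ℕ) ≠ i.1 := fun h1 => hj (Prod.ext (Fin.ext h1) (Fin.ext h2))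
        simp [h2, Polynomial.coeff_monomial, h1]
      · simp [h2]
    · simp
  rw [← this, h0]; simp

/-- Any two functions belonging to pairs are algebraically dependent. -/
theorem Pair.exists_algebraic_relation {Ω : Set ℂ} {c E E' F F' : Polynomial ℂ} {h H k K : ℂ → ℂ}
    (hΩ : SegDom Ω) (hc : c ≠ 0) (hE : InRoots Ω E) (hE' : InRoots Ω E') (hF : InRoots Ω F)
    (hF' : InRoots Ω F') (h1 : Pair Ω c E E' h H) (h2 : Pair Ω c F F' k K) :
    ∃ R : Polynomial (Polynomial ℂ), R ≠ 0 ∧ ∀ z ∈ Ω, E.eval z ≠ 0 → F.eval z ≠ 0 →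
      R.evalEval (h z / E.eval z) (k z / F.eval z) = 0 := by
  set m := (E * F).natDegree + (E' * F').natDegree + 2 with hm
  have hp : ∀ i : Fin (m + 1) × Fin (m + 1), Pair Ω c ((E * F) ^ m) ((E' * F') ^ m)
      (fun z => (h z ^ (i.1 : ℕ) * (E ^ (m - i.1)).eval z) * (k z ^ (i.2 : ℕ) * (F ^ (m - i.2)).eval z))
      (fun z => (H z ^ (i.1 : ℕ) * (E' ^ (m - i.1)).eval z) *
        (K z ^ (i.2 : ℕ) * (F' ^ (m - i.2)).eval z)) := by
    rintro ⟨⟨i, hi⟩, ⟨j, hj⟩⟩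
    have := ((h1.pow hΩ i).scale hΩ (E ^ (m - i)) (E' ^ (m - i))).mul hΩ
      ((h2.pow hΩ j).scale hΩ (F ^ (m - j)) (F' ^ (m - j)))
    simpa only [pow_mul_pow_sub _ (Nat.lt_succ_iff.1 hi), pow_mul_pow_sub _ (Nat.lt_succ_iff.1 hj),
      ← mul_pow] using this
  obtain ⟨b, hb, hsum⟩ := Pair.exists_linear_relation hΩ hc ((hE.mul hF).pow m).ne
    ((hE'.mul hF').pow m).ne ((hE.mul hF).pow m).mem ((hE'.mul hF').pow m).mem hp (by
      rw [Polynomial.natDegree_pow, Polynomial.natDegree_pow, Fintype.card_prod, Fintype.card_fin]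
      nlinarith)
  refine ⟨bipoly b, bipoly_ne_zero hb, fun z hz hEz hFz => ?_⟩
  have h0 := hsum z hz
  have : E.eval z ^ m * F.eval z ^ m * (bipoly b).evalEval (h z / E.eval z) (k z / F.eval z) = 0 := by
    rw [← h0, evalEval_bipoly, Finset.mul_sum]
    refine Finset.sum_congr rfl ?_
    rintro ⟨⟨i, hi⟩, ⟨j, hj⟩⟩ -
    simp only [Polynomial.eval_pow, div_pow]
    rw [← pow_mul_pow_sub (E.eval z) (Nat.lt_succ_iff.1 hi),
      ← pow_mul_pow_sub (F.eval z) (Nat.lt_succ_iff.1 hj)]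
    field_simp
  exact (mul_eq_zero.1 this).resolve_left (by positivity)

/-- `σ / D` is a Schwarz function of `Ω`. -/
structure Schwarz (Ω : Set ℂ) (D : Polynomial ℂ) (σ : ℂ → ℂ) : Prop where
  roots : InRoots Ω D
  ao : AO Ω σ
  bdry : ∀ z ∈ frontier Ω, σ z = conj z * D.eval z

theorem AO.tendsto {Ω : Set ℂ} {f : ℂ → ℂ} (hf : AO Ω f) {p : ℂ} (hp : p ∈ frontier Ω) :
    Tendsto f (𝓝[Ω] p) (𝓝 (f p)) :=
  ((hf.2 p (frontier_subset_closure hp)).mono subset_closure)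

theorem AO.pow {Ω : Set ℂ} {f : ℂ → ℂ} (hf : AO Ω f) (n : ℕ) : AO Ω fun z => f z ^ n :=
  ⟨hf.1.pow n, hf.2.pow n⟩

theorem AO.poly (Ω : Set ℂ) (p : Polynomial ℂ) : AO Ω fun z => p.eval z :=
  AO.of_differentiable p.differentiable

theorem Pair.of_ao {Ω : Set ℂ} (hΩ : SegDom Ω) {c E E' : Polynomial ℂ} {h H : ℂ → ℂ} (h1 : AO Ω h)
    (h2 : AO Ω H) (hb : ∀ p ∈ frontier Ω, conj (h p) * E'.eval p = H p * conj (E.eval p)) :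
    Pair Ω c E E' h H where
  fst := .of_ao hΩ.bdd h1
  snd := .of_ao hΩ.bdd h2
  bdry p hp _ := by
    have t1 := ((continuous_conj.tendsto _).comp (h1.tendsto hp)).mul ((AO.poly Ω E').tendsto hp)
    have t2 := (h2.tendsto hp).mul
      ((continuous_conj.tendsto _).comp ((AO.poly Ω E).tendsto hp))
    have := t1.sub t2
    rw [hb p hp, sub_self] at this
    exact this

theorem continuous_evalEval (P : Polynomial (Polynomial ℂ)) :
    Continuous fun q : ℂ × ℂ => P.evalEval q.1 q.2 := by
  induction P using bipoly_induction with
  | hc a => simpa using continuous_const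
  | hx => simpa [Polynomial.evalEval_C] using continuous_fst
  | hy => simpa using continuous_snd
  | hadd P Q hP hQ =>
    simp only [Polynomial.evalEval_add]; exact hP.add hQ
  | hmul P Q hP hQ =>
    simp only [Polynomial.evalEval_mul]; exact hP.mul hQ

theorem conj_evalEval_map (P : Polynomial (Polynomial ℂ)) (x y : ℂ) :
    conj ((P.map (Polynomial.mapRingHom conj)).evalEval x y) = P.evalEval (conj x) (conj y) := by
  have := Polynomial.map_mapRingHom_evalEval conj P (conj x) (conj y)
  rw [conj_conj, conj_conj] at this
  rw [this, conj_conj]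

theorem sq_of_tangent {s g d r A B : ℂ} (hd : d ≠ 0) (h1 : g * d = 2 * Real.pi * I * (s * r))
    (h2 : A * conj d + B * d = 0) (h3 : r ^ 2 = d * conj d) :
    s ^ 2 * B = g ^ 2 * (A * (4 * (Real.pi : ℂ) ^ 2)⁻¹) := by
  have hpi : (Real.pi : ℂ) ≠ 0 := ofReal_ne_zero.2 Real.pi_ne_zero
  have e1 : d * (g ^ 2 * d) = d * (-(4 * Real.pi ^ 2) * s ^ 2 * conj d) := by
    linear_combination (g * d + 2 * Real.pi * I * (s * r)) * h1 +
      4 * Real.pi ^ 2 * s ^ 2 * r ^ 2 * I_sq - 4 * Real.pi ^ 2 * s ^ 2 * h3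
  have e2 := mul_left_cancel₀ hd e1
  have e3 : d * (g ^ 2 * A) = d * (4 * Real.pi ^ 2 * s ^ 2 * B) := by
    linear_combination A * e2 - 4 * Real.pi ^ 2 * s ^ 2 * h2
  have e4 := mul_left_cancel₀ hd e3
  field_simp
  linear_combination -e4

namespace Schwarz

variable {Ω : Set ℂ} {n : ℕ} {γ : Fin n → ℝ → ℂ} {D : Polynomial ℂ} {σ : ℂ → ℂ}

theorem eval_ne (hs : Schwarz Ω D σ) (hΩ : SegDom Ω) {p : ℂ} (hp : p ∈ frontier Ω) :
    D.eval p ≠ 0 := fun h0 => hΩ.notMem hp (hs.roots.mem p h0)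

theorem div_eq (hs : Schwarz Ω D σ) (hΩ : SegDom Ω) {p : ℂ} (hp : p ∈ frontier Ω) :
    σ p / D.eval p = conj p := by
  rw [hs.bdry p hp, mul_div_cancel_right₀ _ (hs.eval_ne hΩ hp)]

theorem pair (hs : Schwarz Ω D σ) (hΩ : SegDom Ω) : Pair Ω 1 D 1 σ fun z => z :=
  .of_ao hΩ hs.ao (AO.of_differentiable differentiable_id) fun p hp => by
    rw [hs.bdry p hp]; simp

/-- A polynomial relation between `σ / D` and `z` persists at the boundary. -/
theorem evalEval_frontier (hs : Schwarz Ω D σ) (hΩ : SegDom Ω) {P : Polynomial (Polynomial ℂ)}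
    (hP : ∀ z ∈ Ω, D.eval z ≠ 0 → P.evalEval (σ z / D.eval z) z = 0) {p : ℂ}
    (hp : p ∈ frontier Ω) : P.evalEval (conj p) p = 0 := by
  have : (𝓝[Ω] p).NeBot := SegDom.frontier_neBot hp
  have hD := hs.eval_ne hΩ hp
  have t1 : Tendsto (fun z => σ z / D.eval z) (𝓝[Ω] p) (𝓝 (σ p / D.eval p)) :=
    (hs.ao.tendsto hp).div ((AO.poly Ω D).tendsto hp) hD
  rw [hs.div_eq hΩ hp] at t1
  have t2 : Tendsto (fun z : ℂ => z) (𝓝[Ω] p) (𝓝 p) := tendsto_id.mono_left nhdsWithin_le_nhds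
  have t3 := ((continuous_evalEval P).tendsto (conj p, p)).comp (t1.prodMk_nhds t2)
  refine tendsto_nhds_unique t3 (tendsto_const_nhds.congr' ?_)
  filter_upwards [self_mem_nhdsWithin,
    nhdsWithin_le_nhds (D.continuous.continuousAt.eventually_ne hD)] with z hz hz'
  exact (hP z hz hz').symm

theorem frontier_infinite (h : Bdry Ω γ) : (frontier Ω).Infinite := by
  obtain ⟨p, hp⟩ := h.segDom.exists_frontier
  obtain ⟨i, t, rfl⟩ := h.eq_of_frontier hp
  refine Set.Infinite.mono (s := γ i '' Ico 0 (2 * Real.pi)) ?_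
    ((Ico_infinite Real.two_pi_pos).image (h.loop i).inj)
  rintro _ ⟨u, -, rfl⟩
  exact (h.frontier_eq _).2 ⟨i, u, rfl⟩

/-- The square of the unit tangent vector is a rational function of `z` and `conj z` on the
boundary. -/
theorem exists_tangent_relation (hs : Schwarz Ω D σ) (h : Bdry Ω γ) :
    ∃ A B : Polynomial (Polynomial ℂ),
      (∀ i t, A.evalEval (conj (γ i t)) (γ i t) * conj (deriv (γ i) t) +
        B.evalEval (conj (γ i t)) (γ i t) * deriv (γ i) t = 0) ∧
      ∃ z ∈ Ω, D.eval z ≠ 0 ∧ B.evalEval (σ z / D.eval z) z ≠ 0 := by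
  classical
  have hΩ := h.segDom
  have hex : ∃ k : ℕ, ∃ P : Polynomial (Polynomial ℂ), P ≠ 0 ∧ P.natDegree = k ∧
      ∀ z ∈ Ω, D.eval z ≠ 0 → P.evalEval (σ z / D.eval z) z = 0 := by
    obtain ⟨R, hR, hR'⟩ := Pair.exists_algebraic_relation hΩ one_ne_zero hs.roots .one .one
      hs.roots (hs.pair hΩ) (hs.pair hΩ).symm
    exact ⟨_, R, hR, rfl, fun z hz hz' => by simpa using hR' z hz hz' (by simp)⟩
  obtain ⟨P, hP0, hdeg, hP⟩ := Nat.find_spec hex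
  obtain ⟨A, hA⟩ := exists_hasDerivAt_evalEval P
  refine ⟨A, P.derivative, fun i t => ?_, ?_⟩
  · have hd := (h.loop i).hasDerivAt t
    have h1 := hA (fun t => conj (γ i t)) (γ i) _ _ t hd.star hd
    have h2 : (fun t => P.evalEval (conj (γ i t)) (γ i t)) = fun _ => 0 := funext fun t =>
      hs.evalEval_frontier hΩ hP ((h.frontier_eq _).2 ⟨i, t, rfl⟩)
    rw [h2] at h1
    exact h1.unique (hasDerivAt_const t (0 : ℂ))
  · by_contra! hcon
    rcases eq_or_ne P.natDegree 0 with h0 | h0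
    · obtain ⟨p, rfl⟩ := Polynomial.natDegree_eq_zero.1 h0
      have hp0 : p ≠ 0 := fun h' => hP0 (by rw [h', map_zero])
      refine hp0 (Polynomial.eq_zero_of_infinite_isRoot p ?_)
      refine ((frontier_infinite h).image (f := conj)
        (star_injective (R := ℂ)).injOn).mono ?_
      rintro _ ⟨x, hx, rfl⟩
      have := hs.evalEval_frontier hΩ hP hx
      rwa [Polynomial.evalEval_C] at this
    · refine Nat.find_min hex (m := P.derivative.natDegree) ?_ ⟨P.derivative, ?_, rfl, hcon⟩
      · rw [← hdeg]; exact Polynomial.natDegree_derivative_lt h0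
      · exact fun h' => h0 (Polynomial.derivative_eq_zero.1 h')

/-- The family of functions on which the square of the Szegő kernel is modelled. -/
theorem exists_kernel_pairs (hs : Schwarz Ω D σ) {S : ℂ → ℂ → ℂ} (h : Szego Ω γ S) :
    ∃ (N : ℕ) (b H : ℂ → ℂ), Pair Ω 1 (D ^ N) (D ^ N) b H ∧ (∃ z ∈ Ω, b z ≠ 0) ∧
      ∃ G : ℂ → ℂ → ℂ, ∀ w ∈ Ω, Pair Ω 1 (D ^ (N + 2)) (D ^ N)
        (fun z => S z w ^ 2 * (σ z - conj w * D.eval z) ^ 2 * b z) (G w) := by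
  have hΩ := h.segDom
  obtain ⟨A, B, hAB, z0, hz0, hDz0, hBz0⟩ := hs.exists_tangent_relation h.toBdry
  have aoz : AO Ω fun z => z * D.eval z := (AO.of_differentiable differentiable_id).mul (AO.poly Ω D)
  obtain ⟨N1, hN1⟩ := exists_ao_evalEval D hs.ao aoz A
  obtain ⟨N2, hN2⟩ := exists_ao_evalEval D hs.ao aoz B
  obtain ⟨N3, hN3⟩ := exists_ao_evalEval D aoz hs.ao (B.map (Polynomial.mapRingHom conj))
  set N := max N1 (max N2 N3) with hN
  obtain ⟨a0, ha, ha'⟩ := hN1 N (le_max_left _ _)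
  obtain ⟨H, hH, hH'⟩ := hN2 N ((le_max_left _ _).trans (le_max_right _ _))
  obtain ⟨b, hb, hb'⟩ := hN3 N ((le_max_right _ _).trans (le_max_right _ _))
  have va : ∀ p ∈ frontier Ω, a0 p = D.eval p ^ N * A.evalEval (conj p) p := fun p hp => by
    have := hs.eval_ne hΩ hp
    rw [ha' p this, hs.div_eq hΩ hp, mul_div_cancel_right₀ _ this]
  have vH : ∀ p ∈ frontier Ω, H p = D.eval p ^ N * B.evalEval (conj p) p := fun p hp => by
    have := hs.eval_ne hΩ hp
    rw [hH' p this, hs.div_eq hΩ hp, mul_div_cancel_right₀ _ this]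
  have vb : ∀ p ∈ frontier Ω, conj (b p) = conj (D.eval p) ^ N * B.evalEval (conj p) p :=
    fun p hp => by
      have := hs.eval_ne hΩ hp
      rw [hb' p this, hs.div_eq hΩ hp, mul_div_cancel_right₀ _ this, map_mul, map_pow,
        conj_evalEval_map, conj_conj]
  have hpair : Pair Ω 1 (D ^ N) (D ^ N) b H := .of_ao hΩ hb hH fun p hp => by
    rw [vb p hp, vH p hp, Polynomial.eval_pow, map_pow]; ring
  refine ⟨N, b, H, hpair, ?_, fun w z => garL Ω γ S w z ^ 2 * (a0 z * (4 * (Real.pi : ℂ) ^ 2)⁻¹),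
    fun w hw => ?_⟩
  · by_contra! hcon
    have h0 : ∀ z ∈ Ω, ‖H z‖ ≤ 0 := fun z hz => hΩ.norm_le_of_frontier hH.1 (fun p hp M' hM' => by
      have hp0 : H p = 0 := by
        have : (𝓝[Ω] p).NeBot := SegDom.frontier_neBot hp
        have h1 := hb.tendsto hp
        have h2 : b p = 0 := tendsto_nhds_unique h1 (tendsto_const_nhds.congr'
          (mem_of_superset self_mem_nhdsWithin fun z hz => (hcon z hz).symm))
        have h3 := vb p hp
        rw [h2, map_zero] at h3
        have h4 := (mul_eq_zero.1 h3.symm).resolve_left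
          (pow_ne_zero _ ((map_ne_zero _).2 (hs.eval_ne hΩ hp)))
        rw [vH p hp, h4, mul_zero]
      have := (hH.tendsto hp).norm
      rw [hp0, norm_zero] at this
      exact this.eventually (ge_mem_nhds hM')) hz
    have := norm_le_zero_iff.1 (h0 z0 hz0)
    rw [hH' z0 hDz0, mul_div_cancel_right₀ _ hDz0] at this
    exact mul_ne_zero (pow_ne_zero _ hDz0) hBz0 this
  · refine .of_ao hΩ ((((h.ao w hw).pow 2).mul ((hs.ao.sub ((AO.const Ω _).mul
      (AO.poly Ω D))).pow 2)).mul hb) (((h.ao_garL hw).pow 2).mul (ha.mul (AO.const Ω _)))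
      fun p hp => ?_
    obtain ⟨i, t, rfl⟩ := h.eq_of_frontier hp
    have hpw : γ i t ≠ w := fun h0 => hΩ.notMem hp (by rw [h0]; exact hw)
    have h1 := h.gar_bdry hw i t
    have h2 := hAB i t
    have h3 := norm_sq_eq (deriv (γ i) t)
    have hd := (h.loop i).ne t
    beta_reduce
    rw [garL_eq hpw, va _ hp, map_mul, vb _ hp, hs.bdry _ hp]
    simp only [map_mul, map_pow, map_sub, conj_conj, Polynomial.eval_pow]
    have := sq_of_tangent hd h1 h2 h3
    linear_combination ((γ i t - w) ^ 2 * conj (D.eval (γ i t)) ^ (N + 2) *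
      D.eval (γ i t) ^ N) * this

end Schwarz

namespace SegDom

variable {Ω : Set ℂ}

/-- A function algebraic over the rational functions is bounded below by a polynomial. -/
theorem exists_growth (hΩ : SegDom Ω) {h : ℂ → ℂ} (hh : BH Ω h) {E : Polynomial ℂ} (hE : E ≠ 0)
    (l : ℂ) (hne : ∃ z ∈ Ω, h z ≠ l * E.eval z) {R : Polynomial (Polynomial ℂ)} (hR : R ≠ 0)
    (hrel : ∀ z ∈ Ω, E.eval z ≠ 0 → R.evalEval z (h z / E.eval z) = 0) :
    ∃ c : Polynomial ℂ, c ≠ 0 ∧ ∃ C, ∀ z ∈ Ω, ‖c.eval z‖ ≤ C * ‖h z - l * E.eval z‖ := by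
  obtain ⟨R1, hR1, hndvd⟩ := Polynomial.exists_eq_pow_rootMultiplicity_mul_and_not_dvd R hR
    (Polynomial.C l)
  set m := R.rootMultiplicity (Polynomial.C l)
  set c0 := R1.eval (Polynomial.C l) with hc0
  have hc0' : c0 ≠ 0 := fun h0 => hndvd (Polynomial.dvd_iff_isRoot.2 h0)
  obtain ⟨Q, hQ⟩ := Polynomial.X_sub_C_dvd_sub_C_eval (a := Polynomial.C l) (p := R1)
  have hz : BH Ω fun z => z * E.eval z :=
    (BH.of_ao hΩ.bdd (AO.of_differentiable differentiable_id)).mul (hΩ.bh_poly E)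
  have hsub : BH Ω fun z => h z - l * E.eval z := hh.sub ((hΩ.bh_poly E).const_mul l)
  obtain ⟨M, hM⟩ := exists_bh_evalEval hΩ E hz hh R1
  obtain ⟨r, hr, hr'⟩ := hM M le_rfl
  obtain ⟨N, hN⟩ := exists_bh_evalEval hΩ E hz hh Q
  obtain ⟨q, hq, hq'⟩ := hN N le_rfl
  have hr0 : ∀ z ∈ Ω, r z = 0 := by
    have h1 := hΩ.eq_zero_of_off hE (f := fun z => (h z - l * E.eval z) ^ m * r z)
      ((hsub.pow m).mul hr).diff fun z hz hEz => by
        have h2 := hrel z hz hEz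
        rw [hR1] at h2
        simp only [Polynomial.evalEval_mul, Polynomial.evalEval_pow, Polynomial.evalEval_sub,
          Polynomial.evalEval_X, Polynomial.evalEval_C, Polynomial.eval_C] at h2
        have h3 : h z - l * E.eval z = E.eval z * (h z / E.eval z - l) := by field_simp
        rw [hr' z hEz, mul_div_cancel_right₀ _ hEz, h3, mul_pow]
        linear_combination (E.eval z ^ m * E.eval z ^ M) * h2
    refine (hΩ.eq_zero_or (hsub.pow m).diff hr.diff h1).resolve_left fun h2 => ?_
    obtain ⟨z, hz, hz'⟩ := hne
    exact hz' (sub_eq_zero.1 (eq_zero_of_pow_eq_zero (h2 z hz)))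
  obtain ⟨C, hC⟩ := hq.bdd
  refine ⟨E ^ (N + 1) * c0, mul_ne_zero (pow_ne_zero _ hE) hc0', C, fun z hz => ?_⟩
  have hCz := (norm_nonneg _).trans (hC z hz)
  by_cases hEz : E.eval z = 0
  · rw [Polynomial.eval_mul, Polynomial.eval_pow, hEz, zero_pow (by omega), zero_mul, norm_zero]
    positivity
  · have h1 : R1.evalEval z (h z / E.eval z) = 0 := by
      have := hr' z hEz
      rw [hr0 z hz, mul_div_cancel_right₀ _ hEz] at this
      exact (mul_eq_zero.1 this.symm).resolve_left (pow_ne_zero _ hEz)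
    have h2 := congrArg (Polynomial.evalEval z (h z / E.eval z)) hQ
    simp only [Polynomial.evalEval_mul, Polynomial.evalEval_sub, h1,
      Polynomial.evalEval_X, Polynomial.evalEval_C, Polynomial.eval_C] at h2
    have h3 : (E ^ (N + 1) * c0).eval z = -(q z * (h z - l * E.eval z)) := by
      rw [hq' z hEz, mul_div_cancel_right₀ _ hEz, Polynomial.eval_mul, Polynomial.eval_pow]
      have h4 : h z - l * E.eval z = E.eval z * (h z / E.eval z - l) := by field_simp
      rw [h4]
      linear_combination (-E.eval z ^ (N + 1)) * h2
    rw [h3, norm_neg, norm_mul]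
    exact mul_le_mul_of_nonneg_right (hC z hz) (norm_nonneg _)

/-- Splitting off the zeros of a holomorphic function bounded below by a polynomial. -/
theorem exists_zero_polynomial (hΩ : SegDom Ω) (d : ℕ) : ∀ (c : Polynomial ℂ) (φ : ℂ → ℂ),
    c.natDegree = d → c ≠ 0 → DifferentiableOn ℂ φ Ω →
    (∃ C, ∀ z ∈ Ω, ‖c.eval z‖ ≤ C * ‖φ z‖) →
    ∃ (G : Polynomial ℂ) (V : ℂ → ℂ), InRoots Ω G ∧ DifferentiableOn ℂ V Ω ∧
      (∀ z ∈ Ω, V z ≠ 0) ∧ ∀ z ∈ Ω, G.eval z = φ z * V z := by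
  induction d with
  | zero =>
    rintro c φ hd hc hφ ⟨C, hC⟩
    obtain ⟨r, rfl⟩ := Polynomial.natDegree_eq_zero.1 hd
    have hr : r ≠ 0 := fun h0 => hc (by rw [h0, map_zero])
    have h0 : ∀ z ∈ Ω, φ z ≠ 0 := fun z hz h0 => by
      have := hC z hz
      rw [h0, norm_zero, mul_zero, Polynomial.eval_C] at this
      exact hr (norm_le_zero_iff.1 this)
    exact ⟨1, fun z => (φ z)⁻¹, .one, hφ.inv h0, fun z hz => inv_ne_zero (h0 z hz), fun z hz => by
      rw [mul_inv_cancel₀ (h0 z hz), Polynomial.eval_one]⟩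
  | succ d ih =>
    rintro c φ hd hc hφ ⟨C, hC⟩
    by_cases h0 : ∀ z ∈ Ω, φ z ≠ 0
    · exact ⟨1, fun z => (φ z)⁻¹, .one, hφ.inv h0, fun z hz => inv_ne_zero (h0 z hz),
        fun z hz => by rw [mul_inv_cancel₀ (h0 z hz), Polynomial.eval_one]⟩
    push Not at h0
    obtain ⟨w, hw, hφw⟩ := h0
    have hcw : c.IsRoot w := by
      have := hC w hw
      rw [hφw, norm_zero, mul_zero] at this
      exact norm_le_zero_iff.1 this
    obtain ⟨c1, rfl⟩ := Polynomial.dvd_iff_isRoot.2 hcw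
    have hc1 : c1 ≠ 0 := right_ne_zero_of_mul hc
    have hds : ∀ z, φ z = (z - w) * dslope φ w z := fun z => by
      have := sub_smul_dslope φ w z
      rw [hφw, sub_zero] at this
      exact this.symm
    have hdiff : DifferentiableOn ℂ (dslope φ w) Ω :=
      (Complex.differentiableOn_dslope (hΩ.isOpen.mem_nhds hw)).2 hφ
    have hoff : ∀ z ∈ Ω, z ≠ w → ‖c1.eval z‖ ≤ C * ‖dslope φ w z‖ := fun z hz hzw => by
      have := hC z hz
      rw [hds z, Polynomial.eval_mul, norm_mul, norm_mul, mul_left_comm, Polynomial.eval_sub,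
        Polynomial.eval_X, Polynomial.eval_C] at this
      exact le_of_mul_le_mul_left this (norm_pos_iff.2 (sub_ne_zero.2 hzw))
    have hall : ∀ z ∈ Ω, ‖c1.eval z‖ ≤ C * ‖dslope φ w z‖ := fun z hz => by
      rcases eq_or_ne z w with rfl | hzw
      · have h1 : Tendsto (fun y => ‖c1.eval y‖) (𝓝[≠] z) (𝓝 ‖c1.eval z‖) :=
          c1.continuous.norm.continuousAt.mono_left nhdsWithin_le_nhds
        have h2 : Tendsto (fun y => C * ‖dslope φ z y‖) (𝓝[≠] z) (𝓝 (C * ‖dslope φ z z‖)) :=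
          (((hdiff.continuousOn.continuousAt (hΩ.isOpen.mem_nhds hz)).norm).const_mul
            C).mono_left nhdsWithin_le_nhds
        refine le_of_tendsto_of_tendsto h1 h2 ?_
        filter_upwards [self_mem_nhdsWithin,
          nhdsWithin_le_nhds (hΩ.isOpen.mem_nhds hz)] with y hy hyΩ
        exact hoff y hyΩ hy
      · exact hoff z hz hzw
    obtain ⟨G, V, hG, hV, hV0, hGV⟩ := ih c1 (dslope φ w) (by
      rw [Polynomial.natDegree_mul (Polynomial.X_sub_C_ne_zero w) hc1,
        Polynomial.natDegree_X_sub_C] at hd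
      omega) hc1 hdiff ⟨C, hall⟩
    refine ⟨(Polynomial.X - Polynomial.C w) * G, V, InRoots.mul ⟨Polynomial.X_sub_C_ne_zero w,
      fun z hz => ?_⟩ hG, hV, hV0, fun z hz => ?_⟩
    · simp only [Polynomial.eval_sub, Polynomial.eval_X, Polynomial.eval_C] at hz
      rw [sub_eq_zero.1 hz]; exact hw
    · rw [Polynomial.eval_mul, hGV z hz, hds z]
      simp only [Polynomial.eval_sub, Polynomial.eval_X, Polynomial.eval_C]
      ring

/-- An inner function bounded below by a polynomial belongs to a pair. -/
theorem exists_inner_pair (hΩ : SegDom Ω) {φ : ℂ → ℂ} (hφ : BH Ω φ) {c : Polynomial ℂ}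
    (hc : c ≠ 0) (hgr : ∃ C, ∀ z ∈ Ω, ‖c.eval z‖ ≤ C * ‖φ z‖)
    (hb : ∀ p ∈ frontier Ω, c.eval p ≠ 0 → Tendsto (fun z => ‖φ z‖) (𝓝[Ω] p) (𝓝 1)) :
    ∃ (G : Polynomial ℂ) (V : ℂ → ℂ), InRoots Ω G ∧ Pair Ω c 1 G φ V ∧ (∀ z ∈ Ω, V z ≠ 0) ∧
      (∀ z ∈ Ω, G.eval z = φ z * V z) ∧
      ∀ M, 0 ≤ M → (∀ z ∈ Ω, ‖G.eval z‖ ≤ M) → ∀ z ∈ Ω, ‖V z‖ ≤ M := by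
  obtain ⟨G, V, hG, hV, hV0, hGV⟩ := hΩ.exists_zero_polynomial _ c φ rfl hc hφ.diff hgr
  obtain ⟨C, hC⟩ := hgr
  have hbound : ∀ M, 0 ≤ M → (∀ z ∈ Ω, ‖G.eval z‖ ≤ M) → ∀ z ∈ Ω, ‖V z‖ ≤ M := by
    intro M hM hGM z hz
    refine hΩ.norm_le_of_frontier_off hV hc (C := |C| * M) (fun y hy => ?_) hM
      (fun p hp hcp M' hM' => ?_) hz
    · have h1 := hC y hy
      have h2 := hGM y hy
      rw [hGV y hy, norm_mul] at h2
      calc ‖V y‖ * ‖c.eval y‖ ≤ ‖V y‖ * (|C| * ‖φ y‖) :=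
            mul_le_mul_of_nonneg_left (h1.trans (mul_le_mul_of_nonneg_right (le_abs_self C)
              (norm_nonneg _))) (norm_nonneg _)
        _ = |C| * (‖φ y‖ * ‖V y‖) := by ring
        _ ≤ |C| * M := mul_le_mul_of_nonneg_left h2 (abs_nonneg _)
    · have hM'0 : 0 < M' := hM.trans_lt hM'
      have h1 : M / M' < 1 := (div_lt_one hM'0).2 hM'
      filter_upwards [(hb p hp hcp).eventually (lt_mem_nhds h1), self_mem_nhdsWithin] with y hy hyΩ
      have h2 := hGM y hyΩ
      rw [hGV y hyΩ, norm_mul] at h2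
      rw [div_lt_iff₀ hM'0] at hy
      have h3 : ‖φ y‖ * ‖V y‖ ≤ ‖φ y‖ * M' := h2.trans hy.le
      have h4 : 0 < ‖φ y‖ := by
        by_contra! h5
        have := le_antisymm h5 (norm_nonneg _)
        rw [this, zero_mul] at hy
        linarith
      exact le_of_mul_le_mul_left h3 h4
  obtain ⟨M, hM⟩ := (hΩ.bh_poly G).bdd
  have hVb : BH Ω V := ⟨hV, max M 0, hbound _ (le_max_right _ _) fun z hz =>
    (hM z hz).trans (le_max_left _ _)⟩
  refine ⟨G, V, hG, ⟨hφ, hVb, fun p hp hcp => ?_⟩, hV0, hGV, hbound⟩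
  have h1 : Tendsto (fun z => ((‖φ z‖ ^ 2 - 1 : ℝ) : ℂ)) (𝓝[Ω] p) (𝓝 0) := by
    have := (((hb p hp hcp).pow 2).sub_const 1)
    rw [one_pow, sub_self] at this
    exact (continuous_ofReal.tendsto 0).comp this
  refine (tendsto_bdd_mul hVb.bdd h1).congr' ?_
  filter_upwards [self_mem_nhdsWithin] with z hz
  push_cast
  rw [hGV z hz, norm_sq_eq, Polynomial.eval_one, map_one]
  ring

end SegDom

/-- `φ` is an inner function, unimodular on the boundary off the zeros of `c`. -/
structure InnerFun (Ω : Set ℂ) (c : Polynomial ℂ) (φ : ℂ → ℂ) : Prop where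
  bh : BH Ω φ
  lt : ∀ z ∈ Ω, ‖φ z‖ < 1
  ne : c ≠ 0
  growth : ∃ C, ∀ z ∈ Ω, ‖c.eval z‖ ≤ C * ‖φ z‖
  bdry : ∀ p ∈ frontier Ω, c.eval p ≠ 0 → Tendsto (fun z => ‖φ z‖) (𝓝[Ω] p) (𝓝 1)

namespace Szego

variable {Ω : Set ℂ} {n : ℕ} {γ : Fin n → ℝ → ℂ} {S : ℂ → ℂ → ℂ}

theorem self_ne_zero (h : Szego Ω γ S) {b : ℂ} (hb : b ∈ Ω) : S b b ≠ 0 := by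
  rw [h.diag_eq hb]
  exact ofReal_ne_zero.2 (h.diag_pos hb).ne'

theorem norm_garL_frontier (h : Szego Ω γ S) {b : ℂ} (hb : b ∈ Ω) {p : ℂ} (hp : p ∈ frontier Ω) :
    ‖garL Ω γ S b p‖ = 2 * Real.pi * ‖S p b‖ * ‖p - b‖ := by
  obtain ⟨i, t, rfl⟩ := h.eq_of_frontier hp
  have e1 := congrArg norm (h.gar_bdry hb i t)
  have h0 : (‖deriv (γ i) t‖ : ℝ) ≠ 0 := norm_ne_zero_iff.2 ((h.loop i).ne t)
  simp only [norm_mul, norm_I, mul_one, RCLike.norm_conj, norm_real, norm_norm, norm_ofNat,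
    Real.norm_of_nonneg Real.pi_pos.le, ← mul_assoc] at e1
  have e2 := mul_right_cancel₀ h0 e1
  rw [garL_eq (h.off_of_mem hb i t), norm_mul, e2, mul_comm]

end Szego

namespace Schwarz

variable {Ω : Set ℂ} {D : Polynomial ℂ} {σ : ℂ → ℂ}
variable {n : ℕ} {γ : Fin n → ℝ → ℂ} {S : ℂ → ℂ → ℂ}

theorem exists_ne (hs : Schwarz Ω D σ) (hΩ : SegDom Ω) {b : ℂ} (hb : b ∈ Ω) :
    ∃ z ∈ Ω, σ z - conj b * D.eval z ≠ 0 := by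
  by_contra! hcon
  obtain ⟨p, hp⟩ := hΩ.exists_frontier
  have : (𝓝[Ω] p).NeBot := SegDom.frontier_neBot hp
  have h1 := ((hs.ao.sub ((AO.const Ω (conj b)).mul (AO.poly Ω D))).tendsto hp)
  have h2 := tendsto_nhds_unique h1 (tendsto_const_nhds.congr'
    (mem_of_superset self_mem_nhdsWithin fun z hz => (hcon z hz).symm))
  rw [hs.bdry p hp, ← sub_mul] at h2
  have h3 := (mul_eq_zero.1 h2).resolve_right (hs.eval_ne hΩ hp)
  rw [← map_sub, map_eq_zero, sub_eq_zero] at h3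
  exact hΩ.notMem hp (h3 ▸ hb)

theorem exists_relation (hs : Schwarz Ω D σ) (hΩ : SegDom Ω) {c E E' : Polynomial ℂ} (hc : c ≠ 0)
    (hE : InRoots Ω E) (hE' : InRoots Ω E') {h H : ℂ → ℂ} (hp : Pair Ω c E E' h H) :
    ∃ R : Polynomial (Polynomial ℂ), R ≠ 0 ∧
      ∀ z ∈ Ω, E.eval z ≠ 0 → R.evalEval z (h z / E.eval z) = 0 := by
  obtain ⟨R, hR, hrel⟩ := Pair.exists_algebraic_relation hΩ hc .one hs.roots hE hE'
    ((hs.pair hΩ).symm.of_dvd (one_dvd c)) hp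
  refine ⟨R, hR, fun z hz hEz => ?_⟩
  simpa using hrel z hz (by simp) hEz

theorem exists_inner_ahl (hs : Schwarz Ω D σ) (h : Szego Ω γ S) {b : ℂ} (hb : b ∈ Ω) :
    ∃ c, InnerFun Ω c (ahl Ω γ S b) := by
  have hΩ := h.segDom
  obtain ⟨N, b0, H, hp0, ⟨z0, hz0, hbz0⟩, G, hG⟩ := hs.exists_kernel_pairs h
  have hGb := hG b hb
  obtain ⟨R, hR, hrel⟩ := hs.exists_relation hΩ one_ne_zero (hs.roots.pow _) (hs.roots.pow _) hGb
  have aoq := hs.ao.sub ((AO.const Ω (conj b)).mul (AO.poly Ω D))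
  have hne : ∃ z ∈ Ω, S z b ^ 2 * (σ z - conj b * D.eval z) ^ 2 * b0 z ≠
      0 * (D ^ (N + 2)).eval z := by
    by_contra! hcon
    simp only [zero_mul] at hcon
    rcases hΩ.eq_zero_or (((h.ao b hb).pow 2).1.mul (aoq.pow 2).1) hp0.fst.diff hcon with h1 | h1
    · rcases hΩ.eq_zero_or ((h.ao b hb).pow 2).1 (aoq.pow 2).1 h1 with h2 | h2
      · exact pow_ne_zero 2 (h.self_ne_zero hb) (h2 b hb)
      · obtain ⟨z, hz, hz'⟩ := hs.exists_ne hΩ hb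
        exact pow_ne_zero 2 hz' (h2 z hz)
    · exact hbz0 (h1 z0 hz0)
  obtain ⟨c, hc, C, hC⟩ := hΩ.exists_growth hGb.fst (pow_ne_zero _ hs.roots.ne) 0 hne hR hrel
  obtain ⟨C1, hC1⟩ := (((BH.of_ao hΩ.bdd (h.ao b hb)).mul
    ((BH.of_ao hΩ.bdd aoq).pow 2)).mul hp0.fst).bdd
  obtain ⟨C2, hC2⟩ := (BH.of_ao hΩ.bdd (h.ao_garL hb)).bdd
  have hcS : ∀ z ∈ Ω, ‖c.eval z‖ ≤ |C| * C1 * ‖S z b‖ := fun z hz => by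
    have h1 := hC z hz
    have h2 := hC1 z hz
    rw [zero_mul, sub_zero] at h1
    calc ‖c.eval z‖ ≤ |C| * (‖S z b * (σ z - conj b * D.eval z) ^ 2 * b0 z‖ * ‖S z b‖) := by
          refine h1.trans ?_
          rw [← norm_mul]
          refine (mul_le_mul_of_nonneg_right (le_abs_self C) (norm_nonneg _)).trans (le_of_eq ?_)
          congr 2
          ring
      _ ≤ |C| * (C1 * ‖S z b‖) := by gcongr
      _ = _ := by ring
  have hev : ∀ z, (c * (Polynomial.X - Polynomial.C b)).eval z = c.eval z * (z - b) := by simp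
  refine ⟨c * (Polynomial.X - Polynomial.C b), ⟨h.ahl_differentiableOn hb, 1, fun z hz =>
    (h.norm_ahl_lt hb hz).le⟩, fun z hz => h.norm_ahl_lt hb hz,
    mul_ne_zero hc (Polynomial.X_sub_C_ne_zero b), ⟨|C| * C1 * C2, fun z hz => ?_⟩,
    fun p hp hcp => ?_⟩
  · have hL := h.garL_ne_zero hb hz
    have hC1' := (norm_nonneg _).trans (hC1 z hz)
    have e : ‖S z b‖ * ‖z - b‖ ≤ ‖ahl Ω γ S b z‖ * ‖garL Ω γ S b z‖ := by
      rw [← norm_mul, ← norm_mul, ahl, div_mul_cancel₀ _ hL]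
      simp only [norm_mul, norm_ofNat, norm_real, Real.norm_of_nonneg Real.pi_pos.le]
      have : 1 ≤ 2 * Real.pi := by linarith [Real.pi_gt_three]
      rw [mul_assoc]
      exact le_mul_of_one_le_left (by positivity) this
    rw [hev, norm_mul]
    calc ‖c.eval z‖ * ‖z - b‖ ≤ |C| * C1 * ‖S z b‖ * ‖z - b‖ := by gcongr; exact hcS z hz
      _ = |C| * C1 * (‖S z b‖ * ‖z - b‖) := by ring
      _ ≤ |C| * C1 * (‖ahl Ω γ S b z‖ * C2) := by
          refine mul_le_mul_of_nonneg_left (e.trans ?_) (by positivity)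
          exact mul_le_mul_of_nonneg_left (hC2 z hz) (norm_nonneg _)
      _ = _ := by ring
  · rw [hev] at hcp
    have hcp1 := left_ne_zero_of_mul hcp
    have hpb := right_ne_zero_of_mul hcp
    have : (𝓝[Ω] p).NeBot := SegDom.frontier_neBot hp
    have tS := (h.ao b hb).tendsto hp
    have hSp : S p b ≠ 0 := fun h0 => by
      have t1 := ((AO.poly Ω c).tendsto hp).norm
      have t2 := (tS.norm).const_mul (|C| * C1)
      have := le_of_tendsto_of_tendsto t1 t2 (mem_of_superset self_mem_nhdsWithin hcS)
      rw [h0, norm_zero, mul_zero] at this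
      exact hcp1 (norm_le_zero_iff.1 this)
    have hL := h.norm_garL_frontier hb hp
    have hLp : 0 < ‖garL Ω γ S b p‖ := by
      rw [hL]
      have := norm_pos_iff.2 hSp
      have := norm_pos_iff.2 hpb
      have := Real.pi_pos
      positivity
    have t3 := (((((AO.const Ω (2 * (Real.pi : ℂ))).mul (h.ao b hb)).mul
      (AO.sub_const Ω b)).tendsto hp).div ((h.ao_garL hb).tendsto hp) (norm_pos_iff.1 hLp)).norm
    have e : ‖2 * (Real.pi : ℂ) * S p b * (p - b) / garL Ω γ S b p‖ = 1 := by
      rw [norm_div, div_eq_one_iff_eq hLp.ne', hL]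
      simp only [norm_mul, norm_ofNat, norm_real, Real.norm_of_nonneg Real.pi_pos.le]
    rw [e] at t3
    exact t3

end Schwarz

/-- The disc automorphism taking `l` to `0`. -/
def mobius (l x : ℂ) : ℂ := (x - l) / (1 - conj l * x)

section mobius

variable {l x : ℂ}

theorem norm_one_sub_mobius (hx : ‖x‖ < 1) : 1 - ‖l‖ ≤ ‖1 - conj l * x‖ := by
  have h1 := norm_sub_norm_le 1 (conj l * x)
  rw [norm_one, norm_mul, RCLike.norm_conj] at h1
  nlinarith [norm_nonneg l, norm_nonneg x]

theorem mobius_den_ne_zero (hl : ‖l‖ < 1) (hx : ‖x‖ < 1) : 1 - conj l * x ≠ 0 :=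
  norm_pos_iff.1 ((sub_pos.2 hl).trans_le (norm_one_sub_mobius hx))

theorem norm_sq_mobius (hl : ‖l‖ < 1) (hx : ‖x‖ < 1) :
    ‖mobius l x‖ ^ 2 = 1 - (1 - ‖l‖ ^ 2) * (1 - ‖x‖ ^ 2) / ‖1 - conj l * x‖ ^ 2 := by
  have h0 := norm_pos_iff.2 (mobius_den_ne_zero hl hx)
  rw [mobius, norm_div, div_pow, eq_sub_iff_add_eq, ← add_div, div_eq_one_iff_eq (by positivity)]
  simp only [← normSq_eq_norm_sq, normSq_apply, sub_re, sub_im, mul_re, mul_im, conj_re, conj_im,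
    one_re, one_im]
  ring

theorem norm_mobius_lt (hl : ‖l‖ < 1) (hx : ‖x‖ < 1) : ‖mobius l x‖ < 1 := by
  have h0 := norm_pos_iff.2 (mobius_den_ne_zero hl hx)
  have h1 := norm_sq_mobius hl hx
  have h2 : 0 < (1 - ‖l‖ ^ 2) * (1 - ‖x‖ ^ 2) / ‖1 - conj l * x‖ ^ 2 := by
    refine div_pos (mul_pos ?_ ?_) (by positivity) <;> nlinarith [norm_nonneg l, norm_nonneg x]
  refine lt_of_pow_lt_pow_left₀ 2 zero_le_one ?_
  rw [one_pow]
  linarith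

theorem le_norm_mobius (hl : ‖l‖ < 1) (hx : ‖x‖ < 1) :
    1 - (1 - ‖x‖ ^ 2) / (1 - ‖l‖) ^ 2 ≤ ‖mobius l x‖ := by
  have h0 := norm_one_sub_mobius (l := l) hx
  have h1 := norm_sq_mobius hl hx
  have h2 : 0 < 1 - ‖l‖ := by linarith
  have h3 : 0 ≤ 1 - ‖x‖ ^ 2 := by nlinarith [norm_nonneg x]
  have h4 : (1 - ‖l‖ ^ 2) * (1 - ‖x‖ ^ 2) / ‖1 - conj l * x‖ ^ 2 ≤
      (1 - ‖x‖ ^ 2) / (1 - ‖l‖) ^ 2 := by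
    gcongr
    nlinarith [sq_nonneg ‖l‖]
  have h5 := norm_mobius_lt hl hx
  nlinarith [norm_nonneg (mobius l x)]

theorem sub_le_norm_mobius (hl : ‖l‖ < 1) (hx : ‖x‖ < 1) : ‖x - l‖ ≤ 2 * ‖mobius l x‖ := by
  have h0 := mobius_den_ne_zero hl hx
  have h1 : x - l = mobius l x * (1 - conj l * x) := by rw [mobius, div_mul_cancel₀ _ h0]
  have h2 : ‖1 - conj l * x‖ ≤ 2 := by
    refine (norm_sub_le _ _).trans ?_
    rw [norm_one, norm_mul, RCLike.norm_conj]
    nlinarith [norm_nonneg l, norm_nonneg x]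
  rw [h1, norm_mul, mul_comm]
  exact mul_le_mul_of_nonneg_right h2 (norm_nonneg _)

theorem hasDerivAt_mobius (hl : ‖l‖ < 1) : HasDerivAt (mobius l) (1 / (1 - conj l * l)) l := by
  have h0 := mobius_den_ne_zero hl hl
  have h1 := (((hasDerivAt_id l).sub_const l).div
    (((hasDerivAt_id l).const_mul (conj l)).const_sub 1) h0)
  refine h1.congr_deriv ?_
  simp only [id, sub_self]
  field_simp
  ring

end mobius

/-- A holomorphic function has a regular value in the unit disc. -/
theorem exists_regular_value {Ω : Set ℂ} (hΩ : IsOpen Ω) {φ : ℂ → ℂ} (hφ : DifferentiableOn ℂ φ Ω) :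
    ∃ l, ‖l‖ < 1 ∧ ∀ z ∈ Ω, φ z = l → deriv φ z ≠ 0 := by
  set s := {z ∈ Ω | deriv φ z = 0}
  have h1 : volume (φ '' s) = 0 := by
    refine addHaar_image_eq_zero_of_det_fderivWithin_eq_zero volume (f' := fun _ => 0) (fun z hz => ?_)
      fun z _ => ?_
    · have h2 := (hφ.differentiableAt (hΩ.mem_nhds hz.1)).hasDerivAt
      rw [hz.2] at h2
      have h3 := (h2.hasFDerivAt.restrictScalars ℝ).hasFDerivWithinAt (s := s)
      convert h3
      ext; simp
    · rw [ContinuousLinearMap.det, ContinuousLinearMap.toLinearMap_zero, LinearMap.det_zero]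
      simp
  by_contra! hcon
  have h2 : ball (0 : ℂ) 1 ⊆ φ '' s := fun l hl => by
    obtain ⟨z, hz, hzl, hz'⟩ := hcon l (by simpa using hl)
    exact ⟨z, ⟨hz, hz'⟩, hzl⟩
  have h3 := measure_mono_null h2 h1
  exact (measure_ball_pos volume (0 : ℂ) one_pos).ne' h3

namespace Schwarz

variable {Ω : Set ℂ} {D : Polynomial ℂ} {σ : ℂ → ℂ}

/-- A Möbius transform of an inner function is inner; its zeros can be made simple. -/
theorem exists_inner_mobius (hs : Schwarz Ω D σ) (hΩ : SegDom Ω) {c : Polynomial ℂ} {φ : ℂ → ℂ}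
    (hφ : InnerFun Ω c φ) (hd : ∃ a ∈ Ω, deriv φ a ≠ 0) : ∃ l, ‖l‖ < 1 ∧ ∃ c',
      InnerFun Ω c' (fun z => mobius l (φ z)) ∧
      ∀ z ∈ Ω, mobius l (φ z) = 0 → deriv (fun z => mobius l (φ z)) z ≠ 0 := by
  obtain ⟨l, hl, hreg⟩ := exists_regular_value hΩ.isOpen hφ.bh.diff
  obtain ⟨G, V, hG, hpair, -⟩ := hΩ.exists_inner_pair hφ.bh hφ.ne hφ.growth hφ.bdry
  obtain ⟨R, hR, hrel⟩ := hs.exists_relation hΩ hφ.ne .one hG hpair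
  have hne : ∃ z ∈ Ω, φ z ≠ l * (1 : Polynomial ℂ).eval z := by
    by_contra! hcon
    obtain ⟨a, ha, hda⟩ := hd
    have : φ =ᶠ[𝓝 a] fun _ => l := by
      filter_upwards [hΩ.isOpen.mem_nhds ha] with z hz
      simpa using hcon z hz
    rw [this.deriv_eq, deriv_const] at hda
    exact hda rfl
  obtain ⟨c2, hc2, C, hC⟩ := hΩ.exists_growth hφ.bh one_ne_zero l hne hR hrel
  obtain ⟨C', hC'⟩ := (hΩ.bh_poly c).bdd
  have hdiff : DifferentiableOn ℂ (fun z => mobius l (φ z)) Ω :=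
    (hφ.bh.diff.sub_const l).div ((differentiableOn_const 1).sub (hφ.bh.diff.const_mul _))
      fun z hz => mobius_den_ne_zero hl (hφ.lt z hz)
  refine ⟨l, hl, c * c2, ⟨⟨hdiff, 1, fun z hz => (norm_mobius_lt hl (hφ.lt z hz)).le⟩,
    fun z hz => norm_mobius_lt hl (hφ.lt z hz), mul_ne_zero hφ.ne hc2, ⟨C' * (|C| * 2),
    fun z hz => ?_⟩, fun p hp hcp => ?_⟩, fun z hz h0 => ?_⟩
  · have h1 := hC z hz
    rw [Polynomial.eval_one, mul_one] at h1
    have h2 := sub_le_norm_mobius hl (hφ.lt z hz)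
    have h3 := (norm_nonneg _).trans (hC' z hz)
    rw [Polynomial.eval_mul, norm_mul]
    calc ‖c.eval z‖ * ‖c2.eval z‖ ≤ C' * (|C| * (2 * ‖mobius l (φ z)‖)) := by
          refine mul_le_mul (hC' z hz) (h1.trans ?_) (norm_nonneg _) h3
          exact (mul_le_mul_of_nonneg_right (le_abs_self C) (norm_nonneg _)).trans
            (mul_le_mul_of_nonneg_left h2 (abs_nonneg _))
      _ = _ := by ring
  · rw [Polynomial.eval_mul] at hcp
    have t1 := hφ.bdry p hp (left_ne_zero_of_mul hcp)
    have t2 : Tendsto (fun z => 1 - (1 - ‖φ z‖ ^ 2) / (1 - ‖l‖) ^ 2) (𝓝[Ω] p) (𝓝 1) := by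
      have := (((t1.pow 2).const_sub 1).div_const ((1 - ‖l‖) ^ 2)).const_sub 1
      simpa using this
    refine tendsto_of_tendsto_of_tendsto_of_le_of_le' t2 tendsto_const_nhds ?_ ?_
    · filter_upwards [self_mem_nhdsWithin] with z hz using le_norm_mobius hl (hφ.lt z hz)
    · filter_upwards [self_mem_nhdsWithin] with z hz using (norm_mobius_lt hl (hφ.lt z hz)).le
  · have h1 : φ z = l := by
      rw [mobius, div_eq_zero_iff] at h0
      exact sub_eq_zero.1 (h0.resolve_right (mobius_den_ne_zero hl (hφ.lt z hz)))
    have h2 := (hφ.bh.diff.differentiableAt (hΩ.isOpen.mem_nhds hz)).hasDerivAt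
    have h3 : HasDerivAt (mobius l) (1 / (1 - conj l * l)) (φ z) := by
      rw [h1]; exact hasDerivAt_mobius hl
    have h4 := (h3.comp z h2).deriv
    rw [Function.comp_def] at h4
    rw [h4]
    exact mul_ne_zero (one_div_ne_zero (mobius_den_ne_zero hl hl)) (hreg z hz h1)

end Schwarz

/-- The zero polynomial of an inner function with simple zeros. -/
theorem InnerFun.exists_simple_pair {Ω : Set ℂ} (hΩ : SegDom Ω) {c : Polynomial ℂ} {g : ℂ → ℂ}
    (hg : InnerFun Ω c g) (hd : ∀ z ∈ Ω, g z = 0 → deriv g z ≠ 0) :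
    ∃ (G : Polynomial ℂ) (V : ℂ → ℂ), InRoots Ω G ∧ Pair Ω c 1 G g V ∧ (∀ z ∈ Ω, V z ≠ 0) ∧
      (∀ z ∈ Ω, G.eval z = g z * V z) ∧ G.roots.Nodup ∧ 1 ≤ G.natDegree := by
  obtain ⟨G, V, hG, hp, hV, hGV, hM⟩ := hΩ.exists_inner_pair hg.bh hg.ne hg.growth hg.bdry
  refine ⟨G, V, hG, hp, hV, hGV, ?_, ?_⟩
  · rw [Multiset.nodup_iff_count_le_one]
    intro z
    rw [Polynomial.count_roots]
    by_contra! hlt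
    obtain ⟨h1, h2⟩ := (Polynomial.one_lt_rootMultiplicity_iff_isRoot hG.ne).1 hlt
    have hz := hG.mem z h1
    have hn := hΩ.isOpen.mem_nhds hz
    have hgz : g z = 0 := by
      have := hGV z hz
      rw [h1, eq_comm, mul_eq_zero] at this
      exact this.resolve_right (hV z hz)
    have e : (fun x => G.eval x) =ᶠ[𝓝 z] fun x => g x * V x := mem_of_superset hn hGV
    have e1 := e.deriv_eq
    have e2 : deriv (fun x => g x * V x) z = _ := ((hg.bh.diff.differentiableAt hn).hasDerivAt.mul
      (hp.snd.diff.differentiableAt hn).hasDerivAt).deriv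
    rw [e2, Polynomial.deriv, h2, hgz, zero_mul, add_zero, eq_comm, mul_eq_zero] at e1
    exact e1.elim (hd z hz hgz) (hV z hz)
  · by_contra! hlt
    obtain ⟨k, hk⟩ := Polynomial.natDegree_eq_zero.1 (Nat.lt_one_iff.1 hlt)
    obtain ⟨z, hz⟩ := hΩ.conn.nonempty
    have h1 := hM ‖k‖ (norm_nonneg _) (fun z _ => by rw [← hk, Polynomial.eval_C]) z hz
    have h2 := congrArg norm (hGV z hz)
    rw [← hk, Polynomial.eval_C, norm_mul] at h2
    have h3 := hg.lt z hz
    have h4 := norm_pos_iff.2 (hV z hz)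
    nlinarith

theorem hasDerivAt_conj_mul {s p : ℂ → ℂ} {b s' p' : ℂ} (hs : HasDerivAt s s' b)
    (hp : HasDerivAt p p' b) (v : ℂ) :
    HasDerivAt (fun t : ℝ => conj (s (b + t * v)) * p (b + t * v))
      (conj (s' * v) * p b + conj (s b) * (p' * v)) 0 := by
  have h0 : HasDerivAt (fun t : ℝ => b + t * v) v 0 := by
    have := ((hasDerivAt_id (0 : ℝ)).ofReal_comp.mul_const v).const_add b
    simpa using this
  have hs' : HasDerivAt s s' (b + ((0 : ℝ) : ℂ) * v) := by simpa using hs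
  have hp' : HasDerivAt p p' (b + ((0 : ℝ) : ℂ) * v) := by simpa using hp
  have h1 := ((hs'.scomp (0 : ℝ) h0).star).mul (hp'.scomp (0 : ℝ) h0)
  refine h1.congr_deriv ?_
  simp [mul_comm]

/-- The Wronskian identity forced by a sesquiholomorphic proportionality. -/
theorem wronskian_eq_zero {s₁ s₂ p q : ℂ → ℂ} {b : ℂ} (h1 : DifferentiableAt ℂ s₁ b)
    (h2 : DifferentiableAt ℂ s₂ b) (hp : DifferentiableAt ℂ p b) (hq : DifferentiableAt ℂ q b)
    (h : ∀ᶠ z in 𝓝 b, conj (s₁ z) * p z = conj (s₂ z) * q z) :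
    s₁ b * (deriv p b * q b - p b * deriv q b) = 0 := by
  have key : ∀ v, conj (deriv s₁ b * v) * p b + conj (s₁ b) * (deriv p b * v) =
      conj (deriv s₂ b * v) * q b + conj (s₂ b) * (deriv q b * v) := fun v => by
    refine (hasDerivAt_conj_mul h1.hasDerivAt hp.hasDerivAt v).unique
      ((hasDerivAt_conj_mul h2.hasDerivAt hq.hasDerivAt v).congr_of_eventuallyEq ?_)
    have : Tendsto (fun t : ℝ => b + t * v) (𝓝 0) (𝓝 b) := by
      have : Continuous fun t : ℝ => b + t * v := by fun_prop
      simpa using this.tendsto 0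
    exact this.eventually h
  have e1 := key 1
  have eI := key I
  have e0 := h.self_of_nhds
  simp only [map_mul, mul_one, conj_I] at e1 eI
  have e2 : conj (s₁ b) * deriv p b = conj (s₂ b) * deriv q b := by
    linear_combination (1 / 2) * e1 - (I / 2) * eI + (1 / 2) * (conj (s₁ b) * deriv p b -
      conj (s₂ b) * deriv q b - conj (deriv s₁ b) * p b + conj (deriv s₂ b) * q b) * I_sq
  have e3 : conj (s₁ b) * (deriv p b * q b - p b * deriv q b) = 0 := by
    linear_combination q b * e2 - deriv q b * e0
  rcases mul_eq_zero.1 e3 with h3 | h3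
  · rw [(map_eq_zero _).1 h3, zero_mul]
  · rw [h3, mul_zero]

namespace Szego

variable {Ω : Set ℂ} {n : ℕ} {γ : Fin n → ℝ → ℂ} {S : ℂ → ℂ → ℂ}

theorem garL_symm (h : Szego Ω γ S) {a b : ℂ} (ha : a ∈ Ω) (hb : b ∈ Ω) :
    garL Ω γ S b a = garL Ω γ S a b := by
  rcases eq_or_ne a b with rfl | hab
  · rfl
  rw [garL_eq hab, garL_eq hab.symm, h.antisymm ha hb hab]
  ring

theorem ahl_eq (h : Szego Ω γ S) {a b : ℂ} (ha : a ∈ Ω) (hb : b ∈ Ω) :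
    ahl Ω γ S b a = 2 * Real.pi * conj (S b a) * (a - b) / garL Ω γ S a b := by
  rw [ahl, h.garL_symm ha hb, h.herm ha hb]

theorem exists_ahl_ne (h : Szego Ω γ S) {a₁ a₂ : ℂ} (h1 : a₁ ∈ Ω) (h2 : a₂ ∈ Ω) (hne : a₁ ≠ a₂)
    {U : Set ℂ} (hU : IsOpen U) (hUΩ : U ⊆ Ω) (hU0 : U.Nonempty) :
    ∃ b ∈ U, ahl Ω γ S b a₁ ≠ ahl Ω γ S b a₂ := by
  by_contra! hcon
  have hΩ := h.segDom
  obtain ⟨b0, hb0⟩ := hU0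
  set p : ℂ → ℂ := fun b => (a₁ - b) * garL Ω γ S a₂ b with hpdef
  set q : ℂ → ℂ := fun b => (a₂ - b) * garL Ω γ S a₁ b with hqdef
  have hp : DifferentiableOn ℂ p Ω :=
    ((differentiableOn_const a₁).sub differentiableOn_id).mul (h.ao_garL h2).1
  have hq : DifferentiableOn ℂ q Ω :=
    ((differentiableOn_const a₂).sub differentiableOn_id).mul (h.ao_garL h1).1
  have hpi : (Real.pi : ℂ) ≠ 0 := ofReal_ne_zero.2 Real.pi_ne_zero
  have hrel : ∀ b ∈ U, conj (S b a₁) * p b = conj (S b a₂) * q b := fun b hb => by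
    have h3 := hcon b hb
    have hbΩ := hUΩ hb
    rw [h.ahl_eq h1 hbΩ, h.ahl_eq h2 hbΩ, div_eq_div_iff (h.garL_ne_zero h1 hbΩ)
      (h.garL_ne_zero h2 hbΩ)] at h3
    refine mul_left_cancel₀ (mul_ne_zero two_ne_zero hpi) ?_
    linear_combination h3
  have hW : DifferentiableOn ℂ (fun b => deriv p b * q b - p b * deriv q b) Ω :=
    ((hp.deriv hΩ.isOpen).mul hq).sub (hp.mul (hq.deriv hΩ.isOpen))
  have hloc : ∀ b ∈ U, S b a₁ * (deriv p b * q b - p b * deriv q b) = 0 := fun b hb => by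
    have hn := hΩ.isOpen.mem_nhds (hUΩ hb)
    exact wronskian_eq_zero ((h.ao a₁ h1).1.differentiableAt hn)
      ((h.ao a₂ h2).1.differentiableAt hn) (hp.differentiableAt hn) (hq.differentiableAt hn)
      (mem_of_superset (hU.mem_nhds hb) hrel)
  have hglob : ∀ b ∈ Ω, S b a₁ * (deriv p b * q b - p b * deriv q b) = 0 :=
    (((h.ao a₁ h1).1.mul hW).analyticOnNhd
      hΩ.isOpen).eqOn_zero_of_preconnected_of_eventuallyEq_zero hΩ.conn.isPreconnected (hUΩ hb0)
      (mem_of_superset (hU.mem_nhds hb0) hloc)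
  have h0 := (hΩ.eq_zero_or (h.ao a₁ h1).1 hW hglob).resolve_left
    (fun h0 => h.self_ne_zero h1 (h0 a₁ h1)) a₁ h1
  have hn := hΩ.isOpen.mem_nhds h1
  have hp' : deriv p a₁ = -garL Ω γ S a₂ a₁ := by
    have : deriv p a₁ = _ := (((hasDerivAt_id a₁).const_sub a₁).mul
      ((h.ao_garL h2).1.differentiableAt hn).hasDerivAt).deriv
    rw [this]
    simp
  rw [hp'] at h0
  simp only [hpdef, hqdef, garL_self, sub_self, zero_mul, sub_zero, mul_one] at h0
  exact mul_ne_zero (neg_ne_zero.2 (h.garL_ne_zero h2 h1)) (sub_ne_zero.2 hne.symm) h0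

theorem continuousOn_ahl (h : Szego Ω γ S) {a : ℂ} (ha : a ∈ Ω) :
    ContinuousOn (fun b => ahl Ω γ S b a) Ω := by
  have h1 : ContinuousOn (fun b => 2 * (Real.pi : ℂ) * conj (S b a) * (a - b) / garL Ω γ S a b) Ω :=
    ((continuousOn_const.mul (continuous_conj.comp_continuousOn (h.ao a ha).1.continuousOn)).mul
      (continuousOn_const.sub continuousOn_id)).div (h.ao_garL ha).1.continuousOn
      fun b hb => h.garL_ne_zero ha hb
  exact h1.congr fun b hb => h.ahl_eq ha hb

/-- Some Ahlfors map separates the points of a given finite set. -/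
theorem exists_separating (h : Szego Ω γ S) (A : Finset ℂ) (hA : ∀ a ∈ A, a ∈ Ω) :
    ∃ b ∈ Ω, InjOn (ahl Ω γ S b) A := by
  have key : ∀ T : Finset (ℂ × ℂ), (∀ x ∈ T, x.1 ∈ Ω ∧ x.2 ∈ Ω ∧ x.1 ≠ x.2) →
      ∃ U, IsOpen U ∧ U ⊆ Ω ∧ U.Nonempty ∧
        ∀ b ∈ U, ∀ x ∈ T, ahl Ω γ S b x.1 ≠ ahl Ω γ S b x.2 := by
    classical
    intro T
    induction T using Finset.induction_on with
    | empty => exact fun _ => ⟨Ω, h.isOpen, subset_rfl, h.conn.nonempty, by simp⟩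
    | insert x T hx ih =>
      intro hT
      obtain ⟨U, hU, hUΩ, hU0, hUT⟩ := ih fun y hy => hT y (Finset.mem_insert_of_mem hy)
      obtain ⟨h1, h2, h3⟩ := hT x (Finset.mem_insert_self _ _)
      obtain ⟨b, hb, hne⟩ := h.exists_ahl_ne h1 h2 h3 hU hUΩ hU0
      have hn := h.isOpen.mem_nhds (hUΩ hb)
      have ev : ∀ᶠ z in 𝓝 b, ahl Ω γ S z x.1 ≠ ahl Ω γ S z x.2 :=
        ((h.continuousOn_ahl h1).continuousAt hn).ne_iff_eventually_ne
          ((h.continuousOn_ahl h2).continuousAt hn) |>.1 hne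
      obtain ⟨W, hW, hWo, hbW⟩ := _root_.mem_nhds_iff.1 (ev.and (hU.mem_nhds hb))
      refine ⟨W, hWo, fun z hz => hUΩ (hW hz).2, ⟨b, hbW⟩, fun z hz y hy => ?_⟩
      rcases Finset.mem_insert.1 hy with rfl | hy
      · exact (hW hz).1
      · exact hUT z (hW hz).2 y hy
  classical
  obtain ⟨U, -, hUΩ, ⟨b, hb⟩, hsep⟩ := key A.offDiag fun x hx => by
    rw [Finset.mem_offDiag] at hx
    exact ⟨hA _ hx.1, hA _ hx.2.1, hx.2.2⟩
  refine ⟨b, hUΩ hb, fun x hx y hy hxy => ?_⟩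
  by_contra hne
  exact hsep b hb (x, y) (Finset.mem_offDiag.2 ⟨hx, hy, hne⟩) hxy

end Szego

/-- Powers of `g` are independent over polynomials of small degree in a function separating the
zeros of `g`. -/
theorem SegDom.independent {Ω : Set ℂ} (hΩ : SegDom Ω) {g ψ : ℂ → ℂ} (hg : DifferentiableOn ℂ g Ω)
    (hg0 : ∃ z ∈ Ω, g z ≠ 0) (hψ : DifferentiableOn ℂ ψ Ω) {A : Finset ℂ}
    (hA : ∀ a ∈ A, a ∈ Ω ∧ g a = 0) (hinj : InjOn ψ A) : ∀ (K : ℕ) (p : Fin K → Polynomial ℂ),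
    (∀ j, (p j).degree < A.card) →
      (∀ z ∈ Ω, ∑ j, (p j).eval (ψ z) * g z ^ (j : ℕ) = 0) → ∀ j, p j = 0 := by
  intro K
  induction K with
  | zero => exact fun _ _ _ j => j.elim0
  | succ K ih =>
    intro p hdeg hrel
    simp only [Fin.sum_univ_succ, Fin.val_zero, pow_zero, mul_one, Fin.val_succ] at hrel
    have h0 : p 0 = 0 := by
      classical
      refine Polynomial.eq_zero_of_degree_lt_of_eval_finset_eq_zero (A.image ψ) ?_ ?_
      · rw [Finset.card_image_of_injOn hinj]; exact hdeg 0
      · intro x hx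
        obtain ⟨a, ha, rfl⟩ := Finset.mem_image.1 hx
        have := hrel a (hA a ha).1
        simpa [(hA a ha).2] using this
    have h1 : ∀ z ∈ Ω, g z * ∑ j : Fin K, (p j.succ).eval (ψ z) * g z ^ (j : ℕ) = 0 := by
      intro z hz
      have := hrel z hz
      rw [h0, Polynomial.eval_zero, zero_add] at this
      rw [← this, Finset.mul_sum]
      exact Finset.sum_congr rfl fun j _ => by ring
    have h2 := (hΩ.eq_zero_or hg (DifferentiableOn.fun_sum fun j _ =>
      ((p j.succ).differentiable.comp_differentiableOn hψ).mul (hg.pow _)) h1).resolve_left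
      fun h => by obtain ⟨z, hz, hz'⟩ := hg0; exact hz' (h z hz)
    have h3 := ih (fun j => p j.succ) (fun j => hdeg _) h2
    exact fun j => Fin.cases h0 h3 j

/-- Polynomials in `x`, `y` clearing the denominators of `∑ p j (y) * mobius l x ^ j`. -/
def mobiusPoly (l : ℂ) {K : ℕ} (p : Fin (K + 1) → Polynomial ℂ) : Polynomial (Polynomial ℂ) :=
  ∑ j, (p j).map Polynomial.C *
    Polynomial.C ((Polynomial.X - Polynomial.C l) ^ (j : ℕ) *
      (1 - Polynomial.C (conj l) * Polynomial.X) ^ (K - j))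

theorem evalEval_mobiusPoly (l : ℂ) {K : ℕ} (p : Fin (K + 1) → Polynomial ℂ) {x : ℂ} (y : ℂ)
    (hx : 1 - conj l * x ≠ 0) : (mobiusPoly l p).evalEval x y =
      (1 - conj l * x) ^ K * ∑ j, (p j).eval y * mobius l x ^ (j : ℕ) := by
  rw [mobiusPoly, Polynomial.evalEval_finsetSum, Finset.mul_sum]
  refine Finset.sum_congr rfl fun j _ => ?_
  have hj : (1 - conj l * x) ^ K = (1 - conj l * x) ^ (K - j) * (1 - conj l * x) ^ (j : ℕ) := by
    rw [← pow_add]; congr 1; omega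
  have h1 : mobius l x * (1 - conj l * x) = x - l := by rw [mobius, div_mul_cancel₀ _ hx]
  rw [Polynomial.evalEval_mul, Polynomial.evalEval_map_C, Polynomial.evalEval_C]
  simp only [Polynomial.eval_mul, Polynomial.eval_pow, Polynomial.eval_sub, Polynomial.eval_X,
    Polynomial.eval_C, Polynomial.eval_one]
  rw [hj, ← h1, mul_pow]
  ring

theorem pow_clear_denominators {j k : ℕ} (hj : j ≤ k) {x y r : ℂ} (hr : r = x * y) :
    r ^ k * x ^ j = x ^ k * (y ^ (k - j) * r ^ j) := by
  obtain ⟨m, rfl⟩ := Nat.exists_eq_add_of_le hj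
  rw [hr, Nat.add_sub_cancel_left]
  ring

/-- Every pair is rational in a primitive pair of inner functions. -/
theorem SegDom.exists_rational {Ω : Set ℂ} (hΩ : SegDom Ω) {c : Polynomial ℂ} (hc : c ≠ 0)
    {φ ψ : ℂ → ℂ} (hφ : ∀ z ∈ Ω, ‖φ z‖ < 1) {l : ℂ} (hl : ‖l‖ < 1) {G Gb : Polynomial ℂ}
    {V Vb : ℂ → ℂ} (hG : InRoots Ω G) (hGb : InRoots Ω Gb)
    (hgp : Pair Ω c 1 G (fun z => mobius l (φ z)) V) (hbp : Pair Ω c 1 Gb ψ Vb)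
    (hV : ∀ z ∈ Ω, V z ≠ 0) (hGV : ∀ z ∈ Ω, G.eval z = mobius l (φ z) * V z)
    (hnd : G.roots.Nodup) (hdeg : 1 ≤ G.natDegree) (hinj : InjOn ψ G.roots.toFinset)
    {E E' : Polynomial ℂ} {h H : ℂ → ℂ} (hE : InRoots Ω E) (hE' : InRoots Ω E')
    (hp : Pair Ω c E E' h H) : ∃ q e : Polynomial (Polynomial ℂ),
      (∃ z ∈ Ω, q.evalEval (φ z) (ψ z) ≠ 0) ∧
      ∀ z ∈ Ω, q.evalEval (φ z) (ψ z) * h z = e.evalEval (φ z) (ψ z) * E.eval z := by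
  classical
  set n := G.natDegree with hn
  set k := E.natDegree + E'.natDegree + n * Gb.natDegree + 2 with hk
  set g : ℂ → ℂ := fun z => mobius l (φ z) with hgdef
  have hmono : ∀ (i : Fin n) (j : Fin (k + 1)), Pair Ω c (G ^ k) (Gb ^ n)
      (fun z => ψ z ^ (i : ℕ) * (V z ^ (k - j) * G.eval z ^ (j : ℕ)))
      (fun z => Vb z ^ (i : ℕ) * Gb.eval z ^ (n - i) * g z ^ (k - j)) := fun i j => by
    have h1 := (hbp.pow hΩ i).scale hΩ 1 (Gb ^ (n - i))
    have h2 := ((hgp.symm.pow hΩ (k - j)).scale hΩ (G ^ (j : ℕ)) 1)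
    have h3 := h1.mul hΩ h2
    simp only [one_pow, mul_one, one_mul, ← pow_add, Polynomial.eval_one, Polynomial.eval_pow] at h3
    rwa [Nat.add_sub_cancel' i.2.le, Nat.sub_add_cancel (Nat.lt_succ_iff.1 j.2)] at h3
  have hone : Pair Ω c E E' (fun z => E.eval z) (fun z => E'.eval z) := by
    simpa using (Pair.const (Ω := Ω) (c := c) 1).scale hΩ E E'
  set u : Bool → ℂ → ℂ := fun s => if s then h else fun z => E.eval z with hu
  set v : Bool → ℂ → ℂ := fun s => if s then H else fun z => E'.eval z with hv
  have huv : ∀ s, Pair Ω c E E' (u s) (v s) := fun s => by cases s <;> simpa [hu, hv]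
  have hGk := hG.pow k
  have hGbn := hGb.pow n
  obtain ⟨b, hb, hrel⟩ := Pair.exists_linear_relation hΩ hc (mul_ne_zero hE.ne hGk.ne)
    (mul_ne_zero hE'.ne hGbn.ne) (hE.mul hGk).mem (hE'.mul hGbn).mem
    (ι := Bool × (Fin n × Fin (k + 1)))
    (fun x => (huv x.1).mul hΩ (hmono x.2.1 x.2.2)) (by
      rw [Polynomial.natDegree_mul hE.ne hGk.ne, Polynomial.natDegree_mul hE'.ne hGbn.ne,
        Polynomial.natDegree_pow, Polynomial.natDegree_pow, ← hn]
      simp only [Fintype.card_prod, Fintype.card_bool, Fintype.card_fin]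
      nlinarith)
  set p : Bool → Fin (k + 1) → Polynomial ℂ := fun s j =>
    ∑ i : Fin n, Polynomial.C (b (s, (i, j))) * Polynomial.X ^ (i : ℕ) with hpdef
  set A : Bool → ℂ → ℂ := fun s z => ∑ j, (p s j).eval (ψ z) * g z ^ (j : ℕ) with hA
  have hψd := hbp.fst.diff
  have hgd := hgp.fst.diff
  have hAd : ∀ s, DifferentiableOn ℂ (A s) Ω := fun s => DifferentiableOn.fun_sum fun j _ =>
    ((p s j).differentiable.comp_differentiableOn hψd).mul (hgd.pow _)
  have hrel2 : ∀ z ∈ Ω, G.eval z ^ k * (A true z * h z + A false z * E.eval z) = 0 := by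
    intro z hz
    have e1 : ∀ s, (G.eval z ^ k) * (A s z * u s z) = g z ^ k *
        ∑ y : Fin n × Fin (k + 1), b (s, y) * (u s z * (ψ z ^ (y.1 : ℕ) *
          (V z ^ (k - y.2) * G.eval z ^ (y.2 : ℕ)))) := fun s => by
      rw [Fintype.sum_prod_type, Finset.sum_comm, hA]
      simp only [Finset.sum_mul, Finset.mul_sum]
      refine Finset.sum_congr rfl fun j _ => ?_
      have e2 := pow_clear_denominators (Nat.lt_succ_iff.1 j.2) (hGV z hz)
      rw [hpdef]
      simp only [Polynomial.eval_finsetSum, Polynomial.eval_mul, Polynomial.eval_C,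
        Polynomial.eval_pow, Polynomial.eval_X, Finset.sum_mul, Finset.mul_sum]
      refine Finset.sum_congr rfl fun i _ => ?_
      linear_combination (b (s, (i, j)) * ψ z ^ (i : ℕ) * u s z) * e2
    have e2 := hrel z hz
    rw [Fintype.sum_prod_type, Fintype.sum_bool] at e2
    have e3 := congrArg (g z ^ k * ·) e2
    simp only [mul_add, mul_zero] at e3
    have e4 := e1 true
    have e5 := e1 false
    have u1 : u true z = h z := by simp [hu]
    have u2 : u false z = E.eval z := by simp [hu]
    simp only [u1, u2] at e4 e5 e3
    linear_combination e3 + e4 + e5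
  have hrel3 : ∀ z ∈ Ω, A true z * h z + A false z * E.eval z = 0 :=
    (hΩ.eq_zero_or ((hΩ.bh_poly G).pow k).diff (((hAd true).mul hp.fst.diff).add
      ((hAd false).mul (hΩ.bh_poly E).diff)) hrel2).resolve_left fun h0 => by
        obtain ⟨z, hz, hz'⟩ := hΩ.exists_eval_ne hGk.ne
        rw [Polynomial.eval_pow] at hz'
        exact hz' (h0 z hz)
  have hg0 : ∃ z ∈ Ω, g z ≠ 0 := by
    obtain ⟨z, hz, hz'⟩ := hΩ.exists_eval_ne hG.ne
    rw [hGV z hz] at hz'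
    exact ⟨z, hz, left_ne_zero_of_mul hz'⟩
  have hcard : G.roots.toFinset.card = n := by
    rw [Multiset.toFinset_card_of_nodup hnd, IsAlgClosed.card_roots_eq_natDegree]
  have hroot : ∀ a ∈ G.roots.toFinset, a ∈ Ω ∧ g a = 0 := fun a ha => by
    rw [Multiset.mem_toFinset, Polynomial.mem_roots hG.ne] at ha
    have haΩ := hG.mem a ha
    refine ⟨haΩ, ?_⟩
    have := hGV a haΩ
    rw [ha, eq_comm, mul_eq_zero] at this
    exact this.resolve_right (hV a haΩ)
  have hind : ∀ s, (∀ z ∈ Ω, A s z = 0) → ∀ j, p s j = 0 := fun s h0 =>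
    hΩ.independent hgd hg0 hψd hroot hinj (k + 1) (p s)
      (fun j => by rw [hcard]; exact Polynomial.degree_sum_fin_lt _) h0
  have hden : ∀ z ∈ Ω, 1 - conj l * φ z ≠ 0 := fun z hz => mobius_den_ne_zero hl (hφ z hz)
  refine ⟨mobiusPoly l (p true), -mobiusPoly l (p false), ?_, fun z hz => ?_⟩
  · by_contra! hcon
    have ht : ∀ z ∈ Ω, A true z = 0 := fun z hz => by
      have := hcon z hz
      rw [evalEval_mobiusPoly l _ _ (hden z hz)] at this
      exact (mul_eq_zero.1 this).resolve_left (pow_ne_zero _ (hden z hz))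
    have hf : ∀ z ∈ Ω, A false z = 0 := (hΩ.eq_zero_or (hAd false) (hΩ.bh_poly E).diff
      fun z hz => by
        have := hrel3 z hz
        rwa [ht z hz, zero_mul, zero_add] at this).resolve_right fun h0 => by
          obtain ⟨z, hz, hz'⟩ := hΩ.exists_eval_ne hE.ne
          exact hz' (h0 z hz)
    have hall : ∀ s j, p s j = 0 := fun s => by
      cases s
      · exact hind false hf
      · exact hind true ht
    refine hb (funext fun x => ?_)
    have h1 := congrArg (Polynomial.coeff · (x.2.1 : ℕ)) (hall x.1 x.2.2)
    simpa [hpdef, Polynomial.finsetSum_coeff, Polynomial.coeff_X_pow, Fin.val_inj] using h1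
  · have e1 := evalEval_mobiusPoly l (p true) (ψ z) (hden z hz)
    have e2 := evalEval_mobiusPoly l (p false) (ψ z) (hden z hz)
    rw [Polynomial.evalEval_neg, e1, e2]
    linear_combination ((1 - conj l * φ z) ^ k) * hrel3 z hz

/-- Two Ahlfors maps generate all pairs rationally. -/
theorem Schwarz.exists_primitive {Ω : Set ℂ} {D : Polynomial ℂ} {σ : ℂ → ℂ} (hs : Schwarz Ω D σ)
    {n : ℕ} {γ : Fin n → ℝ → ℂ} {S : ℂ → ℂ → ℂ} (h : Szego Ω γ S) : ∃ a ∈ Ω, ∃ b ∈ Ω,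
    ∀ (E E' : Polynomial ℂ) (f F : ℂ → ℂ), InRoots Ω E → InRoots Ω E' → Pair Ω 1 E E' f F →
      ∃ q e : Polynomial (Polynomial ℂ),
        (∃ z ∈ Ω, q.evalEval (ahl Ω γ S a z) (ahl Ω γ S b z) ≠ 0) ∧
        ∀ z ∈ Ω, q.evalEval (ahl Ω γ S a z) (ahl Ω γ S b z) * f z =
          e.evalEval (ahl Ω γ S a z) (ahl Ω γ S b z) * E.eval z := by
  have hΩ := h.segDom
  obtain ⟨a, ha⟩ := hΩ.conn.nonempty
  obtain ⟨c1, hφ⟩ := hs.exists_inner_ahl h ha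
  have hda : deriv (ahl Ω γ S a) a ≠ 0 := by
    rw [h.ahl_deriv ha]
    exact mul_ne_zero (mul_ne_zero two_ne_zero (ofReal_ne_zero.2 Real.pi_ne_zero))
      (h.self_ne_zero ha)
  obtain ⟨l, hl, c2, hg, hsimple⟩ := hs.exists_inner_mobius hΩ hφ ⟨a, ha, hda⟩
  obtain ⟨G, V, hG, hgp, hV, hGV, hnd, hdeg⟩ := hg.exists_simple_pair hΩ hsimple
  obtain ⟨b, hb, hinj⟩ := h.exists_separating G.roots.toFinset fun x hx => by
    rw [Multiset.mem_toFinset, Polynomial.mem_roots hG.ne] at hx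
    exact hG.mem x hx
  obtain ⟨c3, hψ⟩ := hs.exists_inner_ahl h hb
  obtain ⟨Gb, Vb, hGb, hbp, -⟩ := hΩ.exists_inner_pair hψ.bh hψ.ne hψ.growth hψ.bdry
  exact ⟨a, ha, b, hb, fun E E' f F hE hE' hp => hΩ.exists_rational (mul_ne_zero hg.ne hψ.ne)
    hφ.lt hl hG hGb (hgp.of_dvd (dvd_mul_right _ _)) (hbp.of_dvd (dvd_mul_left _ _)) hV hGV hnd
    hdeg hinj hE hE' (hp.of_dvd (one_dvd _))⟩

/-- Interpolation in a finite-dimensional space of functions. -/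
theorem exists_interpolation {ι : Type*} {Ω : Set ℂ} (M : Submodule ℂ (ℂ → ℂ)) : ∀ (d : ℕ)
    (u : ι → ℂ → ℂ), (∀ i, u i ∈ M) →
    (∀ i : Fin d → ι, ∃ b : Fin d → ℂ, b ≠ 0 ∧ ∀ z ∈ Ω, ∑ j, b j * u (i j) z = 0) →
    ∃ (m : ℕ) (x : Fin m → ℂ) (e : Fin m → ℂ → ℂ), (∀ j, x j ∈ Ω) ∧ (∀ j, e j ∈ M) ∧
      ∀ i, ∀ z ∈ Ω, u i z = ∑ j, u i (x j) * e j z := by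
  intro d
  induction d with
  | zero =>
    intro u _ hdep
    obtain ⟨b, hb, -⟩ := hdep fun i => i.elim0
    exact absurd (funext fun i => i.elim0) hb
  | succ d ih =>
    intro u hM hdep
    by_cases h0 : ∀ i, ∀ z ∈ Ω, u i z = 0
    · exact ⟨0, fun i => i.elim0, fun i => i.elim0, fun i => i.elim0, fun i => i.elim0,
        fun i z hz => by simpa using h0 i z hz⟩
    push Not at h0
    obtain ⟨i0, z0, hz0, hne⟩ := h0
    set f0 : ℂ → ℂ := fun z => (u i0 z0)⁻¹ * u i0 z with hf0
    have hf0M : f0 ∈ M := M.smul_mem _ (hM i0)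
    obtain ⟨m, x, e, hx, he, hI⟩ := ih (fun i z => u i z - u i z0 * f0 z)
      (fun i => M.sub_mem (hM i) (M.smul_mem _ hf0M)) fun i => by
        obtain ⟨b, hb, hrel⟩ := hdep (Fin.cons i0 i)
        simp only [Fin.sum_univ_succ, Fin.cons_zero, Fin.cons_succ] at hrel
        have h1 := hrel z0 hz0
        refine ⟨fun j => b j.succ, fun hb0 => hb ?_, fun z hz => ?_⟩
        · have h2 : ∀ j : Fin d, b j.succ = 0 := fun j => congrFun hb0 j
          simp only [h2, zero_mul, Finset.sum_const_zero, add_zero] at h1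
          exact funext fun j => Fin.cases ((mul_eq_zero.1 h1).resolve_right hne) h2 j
        · have h2 := hrel z hz
          simp only [mul_sub, Finset.sum_sub_distrib, ← mul_assoc, ← Finset.sum_mul]
          have h3 : f0 z * u i0 z0 = u i0 z := by rw [hf0]; field_simp
          refine mul_right_cancel₀ hne ?_
          linear_combination u i0 z0 * h2 - u i0 z * h1 -
            (∑ j, b j.succ * u (i j) z0) * h3
    have hM0 : (fun z => f0 z - ∑ j, f0 (x j) * e j z) ∈ M := by
      have : (fun z => f0 z - ∑ j, f0 (x j) * e j z) = f0 - ∑ j, f0 (x j) • e j := by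
        ext z; simp
      rw [this]
      exact M.sub_mem hf0M (M.sum_mem fun j _ => M.smul_mem _ (he j))
    refine ⟨m + 1, Fin.cons z0 x, Fin.cons (fun z => f0 z - ∑ j, f0 (x j) * e j z) e,
      fun j => Fin.cases hz0 hx j, fun j => Fin.cases hM0 he j, fun i z hz => ?_⟩
    · have h1 := hI i z hz
      simp only [Fin.sum_univ_succ, Fin.cons_zero, Fin.cons_succ]
      simp only [sub_mul, Finset.sum_sub_distrib, mul_assoc, ← Finset.mul_sum] at h1
      linear_combination h1

/-- `f` is a rational function of `φ` and `ψ` on `Ω`. -/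
structure RatIn (Ω : Set ℂ) (φ ψ f : ℂ → ℂ) : Prop where
  diff : DifferentiableOn ℂ f Ω
  exists_poly : ∃ q p : Polynomial (Polynomial ℂ), (∃ z ∈ Ω, q.evalEval (φ z) (ψ z) ≠ 0) ∧
    ∀ z ∈ Ω, q.evalEval (φ z) (ψ z) * f z = p.evalEval (φ z) (ψ z)

theorem differentiableOn_evalEval {Ω : Set ℂ} {φ ψ : ℂ → ℂ} (hφ : DifferentiableOn ℂ φ Ω)
    (hψ : DifferentiableOn ℂ ψ Ω) (P : Polynomial (Polynomial ℂ)) :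
    DifferentiableOn ℂ (fun z => P.evalEval (φ z) (ψ z)) Ω := by
  induction P using bipoly_induction with
  | hc a => simp
  | hx => simpa [Polynomial.evalEval_C] using hφ
  | hy => simpa using hψ
  | hadd P Q hP hQ => simp only [Polynomial.evalEval_add]; exact hP.add hQ
  | hmul P Q hP hQ => simp only [Polynomial.evalEval_mul]; exact hP.mul hQ

theorem SegDom.exists_mul_ne {Ω : Set ℂ} (hΩ : SegDom Ω) {f g : ℂ → ℂ}
    (hf : DifferentiableOn ℂ f Ω) (hg : DifferentiableOn ℂ g Ω) (hf0 : ∃ z ∈ Ω, f z ≠ 0)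
    (hg0 : ∃ z ∈ Ω, g z ≠ 0) : ∃ z ∈ Ω, f z * g z ≠ 0 := by
  by_contra! hcon
  rcases hΩ.eq_zero_or hf hg hcon with h | h
  · obtain ⟨z, hz, hz'⟩ := hf0
    exact hz' (h z hz)
  · obtain ⟨z, hz, hz'⟩ := hg0
    exact hz' (h z hz)

namespace RatIn

variable {Ω : Set ℂ} {φ ψ f g : ℂ → ℂ}

theorem evalEval (hΩ : SegDom Ω) (hφ : DifferentiableOn ℂ φ Ω)
    (hψ : DifferentiableOn ℂ ψ Ω) (P : Polynomial (Polynomial ℂ)) :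
    RatIn Ω φ ψ fun z => P.evalEval (φ z) (ψ z) := by
  obtain ⟨z, hz⟩ := hΩ.conn.nonempty
  exact ⟨differentiableOn_evalEval hφ hψ P, 1, P, ⟨z, hz, by simp⟩, fun z _ => by simp⟩

theorem const (hΩ : SegDom Ω) (c : ℂ) : RatIn Ω φ ψ fun _ => c := by
  obtain ⟨z, hz⟩ := hΩ.conn.nonempty
  exact ⟨differentiableOn_const c, 1, Polynomial.C (Polynomial.C c), ⟨z, hz, by simp⟩,
    fun z _ => by simp [Polynomial.evalEval_C]⟩

theorem add (hΩ : SegDom Ω) (hφ : DifferentiableOn ℂ φ Ω) (hψ : DifferentiableOn ℂ ψ Ω)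
    (hf : RatIn Ω φ ψ f) (hg : RatIn Ω φ ψ g) : RatIn Ω φ ψ fun z => f z + g z := by
  obtain ⟨hfd, q, p, hq, hqp⟩ := hf
  obtain ⟨hgd, q', p', hq', hqp'⟩ := hg
  refine ⟨hfd.add hgd, q * q', p * q' + p' * q, ?_, fun z hz => ?_⟩
  · simp only [Polynomial.evalEval_mul]
    exact hΩ.exists_mul_ne (differentiableOn_evalEval hφ hψ q)
      (differentiableOn_evalEval hφ hψ q') hq hq'
  · simp only [Polynomial.evalEval_mul, Polynomial.evalEval_add]
    rw [← hqp z hz, ← hqp' z hz]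
    ring

theorem mul (hΩ : SegDom Ω) (hφ : DifferentiableOn ℂ φ Ω) (hψ : DifferentiableOn ℂ ψ Ω)
    (hf : RatIn Ω φ ψ f) (hg : RatIn Ω φ ψ g) : RatIn Ω φ ψ fun z => f z * g z := by
  obtain ⟨hfd, q, p, hq, hqp⟩ := hf
  obtain ⟨hgd, q', p', hq', hqp'⟩ := hg
  refine ⟨hfd.mul hgd, q * q', p * p', ?_, fun z hz => ?_⟩
  · simp only [Polynomial.evalEval_mul]
    exact hΩ.exists_mul_ne (differentiableOn_evalEval hφ hψ q)
      (differentiableOn_evalEval hφ hψ q') hq hq'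
  · simp only [Polynomial.evalEval_mul]
    rw [← hqp z hz, ← hqp' z hz]
    ring

theorem div (hΩ : SegDom Ω) (hφ : DifferentiableOn ℂ φ Ω) (hψ : DifferentiableOn ℂ ψ Ω)
    (hf : DifferentiableOn ℂ f Ω) (hfg : RatIn Ω φ ψ fun z => f z * g z) (hg : RatIn Ω φ ψ g)
    (hg0 : ∃ z ∈ Ω, g z ≠ 0) : RatIn Ω φ ψ f := by
  obtain ⟨-, q, p, hq, hqp⟩ := hfg
  obtain ⟨hgd, q', p', hq', hqp'⟩ := hg
  refine ⟨hf, q * p', p * q', ?_, fun z hz => ?_⟩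
  · simp only [Polynomial.evalEval_mul]
    obtain ⟨z, hz, hz'⟩ := hΩ.exists_mul_ne (differentiableOn_evalEval hφ hψ q')
      hgd hq' hg0
    rw [hqp' z hz] at hz'
    exact hΩ.exists_mul_ne (differentiableOn_evalEval hφ hψ q)
      (differentiableOn_evalEval hφ hψ p') hq ⟨z, hz, hz'⟩
  · simp only [Polynomial.evalEval_mul]
    rw [← hqp z hz, ← hqp' z hz]
    ring

theorem poly (hΩ : SegDom Ω) (hφ : DifferentiableOn ℂ φ Ω) (hψ : DifferentiableOn ℂ ψ Ω)
    (hid : RatIn Ω φ ψ fun z => z) (p : Polynomial ℂ) : RatIn Ω φ ψ fun z => p.eval z := by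
  induction p using Polynomial.induction_on' with
  | add p q hp hq => simp only [Polynomial.eval_add]; exact hp.add hΩ hφ hψ hq
  | monomial n a =>
    simp only [Polynomial.eval_monomial]
    refine (const hΩ a).mul hΩ hφ hψ ?_
    induction n with
    | zero => simpa using const hΩ 1
    | succ n ih => simp only [pow_succ]; exact ih.mul hΩ hφ hψ hid

/-- The rational functions of `φ` and `ψ` as a subspace. -/
def submodule (hΩ : SegDom Ω) (hφ : DifferentiableOn ℂ φ Ω) (hψ : DifferentiableOn ℂ ψ Ω) :
    Submodule ℂ (ℂ → ℂ) where
  carrier := {f | RatIn Ω φ ψ f}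
  add_mem' hf hg := RatIn.add hΩ hφ hψ hf hg
  zero_mem' := const hΩ 0
  smul_mem' c _ hf := (const hΩ c).mul hΩ hφ hψ hf

end RatIn

/-- `F` is holomorphic in the first variable and antiholomorphic in the second. -/
structure Sesqui (Ω : Set ℂ) (F : ℂ → ℂ → ℂ) : Prop where
  left : ∀ w ∈ Ω, DifferentiableOn ℂ (fun z => F z w) Ω
  right : ∀ z ∈ Ω, DifferentiableOn ℂ (fun w => conj (F z w)) Ω

namespace Sesqui

variable {Ω : Set ℂ} {F G : ℂ → ℂ → ℂ}

theorem add (hF : Sesqui Ω F) (hG : Sesqui Ω G) : Sesqui Ω fun z w => F z w + G z w :=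
  ⟨fun w hw => (hF.left w hw).add (hG.left w hw), fun z hz => by
    simp only [map_add]; exact (hF.right z hz).add (hG.right z hz)⟩

theorem mul (hF : Sesqui Ω F) (hG : Sesqui Ω G) : Sesqui Ω fun z w => F z w * G z w :=
  ⟨fun w hw => (hF.left w hw).mul (hG.left w hw), fun z hz => by
    simp only [map_mul]; exact (hF.right z hz).mul (hG.right z hz)⟩

theorem of_left {f : ℂ → ℂ} (hf : DifferentiableOn ℂ f Ω) : Sesqui Ω fun z _ => f z :=
  ⟨fun _ _ => hf, fun z _ => differentiableOn_const (conj (f z))⟩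

theorem of_right {f : ℂ → ℂ} (hf : DifferentiableOn ℂ f Ω) : Sesqui Ω fun _ w => conj (f w) :=
  ⟨fun w _ => differentiableOn_const (conj (f w)), fun _ _ => by simpa using hf⟩

theorem eval {φ ψ : ℂ → ℂ} (hφ : DifferentiableOn ℂ φ Ω) (hψ : DifferentiableOn ℂ ψ Ω)
    (P : MvPolynomial (Fin 4) ℂ) :
    Sesqui Ω fun z w => MvPolynomial.eval ![φ z, ψ z, conj (φ w), conj (ψ w)] P := by
  induction P using MvPolynomial.induction_on with
  | C a => simp only [MvPolynomial.eval_C]; exact of_left (differentiableOn_const a)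
  | add P Q hP hQ => simp only [map_add]; exact hP.add hQ
  | mul_X P i hP =>
    simp only [map_mul, MvPolynomial.eval_X]
    refine hP.mul ?_
    fin_cases i
    · exact of_left hφ
    · exact of_left hψ
    · exact of_right hφ
    · exact of_right hψ

theorem exists_mul_ne (hΩ : SegDom Ω) (hF : Sesqui Ω F) (hG : Sesqui Ω G)
    (hF0 : ∃ z ∈ Ω, ∃ w ∈ Ω, F z w ≠ 0) (hG0 : ∃ z ∈ Ω, ∃ w ∈ Ω, G z w ≠ 0) :
    ∃ z ∈ Ω, ∃ w ∈ Ω, F z w * G z w ≠ 0 := by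
  obtain ⟨z1, hz1, w1, hw1, h1⟩ := hF0
  obtain ⟨z2, hz2, w2, hw2, h2⟩ := hG0
  obtain ⟨z, hz, h⟩ := hΩ.exists_mul_ne (hF.left w1 hw1) (hG.left w2 hw2) ⟨z1, hz1, h1⟩
    ⟨z2, hz2, h2⟩
  obtain ⟨w, hw, h'⟩ := hΩ.exists_mul_ne (hF.right z hz) (hG.right z hz)
    ⟨w1, hw1, (map_ne_zero _).2 (left_ne_zero_of_mul h)⟩
    ⟨w2, hw2, (map_ne_zero _).2 (right_ne_zero_of_mul h)⟩
  rw [← map_mul] at h'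
  exact ⟨z, hz, w, hw, (map_ne_zero _).1 h'⟩

end Sesqui

/-- `F` is a rational function of `φ z`, `ψ z`, `conj (φ w)` and `conj (ψ w)`. -/
structure SesquiRat (Ω : Set ℂ) (φ ψ : ℂ → ℂ) (F : ℂ → ℂ → ℂ) : Prop where
  sesqui : Sesqui Ω F
  exists_poly : ∃ P Q : MvPolynomial (Fin 4) ℂ,
    (∃ z ∈ Ω, ∃ w ∈ Ω, MvPolynomial.eval ![φ z, ψ z, conj (φ w), conj (ψ w)] Q ≠ 0) ∧
    ∀ z ∈ Ω, ∀ w ∈ Ω, F z w * MvPolynomial.eval ![φ z, ψ z, conj (φ w), conj (ψ w)] Q =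
      MvPolynomial.eval ![φ z, ψ z, conj (φ w), conj (ψ w)] P

theorem exists_eval_left (P : Polynomial (Polynomial ℂ)) : ∃ R : MvPolynomial (Fin 4) ℂ,
    ∀ x y u v, MvPolynomial.eval ![x, y, u, v] R = P.evalEval x y := by
  induction P using bipoly_induction with
  | hc a => exact ⟨MvPolynomial.C a, fun x y u v => by simp [Polynomial.evalEval_C]⟩
  | hx => exact ⟨MvPolynomial.X 0, fun x y u v => by simp [Polynomial.evalEval_C]⟩
  | hy => exact ⟨MvPolynomial.X 1, fun x y u v => by simp⟩
  | hadd P Q hP hQ =>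
    obtain ⟨A, hA⟩ := hP
    obtain ⟨B, hB⟩ := hQ
    exact ⟨A + B, fun x y u v => by rw [map_add, hA, hB, Polynomial.evalEval_add]⟩
  | hmul P Q hP hQ =>
    obtain ⟨A, hA⟩ := hP
    obtain ⟨B, hB⟩ := hQ
    exact ⟨A * B, fun x y u v => by rw [map_mul, hA, hB, Polynomial.evalEval_mul]⟩

theorem exists_eval_right (P : Polynomial (Polynomial ℂ)) : ∃ R : MvPolynomial (Fin 4) ℂ,
    ∀ x y u v, MvPolynomial.eval ![x, y, conj u, conj v] R = conj (P.evalEval u v) := by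
  induction P using bipoly_induction with
  | hc a => exact ⟨MvPolynomial.C (conj a), fun x y u v => by simp [Polynomial.evalEval_C]⟩
  | hx => exact ⟨MvPolynomial.X 2, fun x y u v => by simp [Polynomial.evalEval_C]⟩
  | hy => exact ⟨MvPolynomial.X 3, fun x y u v => by simp⟩
  | hadd P Q hP hQ =>
    obtain ⟨A, hA⟩ := hP
    obtain ⟨B, hB⟩ := hQ
    exact ⟨A + B, fun x y u v => by rw [map_add, hA, hB, Polynomial.evalEval_add, map_add]⟩
  | hmul P Q hP hQ =>
    obtain ⟨A, hA⟩ := hP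
    obtain ⟨B, hB⟩ := hQ
    exact ⟨A * B, fun x y u v => by rw [map_mul, hA, hB, Polynomial.evalEval_mul, map_mul]⟩

namespace SesquiRat

variable {Ω : Set ℂ} {φ ψ : ℂ → ℂ} {F G : ℂ → ℂ → ℂ}

theorem of_left {f : ℂ → ℂ} (hf : RatIn Ω φ ψ f) : SesquiRat Ω φ ψ fun z _ => f z := by
  obtain ⟨hd, q, p, ⟨z0, hz0, hq⟩, hqp⟩ := hf
  obtain ⟨Q, hQ⟩ := exists_eval_left q
  obtain ⟨P, hP⟩ := exists_eval_left p
  exact ⟨.of_left hd, P, Q, ⟨z0, hz0, z0, hz0, by rwa [hQ]⟩, fun z hz w _ => by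
    rw [hQ, hP, ← hqp z hz, mul_comm]⟩

theorem of_right {f : ℂ → ℂ} (hf : RatIn Ω φ ψ f) :
    SesquiRat Ω φ ψ fun _ w => conj (f w) := by
  obtain ⟨hd, q, p, ⟨z0, hz0, hq⟩, hqp⟩ := hf
  obtain ⟨Q, hQ⟩ := exists_eval_right q
  obtain ⟨P, hP⟩ := exists_eval_right p
  exact ⟨.of_right hd, P, Q, ⟨z0, hz0, z0, hz0, by rw [hQ]; exact (map_ne_zero _).2 hq⟩,
    fun z _ w hw => by rw [hQ, hP, ← hqp w hw, map_mul, mul_comm]⟩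

theorem add (hΩ : SegDom Ω) (hφ : DifferentiableOn ℂ φ Ω) (hψ : DifferentiableOn ℂ ψ Ω)
    (hF : SesquiRat Ω φ ψ F) (hG : SesquiRat Ω φ ψ G) :
    SesquiRat Ω φ ψ fun z w => F z w + G z w := by
  obtain ⟨hFs, P, Q, hQ, hPQ⟩ := hF
  obtain ⟨hGs, P', Q', hQ', hPQ'⟩ := hG
  refine ⟨hFs.add hGs, P * Q' + P' * Q, Q * Q', ?_, fun z hz w hw => ?_⟩
  · simp only [map_mul]
    exact (Sesqui.eval hφ hψ Q).exists_mul_ne hΩ (Sesqui.eval hφ hψ Q') hQ hQ'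
  · simp only [map_mul, map_add]
    rw [← hPQ z hz w hw, ← hPQ' z hz w hw]
    ring

theorem mul (hΩ : SegDom Ω) (hφ : DifferentiableOn ℂ φ Ω) (hψ : DifferentiableOn ℂ ψ Ω)
    (hF : SesquiRat Ω φ ψ F) (hG : SesquiRat Ω φ ψ G) :
    SesquiRat Ω φ ψ fun z w => F z w * G z w := by
  obtain ⟨hFs, P, Q, hQ, hPQ⟩ := hF
  obtain ⟨hGs, P', Q', hQ', hPQ'⟩ := hG
  refine ⟨hFs.mul hGs, P * P', Q * Q', ?_, fun z hz w hw => ?_⟩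
  · simp only [map_mul]
    exact (Sesqui.eval hφ hψ Q).exists_mul_ne hΩ (Sesqui.eval hφ hψ Q') hQ hQ'
  · simp only [map_mul]
    rw [← hPQ z hz w hw, ← hPQ' z hz w hw]
    ring

theorem sum (hΩ : SegDom Ω) (hφ : DifferentiableOn ℂ φ Ω) (hψ : DifferentiableOn ℂ ψ Ω)
    {ι : Type*} (s : Finset ι) {F : ι → ℂ → ℂ → ℂ} (hF : ∀ i, SesquiRat Ω φ ψ (F i)) :
    SesquiRat Ω φ ψ fun z w => ∑ i ∈ s, F i z w := by
  classical
  induction s using Finset.induction_on with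
  | empty => simpa using of_left (RatIn.const hΩ 0)
  | insert i s hi ih =>
    simp only [Finset.sum_insert hi]
    exact (hF i).add hΩ hφ hψ ih

theorem div (hΩ : SegDom Ω) (hφ : DifferentiableOn ℂ φ Ω) (hψ : DifferentiableOn ℂ ψ Ω)
    (hF : Sesqui Ω F) (hFG : SesquiRat Ω φ ψ fun z w => F z w * G z w)
    (hG : SesquiRat Ω φ ψ G) (hG0 : ∃ z ∈ Ω, ∃ w ∈ Ω, G z w ≠ 0) : SesquiRat Ω φ ψ F := by
  obtain ⟨-, P, Q, hQ, hPQ⟩ := hFG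
  obtain ⟨hGs, P', Q', hQ', hPQ'⟩ := hG
  refine ⟨hF, P * Q', Q * P', ?_, fun z hz w hw => ?_⟩
  · simp only [map_mul]
    obtain ⟨z, hz, w, hw, h⟩ := hGs.exists_mul_ne hΩ (Sesqui.eval hφ hψ Q') hG0 hQ'
    rw [hPQ' z hz w hw] at h
    exact (Sesqui.eval hφ hψ Q).exists_mul_ne hΩ (Sesqui.eval hφ hψ P') hQ ⟨z, hz, w, hw, h⟩
  · simp only [map_mul]
    rw [← hPQ z hz w hw, ← hPQ' z hz w hw]
    ring

end SesquiRat

theorem Szego.sesqui_sq {Ω : Set ℂ} {n : ℕ} {γ : Fin n → ℝ → ℂ} {S : ℂ → ℂ → ℂ}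
    (h : Szego Ω γ S) : Sesqui Ω fun z w => S z w ^ 2 where
  left w hw := ((h.ao w hw).pow 2).1
  right z hz := ((h.ao z hz).pow 2).1.congr fun w hw => by rw [map_pow, ← h.herm hw hz]

/-- The squared Szegő kernel is rational in two Ahlfors maps. -/
theorem Schwarz.exists_sesquiRat {Ω : Set ℂ} {D : Polynomial ℂ} {σ : ℂ → ℂ} (hs : Schwarz Ω D σ)
    {n : ℕ} {γ : Fin n → ℝ → ℂ} {S : ℂ → ℂ → ℂ} (h : Szego Ω γ S) : ∃ a ∈ Ω, ∃ b ∈ Ω,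
    SesquiRat Ω (ahl Ω γ S a) (ahl Ω γ S b) fun z w => S z w ^ 2 := by
  have hΩ := h.segDom
  obtain ⟨a, ha, b, hb, hprim⟩ := hs.exists_primitive h
  refine ⟨a, ha, b, hb, ?_⟩
  have hφ := h.ahl_differentiableOn ha
  have hψ := h.ahl_differentiableOn hb
  set φ := ahl Ω γ S a
  set ψ := ahl Ω γ S b
  have hid : RatIn Ω φ ψ fun z => z := by
    obtain ⟨q, e, hq, hqe⟩ := hprim 1 D _ _ .one hs.roots (hs.pair hΩ).symm
    exact ⟨differentiableOn_id, q, e, hq, fun z hz => by simpa using hqe z hz⟩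
  have hpoly := RatIn.poly hΩ hφ hψ hid
  have hpair : ∀ (E E' : Polynomial ℂ) (f F : ℂ → ℂ), InRoots Ω E → InRoots Ω E' →
      Pair Ω 1 E E' f F → RatIn Ω φ ψ f := fun E E' f F hE hE' hp => by
    obtain ⟨q, e, hq, hqe⟩ := hprim E E' f F hE hE' hp
    have hq' := RatIn.evalEval hΩ hφ hψ q
    obtain ⟨hd, s, t, hst⟩ := (RatIn.evalEval hΩ hφ hψ e).mul hΩ hφ hψ (hpoly E)
    refine RatIn.div hΩ hφ hψ hp.fst.diff
      ⟨hp.fst.diff.mul hq'.diff, s, t, hst.1, fun z hz => ?_⟩ hq' hq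
    rw [← hst.2 z hz, ← hqe z hz, mul_comm (f z)]
  obtain ⟨N, b0, H, hb0, hb0ne, G, hG⟩ := hs.exists_kernel_pairs h
  have hσ := hpair D 1 _ _ hs.roots .one (hs.pair hΩ)
  have hb0K := hpair _ _ _ _ (hs.roots.pow N) (hs.roots.pow N) hb0
  set u : Ω → ℂ → ℂ := fun w z => S z w ^ 2 * (σ z - conj (w : ℂ) * D.eval z) ^ 2 * b0 z with hu
  have huK : ∀ w, RatIn Ω φ ψ (u w) := fun w =>
    hpair _ _ _ _ (hs.roots.pow (N + 2)) (hs.roots.pow N) (hG w w.2)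
  obtain ⟨m, x, e, hx, he, hI⟩ := exists_interpolation (Ω := Ω) (RatIn.submodule hΩ hφ hψ) _ u huK
    fun i => Pair.exists_linear_relation hΩ one_ne_zero (hs.roots.pow (N + 2)).ne
      (hs.roots.pow N).ne (hs.roots.pow (N + 2)).mem (hs.roots.pow N).mem
      (fun j => hG (i j) (i j).2) (Fintype.card_fin _).ge
  have hquad : ∀ w, RatIn Ω φ ψ fun z => (σ z - conj w * D.eval z) ^ 2 := fun w => by
    have h1 := hσ.add hΩ hφ hψ ((RatIn.const hΩ (-conj w)).mul hΩ hφ hψ (hpoly D))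
    convert h1.mul hΩ hφ hψ h1 using 2
    ring
  have hquad_ne : ∀ w ∈ Ω, ∃ z ∈ Ω, (σ z - conj w * D.eval z) ^ 2 * b0 z ≠ 0 := fun w hw => by
    obtain ⟨z, hz, hz'⟩ := hs.exists_ne hΩ hw
    exact hΩ.exists_mul_ne (hquad w).diff hb0K.diff ⟨z, hz, pow_ne_zero 2 hz'⟩ hb0ne
  have hSK : ∀ w ∈ Ω, RatIn Ω φ ψ fun z => S z w ^ 2 := fun w hw => by
    refine RatIn.div hΩ hφ hψ ((h.ao w hw).pow 2).1 ?_ ((hquad w).mul hΩ hφ hψ hb0K)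
      (hquad_ne w hw)
    simpa only [hu, mul_assoc] using huK ⟨w, hw⟩
  have hquadK : SesquiRat Ω φ ψ fun z w => (σ z - conj w * D.eval z) ^ 2 * b0 z := by
    have h1 := (SesquiRat.of_left hσ).add hΩ hφ hψ ((SesquiRat.of_right hid).mul hΩ hφ hψ
      (SesquiRat.of_left ((RatIn.const hΩ (-1)).mul hΩ hφ hψ (hpoly D))))
    have h2 := (h1.mul hΩ hφ hψ h1).mul hΩ hφ hψ (SesquiRat.of_left hb0K)
    refine (congrArg (SesquiRat Ω φ ψ) (funext fun z => funext fun w => ?_)).mp h2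
    ring
  have hkey : SesquiRat Ω φ ψ fun z w =>
      S z w ^ 2 * ((σ z - conj w * D.eval z) ^ 2 * b0 z) := by
    have h1 : ∀ j, RatIn Ω φ ψ fun w =>
        S w (x j) ^ 2 * (conj (b0 (x j)) * (conj (σ (x j)) - w * conj (D.eval (x j))) ^ 2) :=
      fun j => by
        have h2 := hpoly (Polynomial.C (conj (b0 (x j))) *
          (Polynomial.C (conj (σ (x j))) - Polynomial.X * Polynomial.C (conj (D.eval (x j)))) ^ 2)
        have h3 := (hSK _ (hx j)).mul hΩ hφ hψ h2
        refine (congrArg (RatIn Ω φ ψ) (funext fun w => ?_)).mp h3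
        simp only [Polynomial.eval_mul, Polynomial.eval_C, Polynomial.eval_pow,
          Polynomial.eval_sub, Polynomial.eval_X]
    obtain ⟨hd, P, Q, hQ, hPQ⟩ := SesquiRat.sum hΩ hφ hψ Finset.univ fun j =>
      (SesquiRat.of_left (he j)).mul hΩ hφ hψ (SesquiRat.of_right (h1 j))
    refine ⟨h.sesqui_sq.mul hquadK.sesqui, P, Q, hQ, fun z hz w hw => ?_⟩
    rw [← hPQ z hz w hw]
    congr 1
    have h2 := hI ⟨w, hw⟩ z hz
    simp only [hu] at h2
    rw [← mul_assoc, h2]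
    refine Finset.sum_congr rfl fun j _ => ?_
    simp only [map_mul, map_pow, map_sub, conj_conj]
    rw [← h.herm (hx j) hw]
    ring
  obtain ⟨z, hz, hz'⟩ := hquad_ne a ha
  exact SesquiRat.div hΩ hφ hψ h.sesqui_sq hkey hquadK ⟨z, hz, a, ha, hz'⟩

/-- the square of the Szegő kernel of a smoothly bounded quadrature domain of
finite area is a rational combination of two Ahlfors maps. -/
theorem stmt_2 (Ω : Set ℂ) (hΩ : IsFinConnDomain Ω) (hA : volume Ω < ⊤)
    (hsm : HasSmoothBoundary Ω) (hq : IsQuadratureDomain Ω)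
    (S : ℂ → ℂ → ℂ)
    (hS1 : ∀ w ∈ Ω, DifferentiableOn ℂ (fun z => S z w) Ω ∧
      ContinuousOn (fun z => S z w) (closure Ω))
    (hS2 : ∀ f : ℂ → ℂ, DifferentiableOn ℂ f Ω → ContinuousOn f (closure Ω) →
      ∀ w ∈ Ω, f w = ∫ z in frontier Ω, f z * conj (S z w) ∂(μH[1])) :
    ∃ a ∈ Ω, ∃ b ∈ Ω, ∃ fa fb : ℂ → ℂ,
      IsAhlforsMap Ω a fa ∧ IsAhlforsMap Ω b fb ∧
      ∃ P Q : MvPolynomial (Fin 4) ℂ,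
        (∃ z ∈ Ω, ∃ w ∈ Ω,
          MvPolynomial.eval ![fa z, fb z, conj (fa w), conj (fb w)] Q ≠ 0) ∧
        ∀ z ∈ Ω, ∀ w ∈ Ω,
          S z w ^ 2 * MvPolynomial.eval ![fa z, fb z, conj (fa w), conj (fb w)] Q =
            MvPolynomial.eval ![fa z, fb z, conj (fa w), conj (fb w)] P := by
  obtain ⟨n, γ, hγ⟩ := exists_bdry hΩ hsm
  obtain ⟨D, σ, hD, hDm, hσ, hσc, hb⟩ := exists_schwarz hγ hq
  have h := exists_szego hγ hS1 hS2
  obtain ⟨a, ha, b, hb', hrat⟩ :=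
    Schwarz.exists_sesquiRat ⟨⟨hD, hDm⟩, ⟨hσ, hσc.continuousOn⟩, hb⟩ h
  exact ⟨a, ha, b, hb', _, _, h.isAhlforsMap ha, h.isAhlforsMap hb', hrat.exists_poly⟩
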